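/- Let (I_n) be the internal DLA process on Z^d started from I_0 = {0}. If d = 2, there is an absolute constant c such that with probability 1, B_{n − c log n} ⊂ I_{⌊π n^2⌋} ⊂ B_{n + c log n} for all sufficiently large n. If d ≥ 3, there is an absolute constant C such that with probability 1, B_{n − C√(log n)} ⊂ I_{⌊ω_d n^d⌋} ⊂ B_{n + C√(log n)} for all sufficiently large n. -/

import Mathlib

open MeasureTheory Filter Topology

/-- The lattice neighbors of a point of `ℤ^d` (the `2d` points at `ℓ¹`-distance one). -/
noncomputable def latNbrs {d : ℕ} (x : Fin d → ℤ) : Finset (Fin d → ℤ) :=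
  (Finset.univ ×ˢ ({1, -1} : Finset ℤ)).image (fun p => Function.update x p.1 (x p.1 + p.2))

open Classical in
/-- Probability that the random walk which at each step moves uniformly to one of the
points in `nbr ·`, started at `x`, hits the set `A` within `n` steps, with first
hitting position `y`. -/
noncomputable def hitP {V : Type*} (nbr : V → Finset V) (A : Set V) : ℕ → V → V → ℝ
  | 0, x, y => if x ∈ A ∧ x = y then 1 else 0
  | n+1, x, y =>
      if x ∈ A then (if x = y then 1 else 0)
      else ((nbr x).card : ℝ)⁻¹ * ∑ z ∈ nbr x, hitP nbr A n z y

/-- The hitting distribution `H_A(x,y)`: probability that the random walk started at `x`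
ever hits `A`, with first hitting position `y` (monotone limit of `hitP`). -/
noncomputable def hitMeas {V : Type*} (nbr : V → Finset V) (A : Set V) (x y : V) : ℝ :=
  ⨆ n, hitP nbr A n x y

/-- Outer boundary of a finite set. -/
noncomputable def bdryF {V : Type*} [DecidableEq V] (nbr : V → Finset V) (A : Finset V) :
    Finset V :=
  A.biUnion nbr \ A

/-- Euclidean norm of a lattice point. -/
noncomputable def eunorm {d : ℕ} (x : Fin d → ℤ) : ℝ := Real.sqrt (∑ i, ((x i : ℝ)) ^ 2)
/-- The lattice ball of (real) radius `r` in `ℤ^d`. -/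
def latBall {d : ℕ} (r : ℝ) : Set (Fin d → ℤ) := {x | eunorm x ≤ r}

/-- The volume `ω_d` of the `d`-dimensional Euclidean unit ball. -/
noncomputable def unitBallVol (d : ℕ) : ℝ :=
  (MeasureTheory.volume (Metric.ball (0 : EuclideanSpace ℝ (Fin d)) 1)).toReal

/-- The unit coordinate vector of `ℤ^d`. -/
def stdv {d : ℕ} (i : Fin d) : Fin d → ℤ := Pi.single i 1

/-- The average of `g` over the lattice neighbours of `x`. -/
noncomputable def nbrAvg {d : ℕ} (g : (Fin d → ℤ) → ℝ) (x : Fin d → ℤ) : ℝ :=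
  (2 * d : ℝ)⁻¹ * ∑ i, (g (x + stdv i) + g (x - stdv i))

/-- The discrete Laplacian on `ℤ^d`, normalised as `nbrAvg g - g`. -/
noncomputable def lap {d : ℕ} (g : (Fin d → ℤ) → ℝ) (x : Fin d → ℤ) : ℝ := nbrAvg g x - g x

/-- The exit distribution of simple random walk from the finite set `A`. -/
noncomputable def exitMeas {d : ℕ} (A : Finset (Fin d → ℤ)) (x y : Fin d → ℤ) : ℝ :=
  hitMeas latNbrs (↑(bdryF latNbrs A)) x y

section Walk

variable {d : ℕ}

lemma update_eq_add_stdv (x : Fin d → ℤ) (i : Fin d) (s : ℤ) :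
    Function.update x i (x i + s) = x + s • stdv i := by
  ext j
  by_cases h : j = i
  · subst h; simp [stdv]
  · simp [stdv, h]

lemma latNbrs_injOn (x : Fin d → ℤ) :
    Set.InjOn (fun p : Fin d × ℤ => Function.update x p.1 (x p.1 + p.2))
      (↑((Finset.univ : Finset (Fin d)) ×ˢ ({1, -1} : Finset ℤ))) := by
  rintro ⟨i, s⟩ hi ⟨j, t⟩ hj h
  have hs : s ≠ 0 := by
    simp at hi; rcases hi with rfl | rfl <;> simp
  have h1 := congrFun h i
  have hij : i = j := by
    by_contra hne
    simp [Function.update_of_ne hne] at h1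
    exact hs h1
  subst hij
  simp at h1
  simp [h1]

lemma sum_latNbrs (g : (Fin d → ℤ) → ℝ) (x : Fin d → ℤ) :
    ∑ z ∈ latNbrs x, g z = ∑ i, (g (x + stdv i) + g (x - stdv i)) := by
  unfold latNbrs
  rw [Finset.sum_image (latNbrs_injOn x), Finset.sum_product]
  refine Finset.sum_congr rfl fun i _ => ?_
  rw [Finset.sum_pair (by norm_num)]
  simp only [update_eq_add_stdv]
  simp [sub_eq_add_neg]

lemma card_latNbrs (x : Fin d → ℤ) : (latNbrs x).card = 2 * d := by
  unfold latNbrs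
  rw [Finset.card_image_of_injOn (latNbrs_injOn x), Finset.card_product]
  simp [mul_comm]

lemma nbrAvg_eq (g : (Fin d → ℤ) → ℝ) (x : Fin d → ℤ) :
    nbrAvg g x = ((latNbrs x).card : ℝ)⁻¹ * ∑ z ∈ latNbrs x, g z := by
  rw [sum_latNbrs, card_latNbrs, nbrAvg]; push_cast; rfl

lemma mem_latNbrs {x y : Fin d → ℤ} :
    y ∈ latNbrs x ↔ ∃ i, y = x + stdv i ∨ y = x - stdv i := by
  unfold latNbrs
  simp only [Finset.mem_image, Finset.mem_product, Finset.mem_univ, true_and, Prod.exists,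
    update_eq_add_stdv]
  constructor
  · rintro ⟨i, s, hs, rfl⟩
    refine ⟨i, ?_⟩
    simp at hs
    rcases hs with rfl | rfl
    · left; simp
    · right; simp [sub_eq_add_neg]
  · rintro ⟨i, rfl | rfl⟩
    · exact ⟨i, 1, by simp, by simp⟩
    · exact ⟨i, -1, by simp, by simp [sub_eq_add_neg]⟩

lemma add_stdv_mem (x : Fin d → ℤ) (i : Fin d) : x + stdv i ∈ latNbrs x :=
  mem_latNbrs.2 ⟨i, Or.inl rfl⟩

lemma sub_stdv_mem (x : Fin d → ℤ) (i : Fin d) : x - stdv i ∈ latNbrs x :=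
  mem_latNbrs.2 ⟨i, Or.inr rfl⟩

lemma nbrAvg_mono {g g' : (Fin d → ℤ) → ℝ} {x : Fin d → ℤ}
    (h : ∀ z ∈ latNbrs x, g z ≤ g' z) : nbrAvg g x ≤ nbrAvg g' x := by
  rw [nbrAvg_eq, nbrAvg_eq]
  gcongr with z hz
  exact h z hz

lemma nbrAvg_congr {g g' : (Fin d → ℤ) → ℝ} {x : Fin d → ℤ}
    (h : ∀ z ∈ latNbrs x, g z = g' z) : nbrAvg g x = nbrAvg g' x :=
  le_antisymm (nbrAvg_mono fun z hz => (h z hz).le) (nbrAvg_mono fun z hz => (h z hz).ge)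

lemma nbrAvg_const (hd : d ≠ 0) (c : ℝ) (x : Fin d → ℤ) : nbrAvg (fun _ => c) x = c := by
  have : (d : ℝ) ≠ 0 := by exact_mod_cast hd
  simp [nbrAvg]; field_simp; ring

lemma nbrAvg_add (g g' : (Fin d → ℤ) → ℝ) (x : Fin d → ℤ) :
    nbrAvg (fun z => g z + g' z) x = nbrAvg g x + nbrAvg g' x := by
  simp only [nbrAvg_eq, Finset.sum_add_distrib, mul_add]

lemma nbrAvg_smul (c : ℝ) (g : (Fin d → ℤ) → ℝ) (x : Fin d → ℤ) :
    nbrAvg (fun z => c * g z) x = c * nbrAvg g x := by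
  simp only [nbrAvg_eq, ← Finset.mul_sum]; ring

lemma nbrAvg_sum {ι : Type*} (s : Finset ι) (g : ι → (Fin d → ℤ) → ℝ) (x : Fin d → ℤ) :
    nbrAvg (fun z => ∑ i ∈ s, g i z) x = ∑ i ∈ s, nbrAvg (g i) x := by
  simp only [nbrAvg_eq]
  rw [Finset.sum_comm, Finset.mul_sum]

lemma nbrAvg_le_of_le {g : (Fin d → ℤ) → ℝ} {x : Fin d → ℤ} {c : ℝ} (hd : d ≠ 0)
    (h : ∀ z ∈ latNbrs x, g z ≤ c) : nbrAvg g x ≤ c := by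
  rw [← nbrAvg_const hd c x]; exact nbrAvg_mono h

lemma le_nbrAvg_of_le {g : (Fin d → ℤ) → ℝ} {x : Fin d → ℤ} {c : ℝ} (hd : d ≠ 0)
    (h : ∀ z ∈ latNbrs x, c ≤ g z) : c ≤ nbrAvg g x := by
  nth_rw 1 [← nbrAvg_const hd c x]; exact nbrAvg_mono h

lemma mem_bdryF {A : Finset (Fin d → ℤ)} {y : Fin d → ℤ} :
    y ∈ bdryF latNbrs A ↔ (∃ x ∈ A, y ∈ latNbrs x) ∧ y ∉ A := by
  simp [bdryF]

lemma latNbrs_mem_union {A : Finset (Fin d → ℤ)} {x z : Fin d → ℤ} (hx : x ∈ A)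
    (hz : z ∈ latNbrs x) : z ∈ A ∨ z ∈ bdryF latNbrs A := by
  by_cases h : z ∈ A
  · exact Or.inl h
  · exact Or.inr (mem_bdryF.2 ⟨⟨x, hx, hz⟩, h⟩)

section HitP
variable (B : Set (Fin d → ℤ))

lemma hitP_of_mem {x : Fin d → ℤ} (hx : x ∈ B) (n : ℕ) (y : Fin d → ℤ) :
    hitP latNbrs B n x y = if x = y then 1 else 0 := by
  cases n <;> simp [hitP, hx]

lemma hitP_succ_of_notMem {x : Fin d → ℤ} (hx : x ∉ B) (n : ℕ) (y : Fin d → ℤ) :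
    hitP latNbrs B (n + 1) x y = nbrAvg (fun z => hitP latNbrs B n z y) x := by
  rw [nbrAvg_eq]; simp [hitP, hx]

lemma hitP_nonneg (n : ℕ) (x y : Fin d → ℤ) : 0 ≤ hitP latNbrs B n x y := by
  induction n generalizing x with
  | zero => unfold hitP; split_ifs <;> norm_num
  | succ n ih =>
    by_cases hx : x ∈ B
    · rw [hitP_of_mem B hx]; split_ifs <;> norm_num
    · rw [hitP_succ_of_notMem B hx, nbrAvg_eq]
      exact mul_nonneg (by positivity) (Finset.sum_nonneg fun z _ => ih z)

lemma hitP_le_one (hd : d ≠ 0) (n : ℕ) (x y : Fin d → ℤ) : hitP latNbrs B n x y ≤ 1 := by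
  induction n generalizing x with
  | zero => unfold hitP; split_ifs <;> norm_num
  | succ n ih =>
    by_cases hx : x ∈ B
    · rw [hitP_of_mem B hx]; split_ifs <;> norm_num
    · rw [hitP_succ_of_notMem B hx]
      exact nbrAvg_le_of_le hd fun z _ => ih z

lemma hitP_mono (x y : Fin d → ℤ) : Monotone fun n => hitP latNbrs B n x y := by
  refine monotone_nat_of_le_succ fun n => ?_
  induction n generalizing x with
  | zero =>
    by_cases hx : x ∈ B
    · rw [hitP_of_mem B hx, hitP_of_mem B hx]
    · have : hitP latNbrs B 0 x y = 0 := by simp [hitP, hx]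
      rw [this]; exact hitP_nonneg _ _ _ _
  | succ n ih =>
    by_cases hx : x ∈ B
    · rw [hitP_of_mem B hx, hitP_of_mem B hx]
    · rw [hitP_succ_of_notMem B hx, hitP_succ_of_notMem B hx]
      exact nbrAvg_mono fun z _ => ih z

lemma tendsto_hitP (hd : d ≠ 0) (x y : Fin d → ℤ) :
    Tendsto (fun n => hitP latNbrs B n x y) atTop (𝓝 (hitMeas latNbrs B x y)) :=
  tendsto_atTop_ciSup (hitP_mono B x y)
    ⟨1, by rintro _ ⟨n, rfl⟩; exact hitP_le_one B hd n x y⟩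

lemma hitMeas_nonneg (hd : d ≠ 0) (x y : Fin d → ℤ) : 0 ≤ hitMeas latNbrs B x y :=
  ge_of_tendsto' (tendsto_hitP B hd x y) fun n => hitP_nonneg B n x y

lemma hitMeas_of_mem (hd : d ≠ 0) {x : Fin d → ℤ} (hx : x ∈ B) (y : Fin d → ℤ) :
    hitMeas latNbrs B x y = if x = y then 1 else 0 := by
  refine tendsto_nhds_unique (tendsto_hitP B hd x y) ?_
  simp only [hitP_of_mem B hx]
  exact tendsto_const_nhds

lemma hitMeas_of_notMem (hd : d ≠ 0) {x : Fin d → ℤ} (hx : x ∉ B) (y : Fin d → ℤ) :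
    hitMeas latNbrs B x y = nbrAvg (fun z => hitMeas latNbrs B z y) x := by
  refine tendsto_nhds_unique ((tendsto_hitP B hd x y).comp (tendsto_add_atTop_nat 1)) ?_
  simp only [Function.comp_def, hitP_succ_of_notMem B hx, nbrAvg_eq]
  exact (tendsto_finsetSum _ fun z _ => tendsto_hitP B hd z y).const_mul _

end HitP

lemma exitMeas_nonneg (hd : d ≠ 0) (A : Finset (Fin d → ℤ)) (x y : Fin d → ℤ) :
    0 ≤ exitMeas A x y := hitMeas_nonneg _ hd x y

lemma exitMeas_of_bdry (hd : d ≠ 0) {A : Finset (Fin d → ℤ)} {x : Fin d → ℤ}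
    (hx : x ∈ bdryF latNbrs A) (y : Fin d → ℤ) :
    exitMeas A x y = if x = y then 1 else 0 :=
  hitMeas_of_mem _ hd (by simpa using hx) y

lemma exitMeas_of_mem (hd : d ≠ 0) {A : Finset (Fin d → ℤ)} {x : Fin d → ℤ}
    (hx : x ∈ A) (y : Fin d → ℤ) :
    exitMeas A x y = nbrAvg (fun z => exitMeas A z y) x :=
  hitMeas_of_notMem _ hd (by simp [mem_bdryF, hx]) y

/-- Optional stopping for a nonnegative function that is superharmonic on `A`. -/
lemma sum_exitMeas_mul_le (hd : d ≠ 0) {A : Finset (Fin d → ℤ)} {g : (Fin d → ℤ) → ℝ}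
    (hg : ∀ x ∈ A, 0 ≤ g x)
    (hsup : ∀ x ∈ A, nbrAvg g x ≤ g x) {x : Fin d → ℤ} (hx : x ∈ A) :
    ∑ y ∈ bdryF latNbrs A, exitMeas A x y * g y ≤ g x := by
  set B : Set (Fin d → ℤ) := ↑(bdryF latNbrs A) with hB
  have key : ∀ n : ℕ, ∀ x, (x ∈ A ∨ x ∈ bdryF latNbrs A) →
      ∑ y ∈ bdryF latNbrs A, hitP latNbrs B n x y * g y ≤ g x := by
    intro n
    have bd : ∀ n, ∀ x ∈ bdryF latNbrs A,
        ∑ y ∈ bdryF latNbrs A, hitP latNbrs B n x y * g y ≤ g x := by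
      intro n x hx
      have hx' : x ∈ B := by simpa [hB] using hx
      simp [hitP_of_mem B hx', hx]
    induction n with
    | zero =>
      rintro x (hx | hx)
      · have hx' : x ∉ B := by simp [hB, mem_bdryF, hx]
        simpa [hitP, hx'] using hg x hx
      · exact bd 0 x hx
    | succ n ih =>
      rintro x (hx | hx)
      · have hx' : x ∉ B := by simp [hB, mem_bdryF, hx]
        simp only [hitP_succ_of_notMem B hx']
        refine le_trans (le_of_eq ?_) ((nbrAvg_mono (g' := g) (x := x) fun z hz =>
          ih z (latNbrs_mem_union hx hz)).trans (hsup x hx))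
        rw [nbrAvg_sum]
        refine Finset.sum_congr rfl fun y _ => ?_
        rw [mul_comm, ← nbrAvg_smul]
        simp only [mul_comm]
      · exact bd (n + 1) x hx
  refine le_of_tendsto' (tendsto_finsetSum _ fun y _ =>
    (tendsto_hitP B hd x y).mul_const (g y)) fun n => key n x (Or.inl hx)

lemma stdv_apply (i j : Fin d) : (stdv i : Fin d → ℤ) j = if j = i then 1 else 0 := by
  simp [stdv, Pi.single_apply]

/-- The squared Euclidean norm increases by one on average along a step of the walk. -/
lemma nbrAvg_sum_sq (hd : d ≠ 0) (x : Fin d → ℤ) :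
    nbrAvg (fun z => ∑ j, ((z j : ℝ)) ^ 2) x = ∑ j, ((x j : ℝ)) ^ 2 + 1 := by
  have h : ∀ i : Fin d, (∑ j, (((x + stdv i) j : ℤ) : ℝ) ^ 2) + ∑ j, (((x - stdv i) j : ℤ) : ℝ) ^ 2
      = 2 * ∑ j, ((x j : ℝ)) ^ 2 + 2 := by
    intro i
    rw [← Finset.sum_add_distrib]
    have : ∀ j, (((x + stdv i) j : ℤ) : ℝ) ^ 2 + (((x - stdv i) j : ℤ) : ℝ) ^ 2
        = 2 * ((x j : ℝ)) ^ 2 + if j = i then 2 else 0 := by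
      intro j
      simp only [Pi.add_apply, Pi.sub_apply, stdv_apply]
      split_ifs <;> push_cast <;> ring
    simp only [this, Finset.sum_add_distrib, ← Finset.mul_sum]
    simp
  have hd' : (d : ℝ) ≠ 0 := by exact_mod_cast hd
  simp only [nbrAvg, h]
  simp
  field_simp

/-- The walk leaves a finite set almost surely. -/
lemma sum_exitMeas (hd : d ≠ 0) (A : Finset (Fin d → ℤ)) {x : Fin d → ℤ} (hx : x ∈ A) :
    ∑ y ∈ bdryF latNbrs A, exitMeas A x y = 1 := by
  refine le_antisymm ?_ ?_
  · simpa using sum_exitMeas_mul_le hd (g := fun _ => 1) (fun _ _ => zero_le_one)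
      (fun z _ => (nbrAvg_const hd 1 z).le) hx
  · set u : (Fin d → ℤ) → ℝ := fun z => ∑ y ∈ bdryF latNbrs A, exitMeas A z y with hu
    set N : (Fin d → ℤ) → ℝ := fun z => ∑ j, ((z j : ℝ)) ^ 2 with hN
    have hN0 : ∀ z, 0 ≤ N z := fun z => Finset.sum_nonneg fun j _ => sq_nonneg _
    have hub : ∀ z ∈ bdryF latNbrs A, u z = 1 := by
      intro z hz
      simp [hu, exitMeas_of_bdry hd hz, hz]
    have hua : ∀ z ∈ A, nbrAvg u z = u z := by
      intro z hz
      simp only [hu]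
      rw [nbrAvg_sum]
      exact Finset.sum_congr rfl fun y _ => (exitMeas_of_mem hd hz y).symm
    have key : ∀ ε > 0, 1 - ε * (∑ z ∈ A ∪ bdryF latNbrs A, N z) ≤ u x := by
      intro ε hε
      obtain ⟨z, hz, hmin⟩ := Finset.exists_min_image (A ∪ bdryF latNbrs A)
        (fun z => u z - ε * N z) ⟨x, by simp [hx]⟩
      have hzb : z ∈ bdryF latNbrs A := by
        rcases Finset.mem_union.1 hz with hz | hz
        · exfalso
          have h1 : u z - ε * N z ≤ nbrAvg (fun w => u w + (-ε) * N w) z := by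
            refine le_nbrAvg_of_le hd fun w hw => ?_
            have := hmin w (by simpa using latNbrs_mem_union hz hw)
            linarith
          rw [nbrAvg_add, nbrAvg_smul, hua z hz, hN, nbrAvg_sum_sq hd] at h1
          linarith
        · exact hz
      have h2 := hmin x (by simp [hx])
      simp only [hub z hzb] at h2
      have h3 : N z ≤ ∑ z ∈ A ∪ bdryF latNbrs A, N z :=
        Finset.single_le_sum (fun w _ => hN0 w) hz
      have h4 := mul_le_mul_of_nonneg_left h3 hε.le
      have := mul_nonneg hε.le (hN0 x)
      linarith
    set S := ∑ z ∈ A ∪ bdryF latNbrs A, N z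
    have hS : 0 ≤ S := Finset.sum_nonneg fun w _ => hN0 w
    refine le_of_forall_pos_le_add fun ε hε => ?_
    have h5 := key (ε / (S + 1)) (by positivity)
    have h6 : ε / (S + 1) * S ≤ ε := by
      rw [div_mul_eq_mul_div, div_le_iff₀ (by positivity)]
      nlinarith
    linarith

end Walk

/-- The defining properties of an internal DLA chain. -/
structure IsIDLA {d : ℕ} {Ω : Type*} [MeasurableSpace Ω] (P : Measure Ω)
    (I : ℕ → Ω → Finset (Fin d → ℤ)) (Y : ℕ → Ω → (Fin d → ℤ)) : Prop where
  zero : ∀ ω, I 0 ω = {0}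
  step : ∀ n ω, I (n + 1) ω = insert (Y (n + 1) ω) (I n ω)
  bdry : ∀ n ω, Y (n + 1) ω ∈ bdryF latNbrs (I n ω)
  law : ∀ (n : ℕ) (A : Finset (Fin d → ℤ)), ∀ y ∈ bdryF latNbrs A,
    P {ω | I n ω = A ∧ Y (n + 1) ω = y}
      = ENNReal.ofReal (exitMeas A 0 y) * P {ω | I n ω = A}

namespace IsIDLA

variable {d : ℕ} {Ω : Type*} [MeasurableSpace Ω] {P : Measure Ω}
  {I : ℕ → Ω → Finset (Fin d → ℤ)} {Y : ℕ → Ω → (Fin d → ℤ)}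

lemma zero_mem (h : IsIDLA P I Y) (n : ℕ) (ω : Ω) : (0 : Fin d → ℤ) ∈ I n ω := by
  induction n with
  | zero => simp [h.zero]
  | succ n ih => rw [h.step]; exact Finset.mem_insert_of_mem ih

lemma card_eq (h : IsIDLA P I Y) (n : ℕ) (ω : Ω) : (I n ω).card = n + 1 := by
  induction n with
  | zero => simp [h.zero]
  | succ n ih =>
    rw [h.step, Finset.card_insert_of_notMem (mem_bdryF.1 (h.bdry n ω)).2, ih]

lemma subset_succ (h : IsIDLA P I Y) (n : ℕ) (ω : Ω) : I n ω ⊆ I (n + 1) ω := by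
  rw [h.step]; exact Finset.subset_insert _ _

/-- The cluster is connected: an integer valued function that changes by at most one along
edges takes on the cluster all the values between those at a cluster point and at `0`. -/
lemma exists_eq_of_lipschitz (h : IsIDLA P I Y) (φ : (Fin d → ℤ) → ℤ)
    (hφ : ∀ x, ∀ y ∈ latNbrs x, φ x ≤ φ y + 1) (n : ℕ) (ω : Ω) {z : Fin d → ℤ}
    (hz : z ∈ I n ω) {k : ℤ} (h1 : φ z ≤ k) (h2 : k ≤ φ 0) : ∃ x ∈ I n ω, φ x = k := by
  induction n generalizing z with
  | zero =>
    rw [h.zero] at hz ⊢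
    simp at hz
    subst hz
    exact ⟨0, by simp, le_antisymm h1 h2⟩
  | succ n ih =>
    have key : ∀ {z}, z ∈ I n ω → φ z ≤ k → ∃ x ∈ I (n + 1) ω, φ x = k := by
      intro z hz h1
      obtain ⟨x, hx, hk⟩ := ih hz h1
      exact ⟨x, h.subset_succ n ω hx, hk⟩
    by_cases hzn : z ∈ I n ω
    · exact key hzn h1
    · have hzY : z = Y (n + 1) ω := by
        rw [h.step] at hz
        exact (Finset.mem_insert.1 hz).resolve_right hzn
      rcases h1.eq_or_lt with h1 | h1
      · exact ⟨z, hz, h1⟩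
      · obtain ⟨⟨x, hx, hxy⟩, -⟩ := mem_bdryF.1 (h.bdry n ω)
        rw [← hzY] at hxy
        exact key hx (by have := hφ x z hxy; omega)

/-- Markov inequality for a function of the cluster that is a supermartingale. -/
lemma prob_le_of_supermartingale (h : IsIDLA P I Y) [IsProbabilityMeasure P] (hd : d ≠ 0)
    (Φ : Finset (Fin d → ℤ) → ℝ) (hΦ : ∀ A, 0 ≤ Φ A)
    (hsup : ∀ A : Finset (Fin d → ℤ), 0 ∈ A →
      ∑ y ∈ bdryF latNbrs A, exitMeas A 0 y * Φ (insert y A) ≤ Φ A)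
    (t : ℕ) (Bad : Ω → Prop) {c : ℝ} (hc : 0 < c)
    (hBad : ∀ ω, Bad ω → c ≤ Φ (I t ω)) :
    P {ω | Bad ω} ≤ ENNReal.ofReal (Φ {0} / c) := by
  set p : ℕ → Finset (Fin d → ℤ) → ENNReal := fun t A => P {ω | I t ω = A} with hp
  set φ : Finset (Fin d → ℤ) → ENNReal := fun A => ENNReal.ofReal (Φ A) with hφ
  have hp0 : ∀ t A, (0 : Fin d → ℤ) ∉ A → p t A = 0 := by
    intro t A hA
    have : {ω | I t ω = A} = ∅ := by
      ext ω
      simp only [Set.mem_ofPred_eq, Set.mem_empty_iff_false, iff_false]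
      rintro rfl
      exact hA (h.zero_mem t ω)
    simp [hp, this]
  have hpstep : ∀ t A', p (t + 1) A' ≤ ∑' A, ∑ y ∈ bdryF latNbrs A,
      if insert y A = A' then ENNReal.ofReal (exitMeas A 0 y) * p t A else 0 := by
    intro t A'
    have hsub : {ω | I (t + 1) ω = A'} ⊆ ⋃ A : Finset (Fin d → ℤ),
        ⋃ y ∈ (bdryF latNbrs A).filter (fun y => insert y A = A'),
          {ω | I t ω = A ∧ Y (t + 1) ω = y} := by
      intro ω hω
      simp only [Set.mem_ofPred_eq, Set.mem_iUnion] at hω ⊢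
      refine ⟨I t ω, Y (t + 1) ω, ?_, rfl, rfl⟩
      rw [Finset.mem_filter]
      exact ⟨h.bdry t ω, by rw [← h.step, hω]⟩
    refine (measure_mono hsub).trans ((measure_iUnion_le _).trans ?_)
    refine ENNReal.tsum_le_tsum fun A => ?_
    refine (measure_biUnion_finset_le _ _).trans ?_
    rw [Finset.sum_filter]
    refine Finset.sum_le_sum fun y hy => ?_
    split_ifs
    · rw [h.law t A y hy]
    · exact le_rfl
  have hmono : ∀ t, ∑' A, p t A * φ A ≤ φ {0} := by
    intro t
    induction t with
    | zero =>
      refine (tsum_eq_single {0} ?_).le.trans ?_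
      · intro A hA
        have : {ω | I 0 ω = A} = ∅ := by
          ext ω
          simp only [Set.mem_ofPred_eq, Set.mem_empty_iff_false, iff_false]
          rintro rfl
          exact hA (h.zero ω)
        simp [hp, this]
      · exact (mul_le_mul_left prob_le_one _).trans (one_mul _).le
    | succ t ih =>
      refine le_trans ?_ ih
      calc ∑' A', p (t + 1) A' * φ A'
          ≤ ∑' A', (∑' A, ∑ y ∈ bdryF latNbrs A,
              if insert y A = A' then ENNReal.ofReal (exitMeas A 0 y) * p t A else 0) * φ A' :=
            ENNReal.tsum_le_tsum fun A' => mul_le_mul_left (hpstep t A') _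
        _ = ∑' A', ∑' A, ∑ y ∈ bdryF latNbrs A,
              if insert y A = A' then ENNReal.ofReal (exitMeas A 0 y) * p t A * φ A' else 0 := by
            refine tsum_congr fun A' => ?_
            rw [← ENNReal.tsum_mul_right]
            refine tsum_congr fun A => ?_
            rw [Finset.sum_mul]
            exact Finset.sum_congr rfl fun y _ => by split_ifs <;> simp
        _ = ∑' A, ∑ y ∈ bdryF latNbrs A,
              ENNReal.ofReal (exitMeas A 0 y) * p t A * φ (insert y A) := by
            rw [ENNReal.tsum_comm]
            refine tsum_congr fun A => ?_
            rw [Summable.tsum_finsetSum (fun _ _ => ENNReal.summable)]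
            refine Finset.sum_congr rfl fun y _ => ?_
            rw [tsum_eq_single (insert y A)]
            · simp
            · intro A' hA'
              simp [Ne.symm hA']
        _ ≤ ∑' A, p t A * φ A := by
            refine ENNReal.tsum_le_tsum fun A => ?_
            by_cases hA : (0 : Fin d → ℤ) ∈ A
            · calc ∑ y ∈ bdryF latNbrs A,
                    ENNReal.ofReal (exitMeas A 0 y) * p t A * φ (insert y A)
                  = p t A * ∑ y ∈ bdryF latNbrs A,
                      ENNReal.ofReal (exitMeas A 0 y * Φ (insert y A)) := by
                    rw [Finset.mul_sum]
                    refine Finset.sum_congr rfl fun y _ => ?_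
                    rw [ENNReal.ofReal_mul (exitMeas_nonneg hd A 0 y)]
                    ring
                _ = p t A * ENNReal.ofReal (∑ y ∈ bdryF latNbrs A,
                      exitMeas A 0 y * Φ (insert y A)) := by
                    rw [ENNReal.ofReal_sum_of_nonneg]
                    exact fun y _ => mul_nonneg (exitMeas_nonneg hd A 0 y) (hΦ _)
                _ ≤ p t A * φ A := by
                    gcongr
                    exact ENNReal.ofReal_le_ofReal (hsup A hA)
            · simp [hp0 t A hA]
  have hB : P {ω | Bad ω} ≤ ∑' A, if c ≤ Φ A then p t A else 0 := by
    have hsub : {ω | Bad ω} ⊆ ⋃ A : Finset (Fin d → ℤ), {ω | I t ω = A ∧ c ≤ Φ A} := by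
      intro ω hω
      simp only [Set.mem_iUnion]
      exact ⟨I t ω, rfl, hBad ω hω⟩
    refine (measure_mono hsub).trans ((measure_iUnion_le _).trans ?_)
    refine ENNReal.tsum_le_tsum fun A => ?_
    split_ifs with hA
    · simp [hA, hp]
    · simp [hA]
  rw [ENNReal.ofReal_div_of_pos hc]
  have hc' : ENNReal.ofReal c ≠ 0 := by simpa using hc
  rw [ENNReal.le_div_iff_mul_le (Or.inl hc') (Or.inl ENNReal.ofReal_ne_top)]
  refine (mul_le_mul_left hB _).trans (le_trans ?_ (hmono t))
  rw [← ENNReal.tsum_mul_right]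
  refine ENNReal.tsum_le_tsum fun A => ?_
  split_ifs with hA
  · exact mul_le_mul_right (ENNReal.ofReal_le_ofReal hA) _
  · simp

/-- Supermartingale bound for a product over the points of the cluster, stopped when the
cluster leaves a decreasing family of sets. -/
lemma prob_le_of_prod (h : IsIDLA P I Y) [IsProbabilityMeasure P] (hd : d ≠ 0)
    (φ : (Fin d → ℤ) → ℝ) (hφ : ∀ x, 0 ≤ φ x) (Good : Finset (Fin d → ℤ) → Prop)
    (hGood : ∀ A y, Good (insert y A) → Good A)
    (hsup : ∀ A : Finset (Fin d → ℤ), 0 ∈ A → Good A →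
      ∑ y ∈ bdryF latNbrs A, exitMeas A 0 y * φ y ≤ 1)
    (t : ℕ) (Bad : Ω → Prop) {c : ℝ} (hc : 0 < c)
    (hBad : ∀ ω, Bad ω → Good (I t ω) ∧ c ≤ ∏ x ∈ I t ω, φ x) :
    P {ω | Bad ω} ≤ ENNReal.ofReal (φ 0 / c) := by
  classical
  set Φ : Finset (Fin d → ℤ) → ℝ := fun A => if Good A then ∏ x ∈ A, φ x else 0 with hΦ
  have hpr : ∀ A : Finset (Fin d → ℤ), 0 ≤ ∏ x ∈ A, φ x :=
    fun A => Finset.prod_nonneg fun x _ => hφ x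
  have hΦ0 : ∀ A, 0 ≤ Φ A := by
    intro A; simp only [hΦ]; split_ifs
    · exact hpr A
    · exact le_rfl
  refine (h.prob_le_of_supermartingale hd Φ hΦ0 ?_ t Bad hc ?_).trans ?_
  · intro A hA
    by_cases hG : Good A
    · have : ∀ y ∈ bdryF latNbrs A, exitMeas A 0 y * Φ (insert y A)
          ≤ (exitMeas A 0 y * φ y) * ∏ x ∈ A, φ x := by
        intro y hy
        have hyA := (mem_bdryF.1 hy).2
        have h1 : Φ (insert y A) ≤ φ y * ∏ x ∈ A, φ x := by
          simp only [hΦ]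
          split_ifs
          · rw [Finset.prod_insert hyA]
          · exact mul_nonneg (hφ y) (hpr A)
        calc _ ≤ exitMeas A 0 y * (φ y * ∏ x ∈ A, φ x) :=
              mul_le_mul_of_nonneg_left h1 (exitMeas_nonneg hd A 0 y)
          _ = _ := by ring
      refine (Finset.sum_le_sum this).trans ?_
      rw [← Finset.sum_mul]
      have := mul_le_mul_of_nonneg_right (hsup A hA hG) (hpr A)
      simpa [hΦ, hG] using this
    · have : ∀ y ∈ bdryF latNbrs A, exitMeas A 0 y * Φ (insert y A) = 0 := by
        intro y _
        have : ¬ Good (insert y A) := fun hg => hG (hGood A y hg)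
        simp [hΦ, this]
      rw [Finset.sum_eq_zero this]
      exact hΦ0 A
  · intro ω hω
    obtain ⟨h1, h2⟩ := hBad ω hω
    simpa [hΦ, h1] using h2
  · refine ENNReal.ofReal_le_ofReal ?_
    gcongr
    simp only [hΦ]
    split_ifs
    · simp
    · exact hφ 0

end IsIDLA

lemma abs_le_of_abs_deriv_le {φ φ' : ℝ → ℝ} {C Y : ℝ} (hY : 0 ≤ Y)
    (h : ∀ s, 0 ≤ s → s ≤ Y → HasDerivAt φ (φ' s) s) (hb : ∀ s, 0 ≤ s → s ≤ Y → |φ' s| ≤ C)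
    (h0 : φ 0 = 0) : |φ Y| ≤ C * Y := by
  have := norm_image_sub_le_of_norm_deriv_le_segment' (f := φ) (f' := φ') (a := 0) (b := Y)
    (C := C) (fun s hs => (h s hs.1 hs.2).hasDerivWithinAt)
    (fun s hs => hb s hs.1 hs.2.le) Y ⟨hY, le_rfl⟩
  simpa [h0] using this

/-- The radial kernel: up to scaling, `fker d (|x|²)` is the fundamental solution of the
Laplacian in dimension `d`. -/
noncomputable def fker (d : ℕ) (t : ℝ) : ℝ :=
  if d = 2 then -Real.log t else t ^ (1 - (d : ℝ) / 2) / ((d : ℝ) / 2 - 1)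

section Kernel

variable {d : ℕ}

lemma hasDerivAt_fker (hd : 2 ≤ d) {t : ℝ} (ht : 0 < t) :
    HasDerivAt (fker d) (-t ^ (-((d : ℝ) / 2))) t := by
  by_cases h : d = 2
  · subst h
    have : fker 2 = fun t => -Real.log t := by ext; simp [fker]
    rw [this]
    refine (Real.hasDerivAt_log ht.ne').fun_neg.congr_deriv ?_
    norm_num [Real.rpow_neg_one]
  · have h3 : (3 : ℝ) ≤ d := by exact_mod_cast (by omega : 3 ≤ d)
    have : fker d = fun t => t ^ (1 - (d : ℝ) / 2) / ((d : ℝ) / 2 - 1) := by ext; simp [fker, h]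
    rw [this]
    refine ((Real.hasDerivAt_rpow_const (p := 1 - (d : ℝ) / 2)
      (Or.inl ht.ne')).div_const ((d : ℝ) / 2 - 1)).congr_deriv ?_
    rw [show 1 - (d : ℝ) / 2 - 1 = -((d : ℝ) / 2) by ring]
    have : (d : ℝ) - 2 ≠ 0 := by linarith
    field_simp
    ring

lemma neg_half_nonpos : -((d : ℝ) / 2) ≤ 0 := by
  have : (0 : ℝ) ≤ d := Nat.cast_nonneg d
  linarith

lemma exists_fker_slope (hd : 2 ≤ d) {s D : ℝ} (hs : 0 < s) (hD : 0 < D) :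
    ∃ c, s < c ∧ c < s + D ∧ fker d s - fker d (s + D) = D * c ^ (-((d : ℝ) / 2)) := by
  obtain ⟨c, hc, h⟩ := exists_hasDerivAt_eq_slope (fker d) (fun t => -t ^ (-((d : ℝ) / 2)))
    (show s < s + D by linarith)
    (fun t ht => (hasDerivAt_fker hd (by linarith [ht.1])).continuousAt.continuousWithinAt)
    (fun t ht => hasDerivAt_fker hd (by linarith [ht.1]))
  refine ⟨c, hc.1, hc.2, ?_⟩
  rw [eq_div_iff (by linarith)] at h
  linarith

lemma fker_sub_le (hd : 2 ≤ d) {s D : ℝ} (hs : 0 < s) (hD : 0 ≤ D) :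
    fker d s - fker d (s + D) ≤ D * s ^ (-((d : ℝ) / 2)) := by
  rcases hD.eq_or_lt with rfl | hD
  · simp
  obtain ⟨c, h1, h2, h3⟩ := exists_fker_slope hd hs hD
  rw [h3]
  exact mul_le_mul_of_nonneg_left
    (Real.rpow_le_rpow_of_nonpos hs h1.le neg_half_nonpos) hD.le

lemma le_fker_sub (hd : 2 ≤ d) {s D : ℝ} (hs : 0 < s) (hD : 0 ≤ D) :
    D * (s + D) ^ (-((d : ℝ) / 2)) ≤ fker d s - fker d (s + D) := by
  rcases hD.eq_or_lt with rfl | hD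
  · simp
  obtain ⟨c, h1, h2, h3⟩ := exists_fker_slope hd hs hD
  rw [h3]
  exact mul_le_mul_of_nonneg_left
    (Real.rpow_le_rpow_of_nonpos (hs.trans h1) h2.le neg_half_nonpos) hD.le

lemma fker_anti (hd : 2 ≤ d) {s t : ℝ} (hs : 0 < s) (hst : s ≤ t) : fker d t ≤ fker d s := by
  have := le_fker_sub hd hs (sub_nonneg.2 hst)
  rw [add_sub_cancel] at this
  have h2 : 0 ≤ (t - s) * t ^ (-((d : ℝ) / 2)) :=
    mul_nonneg (by linarith) (Real.rpow_nonneg (by linarith) _)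
  linarith

lemma fker_sub_le_sqrt (hd : 2 ≤ d) {s D : ℝ} (hs : 0 < s) (hD : 0 ≤ D) :
    fker d s - fker d (s + D) ≤ 2 * √D * s ^ ((1 - (d : ℝ)) / 2) := by
  rcases hD.eq_or_lt with rfl | hD
  · simp
  obtain ⟨c, hc, h⟩ := exists_ratio_hasDerivAt_eq_ratio_slope (fker d)
    (fun t => -t ^ (-((d : ℝ) / 2))) (show s < s + D by linarith)
    (fun t ht => (hasDerivAt_fker hd (by linarith [ht.1])).continuousAt.continuousWithinAt)
    (fun t ht => hasDerivAt_fker hd (by linarith [ht.1]))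
    (fun t => √t) (fun t => 1 / (2 * √t)) (Real.continuous_sqrt.continuousOn)
    (fun t ht => Real.hasDerivAt_sqrt (by linarith [ht.1] : (0 : ℝ) < t).ne')
  have hc0 : 0 < c := by linarith [hc.1]
  have hsc : 0 < √c := Real.sqrt_pos.2 hc0
  have h1 : fker d s - fker d (s + D) =
      2 * (√(s + D) - √s) * (√c * c ^ (-((d : ℝ) / 2))) := by
    field_simp at h
    linarith
  have h2 : √c * c ^ (-((d : ℝ) / 2)) ≤ s ^ ((1 - (d : ℝ)) / 2) := by
    rw [Real.sqrt_eq_rpow, ← Real.rpow_add hc0,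
      show (1 : ℝ) / 2 + -((d : ℝ) / 2) = (1 - d) / 2 by ring]
    refine Real.rpow_le_rpow_of_nonpos hs hc.1.le ?_
    have : (2 : ℝ) ≤ d := by exact_mod_cast hd
    linarith
  have h3 : √(s + D) - √s ≤ √D := by
    rw [sub_le_iff_le_add, Real.sqrt_le_left (by positivity)]
    nlinarith [Real.sq_sqrt hs.le, Real.sq_sqrt hD.le,
      mul_nonneg (Real.sqrt_nonneg s) (Real.sqrt_nonneg D)]
  rw [h1]
  gcongr

lemma fker_sub_le_log (hd : 2 ≤ d) {s T : ℝ} (hs : 1 ≤ s) (hT : s ≤ T) :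
    fker d s - fker d T ≤ 2 * (if d = 2 then Real.log T else 1) := by
  by_cases h : d = 2
  · subst h
    simp only [fker, if_true]
    have := Real.log_nonneg hs
    have := Real.log_nonneg (hs.trans hT)
    linarith
  · have h3 : (3 : ℝ) ≤ d := by exact_mod_cast (by omega : 3 ≤ d)
    simp only [fker, h, if_false]
    have h1 : 0 ≤ T ^ (1 - (d : ℝ) / 2) / ((d : ℝ) / 2 - 1) :=
      div_nonneg (Real.rpow_nonneg (by linarith) _) (by linarith)
    have h2 : s ^ (1 - (d : ℝ) / 2) ≤ 1 :=
      Real.rpow_le_one_of_one_le_of_nonpos hs (by linarith)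
    have h4 : s ^ (1 - (d : ℝ) / 2) / ((d : ℝ) / 2 - 1) ≤ 2 := by
      rw [div_le_iff₀ (by linarith)]
      linarith
    linarith

lemma abs_rpow_sub_rpow_le {p t μ : ℝ} (hp : 0 ≤ p) (ht : 0 < t) (hμ : 0 ≤ μ) :
    |(t + μ) ^ (-p) - t ^ (-p)| ≤ p * t ^ (-p - 1) * μ := by
  have := abs_le_of_abs_deriv_le (φ := fun s => (t + s) ^ (-p) - t ^ (-p))
    (φ' := fun s => -p * (t + s) ^ (-p - 1)) (C := p * t ^ (-p - 1)) hμ ?_ ?_ (by simp)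
  · simpa using this
  · intro s hs _
    have h := (Real.hasDerivAt_rpow_const (x := t + s) (p := -p)
      (Or.inl (by linarith : (0 : ℝ) < t + s).ne')).comp_const_add t s
    exact h.sub_const _
  · intro s hs _
    have h1 : (t + s) ^ (-p - 1) ≤ t ^ (-p - 1) :=
      Real.rpow_le_rpow_of_nonpos ht (by linarith) (by linarith)
    have h2 : 0 ≤ (t + s) ^ (-p - 1) := Real.rpow_nonneg (by linarith) _
    rw [abs_mul, abs_neg, abs_of_nonneg hp, abs_of_nonneg h2]
    gcongr

/-- Second order Taylor expansion of the second symmetric difference of a function whose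
derivative is `-t ^ (-q)`. -/
lemma symm_diff_taylor {q : ℝ} (hq : 0 ≤ q) {F : ℝ → ℝ}
    (hF : ∀ t, 0 < t → HasDerivAt F (-t ^ (-q)) t) {T y : ℝ} (hT : 0 < T) (hy : 0 ≤ y)
    (hyT : y ≤ T / 2) :
    |F (T + y) + F (T - y) - 2 * F T - y ^ 2 * (q * T ^ (-q - 1))| ≤
      2 * (q * (q + 1) * (q + 2) * (T / 2) ^ (-q - 3)) * y ^ 4 := by
  set M := q * (q + 1) * (q + 2) * (T / 2) ^ (-q - 3) with hM
  have hM0 : 0 ≤ M := by have := Real.rpow_nonneg (by linarith : 0 ≤ T / 2) (-q - 3); positivity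
  have hadd : ∀ p s, 0 ≤ s → s ≤ y → HasDerivAt (fun s => (T + s) ^ p) (p * (T + s) ^ (p - 1)) s :=
    fun p s hs _ => (Real.hasDerivAt_rpow_const (x := T + s) (p := p)
      (Or.inl (by linarith : (0 : ℝ) < T + s).ne')).comp_const_add T s
  have hsub : ∀ p s, 0 ≤ s → s ≤ y →
      HasDerivAt (fun s => (T - s) ^ p) (-(p * (T - s) ^ (p - 1))) s :=
    fun p s _ hs => (Real.hasDerivAt_rpow_const (x := T - s) (p := p)
      (Or.inl (by linarith : (0 : ℝ) < T - s).ne')).comp_const_sub T s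
  have e3 : ∀ s, 0 ≤ s → s ≤ y →
      |-(q * (q + 1)) * ((T + s) ^ (-q - 2) - (T - s) ^ (-q - 2))| ≤ 2 * M * s := by
    intro s hs hsy
    have h := abs_rpow_sub_rpow_le (p := q + 2) (t := T - s) (μ := 2 * s) (by linarith)
      (by linarith) (by linarith)
    rw [show T - s + 2 * s = T + s by ring, show -(q + 2) = -q - 2 by ring,
      show -q - 2 - 1 = -q - 3 by ring] at h
    have h2 : (T - s) ^ (-q - 3) ≤ (T / 2) ^ (-q - 3) :=
      Real.rpow_le_rpow_of_nonpos (by linarith) (by linarith) (by linarith)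
    rw [abs_mul, abs_neg, abs_of_nonneg (by positivity : 0 ≤ q * (q + 1))]
    calc _ ≤ q * (q + 1) * ((q + 2) * (T - s) ^ (-q - 3) * (2 * s)) := by gcongr
      _ ≤ q * (q + 1) * ((q + 2) * (T / 2) ^ (-q - 3) * (2 * s)) := by gcongr
      _ = 2 * M * s := by rw [hM]; ring
  have e2 : ∀ s, 0 ≤ s → s ≤ y →
      |q * ((T + s) ^ (-q - 1) + (T - s) ^ (-q - 1) - 2 * T ^ (-q - 1))| ≤ 2 * M * s * s := by
    intro s hs hsy
    refine abs_le_of_abs_deriv_le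
      (φ := fun s => q * ((T + s) ^ (-q - 1) + (T - s) ^ (-q - 1) - 2 * T ^ (-q - 1)))
      (φ' := fun s => -(q * (q + 1)) * ((T + s) ^ (-q - 2) - (T - s) ^ (-q - 2))) hs ?_ ?_
      (by simp; right; ring)
    · intro u hu hus
      refine ((((hadd (-q - 1) u hu (by linarith)).add (hsub (-q - 1) u hu (by linarith))).sub_const
        _).const_mul q).congr_deriv ?_
      rw [show -q - 1 - 1 = -q - 2 by ring]
      ring
    · intro u hu hus
      refine (e3 u hu (by linarith)).trans ?_
      gcongr
  have e1 : ∀ s, 0 ≤ s → s ≤ y →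
      |-(T + s) ^ (-q) + (T - s) ^ (-q) - 2 * s * (q * T ^ (-q - 1))| ≤ 2 * M * s * s * s := by
    intro s hs hsy
    refine abs_le_of_abs_deriv_le
      (φ := fun s => -(T + s) ^ (-q) + (T - s) ^ (-q) - 2 * s * (q * T ^ (-q - 1)))
      (φ' := fun s => q * ((T + s) ^ (-q - 1) + (T - s) ^ (-q - 1) - 2 * T ^ (-q - 1))) hs ?_ ?_
      (by simp)
    · intro u hu hus
      refine ((((hadd (-q) u hu (by linarith)).neg).add (hsub (-q) u hu (by linarith))).sub
        (((hasDerivAt_id u).const_mul 2).mul_const (q * T ^ (-q - 1)))).congr_deriv ?_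
      ring
    · intro u hu hus
      refine (e2 u hu (by linarith)).trans ?_
      gcongr
  have := abs_le_of_abs_deriv_le
      (φ := fun s => F (T + s) + F (T - s) - 2 * F T - s ^ 2 * (q * T ^ (-q - 1)))
      (φ' := fun s => -(T + s) ^ (-q) + (T - s) ^ (-q) - 2 * s * (q * T ^ (-q - 1)))
      (C := 2 * M * y * y * y) hy ?_ ?_ (by simp; ring)
  · refine this.trans (le_of_eq (by ring))
  · intro u hu hus
    refine ((((hF (T + u) (by linarith)).comp_const_add T u).add
      ((hF (T - u) (by linarith)).comp_const_sub T u)).sub_const (2 * F T)).sub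
        ((hasDerivAt_pow 2 u).mul_const (q * T ^ (-q - 1))) |>.congr_deriv ?_
    norm_num
  · intro u hu hus
    refine (e1 u hu hus).trans ?_
    gcongr

/-- Expansion of the second symmetric difference around a point shifted by `μ`. -/
lemma symm_diff_taylor_shift {q : ℝ} (hq : 0 ≤ q) {F : ℝ → ℝ}
    (hF : ∀ t, 0 < t → HasDerivAt F (-t ^ (-q)) t) {t μ y : ℝ} (ht : 64 ≤ t) (hμ : 0 ≤ μ)
    (hμ1 : μ ≤ 1) (hy : y ^ 2 ≤ 8 * μ * t) :
    |F (t + μ + y) + F (t + μ - y) - 2 * F t - (-2 * μ * t ^ (-q) + y ^ 2 * (q * t ^ (-q - 1)))| ≤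
      (128 * (q * (q + 1) * (q + 2) * 2 ^ (q + 3)) + 2 * q + 8 * (q * (q + 1))) *
        (μ * t ^ (-q - 1)) := by
  wlog hy0 : 0 ≤ y generalizing y
  · have := this (y := -y) (by simpa using hy) (by linarith)
    refine le_trans (le_of_eq ?_) this
    congr 1
    rw [show t + μ + -y = t + μ - y by ring, show t + μ - -y = t + μ + y by ring]
    ring
  have ht0 : 0 < t := by linarith
  have hyt : y ≤ (t + μ) / 2 := by
    have : y ^ 2 ≤ (t / 2) ^ 2 := by nlinarith
    have := abs_le_of_sq_le_sq this (by linarith)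
    linarith [abs_le.1 this]
  have h1 := symm_diff_taylor hq hF (T := t + μ) (by linarith) hy0 hyt
  have h2 : |F (t + μ) - F t + μ * t ^ (-q)| ≤ q * t ^ (-q - 1) * μ * μ := by
    refine abs_le_of_abs_deriv_le (φ := fun s => F (t + s) - F t + s * t ^ (-q))
      (φ' := fun s => -(t + s) ^ (-q) + t ^ (-q)) hμ ?_ ?_ (by simp)
    · intro s hs _
      refine (((hF (t + s) (by linarith)).comp_const_add t s).sub_const (F t)).add
        ((hasDerivAt_id s).mul_const (t ^ (-q))) |>.congr_deriv ?_
      simp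
    · intro s hs hsμ
      have := abs_rpow_sub_rpow_le hq ht0 hs
      rw [show -(t + s) ^ (-q) + t ^ (-q) = -((t + s) ^ (-q) - t ^ (-q)) by ring, abs_neg]
      refine this.trans ?_
      have := Real.rpow_nonneg ht0.le (-q - 1)
      gcongr
  have h3 := abs_rpow_sub_rpow_le (p := q + 1) (by linarith) ht0 hμ
  rw [show -(q + 1) = -q - 1 by ring] at h3
  set X := t ^ (-q - 1) with hX
  have hX0 : 0 ≤ X := Real.rpow_nonneg ht0.le _
  have hX2 : t ^ (-q - 1 - 1) = X / t := by
    rw [hX, Real.rpow_sub_one ht0.ne']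
  rw [hX2] at h3
  have h4 : ((t + μ) / 2) ^ (-q - 3) ≤ 2 ^ (q + 3) * (X / t ^ 2) := by
    have : ((t + μ) / 2) ^ (-q - 3) ≤ (t / 2) ^ (-q - 3) :=
      Real.rpow_le_rpow_of_nonpos (by linarith) (by linarith) (by linarith)
    refine this.trans (le_of_eq ?_)
    rw [Real.div_rpow ht0.le (by norm_num), show -q - 3 = -q - 1 - (2 : ℕ) by push_cast; ring,
      Real.rpow_sub_natCast ht0.ne', show -q - 1 - ((2 : ℕ) : ℝ) = -(q + 3) by push_cast; ring,
      Real.rpow_neg (by norm_num), ← hX]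
    field_simp
  have hy4 : y ^ 4 ≤ 64 * μ * t ^ 2 := by
    have : y ^ 4 ≤ (8 * μ * t) ^ 2 := by
      rw [show y ^ 4 = (y ^ 2) ^ 2 by ring]
      gcongr
    nlinarith [mul_nonneg (mul_nonneg hμ (sub_nonneg.2 hμ1)) (sq_nonneg t)]
  have b1 : 2 * (q * (q + 1) * (q + 2) * ((t + μ) / 2) ^ (-q - 3)) * y ^ 4 ≤
      128 * (q * (q + 1) * (q + 2) * 2 ^ (q + 3)) * (μ * X) := by
    calc _ ≤ 2 * (q * (q + 1) * (q + 2) * (2 ^ (q + 3) * (X / t ^ 2))) * (64 * μ * t ^ 2) := by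
          gcongr
      _ = _ := by field_simp; ring
  have b2 : q * X * μ * μ ≤ q * (μ * X) := by
    have : 0 ≤ q * X * μ := by positivity
    nlinarith
  have b3 : y ^ 2 * q * ((q + 1) * (X / t) * μ) ≤ 8 * (q * (q + 1)) * (μ * X) := by
    calc _ ≤ (8 * 1 * t) * q * ((q + 1) * (X / t) * μ) := by
          have : y ^ 2 ≤ 8 * 1 * t := by nlinarith
          gcongr
      _ = _ := by field_simp
  have b3' : |y ^ 2 * (q * (t + μ) ^ (-q - 1)) - y ^ 2 * (q * X)| ≤
      8 * (q * (q + 1)) * (μ * X) := by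
    rw [show y ^ 2 * (q * (t + μ) ^ (-q - 1)) - y ^ 2 * (q * X) =
      y ^ 2 * q * ((t + μ) ^ (-q - 1) - X) by ring, abs_mul, abs_of_nonneg (by positivity)]
    refine le_trans ?_ b3
    gcongr
  have hfin := abs_le.1 h1
  have hfin2 := abs_le.1 h2
  have hfin3 := abs_le.1 b3'
  rw [abs_le]
  constructor <;> linarith

end Kernel

/-- A lattice point viewed in Euclidean space. -/
noncomputable def rv {d : ℕ} (x : Fin d → ℤ) : EuclideanSpace ℝ (Fin d) :=
  WithLp.toLp 2 fun i => (x i : ℝ)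

/-- The error constant in the expansion of the discrete Laplacian of the radial kernel. -/
noncomputable def lapC (d : ℕ) : ℝ :=
  (128 * ((d : ℝ) / 2 * ((d : ℝ) / 2 + 1) * ((d : ℝ) / 2 + 2) * 2 ^ ((d : ℝ) / 2 + 3)) +
    2 * ((d : ℝ) / 2) + 8 * ((d : ℝ) / 2 * ((d : ℝ) / 2 + 1))) / 2

/-- The shift of the argument of the kernel which makes it superharmonic. -/
noncomputable def aC (d : ℕ) : ℝ := lapC d + 65

section Lap

variable {d : ℕ}

@[simp] lemma rv_apply (x : Fin d → ℤ) (i : Fin d) : rv x i = x i := rfl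

lemma rv_add (x y : Fin d → ℤ) : rv (x + y) = rv x + rv y := by
  ext i; simp

lemma rv_sub (x y : Fin d → ℤ) : rv (x - y) = rv x - rv y := by
  ext i; simp

@[simp] lemma rv_zero : rv (0 : Fin d → ℤ) = 0 := by
  ext i; simp

lemma rv_stdv (i : Fin d) : rv (stdv i) = EuclideanSpace.single i (1 : ℝ) := by
  ext j; simp [stdv, Pi.single_apply]

lemma norm_rv_stdv (i : Fin d) : ‖rv (stdv i)‖ = 1 := by simp [rv_stdv]

lemma rv_injective : Function.Injective (rv : (Fin d → ℤ) → _) := by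
  intro x y h
  ext i
  have := congrArg (fun v => v i) h
  simpa using this

lemma norm_rv_sq (x : Fin d → ℤ) : ‖rv x‖ ^ 2 = ∑ i, (x i : ℝ) ^ 2 := by
  simp [EuclideanSpace.real_norm_sq_eq]

lemma eunorm_eq (x : Fin d → ℤ) : eunorm x = ‖rv x‖ := by
  rw [eunorm, ← norm_rv_sq, Real.sqrt_sq (norm_nonneg _)]

lemma norm_add_stdv_sub_sq (x : Fin d → ℤ) (z : EuclideanSpace ℝ (Fin d)) (i : Fin d) :
    ‖rv (x + stdv i) - z‖ ^ 2 = ‖rv x - z‖ ^ 2 + 1 + 2 * (x i - z i) := by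
  rw [rv_add, rv_stdv, show rv x + EuclideanSpace.single i (1 : ℝ) - z =
    (rv x - z) + EuclideanSpace.single i (1 : ℝ) by abel, norm_add_sq_real]
  simp [EuclideanSpace.inner_single_right]
  ring

lemma norm_sub_stdv_sub_sq (x : Fin d → ℤ) (z : EuclideanSpace ℝ (Fin d)) (i : Fin d) :
    ‖rv (x - stdv i) - z‖ ^ 2 = ‖rv x - z‖ ^ 2 + 1 - 2 * (x i - z i) := by
  rw [rv_sub, rv_stdv, show rv x - EuclideanSpace.single i (1 : ℝ) - z =
    (rv x - z) - EuclideanSpace.single i (1 : ℝ) by abel, norm_sub_sq_real]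
  simp [EuclideanSpace.inner_single_right]
  ring

lemma norm_nbr_sub_le {x y : Fin d → ℤ} (h : y ∈ latNbrs x) : ‖rv y - rv x‖ ≤ 1 := by
  obtain ⟨i, rfl | rfl⟩ := mem_latNbrs.1 h
  · simp [rv_add, norm_rv_stdv]
  · simp [rv_sub, norm_rv_stdv]

lemma norm_nbr_le {x y : Fin d → ℤ} (h : y ∈ latNbrs x) (z : EuclideanSpace ℝ (Fin d)) :
    ‖rv y - z‖ ≤ ‖rv x - z‖ + 1 := by
  have := norm_add_le (rv y - rv x) (rv x - z)
  rw [sub_add_sub_cancel] at this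
  linarith [norm_nbr_sub_le h]

lemma mem_latNbrs_comm {x y : Fin d → ℤ} : y ∈ latNbrs x ↔ x ∈ latNbrs y := by
  suffices ∀ x y : Fin d → ℤ, y ∈ latNbrs x → x ∈ latNbrs y from ⟨this _ _, this _ _⟩
  intro x y h
  obtain ⟨i, rfl | rfl⟩ := mem_latNbrs.1 h
  · exact mem_latNbrs.2 ⟨i, Or.inr (by simp)⟩
  · exact mem_latNbrs.2 ⟨i, Or.inl (by simp)⟩

lemma norm_nbr_ge {x y : Fin d → ℤ} (h : y ∈ latNbrs x) (z : EuclideanSpace ℝ (Fin d)) :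
    ‖rv x - z‖ - 1 ≤ ‖rv y - z‖ := by
  linarith [norm_nbr_le (mem_latNbrs_comm.1 h) z]

lemma nbrAvg_norm_sub_sq (hd : d ≠ 0) (x : Fin d → ℤ) (z : EuclideanSpace ℝ (Fin d)) :
    nbrAvg (fun y => ‖rv y - z‖ ^ 2) x = ‖rv x - z‖ ^ 2 + 1 := by
  have hd' : (d : ℝ) ≠ 0 := by exact_mod_cast hd
  have : ∀ i : Fin d, ‖rv (x + stdv i) - z‖ ^ 2 + ‖rv (x - stdv i) - z‖ ^ 2 =
      2 * (‖rv x - z‖ ^ 2 + 1) := by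
    intro i; rw [norm_add_stdv_sub_sq, norm_sub_stdv_sub_sq]; ring
  simp only [nbrAvg, this]
  simp
  field_simp

lemma lapC_nonneg : 0 ≤ lapC d := by
  unfold lapC
  have : (0 : ℝ) ≤ 2 ^ ((d : ℝ) / 2 + 3) := by positivity
  positivity

lemma aC_ge : 65 ≤ aC d := by
  have := lapC_nonneg (d := d)
  unfold aC; linarith

lemma aC_pos : 0 < aC d := by linarith [aC_ge (d := d)]

/-- Expansion of the discrete Laplacian of the radial kernel. -/
lemma abs_lap_fker_add_le (hd : 2 ≤ d) (x : Fin d → ℤ) (z : EuclideanSpace ℝ (Fin d))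
    {μ a t : ℝ} (hμ : 0 ≤ μ) (hμ1 : μ ≤ 1) (ht : t = μ * ‖rv x - z‖ ^ 2 + a) (ht64 : 64 ≤ t)
    (hta : μ * ‖rv x - z‖ ^ 2 ≤ 2 * t) :
    |lap (fun y => fker d (μ * ‖rv y - z‖ ^ 2 + a)) x +
      μ * a * t ^ (-((d : ℝ) / 2) - 1)| ≤ lapC d * (μ * t ^ (-((d : ℝ) / 2) - 1)) := by
  have hdpos : (0 : ℝ) < d := by exact_mod_cast (by omega : 0 < d)
  have ht0 : 0 < t := by linarith
  set q : ℝ := (d : ℝ) / 2 with hq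
  set X := t ^ (-q - 1) with hX
  have hX1 : t ^ (-q) = t * X := by
    rw [hX, Real.rpow_sub_one ht0.ne']; field_simp
  set y : Fin d → ℝ := fun i => 2 * μ * (x i - z i) with hy
  have hsum : ∑ i, (y i) ^ 2 = 4 * μ * (t - a) := by
    have : ‖rv x - z‖ ^ 2 = ∑ i, ((x i : ℝ) - z i) ^ 2 := by
      simp [EuclideanSpace.real_norm_sq_eq]
    rw [ht, this]
    simp only [hy, mul_pow, ← Finset.mul_sum]
    ring
  have hyi : ∀ i, (y i) ^ 2 ≤ 8 * μ * t := by
    intro i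
    have h1 : (y i) ^ 2 ≤ ∑ i, (y i) ^ 2 :=
      Finset.single_le_sum (f := fun i => (y i) ^ 2) (fun j _ => sq_nonneg _) (Finset.mem_univ i)
    rw [hsum] at h1
    refine h1.trans ?_
    have : t - a ≤ 2 * t := by rw [ht] at hta ⊢; linarith
    nlinarith
  have hE : ∀ i, |fker d (t + μ + y i) + fker d (t + μ - y i) - 2 * fker d t -
      (-2 * μ * t ^ (-q) + (y i) ^ 2 * (q * X))| ≤ 2 * lapC d * (μ * X) := by
    intro i
    refine (symm_diff_taylor_shift (q := q) (by positivity) (F := fker d)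
      (fun t ht => hasDerivAt_fker hd ht) ht64 hμ hμ1 (hyi i)).trans (le_of_eq ?_)
    rw [lapC, ← hq, hX]; ring
  have hlap : lap (fun y => fker d (μ * ‖rv y - z‖ ^ 2 + a)) x =
      (2 * d : ℝ)⁻¹ * ∑ i, (fker d (t + μ + y i) + fker d (t + μ - y i) - 2 * fker d t) := by
    rw [Finset.sum_sub_distrib, mul_sub]
    simp only [lap, nbrAvg, norm_add_stdv_sub_sq, norm_sub_stdv_sub_sq]
    congr 1
    · congr 1
      refine Finset.sum_congr rfl fun i _ => ?_
      rw [ht, hy]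
      congr 2 <;> ring
    · rw [ht]; simp; field_simp
  have hmain : lap (fun y => fker d (μ * ‖rv y - z‖ ^ 2 + a)) x + μ * a * X =
      (2 * d : ℝ)⁻¹ * ∑ i, (fker d (t + μ + y i) + fker d (t + μ - y i) - 2 * fker d t -
      (-2 * μ * t ^ (-q) + (y i) ^ 2 * (q * X))) := by
    have hs : ∑ i, (-2 * μ * t ^ (-q) + (y i) ^ 2 * (q * X)) =
        d * (-2 * μ * (t * X)) + 4 * μ * (t - a) * (q * X) := by
      rw [Finset.sum_add_distrib, ← hsum, hX1, Finset.sum_mul]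
      simp
    rw [hlap, Finset.sum_sub_distrib (g := fun i => -2 * μ * t ^ (-q) + (y i) ^ 2 * (q * X)), hs,
      hq]
    field_simp
    ring
  rw [hmain, abs_mul, abs_of_pos (by positivity)]
  calc _ ≤ (2 * d : ℝ)⁻¹ * ∑ i : Fin d, 2 * lapC d * (μ * X) := by
        gcongr
        exact (Finset.abs_sum_le_sum_abs _ _).trans (Finset.sum_le_sum fun i _ => hE i)
    _ = _ := by simp; field_simp

/-- The kernel shifted by `aC d` is superharmonic. -/
lemma lap_fker_add_le (hd : 2 ≤ d) (x : Fin d → ℤ) (z : EuclideanSpace ℝ (Fin d))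
    {μ : ℝ} (hμ : 0 ≤ μ) (hμ1 : μ ≤ 1) :
    lap (fun y => fker d (μ * ‖rv y - z‖ ^ 2 + aC d)) x ≤
      -(μ * (μ * ‖rv x - z‖ ^ 2 + aC d) ^ (-((d : ℝ) / 2) - 1)) ∧
    -((2 * aC d) * (μ * (μ * ‖rv x - z‖ ^ 2 + aC d) ^ (-((d : ℝ) / 2) - 1))) ≤
      lap (fun y => fker d (μ * ‖rv y - z‖ ^ 2 + aC d)) x := by
  have h0 : 0 ≤ μ * ‖rv x - z‖ ^ 2 := by positivity
  have ha := aC_ge (d := d)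
  have := abs_le.1 (abs_lap_fker_add_le hd x z hμ hμ1 (a := aC d) rfl (by linarith) (by linarith))
  have hX : 0 ≤ μ * (μ * ‖rv x - z‖ ^ 2 + aC d) ^ (-((d : ℝ) / 2) - 1) :=
    mul_nonneg hμ (Real.rpow_nonneg (by linarith) _)
  have hl : lapC d = aC d - 65 := by simp [aC]
  rw [hl] at this
  constructor <;> nlinarith [this.1, this.2]

/-- The kernel shifted by `-aC d` is subharmonic away from its pole. -/
lemma lap_fker_sub_le (hd : 2 ≤ d) (x : Fin d → ℤ) (z : EuclideanSpace ℝ (Fin d))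
    {μ : ℝ} (hμ : 0 ≤ μ) (hμ1 : μ ≤ 1) (hx : 2 * aC d ≤ μ * ‖rv x - z‖ ^ 2) :
    (μ * (μ * ‖rv x - z‖ ^ 2 - aC d) ^ (-((d : ℝ) / 2) - 1)) ≤
      lap (fun y => fker d (μ * ‖rv y - z‖ ^ 2 - aC d)) x ∧
    lap (fun y => fker d (μ * ‖rv y - z‖ ^ 2 - aC d)) x ≤
      (2 * aC d) * (μ * (μ * ‖rv x - z‖ ^ 2 - aC d) ^ (-((d : ℝ) / 2) - 1)) := by
  have ha := aC_ge (d := d)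
  have := abs_le.1 (abs_lap_fker_add_le hd x z hμ hμ1 (a := -aC d) rfl (by linarith) (by linarith))
  simp only [← sub_eq_add_neg] at this
  have hX : 0 ≤ μ * (μ * ‖rv x - z‖ ^ 2 - aC d) ^ (-((d : ℝ) / 2) - 1) :=
    mul_nonneg hμ (Real.rpow_nonneg (by linarith) _)
  have hl : lapC d = aC d - 65 := by simp [aC]
  rw [hl] at this
  constructor <;> nlinarith [this.1, this.2]

end Lap

/-- The sup norm of a lattice point. -/
def supN {d : ℕ} (x : Fin d → ℤ) : ℕ := Finset.univ.sup fun i => (x i).natAbs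

open Classical in
/-- The Euclidean lattice ball with centre `z` and radius `R`. -/
noncomputable def lball {d : ℕ} (z : Fin d → ℤ) (R : ℝ) : Finset (Fin d → ℤ) :=
  (Fintype.piFinset fun i => Finset.Icc (z i - ⌈R⌉) (z i + ⌈R⌉)).filter
    fun x => ‖rv x - rv z‖ ≤ R

/-- A regularised distance. -/
noncomputable def rho {d : ℕ} (z x : Fin d → ℤ) : ℝ := √(‖rv x - rv z‖ ^ 2 + aC d)

section Sums

variable {d : ℕ}

lemma supN_le {x : Fin d → ℤ} {k : ℕ} : supN x ≤ k ↔ ∀ i, (x i).natAbs ≤ k := by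
  simp [supN]

lemma abs_apply_le_norm (x : Fin d → ℤ) (i : Fin d) : |(x i : ℝ)| ≤ ‖rv x‖ := by
  rw [← Real.norm_eq_abs]
  exact PiLp.norm_apply_le (rv x) i

lemma supN_le_norm (x : Fin d → ℤ) : (supN x : ℝ) ≤ ‖rv x‖ := by
  have h : supN x ≤ ⌊‖rv x‖⌋₊ := by
    rw [supN_le]
    intro i
    refine Nat.le_floor ?_
    rw [Nat.cast_natAbs]
    simpa using abs_apply_le_norm x i
  exact (Nat.cast_le.2 h).trans (Nat.floor_le (norm_nonneg _))

lemma norm_le_supN (x : Fin d → ℤ) : ‖rv x‖ ≤ √d * supN x := by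
  refine (sq_le_sq₀ (norm_nonneg _) (by positivity)).1 ?_
  rw [norm_rv_sq, mul_pow, Real.sq_sqrt (Nat.cast_nonneg d)]
  calc ∑ i, (x i : ℝ) ^ 2 ≤ ∑ i : Fin d, (supN x : ℝ) ^ 2 := by
        refine Finset.sum_le_sum fun i _ => ?_
        have : |(x i : ℝ)| ≤ supN x := by
          have := supN_le.1 (le_refl (supN x)) i
          have h2 : (((x i).natAbs : ℕ) : ℝ) ≤ supN x := by exact_mod_cast this
          rw [Nat.cast_natAbs] at h2
          simpa using h2
        rw [← sq_abs]
        gcongr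
    _ = _ := by simp

lemma mem_lball {z x : Fin d → ℤ} {R : ℝ} : x ∈ lball z R ↔ ‖rv x - rv z‖ ≤ R := by
  simp only [lball, Finset.mem_filter, Fintype.mem_piFinset, Finset.mem_Icc, and_iff_right_iff_imp]
  intro h i
  have h1 := (abs_apply_le_norm (x - z) i).trans ((by rw [rv_sub]; exact h) : _ ≤ R)
  have h2 : |x i - z i| ≤ ⌈R⌉ := by
    have : ((|x i - z i| : ℤ) : ℝ) ≤ ⌈R⌉ := by
      push_cast
      refine le_trans ?_ (Int.le_ceil R)
      simpa using h1
    exact_mod_cast this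
  have := abs_le.1 h2
  constructor <;> linarith [this.1, this.2]

/-- The finset of points with sup norm at most `k`. -/
noncomputable def cubeF (d k : ℕ) : Finset (Fin d → ℤ) :=
  Fintype.piFinset fun _ => Finset.Icc (-(k : ℤ)) k

lemma mem_cubeF {x : Fin d → ℤ} {k : ℕ} : x ∈ cubeF d k ↔ supN x ≤ k := by
  simp only [cubeF, Fintype.mem_piFinset, Finset.mem_Icc, supN_le]
  refine forall_congr' fun i => ?_
  omega

lemma card_cubeF (k : ℕ) : (cubeF d k).card = (2 * k + 1) ^ d := by
  simp only [cubeF, Fintype.card_piFinset, Int.card_Icc, Finset.prod_const, Finset.card_univ,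
    Fintype.card_fin]
  congr 1
  omega

lemma pow_sub_pow_le {a b : ℝ} (hb : 0 ≤ b) (hab : b ≤ a) (n : ℕ) :
    a ^ n - b ^ n ≤ n * (a - b) * a ^ (n - 1) := by
  induction n with
  | zero => simp
  | succ n ih =>
    rcases Nat.eq_zero_or_pos n with rfl | hn
    · simp
    have ha : 0 ≤ a := hb.trans hab
    have h1 : a ^ n = a * a ^ (n - 1) := by
      rw [← pow_succ', Nat.sub_add_cancel hn]
    have h2 : b ^ n ≤ a ^ n := by gcongr
    simp only [Nat.add_sub_cancel]
    push_cast
    calc a ^ (n + 1) - b ^ (n + 1) = a * (a ^ n - b ^ n) + b ^ n * (a - b) := by ring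
      _ ≤ a * (n * (a - b) * a ^ (n - 1)) + a ^ n * (a - b) := by
          gcongr
      _ = (n + 1) * (a - b) * a ^ n := by rw [h1]; ring

lemma card_shell_le (hd : 1 ≤ d) {k : ℕ} (hk : 1 ≤ k) (S : Finset (Fin d → ℤ))
    (hS : ∀ x ∈ S, supN x = k) : (S.card : ℝ) ≤ (2 * d * 3 ^ (d - 1)) * (k : ℝ) ^ (d - 1) := by
  have hsub : S ⊆ cubeF d k \ cubeF d (k - 1) := by
    intro x hx
    rw [Finset.mem_sdiff, mem_cubeF, mem_cubeF, hS x hx]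
    omega
  have hc : cubeF d (k - 1) ⊆ cubeF d k := by
    intro x hx
    rw [mem_cubeF] at hx ⊢
    omega
  have h1 := Finset.card_le_card hsub
  rw [Finset.card_sdiff_of_subset hc, card_cubeF, card_cubeF] at h1
  have hk1 : (1 : ℝ) ≤ k := by exact_mod_cast hk
  have h2 : (S.card : ℝ) ≤ (2 * k + 1 : ℝ) ^ d - (2 * k - 1 : ℝ) ^ d := by
    have hle : (2 * (k - 1) + 1) ^ d ≤ (2 * k + 1) ^ d := by gcongr; omega
    have h3 : (S.card : ℝ) ≤ (((2 * k + 1) ^ d - (2 * (k - 1) + 1) ^ d : ℕ) : ℝ) := by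
      exact_mod_cast h1
    rw [Nat.cast_sub hle] at h3
    push_cast [Nat.cast_sub hk] at h3
    rw [show (2 * ((k : ℝ) - 1) + 1) = 2 * k - 1 by ring] at h3
    exact h3
  refine h2.trans ((pow_sub_pow_le (by linarith) (by linarith) d).trans ?_)
  rw [show (2 * (k : ℝ) + 1 - (2 * k - 1)) = 2 by ring,
    show (2 * (d : ℝ) * 3 ^ (d - 1)) * (k : ℝ) ^ (d - 1) = d * 2 * (3 * k) ^ (d - 1) by
      rw [mul_pow]; ring]
  gcongr
  linarith

lemma rho_sq (z x : Fin d → ℤ) : rho z x ^ 2 = ‖rv x - rv z‖ ^ 2 + aC d :=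
  Real.sq_sqrt (by have := aC_pos (d := d); positivity)

lemma norm_le_rho (z x : Fin d → ℤ) : ‖rv x - rv z‖ ≤ rho z x :=
  Real.le_sqrt_of_sq_le (by linarith [aC_pos (d := d)])

lemma rho_ge (z x : Fin d → ℤ) : 8 ≤ rho z x :=
  Real.le_sqrt_of_sq_le (by linarith [aC_ge (d := d), sq_nonneg ‖rv x - rv z‖])

lemma rho_pos (z x : Fin d → ℤ) : 0 < rho z x := by linarith [rho_ge z x]

/-- Summation over shells. -/
lemma sum_inv_rho_pow_le (hd : 1 ≤ d) (p : ℕ) (z : Fin d → ℤ) {N : ℕ} (S : Finset (Fin d → ℤ))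
    (hS : ∀ x ∈ S, supN (x - z) ≤ N) :
    ∑ x ∈ S, (rho z x ^ p)⁻¹ ≤
      1 + (2 * d * 3 ^ (d - 1)) * ∑ k ∈ Finset.Icc 1 N, (k : ℝ) ^ (d - 1) * ((k : ℝ) ^ p)⁻¹ := by
  classical
  have hmaps : ∀ x ∈ S, supN (x - z) ∈ Finset.range (N + 1) := by
    intro x hx; simpa [Nat.lt_succ_iff] using hS x hx
  rw [← Finset.sum_fiberwise_of_maps_to hmaps, Finset.sum_range_eq_add_Ico _ N.succ_pos,
    Finset.mul_sum]
  refine add_le_add ?_ ?_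
  · calc _ ≤ ∑ x ∈ {z}, (rho z x ^ p)⁻¹ := by
          refine Finset.sum_le_sum_of_subset_of_nonneg ?_ fun x _ _ => by
            have := rho_pos z x; positivity
          intro x hx
          rw [Finset.mem_filter] at hx
          have h1 := norm_le_supN (x - z)
          rw [hx.2] at h1
          have h2 : ‖rv (x - z)‖ ≤ 0 := by simpa using h1
          have h3 : rv (x - z) = rv 0 := by rw [rv_zero]; exact norm_le_zero_iff.1 h2
          have := rv_injective h3
          simpa [sub_eq_zero] using this
      _ ≤ 1 := by
          simp only [Finset.sum_singleton]
          exact inv_le_one_of_one_le₀ (one_le_pow₀ (by linarith [rho_ge z z]))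
  · have : Finset.Ico 1 (N + 1) = Finset.Icc 1 N := by ext; simp
    rw [this]
    refine Finset.sum_le_sum fun k hk => ?_
    rw [Finset.mem_Icc] at hk
    have hk0 : (0 : ℝ) < k := by exact_mod_cast (by omega : 0 < k)
    calc ∑ x ∈ S with supN (x - z) = k, (rho z x ^ p)⁻¹
        ≤ ∑ x ∈ S with supN (x - z) = k, ((k : ℝ) ^ p)⁻¹ := by
          refine Finset.sum_le_sum fun x hx => ?_
          rw [Finset.mem_filter] at hx
          have h1 := supN_le_norm (x - z)
          rw [hx.2, rv_sub] at h1
          have h2 := h1.trans (norm_le_rho z x)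
          gcongr
      _ = ((S.filter fun x => supN (x - z) = k).card : ℝ) * ((k : ℝ) ^ p)⁻¹ := by simp
      _ ≤ (2 * d * 3 ^ (d - 1)) * (k : ℝ) ^ (d - 1) * ((k : ℝ) ^ p)⁻¹ := by
          gcongr
          rw [← Finset.card_image_of_injective (f := fun x => x - z) _ (sub_left_injective)]
          refine card_shell_le hd hk.1 _ ?_
          intro y hy
          simp only [Finset.mem_image, Finset.mem_filter] at hy
          obtain ⟨x, hx, rfl⟩ := hy
          exact hx.2
      _ = _ := by ring

lemma supN_sub_le_of_mem_lball {z x : Fin d → ℤ} {R : ℝ} (h : x ∈ lball z R) :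
    supN (x - z) ≤ ⌊R⌋₊ := by
  refine Nat.le_floor ((supN_le_norm _).trans ?_)
  rw [rv_sub]; exact mem_lball.1 h

lemma exists_sum_rho_succ_le (hd : 1 ≤ d) : ∃ C : ℝ, 0 < C ∧ ∀ (z : Fin d → ℤ)
    (S : Finset (Fin d → ℤ)), ∑ x ∈ S, (rho z x ^ (d + 1))⁻¹ ≤ C := by
  refine ⟨1 + (2 * d * 3 ^ (d - 1)) * 2, by positivity, fun z S => ?_⟩
  refine (sum_inv_rho_pow_le hd (d + 1) z (N := S.sup fun x => supN (x - z)) S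
    fun x hx => Finset.le_sup (f := fun x => supN (x - z)) hx).trans ?_
  gcongr
  set N := S.sup fun x => supN (x - z)
  calc ∑ k ∈ Finset.Icc 1 N, (k : ℝ) ^ (d - 1) * ((k : ℝ) ^ (d + 1))⁻¹
      = ∑ k ∈ Finset.Ioc 0 N, ((k : ℝ) ^ 2)⁻¹ := by
        refine Finset.sum_congr (by ext; simp; omega) fun k hk => ?_
        have : (0 : ℝ) < k := by
          have := (Finset.mem_Ioc.1 hk).1
          exact_mod_cast this
        rw [show d + 1 = (d - 1) + 2 by omega, pow_add]
        field_simp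
    _ ≤ 2 := by
        rcases Nat.eq_zero_or_pos N with h | h
        · simp [h]
        have : Finset.Ioc 0 N = insert 1 (Finset.Ioc 1 N) := by ext; simp; omega
        rw [this, Finset.sum_insert (by simp)]
        have := sum_Ioc_inv_sq_le_sub (α := ℝ) (k := 1) one_ne_zero h
        have h3 : (0 : ℝ) ≤ (N : ℝ)⁻¹ := by positivity
        simp at this ⊢
        linarith

lemma exists_sum_rho_le (hd : 1 ≤ d) : ∃ C : ℝ, 0 < C ∧ ∀ (z : Fin d → ℤ) (R : ℝ), 1 ≤ R →
    ∀ S ⊆ lball z R, ∑ x ∈ S, (rho z x ^ d)⁻¹ ≤ C * (1 + Real.log R) := by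
  refine ⟨1 + (2 * d * 3 ^ (d - 1)), by positivity, fun z R hR S hS => ?_⟩
  refine (sum_inv_rho_pow_le hd d z S
    fun x hx => supN_sub_le_of_mem_lball (hS hx)).trans ?_
  have h1 : ∑ k ∈ Finset.Icc 1 ⌊R⌋₊, (k : ℝ) ^ (d - 1) * ((k : ℝ) ^ d)⁻¹ ≤ 1 + Real.log R := by
    have := harmonic_floor_le_one_add_log R hR
    rw [harmonic_eq_sum_Icc] at this
    push_cast at this
    refine le_trans (le_of_eq ?_) this
    refine Finset.sum_congr rfl fun k hk => ?_
    have : (0 : ℝ) < k := by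
      have := (Finset.mem_Icc.1 hk).1
      exact_mod_cast this
    nth_rw 2 [show d = (d - 1) + 1 by omega]
    rw [pow_add]
    field_simp
  have h2 := Real.log_nonneg hR
  have h3 : 0 ≤ (2 * (d : ℝ) * 3 ^ (d - 1)) := by positivity
  have := mul_le_mul_of_nonneg_left h1 h3
  linarith

lemma exists_sum_rho_pred_le (hd : 1 ≤ d) : ∃ C : ℝ, 0 < C ∧ ∀ (z : Fin d → ℤ) (R : ℝ), 1 ≤ R →
    ∀ S ⊆ lball z R, ∑ x ∈ S, (rho z x ^ (d - 1))⁻¹ ≤ C * R := by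
  refine ⟨1 + (2 * d * 3 ^ (d - 1)), by positivity, fun z R hR S hS => ?_⟩
  refine (sum_inv_rho_pow_le hd (d - 1) z S
    fun x hx => supN_sub_le_of_mem_lball (hS hx)).trans ?_
  have h1 : ∑ k ∈ Finset.Icc 1 ⌊R⌋₊, (k : ℝ) ^ (d - 1) * ((k : ℝ) ^ (d - 1))⁻¹ ≤ R := by
    calc _ = ∑ k ∈ Finset.Icc 1 ⌊R⌋₊, (1 : ℝ) := by
          refine Finset.sum_congr rfl fun k hk => ?_
          have : (0 : ℝ) < k := by
            have := (Finset.mem_Icc.1 hk).1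
            exact_mod_cast this
          field_simp
      _ ≤ R := by simpa using Nat.floor_le (by linarith : 0 ≤ R)
  have h3 : 0 ≤ (2 * (d : ℝ) * 3 ^ (d - 1)) := by positivity
  have := mul_le_mul_of_nonneg_left h1 h3
  linarith

lemma card_le_of_subset_lball {z : Fin d → ℤ} {R : ℝ} (hR : 1 ≤ R) {S : Finset (Fin d → ℤ)}
    (hS : S ⊆ lball z R) : (S.card : ℝ) ≤ (3 * R) ^ d := by
  classical
  have h1 : (S.image fun x => x - z) ⊆ cubeF d ⌊R⌋₊ := by
    intro y hy
    obtain ⟨x, hx, rfl⟩ := Finset.mem_image.1 hy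
    exact mem_cubeF.2 (supN_sub_le_of_mem_lball (hS hx))
  have h2 := Finset.card_le_card h1
  rw [Finset.card_image_of_injective _ sub_left_injective, card_cubeF] at h2
  calc (S.card : ℝ) ≤ (((2 * ⌊R⌋₊ + 1) ^ d : ℕ) : ℝ) := by exact_mod_cast h2
    _ = (2 * (⌊R⌋₊ : ℝ) + 1) ^ d := by push_cast; ring
    _ ≤ (3 * R) ^ d := by
        have := Nat.floor_le (by linarith : 0 ≤ R)
        gcongr
        linarith

lemma le_card_lball (hd : 1 ≤ d) {R : ℝ} (hR : 0 ≤ R) :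
    (R / √d) ^ d ≤ ((lball (0 : Fin d → ℤ) R).card : ℝ) := by
  have hd0 : (0 : ℝ) < √d := Real.sqrt_pos.2 (by exact_mod_cast hd)
  set k := ⌊R / √d⌋₊ with hk
  have hkR : (k : ℝ) ≤ R / √d := Nat.floor_le (by positivity)
  have h1 : cubeF d k ⊆ lball 0 R := by
    intro x hx
    rw [mem_cubeF] at hx
    rw [mem_lball, rv_zero, sub_zero]
    refine (norm_le_supN x).trans ?_
    have : (supN x : ℝ) ≤ R / √d := le_trans (by exact_mod_cast hx) hkR
    calc √d * supN x ≤ √d * (R / √d) := by gcongr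
      _ = R := by field_simp
  have h2 := Finset.card_le_card h1
  rw [card_cubeF] at h2
  calc (R / √d) ^ d ≤ (2 * (k : ℝ) + 1) ^ d := by
        have := Nat.lt_floor_add_one (R / √d)
        gcongr
        rw [← hk] at this
        have : (0 : ℝ) ≤ k := by positivity
        linarith
    _ = (((2 * k + 1) ^ d : ℕ) : ℝ) := by push_cast; ring
    _ ≤ _ := by exact_mod_cast h2

lemma rpow_neg_half_natCast {t : ℝ} (ht : 0 ≤ t) (k : ℕ) :
    t ^ (-((k : ℝ) / 2)) = (√t ^ k)⁻¹ := by
  rw [Real.rpow_neg ht, Real.sqrt_eq_rpow, ← Real.rpow_natCast, ← Real.rpow_mul ht]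
  congr 2; ring

end Sums

section Sums

variable {d : ℕ}

lemma unitBallVol_pos : 0 < unitBallVol d :=
  ENNReal.toReal_pos (Metric.measure_ball_pos _ _ one_pos).ne' measure_ball_lt_top.ne

open scoped Pointwise in
lemma tendsto_card_lball (hd : 1 ≤ d) :
    Tendsto (fun n : ℕ => ((lball (0 : Fin d → ℤ) (n : ℝ)).card : ℝ) / (n : ℝ) ^ d) atTop
      (𝓝 (unitBallVol d)) := by
  have : Nonempty (Fin d) := ⟨⟨0, hd⟩⟩
  set s : Set (Fin d → ℝ) := (WithLp.toLp 2) ⁻¹' (Metric.closedBall (0 : EuclideanSpace ℝ (Fin d)) 1)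
    with hs
  have hs' : s = Set.image WithLp.ofLp (Metric.closedBall (0 : EuclideanSpace ℝ (Fin d)) 1) := by
    ext v
    constructor
    · intro h; exact ⟨WithLp.toLp 2 v, h, rfl⟩
    · rintro ⟨u, hu, rfl⟩; exact hu
  have hcomp : IsCompact s := by
    rw [hs']
    exact (isCompact_closedBall _ _).image (PiLp.continuous_ofLp 2 _)
  have hconv : Convex ℝ s :=
    (convex_closedBall (0 : EuclideanSpace ℝ (Fin d)) 1).linear_preimage
      ((WithLp.linearEquiv 2 ℝ (Fin d → ℝ)).symm.toLinearMap)
  have hvol : volume.real s = unitBallVol d := by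
    rw [measureReal_def, hs, (PiLp.volume_preserving_toLp (Fin d)).measure_preimage
      measurableSet_closedBall.nullMeasurableSet, unitBallVol,
      Measure.addHaar_closedBall_eq_addHaar_ball]
  have := tendsto_card_div_pow_atTop_volume s hcomp.isBounded hcomp.measurableSet
    (hconv.addHaar_frontier volume)
  rw [hvol] at this
  refine this.congr' ?_
  filter_upwards [eventually_gt_atTop 0] with n hn
  have hn0 : (0 : ℝ) < n := by exact_mod_cast hn
  simp only [Fintype.card_fin]
  congr 2
  have himg : s ∩ (n : ℝ)⁻¹ • (Submodule.span ℤ (Set.range (Pi.basisFun ℝ (Fin d))) :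
      Set (Fin d → ℝ)) =
      Set.image (fun x : Fin d → ℤ => (n : ℝ)⁻¹ • (fun i => (x i : ℝ)))
        ↑(lball (0 : Fin d → ℤ) (n : ℝ)) := by
    have hnorm : ∀ x : Fin d → ℤ, (n : ℝ)⁻¹ • (fun i => (x i : ℝ)) ∈ s ↔ x ∈ lball 0 (n : ℝ) := by
      intro x
      rw [mem_lball, rv_zero, sub_zero, hs, Set.mem_preimage, mem_closedBall_zero_iff,
        WithLp.toLp_smul, norm_smul, norm_inv, Real.norm_of_nonneg hn0.le]
      change (n : ℝ)⁻¹ * ‖rv x‖ ≤ 1 ↔ _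
      rw [inv_mul_le_one₀ hn0]
    ext v
    constructor
    · rintro ⟨hv, u, hu, rfl⟩
      obtain ⟨c, rfl⟩ := (Submodule.mem_span_range_iff_exists_fun ℤ).1 hu
      have hc : ∑ i, c i • (Pi.basisFun ℝ (Fin d)) i = fun i => (c i : ℝ) := by
        ext j
        simp [Pi.single_apply]
      simp only [hc] at hv ⊢
      exact ⟨c, (hnorm c).1 hv, rfl⟩
    · rintro ⟨x, hx, rfl⟩
      refine ⟨(hnorm x).2 hx, (fun i => (x i : ℝ)), ?_, rfl⟩
      refine (Submodule.mem_span_range_iff_exists_fun ℤ).2 ⟨x, ?_⟩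
      ext j
      simp [Pi.single_apply]
  have hinj : Function.Injective
      (fun x : Fin d → ℤ => (n : ℝ)⁻¹ • (fun i => (x i : ℝ))) := by
    intro x y h
    ext i
    have := congrFun h i
    simpa [hn0.ne'] using this
  rw [himg, Nat.card_coe_set_eq, Set.ncard_image_of_injective _ hinj, Set.ncard_coe_finset]

lemma sum_shift {h w : (Fin d → ℤ) → ℝ} {S T : Finset (Fin d → ℤ)} (hS : ∀ x, x ∉ S → h x = 0)
    (e : Fin d → ℤ) (hT : ∀ x ∈ S, x + e ∈ T) :
    ∑ x ∈ T, w x * h (x - e) = ∑ x ∈ S, h x * w (x + e) := by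
  classical
  have h1 : ∑ x ∈ S, h x * w (x + e) = ∑ x ∈ S.image (· + e), w x * h (x - e) := by
    rw [Finset.sum_image (fun _ _ _ _ h => add_right_cancel h)]
    exact Finset.sum_congr rfl fun x _ => by rw [add_sub_cancel_right, mul_comm]
  rw [h1]
  refine (Finset.sum_subset ?_ ?_).symm
  · intro x hx
    obtain ⟨y, hy, rfl⟩ := Finset.mem_image.1 hx
    exact hT y hy
  · intro x _ hx
    rw [hS, mul_zero]
    intro hxe
    exact hx (Finset.mem_image.2 ⟨x - e, hxe, by simp⟩)

/-- Summation by parts. -/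
lemma sum_mul_lap {h w : (Fin d → ℤ) → ℝ} {S T : Finset (Fin d → ℤ)}
    (hS : ∀ x, x ∉ S → h x = 0) (hST : S ⊆ T) (hT : ∀ x ∈ S, latNbrs x ⊆ T) :
    ∑ x ∈ S, h x * lap w x = ∑ x ∈ T, w x * lap h x := by
  simp only [lap, mul_sub, Finset.sum_sub_distrib]
  congr 1
  · simp only [nbrAvg, Finset.mul_sum, mul_add, Finset.sum_add_distrib]
    rw [Finset.sum_comm, Finset.sum_comm (s := S), Finset.sum_comm (s := T),
      Finset.sum_comm (s := T)]
    rw [add_comm]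
    congr 1
    · refine Finset.sum_congr rfl fun i _ => ?_
      have := sum_shift (w := w) hS (-stdv i)
        (fun x hx => hT x hx (by rw [← sub_eq_add_neg]; exact sub_stdv_mem x i))
      simp only [sub_neg_eq_add, ← sub_eq_add_neg] at this
      have h2 := congrArg (fun s => (2 * (d : ℝ))⁻¹ * s) this
      simp only [Finset.mul_sum] at h2
      exact (Finset.sum_congr rfl fun x _ => by ring).trans
        (h2.symm.trans (Finset.sum_congr rfl fun x _ => by ring))
    · refine Finset.sum_congr rfl fun i _ => ?_
      have := sum_shift (w := w) hS (stdv i) (fun x hx => hT x hx (add_stdv_mem x i))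
      have h2 := congrArg (fun s => (2 * (d : ℝ))⁻¹ * s) this
      simp only [Finset.mul_sum] at h2
      exact (Finset.sum_congr rfl fun x _ => by ring).trans
        (h2.symm.trans (Finset.sum_congr rfl fun x _ => by ring))
  · rw [← Finset.sum_subset hST (fun x _ hx => by rw [hS x hx, mul_zero])]
    exact Finset.sum_congr rfl fun x _ => mul_comm _ _

end Sums

section Potential

variable {d : ℕ}

/-- The radial profile `α (f(s + a) - f(n² + a)) + s - n²`, convex with a double zero at `n²`. -/
noncomputable def Wf (d : ℕ) (n s : ℝ) : ℝ :=
  √(n ^ 2 + aC d) ^ d * (fker d (s + aC d) - fker d (n ^ 2 + aC d)) + s - n ^ 2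

lemma Wf_self (n : ℝ) : Wf d n (n ^ 2) = 0 := by simp [Wf]

lemma Wf_sub_le (hd : 2 ≤ d) (n : ℝ) {s s' : ℝ} (hs : 0 ≤ s) (hs' : 0 ≤ s') :
    Wf d n s - Wf d n s' ≤
      (s - s') * (1 - √(n ^ 2 + aC d) ^ d * (√(s + aC d) ^ d)⁻¹) := by
  have ha := aC_pos (d := d)
  have hX : 0 ≤ √(n ^ 2 + aC d) ^ d := by positivity
  have e : Wf d n s - Wf d n s' =
      √(n ^ 2 + aC d) ^ d * (fker d (s + aC d) - fker d (s' + aC d)) + (s - s') := by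
    unfold Wf; ring
  have key : fker d (s + aC d) - fker d (s' + aC d) ≤ (s' - s) * (√(s + aC d) ^ d)⁻¹ := by
    rw [← rpow_neg_half_natCast (by linarith)]
    rcases le_total s s' with h | h
    · have := fker_sub_le hd (s := s + aC d) (D := s' - s) (by linarith) (by linarith)
      rwa [show s + aC d + (s' - s) = s' + aC d by ring] at this
    · have := le_fker_sub hd (s := s' + aC d) (D := s - s') (by linarith) (by linarith)
      rw [show s' + aC d + (s - s') = s + aC d by ring] at this
      linarith
  rw [e]
  have := mul_le_mul_of_nonneg_left key hX
  linarith

lemma Wf_nonneg (hd : 2 ≤ d) (n : ℝ) {s : ℝ} (hs : 0 ≤ s) : 0 ≤ Wf d n s := by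
  have := Wf_sub_le hd n (sq_nonneg n) hs
  have hX : √(n ^ 2 + aC d) ^ d ≠ 0 :=
    (pow_pos (Real.sqrt_pos.2 (by have := aC_pos (d := d); positivity)) d).ne'
  rw [Wf_self, mul_inv_cancel₀ hX] at this
  linarith

lemma Wf_slope_le (hd : 2 ≤ d) {n s : ℝ} (hn : 0 < n) (hs : n ^ 2 ≤ 4 * s) :
    |1 - √(n ^ 2 + aC d) ^ d * (√(s + aC d) ^ d)⁻¹| ≤ d * 2 ^ (d + 1) * |n ^ 2 - s| / n ^ 2 := by
  have ha := aC_pos (d := d)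
  have hn2 : 0 < n ^ 2 := by positivity
  have hs0 : 0 < s := by linarith
  set X := √(n ^ 2 + aC d) with hX
  set Y := √(s + aC d) with hY
  have hX2 : X ^ 2 = n ^ 2 + aC d := Real.sq_sqrt (by linarith)
  have hY2 : Y ^ 2 = s + aC d := Real.sq_sqrt (by linarith)
  have hX0 : 0 < X := Real.sqrt_pos.2 (by linarith)
  have hY0 : 0 < Y := Real.sqrt_pos.2 (by linarith)
  have hXY : X ≤ 2 * Y := by
    apply le_of_sq_le_sq _ (by positivity) |>.trans_eq rfl
    rw [mul_pow, hX2, hY2]; linarith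
  obtain ⟨e, rfl⟩ : ∃ e, d = e + 1 := ⟨d - 1, by omega⟩
  have hYd : 0 < Y ^ (e + 1) := by positivity
  have e1 : 1 - X ^ (e + 1) * (Y ^ (e + 1))⁻¹ = (Y ^ (e + 1) - X ^ (e + 1)) / Y ^ (e + 1) := by
    field_simp
  rw [e1, abs_div, abs_of_pos hYd, div_le_iff₀ hYd]
  have e2 : |Y ^ (e + 1) - X ^ (e + 1)| ≤ (e + 1) * |X - Y| * (2 * Y) ^ e := by
    rcases le_total X Y with h | h
    · have := pow_sub_pow_le hX0.le h (e + 1)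
      rw [abs_of_nonneg (sub_nonneg.2 (pow_le_pow_left₀ hX0.le h _)), abs_sub_comm,
        abs_of_nonneg (sub_nonneg.2 h)]
      push_cast at this
      refine this.trans (mul_le_mul_of_nonneg_left ?_ (by
        have := sub_nonneg.2 h; positivity))
      exact pow_le_pow_left₀ hY0.le (by linarith) _
    · have := pow_sub_pow_le hY0.le h (e + 1)
      rw [abs_sub_comm, abs_of_nonneg (sub_nonneg.2 (pow_le_pow_left₀ hY0.le h _)),
        abs_of_nonneg (sub_nonneg.2 h)]
      push_cast at this
      refine this.trans (mul_le_mul_of_nonneg_left ?_ (by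
        have := sub_nonneg.2 h; positivity))
      exact pow_le_pow_left₀ hX0.le hXY _
  have e3 : |X - Y| * n ^ 2 ≤ 4 * Y * |n ^ 2 - s| := by
    have h1 : |X - Y| * (X + Y) = |n ^ 2 - s| := by
      rw [← abs_of_pos (show 0 < X + Y by linarith), ← abs_mul]
      congr 1
      linear_combination hX2 - hY2
    have h2 : n ^ 2 ≤ 4 * Y * (X + Y) := by nlinarith
    nlinarith [abs_nonneg (X - Y)]
  refine e2.trans ?_
  have e4 : |X - Y| ≤ 4 * Y * |n ^ 2 - s| / n ^ 2 := by rwa [le_div_iff₀ hn2]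
  calc (e + 1) * |X - Y| * (2 * Y) ^ e
      ≤ (e + 1) * (4 * Y * |n ^ 2 - s| / n ^ 2) * (2 * Y) ^ e := by gcongr
    _ = _ := by push_cast; rw [mul_pow]; ring

lemma Wf_sub_le_abs (hd : 2 ≤ d) {n s s' : ℝ} (hn : 0 < n) (hs : n ^ 2 ≤ 4 * s) (hs' : 0 ≤ s') :
    Wf d n s - Wf d n s' ≤ d * 2 ^ (d + 1) * (|s - s'| * |n ^ 2 - s|) / n ^ 2 := by
  have hn2 : 0 < n ^ 2 := by positivity
  refine (Wf_sub_le hd n (by linarith) hs').trans ((le_abs_self _).trans ?_)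
  rw [abs_mul]
  refine (mul_le_mul_of_nonneg_left (Wf_slope_le hd hn hs) (abs_nonneg _)).trans_eq ?_
  ring

lemma Wf_le (hd : 2 ≤ d) {n s : ℝ} (hn : 0 < n) (hs : n ^ 2 ≤ 4 * s) :
    Wf d n s ≤ d * 2 ^ (d + 1) * (n ^ 2 - s) ^ 2 / n ^ 2 := by
  have := Wf_sub_le_abs hd hn hs (sq_nonneg n)
  rw [Wf_self, sub_zero, abs_sub_comm, ← sq, sq_abs] at this
  exact this

lemma le_Wf (hd : 2 ≤ d) {n s : ℝ} (hs0 : 0 ≤ s) (hs : s ≤ n ^ 2) :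
    (n ^ 2 - s) ^ 2 / (4 * (n ^ 2 + aC d)) ≤ Wf d n s := by
  have ha := aC_pos (d := d)
  set s' := (s + n ^ 2) / 2 with hs'
  have h1 := Wf_sub_le hd n (s := s') (s' := s) (by positivity) hs0
  have h2 := Wf_nonneg hd n (s := s') (by positivity)
  set X := √(n ^ 2 + aC d) with hX
  set Y := √(s' + aC d) with hY
  have hX2 : X ^ 2 = n ^ 2 + aC d := Real.sq_sqrt (by nlinarith)
  have hY2 : Y ^ 2 = s' + aC d := Real.sq_sqrt (by nlinarith)
  have hX0 : 0 < X := Real.sqrt_pos.2 (by nlinarith)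
  have hY0 : 0 < Y := Real.sqrt_pos.2 (by nlinarith)
  have hYX : Y ≤ X := Real.sqrt_le_sqrt (by linarith)
  have h3 : X ^ d * (Y ^ d)⁻¹ ≥ X ^ 2 * (Y ^ 2)⁻¹ := by
    rw [← div_eq_mul_inv, ← div_eq_mul_inv, ← div_pow, ← div_pow]
    exact pow_le_pow_right₀ ((one_le_div hY0).2 hYX) hd
  have h4 : X ^ 2 * (Y ^ 2)⁻¹ - 1 ≥ (n ^ 2 - s) / 2 / (n ^ 2 + aC d) := by
    have : X ^ 2 * (Y ^ 2)⁻¹ - 1 = ((n ^ 2 - s) / 2) / (Y ^ 2) := by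
      rw [eq_div_iff (by positivity), sub_mul, mul_assoc, inv_mul_cancel₀ (by positivity), hX2, hY2]
      ring
    rw [this, ge_iff_le, ← hX2]
    exact div_le_div_of_nonneg_left (by linarith) (by positivity)
      (pow_le_pow_left₀ hY0.le hYX 2)
  have h5 : (n ^ 2 - s) / 2 * ((n ^ 2 - s) / 2 / (n ^ 2 + aC d)) ≤
      (n ^ 2 - s) / 2 * (X ^ d * (Y ^ d)⁻¹ - 1) :=
    mul_le_mul_of_nonneg_left (by linarith) (by linarith)
  have h6 : (n ^ 2 - s) / 2 * ((n ^ 2 - s) / 2 / (n ^ 2 + aC d)) =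
      (n ^ 2 - s) ^ 2 / (4 * (n ^ 2 + aC d)) := by
    field_simp; ring
  have h7 : s' - s = (n ^ 2 - s) / 2 := by rw [hs']; ring
  rw [h7] at h1
  nlinarith

lemma Wf_le_of_le (hd : 2 ≤ d) {n s : ℝ} (hn : 0 ≤ n) (hs0 : 0 ≤ s) (hs : s ≤ n ^ 2) :
    Wf d n s ≤ 2 * n * √(n ^ 2 + aC d) ^ d * (√(s + aC d) ^ (d - 1))⁻¹ := by
  have ha := aC_pos (d := d)
  have h := fker_sub_le_sqrt hd (s := s + aC d) (D := n ^ 2 - s) (by linarith) (by linarith)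
  rw [show s + aC d + (n ^ 2 - s) = n ^ 2 + aC d by ring,
    show (1 - (d : ℝ)) / 2 = -(((d - 1 : ℕ) : ℝ) / 2) by
      rw [Nat.cast_sub (by omega)]; push_cast; ring,
    rpow_neg_half_natCast (by linarith)] at h
  have h1 : √(n ^ 2 - s) ≤ n := by
    rw [Real.sqrt_le_left hn]; linarith
  have h2 : 0 ≤ (√(s + aC d) ^ (d - 1))⁻¹ := by positivity
  have h3 : fker d (s + aC d) - fker d (n ^ 2 + aC d) ≤ 2 * n * (√(s + aC d) ^ (d - 1))⁻¹ :=
    h.trans (mul_le_mul_of_nonneg_right (by linarith) h2)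
  have := mul_le_mul_of_nonneg_left h3 (show 0 ≤ √(n ^ 2 + aC d) ^ d by positivity)
  unfold Wf
  nlinarith

/-- Sharp enough second order bound near the double zero. -/
lemma Wf_le_sharp (hd : 2 ≤ d) {n D : ℝ} (hD : 0 ≤ D) (hDn : D ≤ n ^ 2)
    (hy : 10 * (d / 2 * D) ≤ n ^ 2 + aC d) :
    Wf d n (n ^ 2 - D) ≤ 5 / 6 * (d / 2 * D ^ 2 / (n ^ 2 + aC d)) := by
  have ha := aC_pos (d := d)
  set T := n ^ 2 + aC d with hT
  have hT0 : 0 < T := by positivity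
  have hd2 : (1 : ℝ) ≤ d / 2 := by
    have : (2 : ℝ) ≤ d := by exact_mod_cast hd
    linarith
  have slope : ∀ E, 0 ≤ E → E ≤ D →
      √T ^ d * (√(n ^ 2 - E + aC d) ^ d)⁻¹ - 1 ≤ 10 / 9 * (d / 2 * E / T) := by
    intro E hE hED
    have hS : n ^ 2 - E + aC d = T - E := by rw [hT]; ring
    have hET : d / 2 * E ≤ d / 2 * D := by gcongr
    have hES : 0 < T - E := by nlinarith
    rw [hS, ← Real.rpow_natCast, ← Real.rpow_natCast, ← Real.inv_rpow (by positivity),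
      ← Real.mul_rpow (by positivity) (by positivity)]
    have b := one_add_mul_self_le_rpow_one_add (s := -(E / T)) (p := d / 2)
      (by rw [neg_le_neg_iff, div_le_one hT0]; linarith) hd2
    set y := d / 2 * E / T with hy'
    have hy0 : 0 ≤ y := by positivity
    have hy1 : y ≤ 1 / 10 := by rw [hy', div_le_iff₀ hT0]; linarith
    have e : 1 + -(E / T) = (T - E) / T := by field_simp; ring
    have e' : 1 + d / 2 * -(E / T) = 1 - y := by rw [hy']; ring
    rw [e, e'] at b
    have hsq : (√T * (√(T - E))⁻¹) ^ (d : ℝ) = (((T - E) / T) ^ ((d : ℝ) / 2))⁻¹ := by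
      rw [← Real.inv_rpow (by positivity), inv_div, ← div_eq_mul_inv, ← Real.sqrt_div hT0.le,
        Real.sqrt_eq_rpow, ← Real.rpow_mul (by positivity)]
      congr 1; ring
    rw [hsq]
    have h9 : (((T - E) / T) ^ ((d : ℝ) / 2))⁻¹ ≤ (1 - y)⁻¹ := inv_anti₀ (by linarith) b
    have h10 : (1 - y)⁻¹ ≤ 1 + 10 / 9 * y := by
      rw [inv_le_iff_one_le_mul₀ (by linarith)]
      nlinarith
    linarith
  have h1 := Wf_sub_le hd n (s := n ^ 2 - D) (s' := n ^ 2 - D / 2) (by linarith) (by linarith)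
  have h2 := Wf_sub_le hd n (s := n ^ 2 - D / 2) (s' := n ^ 2) (by linarith) (by positivity)
  rw [Wf_self] at h2
  have s1 := mul_le_mul_of_nonneg_left (slope D hD le_rfl) (show 0 ≤ D / 2 by linarith)
  have s2 := mul_le_mul_of_nonneg_left (slope (D / 2) (by linarith) (by linarith))
    (show 0 ≤ D / 2 by linarith)
  have e : 5 / 6 * ((d : ℝ) / 2 * D ^ 2 / T) = D / 2 * (10 / 9 * (d / 2 * D / T)) +
      D / 2 * (10 / 9 * (d / 2 * (D / 2) / T)) := by ring
  rw [e]
  rw [← hT] at h1 h2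
  nlinarith

end Potential

section Density

variable {d : ℕ}

/-- Minus the Laplacian of the regularised fundamental solution. -/
noncomputable def dens (x : Fin d → ℤ) : ℝ := -lap (fun y => fker d (‖rv y‖ ^ 2 + aC d)) x

lemma rho_zero (x : Fin d → ℤ) : rho 0 x = √(‖rv x‖ ^ 2 + aC d) := by
  rw [rho, rv_zero, sub_zero]

lemma rpow_neg_half_sub_one {t : ℝ} (ht : 0 ≤ t) :
    t ^ (-((d : ℝ) / 2) - 1) = (√t ^ (d + 2))⁻¹ := by
  rw [← rpow_neg_half_natCast ht]; congr 1; push_cast; ring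

lemma dens_ge (hd : 2 ≤ d) (x : Fin d → ℤ) : (rho 0 x ^ (d + 2))⁻¹ ≤ dens x := by
  have := (lap_fker_add_le hd x 0 zero_le_one le_rfl).1
  simp only [sub_zero, one_mul] at this
  rw [rpow_neg_half_sub_one (by have := aC_pos (d := d); positivity), ← rho_zero] at this
  unfold dens; linarith

lemma dens_le (hd : 2 ≤ d) (x : Fin d → ℤ) : dens x ≤ 2 * aC d * (rho 0 x ^ (d + 2))⁻¹ := by
  have := (lap_fker_add_le hd x 0 zero_le_one le_rfl).2
  simp only [sub_zero, one_mul] at this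
  rw [rpow_neg_half_sub_one (by have := aC_pos (d := d); positivity), ← rho_zero] at this
  unfold dens; linarith

lemma dens_nonneg (hd : 2 ≤ d) (x : Fin d → ℤ) : 0 ≤ dens x :=
  le_trans (by have := rho_pos 0 x; positivity) (dens_ge hd x)

lemma lap_add (g g' : (Fin d → ℤ) → ℝ) (x : Fin d → ℤ) :
    lap (fun y => g y + g' y) x = lap g x + lap g' x := by
  unfold lap; rw [nbrAvg_add]; ring

lemma lap_smul (c : ℝ) (g : (Fin d → ℤ) → ℝ) (x : Fin d → ℤ) :
    lap (fun y => c * g y) x = c * lap g x := by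
  unfold lap; rw [nbrAvg_smul]; ring

lemma lap_const (hd : d ≠ 0) (c : ℝ) (x : Fin d → ℤ) : lap (fun _ => c) x = 0 := by
  unfold lap; rw [nbrAvg_const hd]; ring

lemma lap_norm_sq (hd : d ≠ 0) (x : Fin d → ℤ) : lap (fun y => ‖rv y‖ ^ 2) x = 1 := by
  have := nbrAvg_norm_sub_sq hd x 0
  simp only [sub_zero] at this
  unfold lap; rw [this]; ring

noncomputable def wf (n : ℝ) (x : Fin d → ℤ) : ℝ := Wf d n (‖rv x‖ ^ 2)

lemma wf_nonneg (hd : 2 ≤ d) (n : ℝ) (x : Fin d → ℤ) : 0 ≤ wf n x :=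
  Wf_nonneg hd n (sq_nonneg _)

lemma lap_wf (hd : 2 ≤ d) (n : ℝ) (x : Fin d → ℤ) :
    lap (wf n) x = 1 - √(n ^ 2 + aC d) ^ d * dens x := by
  have e : (wf n : (Fin d → ℤ) → ℝ) = fun y => √(n ^ 2 + aC d) ^ d * fker d (‖rv y‖ ^ 2 + aC d) +
      (‖rv y‖ ^ 2 + (-√(n ^ 2 + aC d) ^ d * fker d (n ^ 2 + aC d) - n ^ 2)) := by
    ext y; unfold wf Wf; ring
  rw [e, lap_add, lap_smul, lap_add, lap_norm_sq (by omega), lap_const (by omega), dens]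
  ring

/-- The function `wf n` truncated at radius `n`. -/
noncomputable def wbar (n : ℝ) (x : Fin d → ℤ) : ℝ := if ‖rv x‖ ≤ n then wf n x else 0

lemma wbar_nonneg (hd : 2 ≤ d) (n : ℝ) (x : Fin d → ℤ) : 0 ≤ wbar n x := by
  unfold wbar; split_ifs
  exacts [wf_nonneg hd n x, le_rfl]

lemma wbar_le_wf (hd : 2 ≤ d) (n : ℝ) (x : Fin d → ℤ) : wbar n x ≤ wf n x := by
  unfold wbar; split_ifs
  exacts [le_rfl, wf_nonneg hd n x]

lemma wbar_pair_le (hd : 2 ≤ d) {n : ℝ} (hn : 20 * d ≤ n) {x : Fin d → ℤ} (hx : n < ‖rv x‖)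
    (hx1 : ‖rv x‖ ≤ n + 1) (i : Fin d) :
    wbar n (x + stdv i) + wbar n (x - stdv i) ≤
      5 / 6 * (d / 2 * (4 * (x i : ℝ) ^ 2) / (n ^ 2 + aC d)) := by
  have ha := aC_ge (d := d)
  have hd2 : (2 : ℝ) ≤ d := by exact_mod_cast hd
  have hn0 : 0 < n := by linarith
  have one : ∀ (y : Fin d → ℤ) (c : ℝ), |c| ≤ n + 1 → 0 ≤ c →
      ‖rv y‖ ^ 2 = ‖rv x‖ ^ 2 + 1 - 2 * c →
      wbar n y ≤ 5 / 6 * (d / 2 * (4 * c ^ 2) / (n ^ 2 + aC d)) := by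
    intro y c hc1 hc0 hy
    unfold wbar
    split_ifs with h
    · have hD0 : 0 ≤ n ^ 2 - ‖rv y‖ ^ 2 := by
        have := pow_le_pow_left₀ (norm_nonneg _) h 2
        linarith
      have hD1 : n ^ 2 - ‖rv y‖ ^ 2 ≤ 2 * c := by
        have := pow_le_pow_left₀ hn0.le hx.le 2
        linarith
      rw [abs_of_nonneg hc0] at hc1
      have := Wf_le_sharp hd (n := n) hD0 (by nlinarith [sq_nonneg ‖rv y‖]) (by
        have : (d : ℝ) / 2 * (n ^ 2 - ‖rv y‖ ^ 2) ≤ d / 2 * (2 * (n + 1)) := by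
          gcongr; linarith
        nlinarith)
      rw [sub_sub_cancel] at this
      refine this.trans ?_
      have h4 : (n ^ 2 - ‖rv y‖ ^ 2) ^ 2 ≤ 4 * c ^ 2 := by nlinarith
      gcongr
    · positivity
  have zero : ∀ y : Fin d → ℤ, n ^ 2 < ‖rv y‖ ^ 2 → wbar n y = 0 := by
    intro y hy
    unfold wbar
    rw [if_neg]
    intro h
    have := pow_le_pow_left₀ (norm_nonneg _) h 2
    linarith
  have hplus : ‖rv (x + stdv i)‖ ^ 2 = ‖rv x‖ ^ 2 + 1 + 2 * x i := by
    have := norm_add_stdv_sub_sq x 0 i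
    simpa using this
  have hminus : ‖rv (x - stdv i)‖ ^ 2 = ‖rv x‖ ^ 2 + 1 - 2 * x i := by
    have := norm_sub_stdv_sub_sq x 0 i
    simpa using this
  have hxn := pow_lt_pow_left₀ hx hn0.le two_ne_zero
  have hxi := (abs_apply_le_norm x i).trans hx1
  rcases le_total (0 : ℝ) (x i) with h | h
  · rw [zero (x + stdv i) (by rw [hplus]; linarith), zero_add]
    exact one _ _ hxi h hminus
  · rw [zero (x - stdv i) (by rw [hminus]; linarith), add_zero]
    have := one (x + stdv i) (-(x i : ℝ)) (by rwa [abs_neg]) (by linarith) (by rw [hplus]; ring)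
    rwa [neg_sq] at this

lemma alpha_dens_le (hd : 2 ≤ d) {n : ℝ} (hn : 0 ≤ n) {x : Fin d → ℤ} (hx : n ≤ ‖rv x‖) :
    √(n ^ 2 + aC d) ^ d * dens x ≤ 2 * aC d / (n ^ 2 + aC d) := by
  have ha := aC_pos (d := d)
  have hX0 : 0 < √(n ^ 2 + aC d) := Real.sqrt_pos.2 (by positivity)
  have h1 : √(n ^ 2 + aC d) ≤ rho 0 x := by
    rw [rho_zero]; exact Real.sqrt_le_sqrt (by gcongr)
  have h2 : dens x ≤ 2 * aC d * (√(n ^ 2 + aC d) ^ (d + 2))⁻¹ :=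
    (dens_le hd x).trans (by gcongr)
  refine (mul_le_mul_of_nonneg_left h2 (by positivity)).trans_eq ?_
  rw [pow_add, Real.sq_sqrt (by positivity)]
  field_simp

lemma lap_wbar_add_le_one (hd : 2 ≤ d) {n : ℝ} (hn : 20 * d + aC d ≤ n) {x : Fin d → ℤ}
    (hx : ‖rv x‖ ≤ n + 1) :
    lap (wbar n) x + √(n ^ 2 + aC d) ^ d * dens x ≤ 1 := by
  have ha := aC_ge (d := d)
  have hd2 : (2 : ℝ) ≤ d := by exact_mod_cast hd
  by_cases h : ‖rv x‖ ≤ n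
  · have h1 : nbrAvg (wbar n) x ≤ nbrAvg (wf n) x := nbrAvg_mono fun y _ => wbar_le_wf hd n y
    have h2 := lap_wf hd n x
    have h3 : wbar n x = wf n x := by rw [wbar, if_pos h]
    unfold lap at h2 ⊢
    linarith
  · push Not at h
    have h3 : wbar n x = 0 := by rw [wbar, if_neg (not_le.2 h)]
    have hT : 0 < n ^ 2 + aC d := by positivity
    have h4 : nbrAvg (wbar n) x ≤ 5 / 6 * (‖rv x‖ ^ 2 / (n ^ 2 + aC d)) := by
      unfold nbrAvg
      refine (mul_le_mul_of_nonneg_left (Finset.sum_le_sum fun i _ =>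
        wbar_pair_le hd (by linarith) h hx i) (by positivity)).trans_eq ?_
      rw [← Finset.mul_sum, ← Finset.sum_div, ← Finset.mul_sum, ← Finset.mul_sum, norm_rv_sq]
      field_simp
      ring
    have h5 := alpha_dens_le hd (by linarith) h.le
    have h6 : ‖rv x‖ ^ 2 ≤ (n + 1) ^ 2 := pow_le_pow_left₀ (norm_nonneg _) hx 2
    have h7 : 5 / 6 * (‖rv x‖ ^ 2 / (n ^ 2 + aC d)) + 2 * aC d / (n ^ 2 + aC d) ≤ 1 := by
      rw [← mul_div_assoc, ← add_div, div_le_one hT]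
      nlinarith
    unfold lap
    linarith

lemma lap_wbar_add_eq (hd : 2 ≤ d) {n : ℝ} {x : Fin d → ℤ} (hx : ‖rv x‖ ≤ n - 1) :
    lap (wbar n) x + √(n ^ 2 + aC d) ^ d * dens x = 1 := by
  have h1 : nbrAvg (wbar n) x = nbrAvg (wf n) x := nbrAvg_congr fun y hy => by
    rw [wbar, if_pos]
    have := norm_nbr_le hy 0
    simp only [sub_zero] at this
    linarith
  have h2 := lap_wf hd n x
  have h3 : wbar n x = wf n x := by rw [wbar, if_pos (by linarith)]
  unfold lap at h2 ⊢
  linarith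

lemma le_lap_wbar_add (hd : 2 ≤ d) {n : ℝ} (hn : 2 ≤ n) {x : Fin d → ℤ} :
    -(d * 2 ^ (d + 1) * 9) ≤ lap (wbar n) x + √(n ^ 2 + aC d) ^ d * dens x := by
  have hC : (0 : ℝ) ≤ d * 2 ^ (d + 1) * 9 := by positivity
  have hden : 0 ≤ √(n ^ 2 + aC d) ^ d * dens x := mul_nonneg (by positivity) (dens_nonneg hd x)
  by_cases h : ‖rv x‖ ≤ n
  · have h1 : nbrAvg (wf n) x ≤ nbrAvg (wbar n) x + d * 2 ^ (d + 1) * 9 := by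
      have e := nbrAvg_const (by omega : d ≠ 0) (d * 2 ^ (d + 1) * 9 : ℝ) x
      rw [← e, ← nbrAvg_add]
      refine nbrAvg_mono fun y hy => ?_
      have hy' := norm_nbr_le hy 0
      simp only [sub_zero] at hy'
      by_cases hyn : ‖rv y‖ ≤ n
      · rw [wbar, if_pos hyn]; linarith
      · push Not at hyn
        rw [wbar, if_neg (not_le.2 hyn), zero_add]
        have hn2 : n ^ 2 < ‖rv y‖ ^ 2 := pow_lt_pow_left₀ hyn (by linarith) two_ne_zero
        have hy2 : ‖rv y‖ ^ 2 ≤ (n + 1) ^ 2 := pow_le_pow_left₀ (norm_nonneg _) (by linarith) 2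
        refine (Wf_le hd (by linarith) (by nlinarith)).trans ?_
        rw [div_le_iff₀ (by positivity), mul_assoc _ 9]
        refine mul_le_mul_of_nonneg_left ?_ (by positivity)
        nlinarith
    have h2 := lap_wf hd n x
    have h3 : wbar n x = wf n x := by rw [wbar, if_pos h]
    unfold lap at h2 ⊢
    linarith
  · have h3 : wbar n x = 0 := by rw [wbar, if_neg h]
    have h4 : 0 ≤ nbrAvg (wbar n) x := le_nbrAvg_of_le (by omega) fun y _ => wbar_nonneg hd n y
    unfold lap
    linarith

end Density

section DensitySum

variable {d : ℕ}

lemma lball_mono {z : Fin d → ℤ} {R R' : ℝ} (h : R ≤ R') : lball z R ⊆ lball z R' :=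
  fun _ hx => mem_lball.2 ((mem_lball.1 hx).trans h)

lemma mem_lball_zero {x : Fin d → ℤ} {R : ℝ} : x ∈ lball 0 R ↔ ‖rv x‖ ≤ R := by
  rw [mem_lball, rv_zero, sub_zero]

lemma norm_nbr_le' {x y : Fin d → ℤ} (h : y ∈ latNbrs x) : ‖rv y‖ ≤ ‖rv x‖ + 1 := by
  have := norm_nbr_le h 0
  simpa using this

lemma latNbrs_subset_lball {x : Fin d → ℤ} {R : ℝ} (h : ‖rv x‖ ≤ R) :
    latNbrs x ⊆ lball 0 (R + 1) :=
  fun _ hy => mem_lball_zero.2 ((norm_nbr_le' hy).trans (by linarith))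

lemma wbar_of_notMem {n : ℝ} {x : Fin d → ℤ} (h : x ∉ lball 0 n) : wbar n x = 0 := by
  rw [wbar, if_neg (fun h' => h (mem_lball_zero.2 h'))]

lemma sum_lap_wbar (hd : 2 ≤ d) (n : ℝ) :
    ∑ x ∈ lball (0 : Fin d → ℤ) (n + 1), lap (wbar n) x = 0 := by
  have := sum_mul_lap (h := wbar n) (w := fun _ : Fin d → ℤ => (1 : ℝ)) (S := lball 0 n)
    (T := lball 0 (n + 1)) (fun x hx => wbar_of_notMem hx) (lball_mono (by linarith))
    (fun x hx => latNbrs_subset_lball (mem_lball_zero.1 hx))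
  simp only [lap_const (by omega : d ≠ 0), mul_zero, Finset.sum_const_zero, one_mul] at this
  exact this.symm

lemma alpha_sum_dens_le (hd : 2 ≤ d) {n : ℝ} (hn : 20 * d + aC d ≤ n) :
    √(n ^ 2 + aC d) ^ d * ∑ x ∈ lball (0 : Fin d → ℤ) (n + 1), dens x ≤
      (lball (0 : Fin d → ℤ) (n + 1)).card := by
  have h : ∑ x ∈ lball (0 : Fin d → ℤ) (n + 1),
      (lap (wbar n) x + √(n ^ 2 + aC d) ^ d * dens x) ≤
      ∑ x ∈ lball (0 : Fin d → ℤ) (n + 1), (1 : ℝ) :=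
    Finset.sum_le_sum fun x hx => lap_wbar_add_le_one hd hn (mem_lball_zero.1 hx)
  rw [Finset.sum_add_distrib, sum_lap_wbar hd, zero_add, ← Finset.mul_sum, Finset.sum_const,
    nsmul_eq_mul, mul_one] at h
  exact h

lemma le_alpha_sum_dens (hd : 2 ≤ d) {n : ℝ} (hn : 2 ≤ n) :
    (1 + d * 2 ^ (d + 1) * 9 : ℝ) * (lball (0 : Fin d → ℤ) (n - 1)).card -
      d * 2 ^ (d + 1) * 9 * (lball (0 : Fin d → ℤ) (n + 1)).card ≤
    √(n ^ 2 + aC d) ^ d * ∑ x ∈ lball (0 : Fin d → ℤ) (n + 1), dens x := by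
  set C : ℝ := d * 2 ^ (d + 1) * 9 with hC
  have h : ∑ x ∈ lball (0 : Fin d → ℤ) (n + 1), (if x ∈ lball 0 (n - 1) then 1 + C else 0) ≤
      ∑ x ∈ lball (0 : Fin d → ℤ) (n + 1),
        (C + (lap (wbar n) x + √(n ^ 2 + aC d) ^ d * dens x)) := by
    refine Finset.sum_le_sum fun x _ => ?_
    split_ifs with hx
    · rw [lap_wbar_add_eq hd (mem_lball_zero.1 hx)]; linarith
    · have := le_lap_wbar_add hd hn (x := x); linarith
  rw [Finset.sum_add_distrib, Finset.sum_add_distrib, sum_lap_wbar hd, zero_add,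
    Finset.sum_const (b := C), nsmul_eq_mul, ← Finset.sum_filter, Finset.sum_const,
    nsmul_eq_mul, Finset.filter_mem_eq_inter,
    Finset.inter_eq_right.2 (lball_mono (by linarith))] at h
  rw [Finset.mul_sum]
  linarith

lemma tendsto_add_div_pow (c : ℝ) (k : ℕ) :
    Tendsto (fun m : ℕ => ((m : ℝ) + c) ^ k / (m : ℝ) ^ k) atTop (𝓝 1) := by
  have h : Tendsto (fun m : ℕ => (1 + c / (m : ℝ)) ^ k) atTop (𝓝 ((1 + 0) ^ k)) :=
    ((tendsto_const_nhds).add (tendsto_const_nhds.div_atTop tendsto_natCast_atTop_atTop)).pow k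
  rw [add_zero, one_pow] at h
  refine h.congr' ?_
  filter_upwards [eventually_gt_atTop 0] with m hm
  have : (m : ℝ) ≠ 0 := by exact_mod_cast hm.ne'
  rw [← div_pow, add_div, div_self this]

lemma tendsto_card_lball_shift (hd : 1 ≤ d) (j : ℕ) :
    Tendsto (fun n : ℕ => ((lball (0 : Fin d → ℤ) ((n : ℝ) + j)).card : ℝ) / (n : ℝ) ^ d) atTop
      (𝓝 (unitBallVol d)) := by
  have h := ((tendsto_card_lball hd).comp (tendsto_add_atTop_nat j)).mul
    (tendsto_add_div_pow (j : ℝ) d)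
  rw [mul_one] at h
  refine h.congr' ?_
  filter_upwards [eventually_gt_atTop 0] with n hn
  have h1 : (0 : ℝ) < n := by exact_mod_cast hn
  simp only [Function.comp, Nat.cast_add]
  rw [div_mul_div_cancel₀ (by positivity)]

lemma sum_dens_le (hd : 2 ≤ d) (S : Finset (Fin d → ℤ)) : ∑ x ∈ S, dens x ≤ unitBallVol d := by
  refine ge_of_tendsto (tendsto_card_lball_shift (by omega : 1 ≤ d) 1) ?_
  obtain ⟨R, hR⟩ : ∃ R : ℝ, S ⊆ lball 0 R := by
    refine ⟨∑ x ∈ S, ‖rv x‖, fun x hx => mem_lball_zero.2 ?_⟩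
    exact Finset.single_le_sum (f := fun x => ‖rv x‖) (fun _ _ => norm_nonneg _) hx
  filter_upwards [tendsto_natCast_atTop_atTop.eventually_ge_atTop (20 * d + aC d),
    tendsto_natCast_atTop_atTop.eventually_ge_atTop R, eventually_gt_atTop 0] with n h1 h2 h3
  have hn : (0 : ℝ) < n := by exact_mod_cast h3
  have h := alpha_sum_dens_le hd h1
  have hS : ∑ x ∈ S, dens x ≤ ∑ x ∈ lball (0 : Fin d → ℤ) ((n : ℝ) + 1), dens x :=
    Finset.sum_le_sum_of_subset_of_nonneg (hR.trans (lball_mono (by linarith)))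
      fun x _ _ => dens_nonneg hd x
  have hα : (n : ℝ) ^ d ≤ √((n : ℝ) ^ 2 + aC d) ^ d := by
    refine pow_le_pow_left₀ hn.le (Real.le_sqrt_of_sq_le ?_) d
    linarith [aC_pos (d := d)]
  rw [le_div_iff₀ (by positivity), Nat.cast_one, mul_comm]
  refine le_trans ?_ h
  exact mul_le_mul hα hS (Finset.sum_nonneg fun x _ => dens_nonneg hd x) (by positivity)

lemma sqrt_sq_add_aC_le {n : ℝ} (hn : 0 ≤ n) : √(n ^ 2 + aC d) ≤ n + aC d := by
  have := aC_ge (d := d)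
  rw [Real.sqrt_le_left (by linarith)]
  nlinarith

lemma exists_le_sum_dens (hd : 2 ≤ d) : ∃ C : ℝ, 0 < C ∧ ∀ R : ℝ, 0 < R →
    unitBallVol d - C / R ≤ ∑ x ∈ lball (0 : Fin d → ℤ) R, dens x := by
  obtain ⟨C, hC, hsum⟩ := exists_sum_rho_succ_le (d := d) (by omega)
  have ha := aC_pos (d := d)
  refine ⟨2 * aC d * C, by positivity, fun R hR => ?_⟩
  set B : ℝ := ∑ x ∈ lball (0 : Fin d → ℤ) R, dens x with hB
  have tail : ∀ M : ℝ, ∑ x ∈ lball (0 : Fin d → ℤ) M, dens x ≤ B + 2 * aC d * C / R := by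
    intro M
    have h1 : ∑ x ∈ lball (0 : Fin d → ℤ) M, dens x ≤
        ∑ x ∈ lball (0 : Fin d → ℤ) M, ((if x ∈ lball 0 R then dens x else 0) +
          2 * aC d / R * (rho 0 x ^ (d + 1))⁻¹) := by
      refine Finset.sum_le_sum fun x _ => ?_
      have hp := rho_pos 0 x
      split_ifs with hx
      · have : 0 ≤ 2 * aC d / R * (rho 0 x ^ (d + 1))⁻¹ := by positivity
        linarith
      · rw [zero_add]
        refine (dens_le hd x).trans ?_
        rw [div_mul_eq_mul_div, mul_div_assoc]
        refine mul_le_mul_of_nonneg_left ?_ (by positivity)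
        rw [mem_lball, not_le] at hx
        have hRr : R ≤ rho 0 x := hx.le.trans (norm_le_rho 0 x)
        rw [pow_succ _ (d + 1), mul_inv, div_eq_mul_inv]
        gcongr
    refine h1.trans ?_
    rw [Finset.sum_add_distrib, ← Finset.sum_filter, ← Finset.mul_sum]
    refine add_le_add ?_ ?_
    · rw [Finset.filter_mem_eq_inter]
      exact Finset.sum_le_sum_of_subset_of_nonneg Finset.inter_subset_right
        fun x _ _ => dens_nonneg hd x
    · rw [show 2 * aC d * C / R = 2 * aC d / R * C by ring]
      exact mul_le_mul_of_nonneg_left (hsum 0 _) (by positivity)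
  set C' : ℝ := d * 2 ^ (d + 1) * 9 with hC'
  have lim1 := ((tendsto_card_lball_shift (by omega : 1 ≤ d) 0).const_mul (1 + C')).sub
    ((tendsto_card_lball_shift (by omega : 1 ≤ d) 2).const_mul C')
  have lim2 := (tendsto_add_div_pow (1 + aC d) d).const_mul (B + 2 * aC d * C / R)
  have key := le_of_tendsto_of_tendsto lim1 lim2 (by
    filter_upwards [eventually_gt_atTop 0] with m hm
    have hm0 : (1 : ℝ) ≤ m := by exact_mod_cast hm
    have h := le_alpha_sum_dens hd (n := (m : ℝ) + 1) (by linarith)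
    rw [add_sub_cancel_right, add_assoc, one_add_one_eq_two, ← hC'] at h
    have h2 : √(((m : ℝ) + 1) ^ 2 + aC d) ^ d ≤ ((m : ℝ) + (1 + aC d)) ^ d := by
      rw [← add_assoc]
      exact pow_le_pow_left₀ (Real.sqrt_nonneg _) (sqrt_sq_add_aC_le (by linarith)) d
    have h3 := mul_le_mul h2 (tail ((m : ℝ) + 2))
      (Finset.sum_nonneg fun x _ => dens_nonneg hd x) (by positivity)
    have h4 := h.trans h3
    have hmd : (0 : ℝ) < (m : ℝ) ^ d := by positivity
    simp only [Nat.cast_zero, add_zero, Nat.cast_ofNat]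
    rw [← mul_div_assoc, ← mul_div_assoc, ← mul_div_assoc, ← sub_div]
    gcongr
    linarith)
  rw [mul_one] at key
  linarith

end DensitySum

section Glue

variable {d : ℕ}

/-- The `ℓ¹` norm on `ℤ^d`. -/
def l1N (x : Fin d → ℤ) : ℕ := ∑ i, (x i).natAbs

lemma l1N_update (x : Fin d → ℤ) (i : Fin d) (k : ℤ) :
    l1N (Function.update x i k) + (x i).natAbs = l1N x + k.natAbs := by
  unfold l1N
  rw [← Finset.add_sum_erase _ _ (Finset.mem_univ i),
    ← Finset.add_sum_erase _ (fun j => (x j).natAbs) (Finset.mem_univ i)]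
  simp only [Function.update_self]
  have : ∑ j ∈ Finset.univ.erase i, (Function.update x i k j).natAbs =
      ∑ j ∈ Finset.univ.erase i, (x j).natAbs :=
    Finset.sum_congr rfl fun j hj => by
      rw [Function.update_of_ne (Finset.ne_of_mem_erase hj)]
  omega

lemma add_stdv_eq_update (x : Fin d → ℤ) (i : Fin d) :
    x + stdv i = Function.update x i (x i + 1) := by
  ext j
  rw [Pi.add_apply, stdv_apply]
  by_cases h : j = i
  · subst h; simp
  · simp [h]

lemma sub_stdv_eq_update (x : Fin d → ℤ) (i : Fin d) :
    x - stdv i = Function.update x i (x i - 1) := by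
  ext j
  rw [Pi.sub_apply, stdv_apply]
  by_cases h : j = i
  · subst h; simp
  · simp [h]

lemma l1N_nbr_le {x y : Fin d → ℤ} (h : y ∈ latNbrs x) (z : Fin d → ℤ) :
    l1N (x - z) ≤ l1N (y - z) + 1 := by
  obtain ⟨i, rfl | rfl⟩ := mem_latNbrs.1 h
  · rw [show x + stdv i - z = (x - z) + stdv i by abel, add_stdv_eq_update]
    have := l1N_update (x - z) i ((x - z) i + 1)
    omega
  · rw [show x - stdv i - z = (x - z) - stdv i by abel, sub_stdv_eq_update]
    have := l1N_update (x - z) i ((x - z) i - 1)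
    omega

lemma exists_nbr_l1N_lt {x z : Fin d → ℤ} (h : x ≠ z) :
    ∃ y ∈ latNbrs x, l1N (y - z) + 1 = l1N (x - z) := by
  obtain ⟨i, hi⟩ := Function.ne_iff.1 h
  have hi' : (x - z) i ≠ 0 := sub_ne_zero.2 hi
  rcases lt_or_gt_of_ne hi' with h' | h'
  · refine ⟨x + stdv i, add_stdv_mem x i, ?_⟩
    rw [show x + stdv i - z = (x - z) + stdv i by abel, add_stdv_eq_update]
    have := l1N_update (x - z) i ((x - z) i + 1)
    omega
  · refine ⟨x - stdv i, sub_stdv_mem x i, ?_⟩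
    rw [show x - stdv i - z = (x - z) - stdv i by abel, sub_stdv_eq_update]
    have := l1N_update (x - z) i ((x - z) i - 1)
    omega

lemma l1N_le (x : Fin d → ℤ) : (l1N x : ℝ) ≤ d * ‖rv x‖ := by
  unfold l1N
  push_cast
  refine (Finset.sum_le_sum fun i _ => ?_).trans_eq
    (by rw [Finset.sum_const, Finset.card_univ, Fintype.card_fin, nsmul_eq_mul] :
      ∑ _i : Fin d, ‖rv x‖ = d * ‖rv x‖)
  rw [Nat.cast_natAbs, Int.cast_abs]
  exact abs_apply_le_norm x i

lemma norm_le_l1N (x : Fin d → ℤ) : ‖rv x‖ ≤ l1N x := by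
  apply le_of_sq_le_sq _ (by positivity) |>.trans_eq rfl
  rw [norm_rv_sq]
  unfold l1N
  push_cast
  refine le_trans (le_of_eq (Finset.sum_congr rfl fun i _ => ?_))
    (Finset.sum_sq_le_sq_sum_of_nonneg (f := fun i => (((x i).natAbs : ℕ) : ℝ)) fun i _ => by positivity)
  rw [Nat.cast_natAbs, Int.cast_abs, sq_abs]

lemma le_nbrAvg_of_mem {g : (Fin d → ℤ) → ℝ} (hg : ∀ y, 0 ≤ g y) {x y : Fin d → ℤ}
    (h : y ∈ latNbrs x) : (2 * (d : ℝ))⁻¹ * g y ≤ nbrAvg g x := by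
  rw [nbrAvg_eq, card_latNbrs]
  push_cast
  exact mul_le_mul_of_nonneg_left (Finset.single_le_sum (f := g) (fun z _ => hg z) h) (by positivity)

/-- A function which is subharmonic away from a ball around `ζ` and bounded above can be modified
near `ζ`, and replaced by its positive part, so as to be subharmonic away from `ζ`. -/
lemma exists_glue (hd : 2 ≤ d) (r₀ : ℝ) (hr₀ : 0 ≤ r₀) : ∃ Γ r₃ : ℝ, 1 ≤ Γ ∧ r₀ + 2 < r₃ ∧
    ∀ (ζ : Fin d → ℤ) (h₀ : (Fin d → ℤ) → ℝ) (M : ℝ), 0 ≤ M →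
    (∀ x, r₀ ≤ ‖rv x - rv ζ‖ → h₀ x ≤ M) → (∀ x, r₀ ≤ ‖rv x - rv ζ‖ → 0 ≤ lap h₀ x) →
    ∃ h : (Fin d → ℤ) → ℝ, (∀ x, 0 ≤ h x) ∧ (∀ x, x ≠ ζ → 0 ≤ lap h x) ∧ (∀ x, h x ≤ Γ * M) ∧
      (∀ x, r₃ ≤ ‖rv x - rv ζ‖ → h x = max (h₀ x) 0) ∧
      (∀ x, r₀ + 2 < ‖rv x - rv ζ‖ → h₀ x ≤ h x) ∧
      ∀ x, ‖rv x - rv ζ‖ ≤ r₀ + 2 → M ≤ h x := by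
  have hd0 : d ≠ 0 := by omega
  have hd2 : (2 : ℝ) ≤ d := by exact_mod_cast hd
  set L : ℕ := ⌈(d : ℝ) * (r₀ + 2)⌉₊ with hL
  set q : ℝ := (2 * (d : ℝ))⁻¹ with hq
  have hq0 : 0 < q := by positivity
  have hq2 : q ≤ 1 / 2 := by
    rw [hq, inv_eq_one_div]
    exact div_le_div_of_nonneg_left zero_le_one (by norm_num) (by linarith)
  have hqL : q ^ L ≤ 1 := pow_le_one₀ hq0.le (by linarith)
  have hqL0 : 0 < q ^ L := by positivity
  set η : ℝ := q ^ L / 2 with hη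
  have hη0 : 0 < η := by positivity
  refine ⟨η⁻¹, L + 1, (one_le_inv₀ hη0).2 (by linarith), ?_, ?_⟩
  · have := Nat.le_ceil ((d : ℝ) * (r₀ + 2))
    rw [← hL] at this
    nlinarith
  intro ζ h₀ M hM hbd hsub
  set ψ : (Fin d → ℤ) → ℝ := fun x => η⁻¹ * M * max (q ^ l1N (x - ζ) - η) 0 with hψ
  have hΓM : 0 ≤ η⁻¹ * M := by positivity
  have ψ0 : ∀ x, 0 ≤ ψ x := fun x => mul_nonneg hΓM (le_max_right _ _)
  have ψle : ∀ x, ψ x ≤ η⁻¹ * M := fun x => by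
    refine mul_le_of_le_one_right hΓM (max_le ?_ zero_le_one)
    have : q ^ l1N (x - ζ) ≤ 1 := pow_le_one₀ hq0.le (by linarith)
    linarith
  have ψsub : ∀ x, x ≠ ζ → ψ x ≤ nbrAvg ψ x := by
    intro x hx
    rw [hψ, nbrAvg_smul]
    refine mul_le_mul_of_nonneg_left (max_le ?_ ?_) hΓM
    · obtain ⟨y, hy, hxy⟩ := exists_nbr_l1N_lt hx
      have h1 := le_nbrAvg_of_mem (g := fun z => q ^ l1N (z - ζ)) (fun _ => by positivity) hy
      have h2 : q ^ l1N (x - ζ) ≤ nbrAvg (fun z => q ^ l1N (z - ζ)) x := by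
        rw [← hxy, pow_succ, mul_comm]; exact h1
      have h3 : nbrAvg (fun z => q ^ l1N (z - ζ) + -η) x = _ := nbrAvg_add _ _ x
      rw [nbrAvg_const hd0] at h3
      calc q ^ l1N (x - ζ) - η ≤ nbrAvg (fun z => q ^ l1N (z - ζ) + -η) x := by
            rw [h3]; linarith
        _ ≤ _ := nbrAvg_mono fun y _ => by
            rw [← sub_eq_add_neg]; exact le_max_left _ _
    · exact le_nbrAvg_of_le hd0 fun y _ => le_max_right _ _
  have ψM : ∀ x, ‖rv x - rv ζ‖ ≤ r₀ + 2 → M ≤ ψ x := by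
    intro x hx
    have h1 : l1N (x - ζ) ≤ L := by
      have h2 := l1N_le (x - ζ)
      rw [rv_sub] at h2
      have h3 : (l1N (x - ζ) : ℝ) ≤ d * (r₀ + 2) := h2.trans (by gcongr)
      exact_mod_cast h3.trans (Nat.le_ceil _)
    have h2 : q ^ L ≤ q ^ l1N (x - ζ) := pow_le_pow_of_le_one hq0.le (by linarith) h1
    calc M = η⁻¹ * M * η := by field_simp
      _ ≤ ψ x := mul_le_mul_of_nonneg_left (le_max_of_le_left (by linarith)) hΓM
  set h : (Fin d → ℤ) → ℝ := fun x =>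
    if ‖rv x - rv ζ‖ ≤ r₀ + 2 then ψ x else max (max (h₀ x) 0) (ψ x) with hh
  have hψh : ∀ x, ψ x ≤ h x := by
    intro x; simp only [hh]; split_ifs
    exacts [le_rfl, le_max_right _ _]
  have h0h : ∀ x, r₀ ≤ ‖rv x - rv ζ‖ → h₀ x ≤ h x := by
    intro x hx; simp only [hh]; split_ifs with h'
    exacts [(hbd x hx).trans (ψM x h'), le_max_of_le_left (le_max_left _ _)]
  have hpos : ∀ x, 0 ≤ h x := fun x => (ψ0 x).trans (hψh x)
  refine ⟨h, hpos, ?_, ?_, ?_, ?_, ?_⟩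
  · intro x hx
    unfold lap
    rw [sub_nonneg]
    have c1 : ψ x ≤ nbrAvg h x := (ψsub x hx).trans (nbrAvg_mono fun y _ => hψh y)
    by_cases hr : ‖rv x - rv ζ‖ ≤ r₀ + 2
    · have : h x = ψ x := by simp only [hh]; rw [if_pos hr]
      rw [this]; exact c1
    · have : h x = max (max (h₀ x) 0) (ψ x) := by simp only [hh]; rw [if_neg hr]
      rw [this]
      push Not at hr
      refine max_le (max_le ?_ (le_nbrAvg_of_le hd0 fun y _ => hpos y)) c1
      have h1 := hsub x (by linarith)
      unfold lap at h1
      refine (sub_nonneg.1 h1).trans (nbrAvg_mono fun y hy => h0h y ?_)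
      have := norm_nbr_ge hy (rv ζ)
      linarith
  · intro x
    simp only [hh]; split_ifs with h'
    · exact ψle x
    · refine max_le (max_le ((hbd x (by push Not at h'; linarith)).trans ?_) hΓM) (ψle x)
      exact le_mul_of_one_le_left hM ((one_le_inv₀ hη0).2 (by linarith))
  · intro x hx
    have h1 : L + 1 ≤ l1N (x - ζ) := by
      have := norm_le_l1N (x - ζ)
      rw [rv_sub] at this
      exact_mod_cast hx.trans this
    have h2 : q ^ l1N (x - ζ) ≤ η := by
      refine (pow_le_pow_of_le_one hq0.le (by linarith) h1).trans ?_
      rw [pow_succ, hη]; nlinarith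
    have h3 : ψ x = 0 := by
      simp only [hψ]; rw [max_eq_right (by linarith), mul_zero]
    have h4 : ¬ ‖rv x - rv ζ‖ ≤ r₀ + 2 := by
      have := Nat.le_ceil ((d : ℝ) * (r₀ + 2))
      rw [← hL] at this
      nlinarith
    simp only [hh]
    rw [if_neg h4, h3, max_eq_left (le_max_right _ _)]
  · intro x hx
    exact h0h x (by linarith)
  · intro x hx
    exact (ψM x hx).trans (hψh x)

end Glue

section Kernel

variable {d : ℕ}

lemma fker_diff_diff_le (hd : 2 ≤ d) {s₀ A A' D D' : ℝ} (hs : 0 < s₀) (hA : s₀ ≤ A)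
    (hA' : s₀ ≤ A') (hD : 0 ≤ D) (hD' : 0 ≤ D') :
    |(fker d A - fker d (A + D)) - (fker d A' - fker d (A' + D'))| ≤
      d * (√s₀ ^ (d + 2))⁻¹ * D * |A - A'| + (√s₀ ^ d)⁻¹ * |D - D'| := by
  have h1 : ∀ {B E E' : ℝ}, s₀ ≤ B → 0 ≤ E → E ≤ E' →
      |fker d (B + E') - fker d (B + E)| ≤ (√s₀ ^ d)⁻¹ * |E - E'| := by
    intro B E E' hB hE hEE
    have a1 := fker_anti hd (s := B + E) (t := B + E') (by linarith) (by linarith)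
    have a2 := fker_sub_le hd (s := B + E) (D := E' - E) (by linarith) (by linarith)
    rw [show B + E + (E' - E) = B + E' by ring] at a2
    have a3 : (B + E) ^ (-((d : ℝ) / 2)) ≤ (√s₀ ^ d)⁻¹ := by
      rw [← rpow_neg_half_natCast hs.le]
      exact Real.rpow_le_rpow_of_nonpos hs (by linarith) neg_half_nonpos
    rw [abs_of_nonpos (by linarith), abs_of_nonpos (by linarith)]
    nlinarith [mul_le_mul_of_nonneg_left a3 (sub_nonneg.2 hEE)]
  have h2 : |(fker d A' - fker d (A' + D)) - (fker d A' - fker d (A' + D'))| ≤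
      (√s₀ ^ d)⁻¹ * |D - D'| := by
    rw [show (fker d A' - fker d (A' + D)) - (fker d A' - fker d (A' + D')) =
      fker d (A' + D') - fker d (A' + D) by ring]
    rcases le_total D D' with h | h
    · exact h1 hA' hD h
    · rw [abs_sub_comm, abs_sub_comm D]; exact h1 hA' hD' h
  have h3 : |(fker d A - fker d (A + D)) - (fker d A' - fker d (A' + D))| ≤
      d * (√s₀ ^ (d + 2))⁻¹ * D * |A - A'| := by
    have := (convex_Ici s₀).norm_image_sub_le_of_norm_hasDerivWithin_le
      (f := fun t => fker d t - fker d (t + D))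
      (f' := fun t => -t ^ (-((d : ℝ) / 2)) - -(t + D) ^ (-((d : ℝ) / 2)))
      (C := d * (√s₀ ^ (d + 2))⁻¹ * D) (x := A') (y := A) ?_ ?_ hA' hA
    · simpa [Real.norm_eq_abs] using this
    · intro t ht
      have ht' : s₀ ≤ t := ht
      exact ((hasDerivAt_fker hd (by linarith)).sub
        ((hasDerivAt_fker hd (by linarith : (0 : ℝ) < t + D)).comp_add_const t D)).hasDerivWithinAt
    · intro t ht
      have ht' : s₀ ≤ t := ht
      have b := abs_rpow_sub_rpow_le (p := (d : ℝ) / 2) (t := t) (μ := D) (by positivity)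
        (by linarith) hD
      rw [Real.norm_eq_abs, show -t ^ (-((d : ℝ) / 2)) - -(t + D) ^ (-((d : ℝ) / 2)) =
        (t + D) ^ (-((d : ℝ) / 2)) - t ^ (-((d : ℝ) / 2)) by ring]
      refine b.trans (mul_le_mul_of_nonneg_right ?_ hD)
      have b2 : t ^ (-((d : ℝ) / 2) - 1) ≤ (√s₀ ^ (d + 2))⁻¹ := by
        rw [← rpow_neg_half_sub_one hs.le]
        exact Real.rpow_le_rpow_of_nonpos hs (by linarith) (by
          have := neg_half_nonpos (d := d); linarith)
      refine mul_le_mul (by linarith [Nat.cast_nonneg (α := ℝ) d]) b2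
        (Real.rpow_nonneg (by linarith) _) (by positivity)
  calc _ = |((fker d A - fker d (A + D)) - (fker d A' - fker d (A' + D))) +
        ((fker d A' - fker d (A' + D)) - (fker d A' - fker d (A' + D')))| := by ring_nf
    _ ≤ _ := abs_add_le _ _
    _ ≤ _ := add_le_add h3 h2

end Kernel

section Inner

variable {d : ℕ} {Ω : Type*} [MeasurableSpace Ω] {P : Measure Ω}
  {I : ℕ → Ω → Finset (Fin d → ℤ)} {Y : ℕ → Ω → (Fin d → ℤ)}

lemma exp_neg_sub_sq_le {u : ℝ} (h0 : 0 ≤ u) (h1 : u ≤ 1 / 2) :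
    Real.exp (-u - u ^ 2) ≤ 1 - u := by
  have h2 := Real.quadratic_le_exp_of_nonneg (x := u + u ^ 2) (by positivity)
  rw [show -u - u ^ 2 = -(u + u ^ 2) by ring, Real.exp_neg,
    inv_le_comm₀ (Real.exp_pos _) (by linarith)]
  refine le_trans ?_ h2
  rw [inv_le_iff_one_le_mul₀ (by linarith)]
  have h3 : 0 ≤ u ^ 2 * (1 / 2 - u) := mul_nonneg (sq_nonneg u) (by linarith)
  have h4 : 0 ≤ u ^ 2 * (1 / 2 - u) * u := mul_nonneg h3 h0
  have h5 : 0 ≤ u ^ 2 * (1 / 2 - u) * u ^ 2 := by positivity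
  nlinarith [sq_nonneg u, pow_nonneg h0 3]

/-- Exponential martingale bound for a site being vacant. -/
lemma IsIDLA.prob_notMem_le (H : IsIDLA P I Y) [IsProbabilityMeasure P] (hd : d ≠ 0)
    {ζ : Fin d → ℤ} {h : (Fin d → ℤ) → ℝ} {S : Finset (Fin d → ℤ)} {lam : ℝ}
    (h0 : ∀ x, 0 ≤ h x) (hS : ∀ x, x ∉ S → h x = 0) (hsub : ∀ x, x ≠ ζ → 0 ≤ lap h x)
    (hlam : 0 ≤ lam) (hM : ∀ x, lam * h x ≤ 1 / 2) (t : ℕ) :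
    P {ω | ζ ∉ I t ω} ≤ ENNReal.ofReal
      (Real.exp (lam * (∑ x ∈ S, h x + lam * ∑ x ∈ S, h x ^ 2 - t * h 0))) := by
  classical
  set E : (Fin d → ℤ) → ℝ := fun x => -(lam * h x) - (lam * h x) ^ 2 + lam * h 0 with hE
  set φ : (Fin d → ℤ) → ℝ := fun x => if x = ζ then 0 else Real.exp (E x) with hφ
  have φ0 : ∀ x, 0 ≤ φ x := by
    intro x; simp only [hφ]; split_ifs
    exacts [le_rfl, (Real.exp_pos _).le]
  have φle : ∀ x, φ x ≤ Real.exp (lam * h 0) * (1 - lam * h x) := by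
    intro x
    simp only [hφ]; split_ifs
    · exact mul_nonneg (Real.exp_pos _).le (by linarith [hM x])
    · rw [hE, Real.exp_add, mul_comm]
      exact mul_le_mul_of_nonneg_left
        (exp_neg_sub_sq_le (mul_nonneg hlam (h0 x)) (hM x)) (Real.exp_pos _).le
  have hone : Real.exp (lam * h 0) * (1 - lam * h 0) ≤ 1 := by
    have := Real.add_one_le_exp (-(lam * h 0))
    calc Real.exp (lam * h 0) * (1 - lam * h 0)
        ≤ Real.exp (lam * h 0) * Real.exp (-(lam * h 0)) :=
          mul_le_mul_of_nonneg_left (by linarith) (Real.exp_pos _).le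
      _ = 1 := by rw [← Real.exp_add, add_neg_cancel, Real.exp_zero]
  have main := H.prob_le_of_prod hd φ φ0 (fun A => ζ ∉ A)
    (fun A y hA hζ => hA (Finset.mem_insert_of_mem hζ)) ?_ t (fun ω => ζ ∉ I t ω)
    (c := Real.exp (-(lam * ∑ x ∈ S, h x) - lam ^ 2 * ∑ x ∈ S, h x ^ 2 + (t + 1) * (lam * h 0)))
    (Real.exp_pos _) ?_
  · refine main.trans (ENNReal.ofReal_le_ofReal ?_)
    rw [div_le_iff₀ (Real.exp_pos _), ← Real.exp_add]
    refine (le_trans (φle 0) ?_).trans (Real.exp_le_exp.2 (le_of_eq ?_) : Real.exp (lam * h 0) ≤ _)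
    · exact mul_le_of_le_one_right (Real.exp_pos _).le
        (by linarith [mul_nonneg hlam (h0 0)])
    · ring
  · intro A hA hζ
    have hh := sum_exitMeas_mul_le hd (A := A) (g := fun x => 1 - lam * h x) (x := 0)
      (fun x _ => by linarith [hM x]) (fun x hx => ?_) hA
    · calc ∑ y ∈ bdryF latNbrs A, exitMeas A 0 y * φ y
          ≤ ∑ y ∈ bdryF latNbrs A, exitMeas A 0 y * (Real.exp (lam * h 0) * (1 - lam * h y)) :=
            Finset.sum_le_sum fun y _ =>
              mul_le_mul_of_nonneg_left (φle y) (exitMeas_nonneg hd A 0 y)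
        _ = Real.exp (lam * h 0) * ∑ y ∈ bdryF latNbrs A, exitMeas A 0 y * (1 - lam * h y) := by
            rw [Finset.mul_sum]; exact Finset.sum_congr rfl fun _ _ => by ring
        _ ≤ _ := (mul_le_mul_of_nonneg_left hh (Real.exp_pos _).le).trans hone
    · have hxζ : x ≠ ζ := fun hxe => hζ (hxe ▸ hx)
      have e : nbrAvg (fun y => 1 - lam * h y) x = 1 - lam * nbrAvg h x := by
        have : (fun y => 1 - lam * h y) = fun y => 1 + (-lam) * h y := by ext y; ring
        rw [this, nbrAvg_add (fun _ => 1) (fun y => -lam * h y), nbrAvg_const hd, nbrAvg_smul]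
        ring
      rw [e]
      have := mul_nonneg hlam (hsub x hxζ)
      unfold lap at this
      linarith
  · intro ω hω
    refine ⟨hω, ?_⟩
    have e1 : ∏ x ∈ I t ω, φ x = Real.exp (∑ x ∈ I t ω, E x) := by
      rw [Real.exp_sum]
      refine Finset.prod_congr rfl fun x hx => ?_
      simp only [hφ]; rw [if_neg (show x ≠ ζ from by rintro rfl; exact hω hx)]
    rw [e1, Real.exp_le_exp]
    simp only [hE, Finset.sum_add_distrib, Finset.sum_sub_distrib, Finset.sum_neg_distrib,
      Finset.sum_const, H.card_eq, nsmul_eq_mul, mul_pow, ← Finset.mul_sum]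
    have s1 : ∑ x ∈ I t ω, h x ≤ ∑ x ∈ S, h x := by
      rw [← Finset.sum_filter_add_sum_filter_not (I t ω) (· ∈ S)]
      rw [Finset.sum_eq_zero (s := (I t ω).filter (· ∉ S)) (fun x hx =>
        hS x (Finset.mem_filter.1 hx).2), add_zero, Finset.filter_mem_eq_inter]
      exact Finset.sum_le_sum_of_subset_of_nonneg Finset.inter_subset_right fun x _ _ => h0 x
    have s2 : ∑ x ∈ I t ω, h x ^ 2 ≤ ∑ x ∈ S, h x ^ 2 := by
      rw [← Finset.sum_filter_add_sum_filter_not (I t ω) (· ∈ S)]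
      rw [Finset.sum_eq_zero (s := (I t ω).filter (· ∉ S)) (fun x hx => by
        rw [hS x (Finset.mem_filter.1 hx).2]; ring), add_zero, Finset.filter_mem_eq_inter]
      exact Finset.sum_le_sum_of_subset_of_nonneg Finset.inter_subset_right
        fun x _ _ => sq_nonneg _
    have s1' := mul_le_mul_of_nonneg_left s1 hlam
    have s2' := mul_le_mul_of_nonneg_left s2 (sq_nonneg lam)
    push_cast
    linarith

end Inner

section Image

variable {d : ℕ}

/-- `log N` in dimension two and `1` in higher dimensions. -/
noncomputable def lamN (d : ℕ) (N : ℝ) : ℝ := if d = 2 then Real.log N else 1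

lemma one_le_log {N : ℝ} (hN : 3 ≤ N) : 1 ≤ Real.log N := by
  rw [Real.le_log_iff_exp_le (by linarith)]
  linarith [Real.exp_one_lt_d9]

lemma one_le_lamN {N : ℝ} (hN : 3 ≤ N) : 1 ≤ lamN d N := by
  unfold lamN; split_ifs
  exacts [one_le_log hN, le_rfl]

lemma log_three_mul_le {N : ℝ} (hN : 3 ≤ N) : 1 + Real.log (3 * N) ≤ 4 * Real.log N := by
  have h1 := one_le_log hN
  rw [Real.log_mul (by norm_num) (by linarith)]
  have : Real.log 3 ≤ 2 := by
    have := Real.log_le_sub_one_of_pos (show (0 : ℝ) < 3 by norm_num); linarith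
  linarith

/-- Difference of the squared distances to the image point and to `ζ`. -/
noncomputable def imgD (n : ℝ) (ζ x : Fin d → ℤ) : ℝ :=
  (1 - ‖rv ζ‖ ^ 2 / n ^ 2) * (n ^ 2 - ‖rv x‖ ^ 2)

lemma imgD_eq {n : ℝ} {ζ : Fin d → ℤ} (hn : n ≠ 0) (hζ : ‖rv ζ‖ ≠ 0) (x : Fin d → ℤ) :
    ‖rv x - rv ζ‖ ^ 2 + imgD n ζ x = ‖rv ζ‖ ^ 2 / n ^ 2 *
      ‖rv x - (n ^ 2 / ‖rv ζ‖ ^ 2) • rv ζ‖ ^ 2 := by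
  rw [norm_sub_sq_real, norm_sub_sq_real, imgD, inner_smul_right, norm_smul, Real.norm_eq_abs,
    mul_pow, sq_abs]
  field_simp
  ring

lemma imgD_add_nonneg {n : ℝ} {ζ : Fin d → ℤ} (hn : n ≠ 0) (hζ : ‖rv ζ‖ ≠ 0) (x : Fin d → ℤ) :
    0 ≤ ‖rv x - rv ζ‖ ^ 2 + imgD n ζ x := by
  rw [imgD_eq hn hζ]; positivity

lemma norm_sq_sub_sq_le (ζ x : Fin d → ℤ) :
    |‖rv x‖ ^ 2 - ‖rv ζ‖ ^ 2| ≤ ‖rv x - rv ζ‖ * (‖rv x‖ + ‖rv ζ‖) := by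
  rw [sq_sub_sq, abs_mul, mul_comm, abs_of_nonneg (by positivity : 0 ≤ ‖rv x‖ + ‖rv ζ‖)]
  exact mul_le_mul_of_nonneg_right (abs_norm_sub_norm_le _ _) (by positivity)

lemma norm_le_add_dist (ζ x : Fin d → ℤ) : ‖rv x‖ ≤ ‖rv ζ‖ + ‖rv x - rv ζ‖ := by
  have := norm_add_le (rv ζ) (rv x - rv ζ); simpa using this

lemma norm_le_add_dist' (ζ x : Fin d → ℤ) : ‖rv ζ‖ ≤ ‖rv x‖ + ‖rv x - rv ζ‖ := by
  have := norm_sub_le (rv x) (rv x - rv ζ); simpa using this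

lemma dist_le_add_norm (ζ x : Fin d → ℤ) : ‖rv x - rv ζ‖ ≤ ‖rv x‖ + ‖rv ζ‖ := norm_sub_le _ _

lemma norm_rv_zero_sub (ζ : Fin d → ℤ) : ‖rv 0 - rv ζ‖ = ‖rv ζ‖ := by
  rw [rv_zero, zero_sub, norm_neg]

/-- Green's function type potential of `ζ` with respect to the image point, for the ball of
radius `n`. -/
noncomputable def farH (n : ℝ) (ζ x : Fin d → ℤ) : ℝ :=
  fker d (‖rv x - rv ζ‖ ^ 2 - aC d) - fker d (‖rv x - rv ζ‖ ^ 2 + imgD n ζ x + aC d)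

lemma lap_sub (g g' : (Fin d → ℤ) → ℝ) (x : Fin d → ℤ) :
    lap (fun y => g y - g' y) x = lap g x - lap g' x := by
  have : (fun y => g y - g' y) = fun y => g y + (-1) * g' y := by ext; ring
  rw [this, lap_add g (fun y => (-1) * g' y), lap_smul]; ring

lemma three_aC_le_of_sqrt_le {r : ℝ} (hr : √(3 * aC d) ≤ r) : 3 * aC d ≤ r ^ 2 := by
  have := aC_pos (d := d)
  calc 3 * aC d = √(3 * aC d) ^ 2 := (Real.sq_sqrt (by positivity)).symm
    _ ≤ r ^ 2 := pow_le_pow_left₀ (Real.sqrt_nonneg _) hr 2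

lemma half_rho_sq_le {ζ x : Fin d → ℤ} (hr : √(3 * aC d) ≤ ‖rv x - rv ζ‖) :
    (rho ζ x / 2) ^ 2 ≤ ‖rv x - rv ζ‖ ^ 2 - aC d := by
  have := three_aC_le_of_sqrt_le hr
  have := aC_pos (d := d)
  rw [div_pow, rho_sq]; linarith

lemma half_rho_le_sqrt {ζ x : Fin d → ℤ} (hr : √(3 * aC d) ≤ ‖rv x - rv ζ‖) :
    rho ζ x / 2 ≤ √(‖rv x - rv ζ‖ ^ 2 - aC d) := by
  have h := half_rho_sq_le hr
  have := Real.sqrt_le_sqrt h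
  rwa [Real.sqrt_sq (by linarith [rho_pos ζ x])] at this

lemma inv_pow_le_of_half_rho_le {ζ x : Fin d → ℤ} {s : ℝ} (hs : rho ζ x / 2 ≤ s) (k : ℕ) :
    (s ^ k)⁻¹ ≤ 2 ^ k * (rho ζ x ^ k)⁻¹ := by
  have := rho_pos ζ x
  calc (s ^ k)⁻¹ ≤ ((rho ζ x / 2) ^ k)⁻¹ :=
        inv_anti₀ (by positivity) (pow_le_pow_left₀ (by positivity) hs k)
    _ = _ := by rw [div_pow, inv_div]; ring

lemma lap_farH (hd : 2 ≤ d) {n : ℝ} {ζ x : Fin d → ℤ} (hn : n ≠ 0) (hζ : ‖rv ζ‖ ≠ 0)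
    (hζn : ‖rv ζ‖ ≤ n) (hr : √(3 * aC d) ≤ ‖rv x - rv ζ‖) :
    0 ≤ lap (farH n ζ) x ∧ (0 ≤ imgD n ζ x →
      lap (farH n ζ) x ≤ 2 * aC d * 2 ^ (d + 3) * (rho ζ x ^ (d + 2))⁻¹) := by
  have ha := aC_pos (d := d)
  have h3 := three_aC_le_of_sqrt_le hr
  have hμ : 0 ≤ ‖rv ζ‖ ^ 2 / n ^ 2 := by positivity
  have hμ1 : ‖rv ζ‖ ^ 2 / n ^ 2 ≤ 1 :=
    div_le_one_of_le₀ (pow_le_pow_left₀ (norm_nonneg _) hζn 2) (sq_nonneg n)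
  obtain ⟨a1, a2⟩ := lap_fker_sub_le hd x (rv ζ) zero_le_one le_rfl (by linarith)
  obtain ⟨b1, b2⟩ := lap_fker_add_le hd x ((n ^ 2 / ‖rv ζ‖ ^ 2) • rv ζ) hμ hμ1
  simp only [one_mul, ← imgD_eq hn hζ] at a1 a2 b1 b2
  have e : lap (farH n ζ) x = lap (fun y => fker d (‖rv y - rv ζ‖ ^ 2 - aC d)) x -
      lap (fun y => fker d (‖rv y - rv ζ‖ ^ 2 + imgD n ζ y + aC d)) x := lap_sub _ _ x
  have hv := imgD_add_nonneg hn hζ x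
  have p1 : (0:ℝ) ≤ (‖rv x - rv ζ‖ ^ 2 - aC d) ^ (-((d : ℝ) / 2) - 1) :=
    Real.rpow_nonneg (by linarith) _
  have p2 : (0:ℝ) ≤ (‖rv x - rv ζ‖ ^ 2 + imgD n ζ x + aC d) ^ (-((d : ℝ) / 2) - 1) :=
    Real.rpow_nonneg (by linarith) _
  refine ⟨by rw [e]; linarith [mul_nonneg hμ p2], fun hδ => ?_⟩
  have hs : 0 < ‖rv x - rv ζ‖ ^ 2 - aC d := by linarith
  have c1 : (‖rv x - rv ζ‖ ^ 2 - aC d) ^ (-((d : ℝ) / 2) - 1) ≤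
      2 ^ (d + 2) * (rho ζ x ^ (d + 2))⁻¹ := by
    rw [rpow_neg_half_sub_one hs.le]
    exact inv_pow_le_of_half_rho_le (half_rho_le_sqrt hr) _
  have c2 : (‖rv x - rv ζ‖ ^ 2 + imgD n ζ x + aC d) ^ (-((d : ℝ) / 2) - 1) ≤
      (‖rv x - rv ζ‖ ^ 2 - aC d) ^ (-((d : ℝ) / 2) - 1) :=
    Real.rpow_le_rpow_of_nonpos hs (by linarith) (by
      have := neg_half_nonpos (d := d); linarith)
  have c3 := mul_le_of_le_one_left p2 hμ1
  rw [e]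
  have e2 : 2 * aC d * 2 ^ (d + 3) * (rho ζ x ^ (d + 2))⁻¹ =
    2 * (2 * aC d * (2 ^ (d + 2) * (rho ζ x ^ (d + 2))⁻¹)) := by ring
  rw [e2]
  have c4 := mul_le_mul_of_nonneg_left c1 (by positivity : 0 ≤ 2 * aC d)
  have c5 := mul_le_mul_of_nonneg_left (c3.trans (c2.trans c1)) (by positivity : 0 ≤ 2 * aC d)
  linarith

lemma farH_nonpos (hd : 2 ≤ d) {n : ℝ} {ζ x : Fin d → ℤ} (hn : n ≠ 0) (hζ : ‖rv ζ‖ ≠ 0)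
    (hx : imgD n ζ x ≤ -(2 * aC d)) : farH n ζ x ≤ 0 := by
  have hv := imgD_add_nonneg hn hζ x
  have := fker_anti hd (s := ‖rv x - rv ζ‖ ^ 2 + imgD n ζ x + aC d)
    (t := ‖rv x - rv ζ‖ ^ 2 - aC d) (by linarith [aC_pos (d := d)]) (by linarith)
  unfold farH; linarith

lemma farH_nonneg (hd : 2 ≤ d) {n : ℝ} {ζ x : Fin d → ℤ}
    (hr : √(3 * aC d) ≤ ‖rv x - rv ζ‖) (hx : 0 ≤ imgD n ζ x) : 0 ≤ farH n ζ x := by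
  have h3 := three_aC_le_of_sqrt_le hr
  have ha := aC_pos (d := d)
  have := fker_anti hd (t := ‖rv x - rv ζ‖ ^ 2 + imgD n ζ x + aC d)
    (s := ‖rv x - rv ζ‖ ^ 2 - aC d) (by linarith) (by linarith)
  unfold farH; linarith

/-- Standing assumptions on the potential of a site `ζ` at distance `ℓ` inside the ball of
radius `n`. -/
structure FarData (d : ℕ) (r₃ B N ℓ n : ℝ) (ζ : Fin d → ℤ) (h : (Fin d → ℤ) → ℝ) : Prop where
  hd : 2 ≤ d
  hN : 3 ≤ N
  hr₃ : √(3 * aC d) ≤ r₃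
  hℓr : 16 * (r₃ + aC d + 1) ≤ ℓ
  hℓd : 600 * (d * 2 ^ (d + 1)) ≤ ℓ
  hΛ : lamN d N ≤ ℓ
  hζ : 8 * ℓ ≤ ‖rv ζ‖
  hn : n = ‖rv ζ‖ + ℓ
  hnN : n ≤ N
  nonneg : ∀ x, 0 ≤ h x
  lap_nonneg : ∀ x, x ≠ ζ → 0 ≤ lap h x
  le : ∀ x, h x ≤ B * lamN d N
  eq : ∀ x, r₃ ≤ ‖rv x - rv ζ‖ → h x = max (farH n ζ x) 0

namespace FarData

variable {r₃ B N ℓ n : ℝ} {ζ : Fin d → ℤ} {h : (Fin d → ℤ) → ℝ}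

lemma basic (H : FarData d r₃ B N ℓ n ζ h) : 65 ≤ aC d ∧ 0 < r₃ ∧ 16 * 66 ≤ ℓ ∧ 9 * ℓ ≤ n ∧
    0 < n ∧ 0 < ‖rv ζ‖ ∧ ‖rv ζ‖ ≤ n ∧ 8 * n ≤ 9 * ‖rv ζ‖ := by
  have h1 := aC_ge (d := d)
  have h2 : 0 < r₃ := lt_of_lt_of_le (Real.sqrt_pos.2 (by positivity)) H.hr₃
  have h3 := H.hℓr
  have h4 := H.hζ
  have h5 := H.hn
  exact ⟨h1, h2, by linarith, by linarith, by linarith, by linarith, by linarith, by linarith⟩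

lemma one_sub_ge (H : FarData d r₃ B N ℓ n ζ h) : ℓ / n ≤ 1 - ‖rv ζ‖ ^ 2 / n ^ 2 := by
  obtain ⟨-, -, h3, h4, h5, h6, h7, h8⟩ := H.basic
  have e : 1 - ‖rv ζ‖ ^ 2 / n ^ 2 = ℓ / n * ((n + ‖rv ζ‖) / n) := by
    have := H.hn
    field_simp
    have : ℓ = n - ‖rv ζ‖ := by linarith
    rw [this]; ring
  rw [e]
  refine le_mul_of_one_le_right (by positivity) ?_
  rw [le_div_iff₀ h5]; linarith

lemma one_sub_le (H : FarData d r₃ B N ℓ n ζ h) : 1 - ‖rv ζ‖ ^ 2 / n ^ 2 ≤ 2 * (ℓ / n) := by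
  obtain ⟨-, -, h3, h4, h5, h6, h7, h8⟩ := H.basic
  have e : 1 - ‖rv ζ‖ ^ 2 / n ^ 2 = ℓ / n * ((n + ‖rv ζ‖) / n) := by
    have := H.hn
    field_simp
    have : ℓ = n - ‖rv ζ‖ := by linarith
    rw [this]; ring
  rw [e, mul_comm 2]
  refine mul_le_mul_of_nonneg_left ?_ (by positivity)
  rw [div_le_iff₀ h5]; linarith

lemma imgD_nonneg (H : FarData d r₃ B N ℓ n ζ h) {x : Fin d → ℤ} (hx : ‖rv x‖ ≤ n) :
    0 ≤ imgD n ζ x := by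
  obtain ⟨-, -, h3, h4, h5, h6, h7, h8⟩ := H.basic
  have := H.one_sub_ge
  refine mul_nonneg (le_trans (by positivity) this) ?_
  nlinarith [norm_nonneg (rv x)]

lemma imgD_le (H : FarData d r₃ B N ℓ n ζ h) (x : Fin d → ℤ) :
    imgD n ζ x ≤ 4 * ℓ * (ℓ + ‖rv x - rv ζ‖) := by
  obtain ⟨-, -, h3, h4, h5, h6, h7, h8⟩ := H.basic
  have h1 := H.one_sub_le
  have h2 := H.one_sub_ge
  have h9 := norm_le_add_dist' ζ x
  have h10 := norm_nonneg (rv x - rv ζ)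
  have h11 := H.hn
  have p : 0 ≤ 1 - ‖rv ζ‖ ^ 2 / n ^ 2 := le_trans (by positivity) h2
  have q : n ^ 2 - ‖rv x‖ ^ 2 ≤ 2 * n * (ℓ + ‖rv x - rv ζ‖) := by
    rcases le_total n ‖rv x‖ with hx | hx
    · have : n ^ 2 - ‖rv x‖ ^ 2 ≤ 0 := by nlinarith
      have : 0 ≤ 2 * n * (ℓ + ‖rv x - rv ζ‖) := by positivity
      linarith
    · have hy : n - ‖rv x‖ ≤ ℓ + ‖rv x - rv ζ‖ := by linarith
      nlinarith [norm_nonneg (rv x)]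
  calc imgD n ζ x ≤ (1 - ‖rv ζ‖ ^ 2 / n ^ 2) * (2 * n * (ℓ + ‖rv x - rv ζ‖)) :=
        mul_le_mul_of_nonneg_left q p
    _ ≤ (2 * (ℓ / n)) * (2 * n * (ℓ + ‖rv x - rv ζ‖)) :=
        mul_le_mul_of_nonneg_right h1 (by positivity)
    _ = _ := by field_simp; ring

lemma eq_zero (H : FarData d r₃ B N ℓ n ζ h) {x : Fin d → ℤ} (hx : x ∉ lball 0 (n + 1)) :
    h x = 0 := by
  obtain ⟨h1, h2, h3, h4, h5, h6, h7, h8⟩ := H.basic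
  rw [mem_lball_zero, not_le] at hx
  have h9 := norm_le_add_dist ζ x
  have h10 := H.hn
  have h11 := H.hℓr
  rw [H.eq x (by linarith)]
  refine max_eq_right (farH_nonpos H.hd h5.ne' h6.ne' ?_)
  have h12 := H.one_sub_ge
  have h13 : n ^ 2 - ‖rv x‖ ^ 2 ≤ -(2 * n) := by nlinarith
  have h14 : 0 ≤ 1 - ‖rv ζ‖ ^ 2 / n ^ 2 := le_trans (by positivity) h12
  calc imgD n ζ x ≤ (1 - ‖rv ζ‖ ^ 2 / n ^ 2) * (-(2 * n)) := mul_le_mul_of_nonneg_left h13 h14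
    _ ≤ ℓ / n * (-(2 * n)) := mul_le_mul_of_nonpos_right h12 (by linarith)
    _ = -(2 * ℓ) := by field_simp
    _ ≤ _ := by linarith

lemma eq_farH (H : FarData d r₃ B N ℓ n ζ h) {x : Fin d → ℤ} (hr : r₃ ≤ ‖rv x - rv ζ‖)
    (hx : ‖rv x‖ ≤ n) : h x = farH n ζ x := by
  rw [H.eq x hr]
  exact max_eq_left (farH_nonneg H.hd (H.hr₃.trans hr) (H.imgD_nonneg hx))

lemma le_rho_pred (H : FarData d r₃ B N ℓ n ζ h) {x : Fin d → ℤ} (hr : r₃ ≤ ‖rv x - rv ζ‖) :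
    h x ≤ 9 * 2 ^ d * (ℓ * (rho ζ x ^ (d - 1))⁻¹) := by
  obtain ⟨h1, h2, h3, h4, h5, h6, h7, h8⟩ := H.basic
  have hd := H.hd
  have hρ := rho_pos ζ x
  have hℓ := H.hℓr
  have hr' := H.hr₃.trans hr
  have ht := three_aC_le_of_sqrt_le hr'
  have hR : 0 ≤ 9 * 2 ^ d * (ℓ * (rho ζ x ^ (d - 1))⁻¹) := by positivity
  rw [H.eq x hr]
  refine max_le ?_ hR
  rcases le_total (imgD n ζ x) (-(2 * aC d)) with hδ | hδ
  · exact (farH_nonpos hd h5.ne' h6.ne' hδ).trans hR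
  set s := ‖rv x - rv ζ‖ ^ 2 - aC d with hs
  set D := imgD n ζ x + 2 * aC d with hD
  have hs0 : 0 < s := by linarith
  have hD0 : 0 ≤ D := by linarith
  have e : farH n ζ x = fker d s - fker d (s + D) := by
    unfold farH; rw [hs, hD]; congr 2; ring
  rw [e]
  have hDle := H.imgD_le x
  have hr0 : 0 < ‖rv x - rv ζ‖ := by linarith
  rcases le_total ℓ ‖rv x - rv ζ‖ with hrℓ | hrℓ
  · have k1 := fker_sub_le hd hs0 hD0
    rw [rpow_neg_half_natCast hs0.le] at k1
    have k2 := inv_pow_le_of_half_rho_le (half_rho_le_sqrt hr') d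
    have k3 : D ≤ 9 * (ℓ * rho ζ x) := by
      have := norm_le_rho ζ x
      have q1 : ℓ * ‖rv x - rv ζ‖ ≤ ℓ * rho ζ x := mul_le_mul_of_nonneg_left this (by linarith)
      have q2 : ℓ * ℓ ≤ ℓ * ‖rv x - rv ζ‖ := mul_le_mul_of_nonneg_left hrℓ (by linarith)
      have q3 : 2 * aC d ≤ ℓ * ℓ := by nlinarith
      have q4 : (2 * aC d) ≤ ℓ * 1 := by linarith
      have q5 : ℓ * 1 ≤ ℓ * rho ζ x := mul_le_mul_of_nonneg_left (by linarith) (by linarith)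
      linarith
    calc _ ≤ _ := k1
      _ ≤ 9 * (ℓ * rho ζ x) * (2 ^ d * (rho ζ x ^ d)⁻¹) :=
          mul_le_mul k3 k2 (by positivity) (by positivity)
      _ = 9 * 2 ^ d * (ℓ * (rho ζ x ^ (d - 1))⁻¹) := by
          obtain ⟨k, rfl⟩ : ∃ k, d = k + 1 := ⟨d - 1, by omega⟩
          rw [Nat.add_sub_cancel, pow_succ (rho ζ x) k, mul_inv]
          field_simp
  · have k1 := fker_sub_le_sqrt hd hs0 hD0
    have k0 : s ^ ((1 - (d : ℝ)) / 2) = (√s ^ (d - 1))⁻¹ := by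
      rw [← rpow_neg_half_natCast hs0.le]
      congr 1
      rw [Nat.cast_sub (by omega), Nat.cast_one]; ring
    rw [k0] at k1
    have k2 := inv_pow_le_of_half_rho_le (half_rho_le_sqrt hr') (d - 1)
    have k3 : √D ≤ 3 * ℓ := by
      rw [Real.sqrt_le_left (by linarith)]
      have q2 : ℓ * ‖rv x - rv ζ‖ ≤ ℓ * ℓ := mul_le_mul_of_nonneg_left hrℓ (by linarith)
      have q3 : 2 * aC d ≤ ℓ * 1 := by linarith
      nlinarith
    calc _ ≤ _ := k1
      _ ≤ 2 * (3 * ℓ) * (2 ^ (d - 1) * (rho ζ x ^ (d - 1))⁻¹) :=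
          mul_le_mul (by linarith) k2 (by positivity) (by positivity)
      _ = 6 * 2 ^ (d - 1) * (ℓ * (rho ζ x ^ (d - 1))⁻¹) := by ring
      _ ≤ 9 * 2 ^ d * (ℓ * (rho ζ x ^ (d - 1))⁻¹) := by
          refine mul_le_mul_of_nonneg_right ?_ (by positivity)
          have := pow_le_pow_right₀ (one_le_two : (1 : ℝ) ≤ 2) (Nat.sub_le d 1)
          have := pow_pos (two_pos : (0 : ℝ) < 2) d
          linarith

lemma apply_zero_le (H : FarData d r₃ B N ℓ n ζ h) : h 0 ≤ 9 * 4 ^ d * (ℓ * (n ^ (d - 1))⁻¹) := by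
  obtain ⟨h1, h2, h3, h4, h5, h6, h7, h8⟩ := H.basic
  have hℓ := H.hℓr
  have hd := H.hd
  have h0 := H.le_rho_pred (x := 0) (by rw [norm_rv_zero_sub]; linarith)
  have hr := norm_le_rho ζ 0
  rw [norm_rv_zero_sub] at hr
  refine h0.trans ?_
  have : (rho ζ 0 ^ (d - 1))⁻¹ ≤ 2 ^ (d - 1) * (n ^ (d - 1))⁻¹ := by
    calc (rho ζ 0 ^ (d - 1))⁻¹ ≤ ((n / 2) ^ (d - 1))⁻¹ :=
          inv_anti₀ (by positivity) (pow_le_pow_left₀ (by positivity) (by linarith) _)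
      _ = _ := by rw [div_pow, inv_div]; ring
  calc 9 * 2 ^ d * (ℓ * (rho ζ 0 ^ (d - 1))⁻¹)
      ≤ 9 * 2 ^ d * (ℓ * (2 ^ (d - 1) * (n ^ (d - 1))⁻¹)) := by gcongr
    _ = 9 * (2 ^ d * 2 ^ (d - 1)) * (ℓ * (n ^ (d - 1))⁻¹) := by ring
    _ ≤ 9 * 4 ^ d * (ℓ * (n ^ (d - 1))⁻¹) := by
        have e : (4 : ℝ) ^ d = 2 ^ d * 2 ^ d := by rw [← mul_pow]; norm_num
        rw [e]
        refine mul_le_mul_of_nonneg_right ?_ (by positivity)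
        have := pow_le_pow_right₀ (one_le_two : (1 : ℝ) ≤ 2) (Nat.sub_le d 1)
        have q := pow_pos (two_pos : (0 : ℝ) < 2) d
        nlinarith

lemma norm_lower (H : FarData d r₃ B N ℓ n ζ h) {x : Fin d → ℤ} (hx : ‖rv x‖ ≤ n / 4) :
    n / 2 ≤ ‖rv x - rv ζ‖ ∧ r₃ ≤ ‖rv x - rv ζ‖ := by
  obtain ⟨h1, h2, h3, h4, h5, h6, h7, h8⟩ := H.basic
  have := norm_le_add_dist' ζ x
  have := H.hℓr
  constructor <;> linarith

lemma abs_sub_apply_zero_le (H : FarData d r₃ B N ℓ n ζ h) {x : Fin d → ℤ}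
    (hx : ‖rv x‖ ≤ n / 4) :
    |h x - h 0| ≤ (12 * d * 4 ^ (d + 2) + 4 ^ d) * (‖rv x‖ * ℓ * (n ^ d)⁻¹) := by
  obtain ⟨h1, h2, h3, h4, h5, h6, h7, h8⟩ := H.basic
  have hℓ := H.hℓr
  have hx0 := norm_nonneg (rv x)
  have hz : ‖rv (0 : Fin d → ℤ)‖ = 0 := by rw [rv_zero, norm_zero]
  obtain ⟨g1, g2⟩ := H.norm_lower hx
  obtain ⟨g3, g4⟩ := H.norm_lower (x := 0) (by rw [hz]; linarith)
  rw [H.eq_farH g2 (by linarith), H.eq_farH g4 (by rw [hz]; linarith)]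
  have i0 := H.imgD_nonneg (x := 0) (by rw [hz]; linarith)
  have ix := H.imgD_nonneg (x := x) (by linarith)
  have i0' : imgD n ζ 0 + 2 * aC d ≤ 4 * ℓ * n := by
    have := H.one_sub_le
    have e : imgD n ζ 0 = (1 - ‖rv ζ‖ ^ 2 / n ^ 2) * n ^ 2 := by
      rw [imgD, hz]; ring
    have : imgD n ζ 0 ≤ 2 * (ℓ / n) * n ^ 2 := by
      rw [e]; exact mul_le_mul_of_nonneg_right this (sq_nonneg n)
    have e2 : 2 * (ℓ / n) * n ^ 2 = 2 * ℓ * n := by field_simp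
    nlinarith
  have ix0 : imgD n ζ x ≤ imgD n ζ 0 := by
    have := H.one_sub_ge
    unfold imgD
    refine mul_le_mul_of_nonneg_left ?_ (le_trans (by positivity) this)
    rw [hz]; nlinarith
  have ixd : |(imgD n ζ x + 2 * aC d) - (imgD n ζ 0 + 2 * aC d)| ≤ ℓ * ‖rv x‖ := by
    have e : (imgD n ζ x + 2 * aC d) - (imgD n ζ 0 + 2 * aC d) =
      -((1 - ‖rv ζ‖ ^ 2 / n ^ 2) * ‖rv x‖ ^ 2) := by unfold imgD; rw [hz]; ring
    have := H.one_sub_ge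
    have p : 0 ≤ 1 - ‖rv ζ‖ ^ 2 / n ^ 2 := le_trans (by positivity) this
    rw [e, abs_neg, abs_of_nonneg (by positivity)]
    calc (1 - ‖rv ζ‖ ^ 2 / n ^ 2) * ‖rv x‖ ^ 2 ≤ 2 * (ℓ / n) * ‖rv x‖ ^ 2 :=
          mul_le_mul_of_nonneg_right H.one_sub_le (by positivity)
      _ = (2 * (ℓ / n) * ‖rv x‖) * ‖rv x‖ := by ring
      _ ≤ (2 * (ℓ / n) * ‖rv x‖) * (n / 4) := mul_le_mul_of_nonneg_left hx (by positivity)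
      _ = ℓ * ‖rv x‖ / 2 := by field_simp; ring
      _ ≤ _ := by nlinarith
  have hAA : |(‖rv x - rv ζ‖ ^ 2 - aC d) - (‖rv 0 - rv ζ‖ ^ 2 - aC d)| ≤ 3 * n * ‖rv x‖ := by
    rw [show (‖rv x - rv ζ‖ ^ 2 - aC d) - (‖rv 0 - rv ζ‖ ^ 2 - aC d) =
      (‖rv x - rv ζ‖ - ‖rv ζ‖) * (‖rv x - rv ζ‖ + ‖rv ζ‖) by rw [norm_rv_zero_sub]; ring, abs_mul]
    have q1 : |‖rv x - rv ζ‖ - ‖rv ζ‖| ≤ ‖rv x‖ := by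
      rw [abs_le]
      have := dist_le_add_norm ζ x
      have := norm_le_add_dist' ζ x
      constructor <;> linarith
    have q2 : |‖rv x - rv ζ‖ + ‖rv ζ‖| ≤ 3 * n := by
      rw [abs_of_nonneg (by positivity)]
      have := dist_le_add_norm ζ x
      linarith
    calc _ ≤ ‖rv x‖ * (3 * n) := mul_le_mul q1 q2 (abs_nonneg _) hx0
      _ = _ := by ring
  have hs0 : (n / 4) ^ 2 ≤ ‖rv x - rv ζ‖ ^ 2 - aC d := by nlinarith
  have hs0' : (n / 4) ^ 2 ≤ ‖rv 0 - rv ζ‖ ^ 2 - aC d := by nlinarith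
  have key := fker_diff_diff_le H.hd (s₀ := (n / 4) ^ 2) (by positivity) hs0' hs0
    (D := imgD n ζ 0 + 2 * aC d) (D' := imgD n ζ x + 2 * aC d) (by linarith) (by linarith)
  rw [Real.sqrt_sq (by positivity)] at key
  rw [abs_sub_comm] at ixd hAA
  have e1 : farH n ζ x - farH n ζ 0 = -((fker d (‖rv 0 - rv ζ‖ ^ 2 - aC d) -
      fker d ((‖rv 0 - rv ζ‖ ^ 2 - aC d) + (imgD n ζ 0 + 2 * aC d))) -
      (fker d (‖rv x - rv ζ‖ ^ 2 - aC d) -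
      fker d ((‖rv x - rv ζ‖ ^ 2 - aC d) + (imgD n ζ x + 2 * aC d)))) := by
    unfold farH
    rw [show (‖rv 0 - rv ζ‖ ^ 2 - aC d) + (imgD n ζ 0 + 2 * aC d) =
        ‖rv 0 - rv ζ‖ ^ 2 + imgD n ζ 0 + aC d by ring,
      show (‖rv x - rv ζ‖ ^ 2 - aC d) + (imgD n ζ x + 2 * aC d) =
        ‖rv x - rv ζ‖ ^ 2 + imgD n ζ x + aC d by ring]
    ring
  rw [e1, abs_neg]
  refine key.trans ?_
  have t1 : d * ((n / 4) ^ (d + 2))⁻¹ * (imgD n ζ 0 + 2 * aC d) *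
      |(‖rv 0 - rv ζ‖ ^ 2 - aC d) - (‖rv x - rv ζ‖ ^ 2 - aC d)| ≤
      d * ((n / 4) ^ (d + 2))⁻¹ * (4 * ℓ * n) * (3 * n * ‖rv x‖) :=
    mul_le_mul (mul_le_mul_of_nonneg_left i0' (by positivity)) hAA (abs_nonneg _) (by positivity)
  have t2 : ((n / 4) ^ d)⁻¹ * |(imgD n ζ 0 + 2 * aC d) - (imgD n ζ x + 2 * aC d)| ≤
      ((n / 4) ^ d)⁻¹ * (ℓ * ‖rv x‖) := mul_le_mul_of_nonneg_left ixd (by positivity)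
  refine (add_le_add t1 t2).trans (le_of_eq ?_)
  rw [div_pow, div_pow, inv_div, inv_div, pow_add n d 2]
  field_simp
  ring

lemma le_apply (H : FarData d r₃ B N ℓ n ζ h) {x : Fin d → ℤ} (hx : ‖rv x‖ ≤ n / 4) :
    (2 ^ (d + 1))⁻¹ * (ℓ * (n ^ (d - 1))⁻¹) ≤ h x := by
  obtain ⟨h1, h2, h3, h4, h5, h6, h7, h8⟩ := H.basic
  have hd := H.hd
  have hℓ := H.hℓr
  have hx0 := norm_nonneg (rv x)
  obtain ⟨g1, g2⟩ := H.norm_lower hx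
  rw [H.eq_farH g2 (by linarith)]
  have h3a := three_aC_le_of_sqrt_le (H.hr₃.trans g2)
  have i1 : ℓ * n / 2 ≤ imgD n ζ x := by
    have := H.one_sub_ge
    have p : n ^ 2 / 2 ≤ n ^ 2 - ‖rv x‖ ^ 2 := by nlinarith
    calc ℓ * n / 2 = ℓ / n * (n ^ 2 / 2) := by field_simp
      _ ≤ (1 - ‖rv ζ‖ ^ 2 / n ^ 2) * (n ^ 2 - ‖rv x‖ ^ 2) :=
        mul_le_mul this p (by positivity) (le_trans (by positivity) this)
  have i2 : ‖rv x - rv ζ‖ ^ 2 + imgD n ζ x + aC d ≤ (2 * n) ^ 2 := by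
    have q1 : imgD n ζ x ≤ 2 * (ℓ / n) * n ^ 2 := by
      have := H.one_sub_le
      have p : 0 ≤ 1 - ‖rv ζ‖ ^ 2 / n ^ 2 := le_trans (by positivity) H.one_sub_ge
      exact mul_le_mul this (by nlinarith) (by nlinarith) (by positivity)
    have e2 : 2 * (ℓ / n) * n ^ 2 = 2 * ℓ * n := by field_simp
    have q2 : ‖rv x - rv ζ‖ ≤ 5 / 4 * n := by
      have := dist_le_add_norm ζ x; linarith
    nlinarith [norm_nonneg (rv x - rv ζ)]
  have k := le_fker_sub hd (s := ‖rv x - rv ζ‖ ^ 2 - aC d) (D := imgD n ζ x + 2 * aC d)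
    (by linarith) (by nlinarith)
  rw [show ‖rv x - rv ζ‖ ^ 2 - aC d + (imgD n ζ x + 2 * aC d) =
    ‖rv x - rv ζ‖ ^ 2 + imgD n ζ x + aC d by ring] at k
  refine le_trans ?_ k
  have k2 : ((2 * n) ^ d)⁻¹ ≤ (‖rv x - rv ζ‖ ^ 2 + imgD n ζ x + aC d) ^ (-((d : ℝ) / 2)) := by
    have : ((2 * n) ^ d)⁻¹ = ((2 * n) ^ 2) ^ (-((d : ℝ) / 2)) := by
      rw [rpow_neg_half_natCast (by positivity), Real.sqrt_sq (by positivity)]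
    rw [this]
    exact Real.rpow_le_rpow_of_nonpos (by nlinarith) i2 neg_half_nonpos
  calc (2 ^ (d + 1))⁻¹ * (ℓ * (n ^ (d - 1))⁻¹) = ℓ * n / 2 * ((2 * n) ^ d)⁻¹ := by
        obtain ⟨j, rfl⟩ : ∃ j, d = j + 1 := ⟨d - 1, by omega⟩
        rw [Nat.add_sub_cancel, mul_pow, pow_succ n j, pow_succ 2 (j + 1)]
        field_simp
    _ ≤ _ := mul_le_mul (by linarith) k2 (by positivity) (by linarith [mul_pos (by linarith : 0 < ℓ) h5])

end FarData

end Image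

section Far

variable {d : ℕ}

lemma sum_near_le {ζ : Fin d → ℤ} {r c : ℝ} (hr : 1 ≤ r) (hc : 0 ≤ c) (S : Finset (Fin d → ℤ)) :
    ∑ x ∈ S, (if ‖rv x - rv ζ‖ ≤ r then c else 0) ≤ (3 * r) ^ d * c := by
  rw [← Finset.sum_filter, Finset.sum_const, nsmul_eq_mul]
  refine mul_le_mul_of_nonneg_right (card_le_of_subset_lball (z := ζ) hr fun x hx => ?_) hc
  exact mem_lball.2 (Finset.mem_filter.1 hx).2

lemma exists_sum_rho_sq_le (hd : 2 ≤ d) : ∃ C : ℝ, 0 < C ∧ ∀ (z : Fin d → ℤ) (N : ℝ), 3 ≤ N →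
    ∀ S ⊆ lball z (3 * N), ∑ x ∈ S, ((rho z x ^ (d - 1))⁻¹) ^ 2 ≤ C * lamN d N := by
  rcases hd.eq_or_lt with rfl | hd3
  · obtain ⟨C, hC, h⟩ := exists_sum_rho_le (d := 2) (by norm_num)
    refine ⟨4 * C, by positivity, fun z N hN S hS => ?_⟩
    have h1 := h z (3 * N) (by linarith) S hS
    have h2 := log_three_mul_le hN
    calc ∑ x ∈ S, ((rho z x ^ (2 - 1))⁻¹) ^ 2 = ∑ x ∈ S, (rho z x ^ 2)⁻¹ :=
          Finset.sum_congr rfl fun x _ => by norm_num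
      _ ≤ _ := h1
      _ ≤ C * (4 * Real.log N) := mul_le_mul_of_nonneg_left h2 hC.le
      _ = _ := by simp [lamN]; ring
  · obtain ⟨C, hC, h⟩ := exists_sum_rho_succ_le (d := d) (by omega)
    refine ⟨C, hC, fun z N hN S hS => ?_⟩
    have : lamN d N = 1 := by rw [lamN, if_neg (by omega)]
    rw [this, mul_one]
    refine le_trans (Finset.sum_le_sum fun x _ => ?_) (h z S)
    rw [inv_pow, ← pow_mul]
    have := rho_ge z x
    exact inv_anti₀ (by positivity) (pow_le_pow_right₀ (by linarith) (by omega))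

namespace FarData

variable {r₃ B N ℓ n : ℝ} {ζ : Fin d → ℤ} {h : (Fin d → ℤ) → ℝ}

lemma one_le_r₃ (H : FarData d r₃ B N ℓ n ζ h) : 1 ≤ r₃ := by
  refine le_trans ?_ H.hr₃
  rw [Real.one_le_sqrt]; linarith [aC_ge (d := d)]

lemma subset_lball (H : FarData d r₃ B N ℓ n ζ h) : lball 0 (n + 2) ⊆ lball ζ (3 * n) := by
  intro x hx
  rw [mem_lball_zero] at hx
  rw [mem_lball]
  obtain ⟨h1, h2, h3, h4, h5, h6, h7, h8⟩ := H.basic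
  have := dist_le_add_norm ζ x
  linarith

lemma le_pointwise (H : FarData d r₃ B N ℓ n ζ h) (x : Fin d → ℤ) :
    h x ≤ (if ‖rv x - rv ζ‖ ≤ r₃ then B * lamN d N else 0) +
      9 * 2 ^ d * (ℓ * (rho ζ x ^ (d - 1))⁻¹) := by
  obtain ⟨h1, h2, h3, h4, h5, h6, h7, h8⟩ := H.basic
  have hρ := rho_pos ζ x
  split_ifs with hr
  · have : 0 ≤ 9 * 2 ^ d * (ℓ * (rho ζ x ^ (d - 1))⁻¹) := by positivity
    linarith [H.le x]
  · rw [zero_add]; exact H.le_rho_pred (by linarith)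

lemma B_nonneg (H : FarData d r₃ B N ℓ n ζ h) : 0 ≤ B * lamN d N :=
  (H.nonneg 0).trans (H.le 0)

lemma exists_sum_le (hd : 2 ≤ d) (r₃ B : ℝ) (hB : 0 ≤ B) : ∃ C : ℝ, 0 < C ∧ ∀ N ℓ n ζ h,
    FarData d r₃ B N ℓ n ζ h → ∑ x ∈ lball 0 (n + 1), h x ≤ C * (ℓ * n) := by
  obtain ⟨C, hC, hs⟩ := exists_sum_rho_pred_le (d := d) (by omega)
  refine ⟨(3 * |r₃|) ^ d * B + 9 * 2 ^ d * (C * 3), by positivity, fun N ℓ n ζ h H => ?_⟩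
  obtain ⟨h1, h2, h3, h4, h5, h6, h7, h8⟩ := H.basic
  rw [abs_of_pos h2]
  have hsub := (lball_mono (by linarith : n + 1 ≤ n + 2)).trans H.subset_lball
  calc ∑ x ∈ lball 0 (n + 1), h x ≤ ∑ x ∈ lball 0 (n + 1),
        ((if ‖rv x - rv ζ‖ ≤ r₃ then B * lamN d N else 0) +
        9 * 2 ^ d * (ℓ * (rho ζ x ^ (d - 1))⁻¹)) := Finset.sum_le_sum fun x _ => H.le_pointwise x
    _ ≤ (3 * r₃) ^ d * (B * lamN d N) + 9 * 2 ^ d * (ℓ * (C * (3 * n))) := by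
        rw [Finset.sum_add_distrib, ← Finset.mul_sum, ← Finset.mul_sum]
        refine add_le_add (sum_near_le H.one_le_r₃ H.B_nonneg _)
          (mul_le_mul_of_nonneg_left (mul_le_mul_of_nonneg_left
            (hs ζ (3 * n) (by linarith) _ hsub) (by linarith)) (by positivity))
    _ ≤ (3 * r₃) ^ d * (B * (ℓ * n)) + 9 * 2 ^ d * (ℓ * (C * (3 * n))) := by
        have : lamN d N ≤ ℓ * n := by nlinarith [H.hΛ]
        gcongr
    _ = _ := by ring

lemma exists_sum_sq_le (hd : 2 ≤ d) (r₃ B : ℝ) : ∃ C : ℝ, 0 < C ∧ ∀ N ℓ n ζ h,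
    FarData d r₃ B N ℓ n ζ h → ∑ x ∈ lball 0 (n + 1), h x ^ 2 ≤ C * (lamN d N * ℓ ^ 2) := by
  obtain ⟨C, hC, hs⟩ := exists_sum_rho_sq_le hd
  refine ⟨2 * ((3 * |r₃|) ^ d * B ^ 2) + 2 * (9 * 2 ^ d) ^ 2 * C, by positivity,
    fun N ℓ n ζ h H => ?_⟩
  obtain ⟨h1, h2, h3, h4, h5, h6, h7, h8⟩ := H.basic
  rw [abs_of_pos h2]
  have hΛ := one_le_lamN (d := d) H.hN
  have hsub := (lball_mono (by linarith : n + 1 ≤ n + 2)).trans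
    (H.subset_lball.trans (lball_mono (by linarith [H.hnN] : 3 * n ≤ 3 * N)))
  have hpt : ∀ x, h x ^ 2 ≤ 2 * (if ‖rv x - rv ζ‖ ≤ r₃ then (B * lamN d N) ^ 2 else 0) +
      2 * (9 * 2 ^ d) ^ 2 * (ℓ ^ 2 * ((rho ζ x ^ (d - 1))⁻¹) ^ 2) := by
    intro x
    have := pow_le_pow_left₀ (H.nonneg x) (H.le_pointwise x) 2
    refine this.trans ((add_sq_le).trans (le_of_eq ?_))
    split_ifs <;> ring
  calc ∑ x ∈ lball 0 (n + 1), h x ^ 2 ≤ ∑ x ∈ lball 0 (n + 1),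
        (2 * (if ‖rv x - rv ζ‖ ≤ r₃ then (B * lamN d N) ^ 2 else 0) +
      2 * (9 * 2 ^ d) ^ 2 * (ℓ ^ 2 * ((rho ζ x ^ (d - 1))⁻¹) ^ 2)) :=
        Finset.sum_le_sum fun x _ => hpt x
    _ ≤ 2 * ((3 * r₃) ^ d * (B * lamN d N) ^ 2) +
        2 * (9 * 2 ^ d) ^ 2 * (ℓ ^ 2 * (C * lamN d N)) := by
        rw [Finset.sum_add_distrib, ← Finset.mul_sum, ← Finset.mul_sum, ← Finset.mul_sum]
        refine add_le_add (mul_le_mul_of_nonneg_left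
          (sum_near_le H.one_le_r₃ (sq_nonneg _) _) (by norm_num))
          (mul_le_mul_of_nonneg_left (mul_le_mul_of_nonneg_left
            (hs ζ N H.hN _ hsub) (by positivity)) (by positivity))
    _ ≤ 2 * ((3 * r₃) ^ d * (B ^ 2 * (lamN d N * ℓ ^ 2))) +
        2 * (9 * 2 ^ d) ^ 2 * (ℓ ^ 2 * (C * lamN d N)) := by
        have : (B * lamN d N) ^ 2 ≤ B ^ 2 * (lamN d N * ℓ ^ 2) := by
          rw [mul_pow]
          refine mul_le_mul_of_nonneg_left ?_ (sq_nonneg B)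
          rw [sq]
          refine mul_le_mul_of_nonneg_left ?_ (by linarith)
          nlinarith [H.hΛ]
        gcongr
    _ = _ := by ring

lemma exists_le_sum (hd : 2 ≤ d) : ∃ c : ℝ, 0 < c ∧ ∀ r₃ B N ℓ n ζ h,
    FarData d r₃ B N ℓ n ζ h → c * (ℓ * n) ≤ ∑ x ∈ lball 0 (n + 1), h x := by
  have hd0 : (0 : ℝ) < d := by exact_mod_cast (by omega : 0 < d)
  refine ⟨((4 * √d) ^ d)⁻¹ * (2 ^ (d + 1))⁻¹, by positivity, fun r₃ B N ℓ n ζ h H => ?_⟩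
  obtain ⟨h1, h2, h3, h4, h5, h6, h7, h8⟩ := H.basic
  have hc := le_card_lball (d := d) (by omega) (R := n / 4) (by positivity)
  calc ((4 * √d) ^ d)⁻¹ * (2 ^ (d + 1))⁻¹ * (ℓ * n)
      = (n / 4 / √d) ^ d * ((2 ^ (d + 1))⁻¹ * (ℓ * (n ^ (d - 1))⁻¹)) := by
        have : (n / 4 / √d) ^ d = n ^ d * ((4 * √d) ^ d)⁻¹ := by
          rw [div_div, div_pow]; rfl
        rw [this]
        obtain ⟨j, rfl⟩ : ∃ j, d = j + 1 := ⟨d - 1, by omega⟩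
        rw [Nat.add_sub_cancel, pow_succ n j]
        field_simp
    _ ≤ (lball (0 : Fin d → ℤ) (n / 4)).card * ((2 ^ (d + 1))⁻¹ * (ℓ * (n ^ (d - 1))⁻¹)) :=
        mul_le_mul_of_nonneg_right hc (by positivity)
    _ = ∑ x ∈ lball (0 : Fin d → ℤ) (n / 4), (2 ^ (d + 1))⁻¹ * (ℓ * (n ^ (d - 1))⁻¹) := by
        rw [Finset.sum_const, nsmul_eq_mul]
    _ ≤ ∑ x ∈ lball (0 : Fin d → ℤ) (n / 4), h x :=
        Finset.sum_le_sum fun x hx => H.le_apply (mem_lball_zero.1 hx)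
    _ ≤ _ := Finset.sum_le_sum_of_subset_of_nonneg (lball_mono (by linarith))
        fun x _ _ => H.nonneg x

lemma sqrt_pow_le (H : FarData d r₃ B N ℓ n ζ h) : √(n ^ 2 + aC d) ^ d ≤ (2 * n) ^ d := by
  obtain ⟨h1, h2, h3, h4, h5, h6, h7, h8⟩ := H.basic
  have := sqrt_sq_add_aC_le (d := d) h5.le
  exact pow_le_pow_left₀ (Real.sqrt_nonneg _) (by linarith [H.hℓr]) _

lemma sqrt_pow_sub_le (H : FarData d r₃ B N ℓ n ζ h) :
    √(n ^ 2 + aC d) ^ d ≤ n ^ d + d * aC d * (2 * n) ^ (d - 1) := by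
  obtain ⟨h1, h2, h3, h4, h5, h6, h7, h8⟩ := H.basic
  have e1 := sqrt_sq_add_aC_le (d := d) h5.le
  have e2 := pow_sub_pow_le (a := n + aC d) (b := n) h5.le (by linarith) d
  rw [add_sub_cancel_left] at e2
  have e3 : (n + aC d) ^ (d - 1) ≤ (2 * n) ^ (d - 1) :=
    pow_le_pow_left₀ (by linarith) (by linarith [H.hℓr]) _
  have e4 := mul_le_mul_of_nonneg_left e3 (by positivity : 0 ≤ (d : ℝ) * aC d)
  have e5 := pow_le_pow_left₀ (Real.sqrt_nonneg (n ^ 2 + aC d)) e1 d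
  linarith

lemma exists_dens_part_le (hd : 2 ≤ d) (r₃ B : ℝ) (hB : 0 ≤ B) : ∃ C : ℝ, 0 < C ∧ ∀ N ℓ n ζ h,
    FarData d r₃ B N ℓ n ζ h → √(n ^ 2 + aC d) ^ d * ∑ x ∈ lball 0 (n + 1), dens x * h x ≤
      unitBallVol d * n ^ d * h 0 + C * ℓ := by
  obtain ⟨C₁, hC₁, hs₁⟩ := exists_sum_le hd r₃ B hB
  obtain ⟨C₂, hC₂, hs₂⟩ := exists_sum_rho_succ_le (d := d) (by omega)
  have ha := aC_pos (d := d)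
  have hω := unitBallVol_pos (d := d)
  set K : ℝ := 12 * d * 4 ^ (d + 2) + 4 ^ d with hK
  have hK0 : 0 < K := by positivity
  refine ⟨2 ^ d * (K * (2 * aC d) * C₂ + 2 * aC d * 4 ^ (d + 2) * C₁) +
    d * aC d * 2 ^ (d - 1) * unitBallVol d * (9 * 4 ^ d), by positivity,
    fun N ℓ n ζ h H => ?_⟩
  obtain ⟨h1, h2, h3, h4, h5, h6, h7, h8⟩ := H.basic
  have hpt : ∀ x, dens x * h x ≤ dens x * h 0 +
      K * (ℓ * (n ^ d)⁻¹) * (2 * aC d * (rho 0 x ^ (d + 1))⁻¹) +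
      2 * aC d * 4 ^ (d + 2) * (n ^ (d + 2))⁻¹ * h x := by
    intro x
    have hρ := rho_pos 0 x
    have dn := dens_nonneg hd x
    have dl := dens_le hd x
    have hx0 := H.nonneg x
    have h00 := H.nonneg 0
    have hnr := norm_le_rho 0 x
    rw [rv_zero, sub_zero] at hnr
    rcases le_or_gt ‖rv x‖ (n / 4) with hx | hx
    · have k1 := (abs_le.1 (H.abs_sub_apply_zero_le hx)).2
      have k2 : dens x * ‖rv x‖ ≤ 2 * aC d * (rho 0 x ^ (d + 1))⁻¹ := by
        calc dens x * ‖rv x‖ ≤ 2 * aC d * (rho 0 x ^ (d + 2))⁻¹ * rho 0 x :=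
              mul_le_mul dl hnr (norm_nonneg _) (by positivity)
          _ = _ := by rw [pow_succ (rho 0 x) (d + 1)]; field_simp
      have k3 : 0 ≤ 2 * aC d * 4 ^ (d + 2) * (n ^ (d + 2))⁻¹ * h x := by positivity
      have k4 := mul_le_mul_of_nonneg_left k1 dn
      have k5 := mul_le_mul_of_nonneg_left k2 (by positivity : 0 ≤ K * (ℓ * (n ^ d)⁻¹))
      have k6 : dens x * (K * (‖rv x‖ * ℓ * (n ^ d)⁻¹)) =
        K * (ℓ * (n ^ d)⁻¹) * (dens x * ‖rv x‖) := by ring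
      nlinarith
    · have k1 : dens x ≤ 2 * aC d * 4 ^ (d + 2) * (n ^ (d + 2))⁻¹ := by
        refine dl.trans ?_
        have : (rho 0 x ^ (d + 2))⁻¹ ≤ ((n / 4) ^ (d + 2))⁻¹ :=
          inv_anti₀ (by positivity) (pow_le_pow_left₀ (by positivity) (by linarith) _)
        rw [div_pow, inv_div] at this
        calc _ ≤ 2 * aC d * (4 ^ (d + 2) / n ^ (d + 2)) :=
              mul_le_mul_of_nonneg_left this (by positivity)
          _ = _ := by ring
      have k2 := mul_le_mul_of_nonneg_right k1 hx0
      have k3 : 0 ≤ dens x * h 0 := by positivity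
      have k4 : 0 ≤ K * (ℓ * (n ^ d)⁻¹) * (2 * aC d * (rho 0 x ^ (d + 1))⁻¹) := by positivity
      linarith
  have hsum : ∑ x ∈ lball 0 (n + 1), dens x * h x ≤ unitBallVol d * h 0 +
      K * (ℓ * (n ^ d)⁻¹) * (2 * aC d * C₂) +
      2 * aC d * 4 ^ (d + 2) * (n ^ (d + 2))⁻¹ * (C₁ * (ℓ * n)) := by
    refine (Finset.sum_le_sum fun x _ => hpt x).trans ?_
    rw [Finset.sum_add_distrib, Finset.sum_add_distrib, ← Finset.sum_mul, ← Finset.mul_sum,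
      ← Finset.mul_sum, ← Finset.mul_sum]
    refine add_le_add (add_le_add (mul_le_mul_of_nonneg_right (sum_dens_le hd _) (H.nonneg 0))
      (mul_le_mul_of_nonneg_left (mul_le_mul_of_nonneg_left (hs₂ _ _) (by positivity))
        (by positivity))) (mul_le_mul_of_nonneg_left (hs₁ N ℓ n ζ h H) (by positivity))
  have hα := H.sqrt_pow_le
  have hα2 := H.sqrt_pow_sub_le
  have h00 := H.nonneg 0
  have h0l := H.apply_zero_le
  calc √(n ^ 2 + aC d) ^ d * ∑ x ∈ lball 0 (n + 1), dens x * h x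
      ≤ √(n ^ 2 + aC d) ^ d * (unitBallVol d * h 0 +
      (K * (ℓ * (n ^ d)⁻¹) * (2 * aC d * C₂) +
      2 * aC d * 4 ^ (d + 2) * (n ^ (d + 2))⁻¹ * (C₁ * (ℓ * n)))) :=
        mul_le_mul_of_nonneg_left (by linarith) (by positivity)
    _ = √(n ^ 2 + aC d) ^ d * (unitBallVol d * h 0) + √(n ^ 2 + aC d) ^ d *
      (K * (ℓ * (n ^ d)⁻¹) * (2 * aC d * C₂) +
      2 * aC d * 4 ^ (d + 2) * (n ^ (d + 2))⁻¹ * (C₁ * (ℓ * n))) := by ring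
    _ ≤ (n ^ d + d * aC d * (2 * n) ^ (d - 1)) * (unitBallVol d * h 0) + (2 * n) ^ d *
      (K * (ℓ * (n ^ d)⁻¹) * (2 * aC d * C₂) +
      2 * aC d * 4 ^ (d + 2) * (n ^ (d + 2))⁻¹ * (C₁ * (ℓ * n))) :=
        add_le_add (mul_le_mul_of_nonneg_right hα2 (by positivity))
          (mul_le_mul_of_nonneg_right hα (by positivity))
    _ = unitBallVol d * n ^ d * h 0 + d * aC d * (2 * n) ^ (d - 1) * unitBallVol d * h 0 +
      2 ^ d * (K * (2 * aC d) * C₂ * ℓ + 2 * aC d * 4 ^ (d + 2) * C₁ * (ℓ * n⁻¹)) := by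
        rw [mul_pow 2 n d, pow_add n d 2]
        field_simp
    _ ≤ unitBallVol d * n ^ d * h 0 +
      d * aC d * (2 * n) ^ (d - 1) * unitBallVol d * (9 * 4 ^ d * (ℓ * (n ^ (d - 1))⁻¹)) +
      2 ^ d * (K * (2 * aC d) * C₂ * ℓ + 2 * aC d * 4 ^ (d + 2) * C₁ * (ℓ * 1)) := by
        have hn1 : n⁻¹ ≤ 1 := inv_le_one_of_one_le₀ (by linarith)
        gcongr
    _ = _ := by
        rw [mul_pow 2 n (d - 1)]
        field_simp
        ring

lemma lap_le_near (H : FarData d r₃ B N ℓ n ζ h) (x : Fin d → ℤ) : lap h x ≤ B * lamN d N := by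
  have hd := H.hd
  have := nbrAvg_le_of_le (g := h) (x := x) (c := B * lamN d N) (by omega) fun z _ => H.le z
  unfold lap
  linarith [H.nonneg x]

lemma lap_le_far (H : FarData d r₃ B N ℓ n ζ h) {x : Fin d → ℤ}
    (hr : r₃ + 1 ≤ ‖rv x - rv ζ‖) (hx : ‖rv x‖ ≤ n - 1) :
    lap h x ≤ 2 * aC d * 2 ^ (d + 3) * (rho ζ x ^ (d + 2))⁻¹ := by
  obtain ⟨h1, h2, h3, h4, h5, h6, h7, h8⟩ := H.basic
  have e : lap h x = lap (farH n ζ) x := by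
    unfold lap
    rw [H.eq_farH (by linarith) (by linarith)]
    congr 1
    refine nbrAvg_congr fun z hz => H.eq_farH ?_ ?_
    · have := norm_nbr_ge hz (rv ζ); linarith
    · have := norm_nbr_le' hz; linarith
  rw [e]
  exact (lap_farH H.hd h5.ne' h6.ne' h7 (H.hr₃.trans (by linarith))).2
    (H.imgD_nonneg (by linarith))

end FarData

end Far

section Far

variable {d : ℕ}

/-- Test function for the drift estimate of the inner bound. -/
noncomputable def farW (n ℓ : ℝ) (ζ x : Fin d → ℤ) : ℝ :=
  wf n x - wf n ζ + 1 / 96 * (ℓ / n) * (‖rv x‖ ^ 2 - ‖rv ζ‖ ^ 2)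

lemma lap_farW (hd : 2 ≤ d) (n ℓ : ℝ) (ζ x : Fin d → ℤ) :
    lap (farW n ℓ ζ) x = 1 - √(n ^ 2 + aC d) ^ d * dens x + 1 / 96 * (ℓ / n) := by
  have hd0 : d ≠ 0 := by omega
  have e : farW n ℓ ζ = fun y => wf n y + ((1 / 96 * (ℓ / n)) * ‖rv y‖ ^ 2 +
      (-wf n ζ - 1 / 96 * (ℓ / n) * ‖rv ζ‖ ^ 2)) := by
    ext y; unfold farW; ring
  rw [e, lap_add (wf n) (fun y => (1 / 96 * (ℓ / n)) * ‖rv y‖ ^ 2 +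
      (-wf n ζ - 1 / 96 * (ℓ / n) * ‖rv ζ‖ ^ 2)),
    lap_add (fun y => (1 / 96 * (ℓ / n)) * ‖rv y‖ ^ 2), lap_smul, lap_const hd0, lap_norm_sq hd0,
    lap_wf hd]
  ring

namespace FarData

variable {r₃ B N ℓ n : ℝ} {ζ : Fin d → ℤ} {h : (Fin d → ℤ) → ℝ}

lemma farW_le_mid (H : FarData d r₃ B N ℓ n ζ h) {x : Fin d → ℤ} (hx : n / 2 ≤ ‖rv x‖)
    (hxn : ‖rv x‖ ≤ n) : farW n ℓ ζ x ≤
      (4 * (d * 2 ^ (d + 1)) + 1) * (‖rv x - rv ζ‖ * (ℓ + ‖rv x - rv ζ‖)) := by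
  obtain ⟨h1, h2, h3, h4, h5, h6, h7, h8⟩ := H.basic
  have hr0 := norm_nonneg (rv x - rv ζ)
  have k1 := Wf_sub_le_abs H.hd (n := n) (s := ‖rv x‖ ^ 2) (s' := ‖rv ζ‖ ^ 2) h5
    (by nlinarith) (sq_nonneg _)
  have k2 : |‖rv x‖ ^ 2 - ‖rv ζ‖ ^ 2| ≤ ‖rv x - rv ζ‖ * (2 * n) :=
    (norm_sq_sub_sq_le ζ x).trans (mul_le_mul_of_nonneg_left (by linarith) hr0)
  have k3 : |n ^ 2 - ‖rv x‖ ^ 2| ≤ (ℓ + ‖rv x - rv ζ‖) * (2 * n) := by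
    rw [abs_of_nonneg (by nlinarith [norm_nonneg (rv x)]), sq_sub_sq, mul_comm]
    have := norm_le_add_dist' ζ x
    exact mul_le_mul (by linarith [H.hn]) (by linarith) (by linarith) (by linarith)
  have k4 := mul_le_mul k2 k3 (abs_nonneg _) (by positivity)
  have k5 : d * 2 ^ (d + 1) * (|‖rv x‖ ^ 2 - ‖rv ζ‖ ^ 2| * |n ^ 2 - ‖rv x‖ ^ 2|) / n ^ 2 ≤
      4 * (d * 2 ^ (d + 1)) * (‖rv x - rv ζ‖ * (ℓ + ‖rv x - rv ζ‖)) := by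
    rw [div_le_iff₀ (by positivity)]
    calc _ ≤ d * 2 ^ (d + 1) * (‖rv x - rv ζ‖ * (2 * n) * ((ℓ + ‖rv x - rv ζ‖) * (2 * n))) :=
          mul_le_mul_of_nonneg_left k4 (by positivity)
      _ = _ := by ring
  have k6 : 1 / 96 * (ℓ / n) * (‖rv x‖ ^ 2 - ‖rv ζ‖ ^ 2) ≤ ‖rv x - rv ζ‖ * (ℓ + ‖rv x - rv ζ‖) := by
    calc 1 / 96 * (ℓ / n) * (‖rv x‖ ^ 2 - ‖rv ζ‖ ^ 2) ≤
          1 / 96 * (ℓ / n) * (‖rv x - rv ζ‖ * (2 * n)) :=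
          mul_le_mul_of_nonneg_left ((le_abs_self _).trans k2) (by positivity)
      _ = 2 / 96 * (‖rv x - rv ζ‖ * ℓ) := by field_simp
      _ ≤ _ := by nlinarith [mul_nonneg hr0 (by linarith : 0 ≤ ℓ)]
  unfold farW wf
  linarith

lemma farW_le_small (H : FarData d r₃ B N ℓ n ζ h) {x : Fin d → ℤ} (hx : ‖rv x‖ < n / 2) :
    farW n ℓ ζ x ≤ 2 * n * (2 * n) ^ d * (rho 0 x ^ (d - 1))⁻¹ := by
  obtain ⟨h1, h2, h3, h4, h5, h6, h7, h8⟩ := H.basic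
  have hx0 := norm_nonneg (rv x)
  have k1 := Wf_le_of_le H.hd (n := n) (s := ‖rv x‖ ^ 2) h5.le (sq_nonneg _) (by nlinarith)
  rw [← rho_zero] at k1
  have k2 := wf_nonneg H.hd n ζ
  have k3 : 1 / 96 * (ℓ / n) * (‖rv x‖ ^ 2 - ‖rv ζ‖ ^ 2) ≤ 0 :=
    mul_nonpos_of_nonneg_of_nonpos (by positivity) (by nlinarith)
  have hρ := rho_pos 0 x
  have k4 : 2 * n * √(n ^ 2 + aC d) ^ d * (rho 0 x ^ (d - 1))⁻¹ ≤
      2 * n * (2 * n) ^ d * (rho 0 x ^ (d - 1))⁻¹ :=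
    mul_le_mul_of_nonneg_right (mul_le_mul_of_nonneg_left H.sqrt_pow_le (by positivity))
      (by positivity)
  unfold farW
  unfold wf at *
  linarith

lemma farW_nonpos (H : FarData d r₃ B N ℓ n ζ h) {x : Fin d → ℤ} (hx : n - 1 ≤ ‖rv x‖)
    (hxn : ‖rv x‖ ≤ n + 2) : farW n ℓ ζ x ≤ 0 := by
  obtain ⟨h1, h2, h3, h4, h5, h6, h7, h8⟩ := H.basic
  have hx0 := norm_nonneg (rv x)
  have hn := H.hn
  have k1 := Wf_le H.hd (n := n) (s := ‖rv x‖ ^ 2) h5 (by nlinarith)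
  have k2 := le_Wf H.hd (n := n) (s := ‖rv ζ‖ ^ 2) (sq_nonneg _) (by nlinarith)
  have k3 : d * 2 ^ (d + 1) * (n ^ 2 - ‖rv x‖ ^ 2) ^ 2 / n ^ 2 ≤ d * 2 ^ (d + 1) * 36 := by
    rw [div_le_iff₀ (by positivity), mul_assoc _ (36 : ℝ)]
    refine mul_le_mul_of_nonneg_left ?_ (by positivity)
    have : |n ^ 2 - ‖rv x‖ ^ 2| ≤ 6 * n := by
      rw [abs_le]; constructor <;> nlinarith
    have := pow_le_pow_left₀ (abs_nonneg _) this 2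
    rw [sq_abs] at this
    linarith
  have k4 : ℓ ^ 2 / 8 ≤ (n ^ 2 - ‖rv ζ‖ ^ 2) ^ 2 / (4 * (n ^ 2 + aC d)) := by
    rw [div_le_div_iff₀ (by norm_num) (by positivity)]
    have e1 : ℓ * n ≤ n ^ 2 - ‖rv ζ‖ ^ 2 := by
      have : ‖rv ζ‖ = n - ℓ := by linarith
      rw [this]; nlinarith
    have e2 := pow_le_pow_left₀ (by positivity) e1 2
    have e3 : aC d ≤ n ^ 2 := by nlinarith [H.hℓr]
    have e4 := mul_le_mul_of_nonneg_left e3 (sq_nonneg ℓ)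
    nlinarith
  have k5 : 1 / 96 * (ℓ / n) * (‖rv x‖ ^ 2 - ‖rv ζ‖ ^ 2) ≤ ℓ ^ 2 / 16 := by
    have e1 : ‖rv x‖ ^ 2 - ‖rv ζ‖ ^ 2 ≤ (2 * ℓ) * (3 * n) := by
      rw [sq_sub_sq, mul_comm]
      exact mul_le_mul (by linarith) (by linarith) (by linarith [norm_nonneg (rv ζ)]) (by linarith)
    calc _ ≤ 1 / 96 * (ℓ / n) * ((2 * ℓ) * (3 * n)) :=
          mul_le_mul_of_nonneg_left e1 (by positivity)
      _ = _ := by field_simp; ring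
  have k6 : d * 2 ^ (d + 1) * 36 ≤ ℓ ^ 2 / 16 := by
    have := H.hℓd
    nlinarith
  unfold farW wf
  linarith

lemma mul_lap_le (H : FarData d r₃ B N ℓ n ζ h) {x : Fin d → ℤ} (hx : x ∈ lball 0 (n + 2)) :
    farW n ℓ ζ x * lap h x ≤
      (if ‖rv x - rv ζ‖ ≤ r₃ + 1 then
        (4 * (d * 2 ^ (d + 1)) + 1) * ((r₃ + 1) * (2 * ℓ)) * (B * lamN d N) else 0) +
      (4 * (d * 2 ^ (d + 1)) + 1) * (2 * aC d * 2 ^ (d + 3)) *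
        (ℓ * (rho ζ x ^ (d + 1))⁻¹ + (rho ζ x ^ d)⁻¹) +
      2 * 2 ^ d * (2 * aC d * 2 ^ (d + 3)) * 3 ^ (d + 2) * (n⁻¹ * (rho 0 x ^ (d - 1))⁻¹) := by
  obtain ⟨h1, h2, h3, h4, h5, h6, h7, h8⟩ := H.basic
  have hρ := rho_pos ζ x
  have hρ0 := rho_pos 0 x
  have hB := H.B_nonneg
  have hℓr := H.hℓr
  have hn := H.hn
  have hrn := norm_nonneg (rv x - rv ζ)
  rw [mem_lball_zero] at hx
  have t1 : 0 ≤ (if ‖rv x - rv ζ‖ ≤ r₃ + 1 then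
        (4 * (d * 2 ^ (d + 1)) + 1) * ((r₃ + 1) * (2 * ℓ)) * (B * lamN d N) else 0) := by
    split_ifs
    · positivity
    · exact le_rfl
  have t2 : 0 ≤ (4 * (d * 2 ^ (d + 1)) + 1) * (2 * aC d * 2 ^ (d + 3)) *
        (ℓ * (rho ζ x ^ (d + 1))⁻¹ + (rho ζ x ^ d)⁻¹) := by positivity
  have t3 : 0 ≤ 2 * 2 ^ d * (2 * aC d * 2 ^ (d + 3)) * 3 ^ (d + 2) *
      (n⁻¹ * (rho 0 x ^ (d - 1))⁻¹) := by positivity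
  rcases eq_or_ne x ζ with hxζ | hxζ
  · have : farW n ℓ ζ x = 0 := by rw [hxζ]; unfold farW; ring
    rw [this, zero_mul]; linarith
  have hl := H.lap_nonneg x hxζ
  rcases le_or_gt ‖rv x - rv ζ‖ (r₃ + 1) with hr | hr
  · rw [if_pos hr]
    have a1 := norm_le_add_dist' ζ x
    have a2 := norm_le_add_dist ζ x
    have w := H.farW_le_mid (x := x) (by linarith) (by linarith)
    have w2 : ‖rv x - rv ζ‖ * (ℓ + ‖rv x - rv ζ‖) ≤ (r₃ + 1) * (2 * ℓ) :=
      mul_le_mul hr (by linarith) (by positivity) (by linarith)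
    have w3 : farW n ℓ ζ x ≤ (4 * (d * 2 ^ (d + 1)) + 1) * ((r₃ + 1) * (2 * ℓ)) :=
      w.trans (mul_le_mul_of_nonneg_left w2 (by positivity))
    have := mul_le_mul_of_nonneg_right w3 hl
    have := mul_le_mul_of_nonneg_left (H.lap_le_near x)
      (by positivity : 0 ≤ (4 * ((d:ℝ) * 2 ^ (d + 1)) + 1) * ((r₃ + 1) * (2 * ℓ)))
    linarith
  · rcases le_or_gt (n - 1) ‖rv x‖ with hx1 | hx1
    · have := mul_nonpos_of_nonpos_of_nonneg (H.farW_nonpos hx1 hx) hl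
      linarith
    · have l1 := H.lap_le_far hr.le hx1.le
      rcases le_or_gt (n / 2) ‖rv x‖ with hx2 | hx2
      · have w := H.farW_le_mid hx2 (by linarith)
        have w2 : ‖rv x - rv ζ‖ * (ℓ + ‖rv x - rv ζ‖) ≤ rho ζ x * (ℓ + rho ζ x) := by
          have := norm_le_rho ζ x
          exact mul_le_mul this (by linarith) (by positivity) hρ.le
        have w3 := w.trans (mul_le_mul_of_nonneg_left w2 (by positivity))
        have w4 := mul_le_mul w3 l1 hl (by positivity)
        have e : (4 * (d * 2 ^ (d + 1)) + 1) * (rho ζ x * (ℓ + rho ζ x)) *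
            (2 * aC d * 2 ^ (d + 3) * (rho ζ x ^ (d + 2))⁻¹) =
            (4 * (d * 2 ^ (d + 1)) + 1) * (2 * aC d * 2 ^ (d + 3)) *
            (ℓ * (rho ζ x ^ (d + 1))⁻¹ + (rho ζ x ^ d)⁻¹) := by
          rw [pow_add _ d 2, pow_add _ d 1]
          field_simp
          ring
        linarith
      · have w := H.farW_le_small hx2
        have l2 : (rho ζ x ^ (d + 2))⁻¹ ≤ 3 ^ (d + 2) * (n ^ (d + 2))⁻¹ := by
          have a1 := norm_le_add_dist' ζ x
          have a2 := norm_le_rho ζ x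
          calc (rho ζ x ^ (d + 2))⁻¹ ≤ ((n / 3) ^ (d + 2))⁻¹ :=
                inv_anti₀ (by positivity) (pow_le_pow_left₀ (by positivity) (by linarith) _)
            _ = _ := by rw [div_pow, inv_div]; ring
        have l3 := l1.trans (mul_le_mul_of_nonneg_left l2 (by positivity))
        have w4 := mul_le_mul w l3 hl (by positivity)
        have e : 2 * n * (2 * n) ^ d * (rho 0 x ^ (d - 1))⁻¹ *
            (2 * aC d * 2 ^ (d + 3) * (3 ^ (d + 2) * (n ^ (d + 2))⁻¹)) =
            2 * 2 ^ d * (2 * aC d * 2 ^ (d + 3)) * 3 ^ (d + 2) *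
            (n⁻¹ * (rho 0 x ^ (d - 1))⁻¹) := by
          rw [mul_pow, pow_add n d 2]
          field_simp
        linarith

lemma exists_sum_mul_lap_le (hd : 2 ≤ d) (r₃ B : ℝ) (hB : 0 ≤ B) : ∃ C : ℝ, 0 < C ∧
    ∀ N ℓ n ζ h, FarData d r₃ B N ℓ n ζ h →
      ∑ x ∈ lball 0 (n + 2), farW n ℓ ζ x * lap h x ≤ C * (lamN d N * ℓ + Real.log N) := by
  obtain ⟨C₁, hC₁, hs₁⟩ := exists_sum_rho_succ_le (d := d) (by omega)
  obtain ⟨C₂, hC₂, hs₂⟩ := exists_sum_rho_le (d := d) (by omega)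
  obtain ⟨C₃, hC₃, hs₃⟩ := exists_sum_rho_pred_le (d := d) (by omega)
  have ha := aC_pos (d := d)
  refine ⟨(3 * (|r₃| + 1)) ^ d * ((4 * (d * 2 ^ (d + 1)) + 1) * ((|r₃| + 1) * 2) * B) +
    (4 * (d * 2 ^ (d + 1)) + 1) * (2 * aC d * 2 ^ (d + 3)) * (C₁ + 4 * C₂) +
    2 * 2 ^ d * (2 * aC d * 2 ^ (d + 3)) * 3 ^ (d + 2) * (3 * C₃), by positivity,
    fun N ℓ n ζ h H => ?_⟩
  obtain ⟨h1, h2, h3, h4, h5, h6, h7, h8⟩ := H.basic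
  rw [abs_of_pos h2]
  have hN := H.hN
  have hnN := H.hnN
  have hΛ := one_le_lamN (d := d) hN
  have hL := one_le_log hN
  have hsub := H.subset_lball
  refine (Finset.sum_le_sum fun x hx => H.mul_lap_le hx).trans ?_
  rw [Finset.sum_add_distrib, Finset.sum_add_distrib, ← Finset.mul_sum, ← Finset.mul_sum,
    ← Finset.mul_sum, Finset.sum_add_distrib, ← Finset.mul_sum]
  have a1 := sum_near_le (ζ := ζ) (r := r₃ + 1)
    (c := (4 * (d * 2 ^ (d + 1)) + 1) * ((r₃ + 1) * (2 * ℓ)) * (B * lamN d N))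
    (by linarith) (by have := H.B_nonneg; positivity) (lball 0 (n + 2))
  have a2 := hs₁ ζ (lball 0 (n + 2))
  have a3 := hs₂ ζ (3 * N) (by linarith) _ (hsub.trans (lball_mono (by linarith)))
  have a4 := hs₃ 0 (n + 2) (by linarith) _ subset_rfl
  have a3' := a3.trans (mul_le_mul_of_nonneg_left (log_three_mul_le hN) hC₂.le)
  have a5 : n⁻¹ * ∑ x ∈ lball (0 : Fin d → ℤ) (n + 2), (rho 0 x ^ (d - 1))⁻¹ ≤ 3 * C₃ := by
    calc _ ≤ n⁻¹ * (C₃ * (3 * n)) := mul_le_mul_of_nonneg_left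
          (a4.trans (mul_le_mul_of_nonneg_left (by linarith) hC₃.le)) (by positivity)
      _ = _ := by field_simp
  have b2 : ℓ * ∑ x ∈ lball 0 (n + 2), (rho ζ x ^ (d + 1))⁻¹ ≤ C₁ * (lamN d N * ℓ) := by
    calc _ ≤ ℓ * C₁ := mul_le_mul_of_nonneg_left a2 (by linarith)
      _ = C₁ * (1 * ℓ) := by ring
      _ ≤ _ := mul_le_mul_of_nonneg_left (mul_le_mul_of_nonneg_right hΛ (by linarith)) hC₁.le
  have hΛℓ : 0 ≤ lamN d N * ℓ := mul_nonneg (by linarith) (by linarith)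
  set K := (4 * ((d : ℝ) * 2 ^ (d + 1)) + 1) * (2 * aC d * 2 ^ (d + 3)) with hK
  set K' := (2 : ℝ) * 2 ^ d * (2 * aC d * 2 ^ (d + 3)) * 3 ^ (d + 2) with hK'
  have hK0 : 0 ≤ K := by positivity
  have hK'0 : 0 ≤ K' := by positivity
  have c1 : (3 * (r₃ + 1)) ^ d * ((4 * (d * 2 ^ (d + 1)) + 1) * ((r₃ + 1) * (2 * ℓ)) *
      (B * lamN d N)) ≤ (3 * (r₃ + 1)) ^ d * ((4 * (d * 2 ^ (d + 1)) + 1) * ((r₃ + 1) * 2) * B) *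
      (lamN d N * ℓ + Real.log N) := by
    have : 0 ≤ (3 * (r₃ + 1)) ^ d * ((4 * ((d:ℝ) * 2 ^ (d + 1)) + 1) * ((r₃ + 1) * 2) * B) *
      Real.log N := by positivity
    linarith
  have c2 : K * (ℓ * ∑ x ∈ lball 0 (n + 2), (rho ζ x ^ (d + 1))⁻¹ +
      ∑ x ∈ lball 0 (n + 2), (rho ζ x ^ d)⁻¹) ≤
      K * (C₁ + 4 * C₂) * (lamN d N * ℓ + Real.log N) := by
    rw [mul_assoc K]
    refine mul_le_mul_of_nonneg_left ?_ hK0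
    have : 0 ≤ C₁ * Real.log N := by positivity
    have : 0 ≤ 4 * C₂ * (lamN d N * ℓ) := by positivity
    linarith
  have c3 : K' * (n⁻¹ * ∑ x ∈ lball (0 : Fin d → ℤ) (n + 2), (rho 0 x ^ (d - 1))⁻¹) ≤
      K' * (3 * C₃) * (lamN d N * ℓ + Real.log N) := by
    rw [mul_assoc K']
    refine mul_le_mul_of_nonneg_left ?_ hK'0
    have : 1 ≤ lamN d N * ℓ + Real.log N := by linarith
    nlinarith
  linarith

lemma exists_drift_le (hd : 2 ≤ d) (r₃ B : ℝ) (hB : 0 ≤ B) : ∃ c C : ℝ, 0 < c ∧ 0 < C ∧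
    ∀ N ℓ n ζ h, FarData d r₃ B N ℓ n ζ h →
      ∑ x ∈ lball 0 (n + 1), h x - unitBallVol d * n ^ d * h 0 ≤
        C * (lamN d N * ℓ + Real.log N) - c * ℓ ^ 2 := by
  obtain ⟨C₁, hC₁, hs₁⟩ := exists_sum_mul_lap_le hd r₃ B hB
  obtain ⟨C₂, hC₂, hs₂⟩ := exists_dens_part_le hd r₃ B hB
  obtain ⟨c, hc, hs₃⟩ := exists_le_sum hd
  refine ⟨c / 96, C₁ + C₂, by positivity, by positivity, fun N ℓ n ζ h H => ?_⟩
  obtain ⟨h1, h2, h3, h4, h5, h6, h7, h8⟩ := H.basic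
  have hΛ := one_le_lamN (d := d) H.hN
  have hL := one_le_log H.hN
  have b1 := hs₁ N ℓ n ζ h H
  have b2 := hs₂ N ℓ n ζ h H
  have b3 := hs₃ r₃ B N ℓ n ζ h H
  have key := sum_mul_lap (h := h) (w := farW n ℓ ζ) (S := lball 0 (n + 1)) (T := lball 0 (n + 2))
    (fun x hx => H.eq_zero hx) (lball_mono (by linarith)) (fun x hx => by
      have := latNbrs_subset_lball (mem_lball_zero.1 hx)
      exact this.trans (lball_mono (by linarith)))
  have e : ∑ x ∈ lball 0 (n + 1), h x * lap (farW n ℓ ζ) x =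
      ∑ x ∈ lball 0 (n + 1), h x - √(n ^ 2 + aC d) ^ d * ∑ x ∈ lball 0 (n + 1), dens x * h x +
      1 / 96 * (ℓ / n) * ∑ x ∈ lball 0 (n + 1), h x := by
    rw [Finset.mul_sum, Finset.mul_sum, ← Finset.sum_sub_distrib, ← Finset.sum_add_distrib]
    refine Finset.sum_congr rfl fun x _ => ?_
    rw [lap_farW hd]; ring
  have b4 : c / 96 * ℓ ^ 2 ≤ 1 / 96 * (ℓ / n) * ∑ x ∈ lball 0 (n + 1), h x := by
    calc c / 96 * ℓ ^ 2 = 1 / 96 * (ℓ / n) * (c * (ℓ * n)) := by field_simp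
      _ ≤ _ := mul_le_mul_of_nonneg_left b3 (by positivity)
  have b5 : C₂ * ℓ ≤ C₂ * (lamN d N * ℓ + Real.log N) := by
    refine mul_le_mul_of_nonneg_left ?_ hC₂.le
    nlinarith
  linarith

end FarData

end Far

section InnerBound

variable {d : ℕ}

lemma fker_sub_le_lamN (hd : 2 ≤ d) {s T N : ℝ} (hN : 3 ≤ N) (hs : 1 ≤ s)
    (hT : T ≤ (300 + aC d) * N ^ 2) :
    fker d s - fker d T ≤ 2 * (Real.log (300 + aC d) + 2) * lamN d N ∨ T ≤ s := by
  rcases le_total T s with h | h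
  · exact Or.inr h
  left
  have ha := aC_pos (d := d)
  have hlog := one_le_log hN
  have hla : 0 ≤ Real.log (300 + aC d) := Real.log_nonneg (by linarith)
  refine (fker_sub_le_log hd hs h).trans ?_
  unfold lamN
  split_ifs with h2
  · have : Real.log T ≤ Real.log ((300 + aC d) * N ^ 2) := Real.log_le_log (by linarith) hT
    rw [Real.log_mul (by positivity) (by positivity), Real.log_pow] at this
    push_cast at this
    nlinarith
  · linarith

lemma fker_sub_le_lamN' (hd : 2 ≤ d) {s T N : ℝ} (hN : 3 ≤ N) (hs : 1 ≤ s) (hT0 : 0 < T)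
    (hT : T ≤ (300 + aC d) * N ^ 2) :
    fker d s - fker d T ≤ 2 * (Real.log (300 + aC d) + 2) * lamN d N := by
  rcases fker_sub_le_lamN hd hN hs hT with h | h
  · exact h
  · have h1 := fker_anti hd hT0 h
    have h2 := one_le_lamN (d := d) hN
    have hla : 0 ≤ Real.log (300 + aC d) := Real.log_nonneg (by linarith [aC_pos (d := d)])
    have : 0 ≤ 2 * (Real.log (300 + aC d) + 2) * lamN d N := by positivity
    linarith

lemma farH_le (hd : 2 ≤ d) {N ℓ n : ℝ} {ζ x : Fin d → ℤ} (hN : 3 ≤ N) (hℓ : 16 * aC d ≤ ℓ)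
    (hζ : 8 * ℓ ≤ ‖rv ζ‖) (hn : n = ‖rv ζ‖ + ℓ) (hnN : n ≤ N) (hr : √(3 * aC d) ≤ ‖rv x - rv ζ‖) :
    farH n ζ x ≤ 2 * (Real.log (300 + aC d) + 2) * lamN d N := by
  have ha := aC_ge (d := d)
  have h3 := three_aC_le_of_sqrt_le hr
  have h2 := one_le_lamN (d := d) hN
  have hla : 0 ≤ Real.log (300 + aC d) := Real.log_nonneg (by linarith)
  have hn0 : 0 < n := by linarith
  have hζ0 : 0 < ‖rv ζ‖ := by linarith
  by_cases hD : imgD n ζ x ≤ -(2 * aC d)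
  · have : 0 ≤ 2 * (Real.log (300 + aC d) + 2) * lamN d N := by positivity
    exact (farH_nonpos hd hn0.ne' hζ0.ne' hD).trans this
  have hcoef : ℓ / n ≤ 1 - ‖rv ζ‖ ^ 2 / n ^ 2 := by
    have e : 1 - ‖rv ζ‖ ^ 2 / n ^ 2 = ℓ / n * ((n + ‖rv ζ‖) / n) := by
      field_simp
      have : ℓ = n - ‖rv ζ‖ := by linarith
      rw [this]; ring
    rw [e]
    refine le_mul_of_one_le_right (div_nonneg (by linarith) hn0.le) ?_
    rw [le_div_iff₀ hn0]; linarith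
  have hcoef0 : 0 ≤ ℓ / n := div_nonneg (by linarith) hn0.le
  have hcoef1 : 1 - ‖rv ζ‖ ^ 2 / n ^ 2 ≤ 1 := by
    have : 0 ≤ ‖rv ζ‖ ^ 2 / n ^ 2 := by positivity
    linarith
  have hx : ‖rv x‖ ≤ n + 1 := by
    by_contra hx
    push Not at hx
    apply hD
    have h13 : n ^ 2 - ‖rv x‖ ^ 2 ≤ -(2 * n) := by nlinarith
    calc imgD n ζ x ≤ (1 - ‖rv ζ‖ ^ 2 / n ^ 2) * (-(2 * n)) :=
          mul_le_mul_of_nonneg_left h13 (hcoef0.trans hcoef)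
      _ ≤ ℓ / n * (-(2 * n)) := mul_le_mul_of_nonpos_right hcoef (by linarith)
      _ = -(2 * ℓ) := by field_simp
      _ ≤ _ := by linarith
  have hDle : imgD n ζ x ≤ n ^ 2 := by
    calc imgD n ζ x ≤ (1 - ‖rv ζ‖ ^ 2 / n ^ 2) * n ^ 2 :=
          mul_le_mul_of_nonneg_left (by nlinarith [sq_nonneg ‖rv x‖]) (hcoef0.trans hcoef)
      _ ≤ 1 * n ^ 2 := mul_le_mul_of_nonneg_right hcoef1 (by positivity)
      _ = _ := one_mul _
  have hdist : ‖rv x - rv ζ‖ ≤ 3 * N := by linarith [dist_le_add_norm ζ x]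
  have hd2 : ‖rv x - rv ζ‖ ^ 2 ≤ 9 * N ^ 2 := by
    nlinarith [norm_nonneg (rv x - rv ζ)]
  have hn2 : n ^ 2 ≤ N ^ 2 := pow_le_pow_left₀ hn0.le hnN 2
  refine fker_sub_le_lamN' hd hN (by linarith) ?_ ?_
  · linarith [imgD_add_nonneg hn0.ne' hζ0.ne' x]
  · nlinarith

variable {Ω : Type*} [MeasurableSpace Ω] {P : Measure Ω} [IsProbabilityMeasure P]
  {I : ℕ → Ω → Finset (Fin d → ℤ)} {Y : ℕ → Ω → (Fin d → ℤ)}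

set_option maxHeartbeats 1000000 in
lemma IsIDLA.exists_prob_notMem_far (H : IsIDLA P I Y) (hd : 2 ≤ d) :
    ∃ c C₀ : ℝ, 0 < c ∧ 0 < C₀ ∧ ∀ (N ℓ ρ : ℝ) (ζ : Fin d → ℤ) (t : ℕ), 3 ≤ N →
      C₀ * lamN d N ≤ ℓ → C₀ * Real.log N ≤ ℓ ^ 2 → C₀ ≤ ℓ → ρ ≤ N →
      unitBallVol d * ρ ^ d - 1 ≤ t → 8 * ℓ ≤ ‖rv ζ‖ → ‖rv ζ‖ ≤ ρ - ℓ →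
      P {ω | ζ ∉ I t ω} ≤ ENNReal.ofReal (Real.exp (-(c * (ℓ ^ 2 / lamN d N)))) := by
  have ha := aC_ge (d := d)
  have hω := unitBallVol_pos (d := d)
  obtain ⟨Γ, r₃, hΓ, hr₃, hglue⟩ := exists_glue hd (√(3 * aC d)) (Real.sqrt_nonneg _)
  set K : ℝ := 2 * (Real.log (300 + aC d) + 2) with hK
  have hla : 0 ≤ Real.log (300 + aC d) := Real.log_nonneg (by linarith)
  have hK0 : 0 < K := by positivity
  set B : ℝ := Γ * K with hB
  have hB0 : 0 < B := by positivity
  obtain ⟨c₁, C₁, hc₁, hC₁, hdrift⟩ := FarData.exists_drift_le hd r₃ B hB0.le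
  obtain ⟨C₂, hC₂, hsq⟩ := FarData.exists_sum_sq_le hd r₃ B
  set ε : ℝ := min (1 / (2 * B)) (c₁ / (4 * C₂)) with hε
  have hε0 : 0 < ε := by positivity
  have hr₃0 : 0 < r₃ := by linarith [Real.sqrt_nonneg (3 * aC d)]
  refine ⟨ε * c₁ / 2, 16 * (C₁ + B) / c₁ + 16 * (r₃ + aC d + 1) + 600 * (d * 2 ^ (d + 1)) + 1,
    by positivity, by positivity, fun N ℓ ρ ζ t hN h1 h2 h3 hρN ht hζ hζρ => ?_⟩
  set Λ := lamN d N with hΛ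
  have hΛ1 : 1 ≤ Λ := one_le_lamN hN
  have hL1 := one_le_log hN
  have p1 : 0 ≤ 16 * (C₁ + B) / c₁ := by positivity
  have p2 : 0 ≤ 16 * (r₃ + aC d + 1) := by positivity
  have p3 : (0 : ℝ) ≤ 600 * (d * 2 ^ (d + 1)) := by positivity
  have hΛℓ : Λ ≤ ℓ := by nlinarith
  have q1 : 16 * (C₁ + B) * Λ ≤ c₁ * ℓ := by
    have : 16 * (C₁ + B) / c₁ * Λ ≤ ℓ := by nlinarith
    rw [div_mul_eq_mul_div, div_le_iff₀ hc₁] at this; linarith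
  have q2 : 16 * (C₁ + B) * Real.log N ≤ c₁ * ℓ ^ 2 := by
    have : 16 * (C₁ + B) / c₁ * Real.log N ≤ ℓ ^ 2 := by nlinarith
    rw [div_mul_eq_mul_div, div_le_iff₀ hc₁] at this; linarith
  have hℓ1 : 1 ≤ ℓ := by linarith
  have hℓa : 16 * aC d ≤ ℓ := by linarith
  set n : ℝ := ‖rv ζ‖ + ℓ with hn
  have hnN : n ≤ N := by linarith
  obtain ⟨h, g1, g2, g3, g4, -, -⟩ := hglue ζ (farH n ζ) (K * Λ) (by positivity)
    (fun x hx => farH_le hd hN hℓa hζ hn hnN hx)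
    (fun x hx => (lap_farH hd (by linarith) (by linarith) (by linarith) hx).1)
  have F : FarData d r₃ B N ℓ n ζ h := ⟨hd, hN, by linarith, by linarith, by linarith, hΛℓ, hζ, hn,
    hnN, g1, g2, fun x => by rw [hB, mul_assoc]; exact g3 x, g4⟩
  have d1 := hdrift _ _ _ _ _ F
  have d2 := hsq _ _ _ _ _ F
  have hεB : ε * B ≤ 1 / 2 := by
    calc ε * B ≤ 1 / (2 * B) * B := mul_le_mul_of_nonneg_right (min_le_left _ _) hB0.le
      _ = 1 / 2 := by field_simp
  have hεC : ε * C₂ ≤ c₁ / 4 := by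
    calc ε * C₂ ≤ c₁ / (4 * C₂) * C₂ := mul_le_mul_of_nonneg_right (min_le_right _ _) hC₂.le
      _ = c₁ / 4 := by field_simp
  refine (H.prob_notMem_le (by omega) (S := lball 0 (n + 1)) (lam := ε / Λ) g1
    (fun x hx => F.eq_zero hx) g2 (by positivity) (fun x => ?_) t).trans ?_
  · calc ε / Λ * h x ≤ ε / Λ * (B * Λ) := mul_le_mul_of_nonneg_left (F.le x) (by positivity)
      _ = ε * B := by field_simp
      _ ≤ _ := hεB
  refine ENNReal.ofReal_le_ofReal (Real.exp_le_exp.2 ?_)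
  have e1 : ε / Λ * ∑ x ∈ lball 0 (n + 1), h x ^ 2 ≤ c₁ / 4 * ℓ ^ 2 := by
    calc ε / Λ * ∑ x ∈ lball 0 (n + 1), h x ^ 2 ≤ ε / Λ * (C₂ * (Λ * ℓ ^ 2)) :=
          mul_le_mul_of_nonneg_left d2 (by positivity)
      _ = ε * C₂ * ℓ ^ 2 := by field_simp
      _ ≤ _ := mul_le_mul_of_nonneg_right hεC (by positivity)
  have e2 : (unitBallVol d * n ^ d - 1) * h 0 ≤ t * h 0 := by
    refine mul_le_mul_of_nonneg_right (le_trans ?_ ht) (g1 0)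
    have : n ^ d ≤ ρ ^ d := pow_le_pow_left₀ (by positivity) (by linarith) d
    exact sub_le_sub_right (mul_le_mul_of_nonneg_left this hω.le) 1
  have e3 : h 0 ≤ B * Λ := F.le 0
  have e4 : 16 * C₁ * (Λ * ℓ) + 16 * B * Λ ≤ c₁ * ℓ ^ 2 := by
    have : B * Λ * 1 ≤ B * Λ * ℓ := mul_le_mul_of_nonneg_left hℓ1 (by positivity)
    have q3 := mul_le_mul_of_nonneg_right q1 (by linarith : 0 ≤ ℓ)
    linarith
  have e5 : 16 * C₁ * Real.log N ≤ c₁ * ℓ ^ 2 := by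
    have : 0 ≤ B * Real.log N := by positivity
    linarith
  have e6 : ∑ x ∈ lball 0 (n + 1), h x + ε / Λ * ∑ x ∈ lball 0 (n + 1), h x ^ 2 - t * h 0 ≤
      -(c₁ / 2 * ℓ ^ 2) := by
    have : 0 ≤ c₁ * ℓ ^ 2 := by positivity
    linarith
  calc _ ≤ ε / Λ * (-(c₁ / 2 * ℓ ^ 2)) := mul_le_mul_of_nonneg_left e6 (by positivity)
    _ = _ := by field_simp

lemma nearH_le {R : ℝ} (hd : 2 ≤ d) (hR : 0 < R) {ζ x : Fin d → ℤ}
    (hr : √(3 * aC d) ≤ ‖rv x - rv ζ‖) :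
    fker d (‖rv x - rv ζ‖ ^ 2 - aC d) - fker d (R ^ 2) ≤
      2 * R * (2 ^ (d - 1) * (rho ζ x ^ (d - 1))⁻¹) := by
  have h3 := three_aC_le_of_sqrt_le hr
  have ha := aC_pos (d := d)
  set s := ‖rv x - rv ζ‖ ^ 2 - aC d with hs
  have hs0 : 0 < s := by linarith
  have hρ := rho_pos ζ x
  rcases le_total (R ^ 2) s with h | h
  · have := fker_anti hd (by positivity) h
    have : 0 ≤ 2 * R * (2 ^ (d - 1) * (rho ζ x ^ (d - 1))⁻¹) := by positivity
    linarith
  · have h1 := fker_sub_le_sqrt hd hs0 (sub_nonneg.2 h)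
    rw [add_sub_cancel] at h1
    have e : s ^ ((1 - (d : ℝ)) / 2) = (√s ^ (d - 1))⁻¹ := by
      rw [← rpow_neg_half_natCast hs0.le, Nat.cast_sub (by omega)]
      congr 1; push_cast; ring
    rw [e] at h1
    refine h1.trans (mul_le_mul ?_ (inv_pow_le_of_half_rho_le (half_rho_le_sqrt hr) _)
      (by positivity) (by positivity))
    refine mul_le_mul_of_nonneg_left ?_ zero_le_two
    exact (Real.sqrt_le_sqrt (by linarith)).trans_eq (Real.sqrt_sq hR.le)

set_option maxHeartbeats 1000000 in
lemma IsIDLA.exists_prob_notMem_near (H : IsIDLA P I Y) (hd : 2 ≤ d) :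
    ∃ c C₀ : ℝ, 0 < c ∧ 0 < C₀ ∧ ∀ (N ℓ ρ : ℝ) (ζ : Fin d → ℤ) (t : ℕ), 3 ≤ N →
      C₀ * lamN d N ≤ ℓ → C₀ ≤ ℓ → ρ ≤ N → C₀ * ℓ ≤ ρ →
      unitBallVol d * ρ ^ d - 1 ≤ t → ‖rv ζ‖ ≤ 8 * ℓ →
      P {ω | ζ ∉ I t ω} ≤ ENNReal.ofReal (Real.exp (-(c * (ℓ ^ 2 / lamN d N)))) := by
  have ha := aC_ge (d := d)
  have hω := unitBallVol_pos (d := d)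
  have hd1 : (2 : ℝ) ≤ d := by exact_mod_cast hd
  obtain ⟨Γ, r₃, hΓ, hr₃, hglue⟩ := exists_glue hd (√(3 * aC d)) (Real.sqrt_nonneg _)
  obtain ⟨C₁, hC₁, hs₁⟩ := exists_sum_rho_pred_le (d := d) (by omega)
  set K : ℝ := 2 * (Real.log (300 + aC d) + 2) with hK
  have hla : 0 ≤ Real.log (300 + aC d) := Real.log_nonneg (by linarith)
  have hK1 : 1 ≤ K := by linarith
  set B : ℝ := Γ * K with hB
  have hB0 : 0 < B := by positivity
  have hs0 := Real.sqrt_nonneg (3 * aC d)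
  have hr₃0 : 1 ≤ r₃ := by linarith
  set C₂ : ℝ := (3 * r₃) ^ d * B + 2 * 16 * 2 ^ (d - 1) * (C₁ * 17) with hC₂
  have hC₂0 : 0 < C₂ := by positivity
  set C₃ : ℝ := (1 + 16 ^ d * (2 * C₂)) / unitBallVol d + 1 with hC₃
  have hC₃0 : 1 ≤ C₃ := by
    have : 0 ≤ (1 + 16 ^ d * (2 * C₂)) / unitBallVol d := by positivity
    linarith
  refine ⟨C₂ / (4 * B), C₃ + r₃ + aC d + 1, by positivity, by positivity,
    fun N ℓ ρ ζ t hN h1 h2 hρN hρ ht hζ => ?_⟩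
  set Λ := lamN d N with hΛ
  have hΛ1 : 1 ≤ Λ := one_le_lamN hN
  have hΛℓ : Λ ≤ ℓ := by nlinarith
  have hℓ1 : 1 ≤ ℓ := by linarith
  have hℓρ : C₃ * ℓ ≤ ρ := by nlinarith
  have hℓN : ℓ ≤ N := by nlinarith
  set R : ℝ := 16 * ℓ with hR
  have hR0 : 0 < R := by positivity
  obtain ⟨h, g1, g2, g3, g4, g5, g6⟩ := hglue ζ
    (fun x => fker d (‖rv x - rv ζ‖ ^ 2 - aC d) - fker d (R ^ 2)) (K * Λ) (by positivity)
    (fun x hx => by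
      have := three_aC_le_of_sqrt_le hx
      refine fker_sub_le_lamN' hd hN (by linarith) (by positivity) ?_
      nlinarith)
    (fun x hx => by
      have h3 := three_aC_le_of_sqrt_le hx
      have := (lap_fker_sub_le hd x (rv ζ) (μ := 1) zero_le_one le_rfl (by linarith)).1
      simp only [one_mul] at this
      rw [lap_sub, lap_const (by omega), sub_zero]
      exact le_trans (Real.rpow_nonneg (by linarith) _) this)
  have hle : ∀ x, h x ≤ B * Λ := fun x => by rw [hB, mul_assoc]; exact g3 x
  have hsupp : ∀ x, x ∉ lball ζ (R + 1) → h x = 0 := by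
    intro x hx
    rw [mem_lball, not_le] at hx
    rw [g4 x (by linarith)]
    refine max_eq_right ?_
    have := fker_anti hd (s := R ^ 2) (t := ‖rv x - rv ζ‖ ^ 2 - aC d) (by positivity)
      (by nlinarith)
    linarith
  have hsum : ∑ x ∈ lball ζ (R + 1), h x ≤ C₂ * ℓ ^ 2 := by
    have hpt : ∀ x, h x ≤ (if ‖rv x - rv ζ‖ ≤ r₃ then B * Λ else 0) +
        2 * R * 2 ^ (d - 1) * (rho ζ x ^ (d - 1))⁻¹ := by
      intro x
      have hρ := rho_pos ζ x
      split_ifs with hr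
      · have : 0 ≤ 2 * R * 2 ^ (d - 1) * (rho ζ x ^ (d - 1))⁻¹ := by positivity
        linarith [hle x]
      · push Not at hr
        rw [zero_add, g4 x hr.le]
        refine max_le ?_ (by positivity)
        have := nearH_le hd hR0 (ζ := ζ) (x := x) (by linarith)
        linarith
    calc ∑ x ∈ lball ζ (R + 1), h x ≤ ∑ x ∈ lball ζ (R + 1),
          ((if ‖rv x - rv ζ‖ ≤ r₃ then B * Λ else 0) +
            2 * R * 2 ^ (d - 1) * (rho ζ x ^ (d - 1))⁻¹) := Finset.sum_le_sum fun x _ => hpt x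
      _ ≤ (3 * r₃) ^ d * (B * Λ) + 2 * R * 2 ^ (d - 1) * (C₁ * (R + 1)) := by
        rw [Finset.sum_add_distrib, ← Finset.mul_sum]
        refine add_le_add (sum_near_le hr₃0 (by positivity) _) ?_
        exact mul_le_mul_of_nonneg_left (hs₁ ζ (R + 1) (by linarith) _ subset_rfl) (by positivity)
      _ ≤ (3 * r₃) ^ d * (B * ℓ ^ 2) + 2 * R * 2 ^ (d - 1) * (C₁ * (17 * ℓ)) := by
        refine add_le_add (mul_le_mul_of_nonneg_left (mul_le_mul_of_nonneg_left ?_ hB0.le)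
          (by positivity)) (mul_le_mul_of_nonneg_left (mul_le_mul_of_nonneg_left ?_ hC₁.le)
          (by positivity))
        · nlinarith
        · linarith
      _ = C₂ * ℓ ^ 2 := by rw [hC₂, hR]; ring
  have hzero : ℓ ^ 2 * (R ^ d)⁻¹ ≤ h 0 := by
    by_cases hr : ‖rv 0 - rv ζ‖ ≤ √(3 * aC d) + 2
    · refine le_trans ?_ (g6 0 hr)
      have : ℓ ^ 2 ≤ R ^ d := by
        calc ℓ ^ 2 ≤ R ^ 2 := pow_le_pow_left₀ (by linarith) (by linarith) 2
          _ ≤ R ^ d := pow_le_pow_right₀ (by linarith) hd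
      calc ℓ ^ 2 * (R ^ d)⁻¹ ≤ R ^ d * (R ^ d)⁻¹ :=
            mul_le_mul_of_nonneg_right this (by positivity)
        _ = 1 * 1 := by field_simp
        _ ≤ K * Λ := mul_le_mul hK1 hΛ1 zero_le_one (by positivity)
    · push Not at hr
      refine le_trans ?_ (g5 0 hr)
      have h3 := three_aC_le_of_sqrt_le (show √(3 * aC d) ≤ ‖rv 0 - rv ζ‖ by linarith)
      have h4 : ‖rv 0 - rv ζ‖ ^ 2 ≤ 64 * ℓ ^ 2 := by
        rw [norm_rv_zero_sub] at *
        nlinarith [norm_nonneg (rv ζ)]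
      have h5 : ℓ ^ 2 ≤ R ^ 2 - (‖rv 0 - rv ζ‖ ^ 2 - aC d) := by
        rw [hR]; nlinarith
      have h6 := le_fker_sub hd (s := ‖rv 0 - rv ζ‖ ^ 2 - aC d)
        (D := R ^ 2 - (‖rv 0 - rv ζ‖ ^ 2 - aC d)) (by linarith) (by nlinarith)
      rw [add_sub_cancel, rpow_neg_half_natCast (by positivity), Real.sqrt_sq hR0.le] at h6
      exact le_trans (mul_le_mul_of_nonneg_right h5 (by positivity)) h6
  refine (H.prob_notMem_le (by omega) (S := lball ζ (R + 1)) (lam := 1 / (2 * (B * Λ))) g1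
    hsupp g2 (by positivity) (fun x => ?_) t).trans ?_
  · calc 1 / (2 * (B * Λ)) * h x ≤ 1 / (2 * (B * Λ)) * (B * Λ) :=
          mul_le_mul_of_nonneg_left (hle x) (by positivity)
      _ = 1 / 2 := by field_simp
      _ ≤ _ := le_rfl
  refine ENNReal.ofReal_le_ofReal (Real.exp_le_exp.2 ?_)
  have e1 : 1 / (2 * (B * Λ)) * ∑ x ∈ lball ζ (R + 1), h x ^ 2 ≤
      1 / 2 * ∑ x ∈ lball ζ (R + 1), h x := by
    rw [Finset.mul_sum, Finset.mul_sum]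
    refine Finset.sum_le_sum fun x _ => ?_
    calc 1 / (2 * (B * Λ)) * h x ^ 2 = 1 / (2 * (B * Λ)) * h x * h x := by ring
      _ ≤ 1 / 2 * h x := by
        refine mul_le_mul_of_nonneg_right ?_ (g1 x)
        calc 1 / (2 * (B * Λ)) * h x ≤ 1 / (2 * (B * Λ)) * (B * Λ) :=
              mul_le_mul_of_nonneg_left (hle x) (by positivity)
          _ = 1 / 2 := by field_simp
  have e2 : 2 * C₂ * ℓ ^ 2 ≤ t * h 0 := by
    have hρd : C₃ * ℓ ^ d ≤ ρ ^ d := by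
      calc C₃ * ℓ ^ d ≤ C₃ ^ d * ℓ ^ d :=
            mul_le_mul_of_nonneg_right (le_self_pow₀ hC₃0 (by omega)) (by positivity)
        _ = (C₃ * ℓ) ^ d := (mul_pow _ _ _).symm
        _ ≤ ρ ^ d := pow_le_pow_left₀ (by positivity) hℓρ d
    have hℓd : 1 ≤ ℓ ^ d := one_le_pow₀ hℓ1
    have ht1 : 16 ^ d * (2 * C₂) * ℓ ^ d ≤ t := by
      have e : unitBallVol d * C₃ = 1 + 16 ^ d * (2 * C₂) + unitBallVol d := by
        rw [hC₃]; field_simp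
      have e' : unitBallVol d * (C₃ * ℓ ^ d) =
          ℓ ^ d + 16 ^ d * (2 * C₂) * ℓ ^ d + unitBallVol d * ℓ ^ d := by
        rw [← mul_assoc, e]; ring
      have : unitBallVol d * (C₃ * ℓ ^ d) ≤ unitBallVol d * ρ ^ d :=
        mul_le_mul_of_nonneg_left hρd hω.le
      have : 0 ≤ unitBallVol d * ℓ ^ d := by positivity
      linarith
    calc 2 * C₂ * ℓ ^ 2 = 16 ^ d * (2 * C₂) * ℓ ^ d * (ℓ ^ 2 * (R ^ d)⁻¹) := by
          rw [hR, mul_pow]; field_simp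
      _ ≤ t * h 0 := mul_le_mul ht1 hzero (by positivity) (by positivity)
  have e6 : ∑ x ∈ lball ζ (R + 1), h x + 1 / (2 * (B * Λ)) * ∑ x ∈ lball ζ (R + 1), h x ^ 2
      - t * h 0 ≤ -(C₂ / 2 * ℓ ^ 2) := by linarith
  calc _ ≤ 1 / (2 * (B * Λ)) * (-(C₂ / 2 * ℓ ^ 2)) := mul_le_mul_of_nonneg_left e6 (by positivity)
    _ = _ := by field_simp; norm_num

/-- Large deviation bound for sites well inside the ball to be vacant. -/
lemma IsIDLA.exists_prob_notMem (H : IsIDLA P I Y) (hd : 2 ≤ d) :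
    ∃ c C₀ : ℝ, 0 < c ∧ 0 < C₀ ∧ ∀ (N ℓ ρ : ℝ) (ζ : Fin d → ℤ) (t : ℕ), 3 ≤ N →
      C₀ * lamN d N ≤ ℓ → C₀ * Real.log N ≤ ℓ ^ 2 → C₀ ≤ ℓ → ρ ≤ N → C₀ * ℓ ≤ ρ →
      unitBallVol d * ρ ^ d - 1 ≤ t → ‖rv ζ‖ ≤ ρ - ℓ →
      P {ω | ζ ∉ I t ω} ≤ ENNReal.ofReal (Real.exp (-(c * (ℓ ^ 2 / lamN d N)))) := by
  obtain ⟨c₁, C₁, hc₁, hC₁, h₁⟩ := H.exists_prob_notMem_far hd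
  obtain ⟨c₂, C₂, hc₂, hC₂, h₂⟩ := H.exists_prob_notMem_near hd
  refine ⟨min c₁ c₂, C₁ + C₂, by positivity, by positivity,
    fun N ℓ ρ ζ t hN k1 k2 k3 k4 k5 k6 k7 => ?_⟩
  have hΛ := one_le_lamN (d := d) hN
  have hL := one_le_log hN
  have hq : 0 ≤ ℓ ^ 2 / lamN d N := by positivity
  have hℓ : 0 < ℓ := by linarith
  rcases le_total (8 * ℓ) ‖rv ζ‖ with h | h
  · refine (h₁ N ℓ ρ ζ t hN (by nlinarith) (by nlinarith) (by linarith) k4 k6 h k7).trans ?_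
    refine ENNReal.ofReal_le_ofReal (Real.exp_le_exp.2 (neg_le_neg ?_))
    exact mul_le_mul_of_nonneg_right (min_le_left _ _) hq
  · refine (h₂ N ℓ ρ ζ t hN (by nlinarith) (by linarith) k4 (by nlinarith) k6 h).trans ?_
    refine ENNReal.ofReal_le_ofReal (Real.exp_le_exp.2 (neg_le_neg ?_))
    exact mul_le_mul_of_nonneg_right (min_le_right _ _) hq

end InnerBound

section Tentacle

variable {d : ℕ}

lemma rho_comm (x y : Fin d → ℤ) : rho x y = rho y x := by
  unfold rho; rw [norm_sub_rev]

lemma rho_self (x : Fin d → ℤ) : rho x x = √(aC d) := by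
  unfold rho; simp

lemma lap_fker_rho_le (hd : 2 ≤ d) (b z : Fin d → ℤ) :
    lap (fun y => fker d (‖rv y - rv b‖ ^ 2 + aC d)) z ≤ -(rho b z ^ (d + 2))⁻¹ := by
  have h := (lap_fker_add_le hd z (rv b) (μ := 1) zero_le_one le_rfl).1
  simp only [one_mul] at h
  rwa [rpow_neg_half_sub_one (by have := aC_pos (d := d); positivity)] at h

lemma fker_rho_sub_le (hd : 2 ≤ d) {s : ℝ} {b z : Fin d → ℤ} (hs : 0 ≤ s)
    (hb : ‖rv z - rv b‖ ≤ 3 * s) :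
    fker d (‖rv z - rv b‖ ^ 2 + aC d) - fker d (9 * s ^ 2 + aC d) ≤
      6 * s * (rho z b ^ (d - 1))⁻¹ := by
  have ha := aC_pos (d := d)
  have h0 : 0 < ‖rv z - rv b‖ ^ 2 + aC d := by positivity
  have hsq : ‖rv z - rv b‖ ^ 2 ≤ 9 * s ^ 2 := by nlinarith [norm_nonneg (rv z - rv b)]
  have h1 := fker_sub_le_sqrt hd h0 (sub_nonneg.2 hsq)
  have e : ‖rv z - rv b‖ ^ 2 + aC d + (9 * s ^ 2 - ‖rv z - rv b‖ ^ 2) = 9 * s ^ 2 + aC d := by ring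
  have e2 : (‖rv z - rv b‖ ^ 2 + aC d) ^ ((1 - (d : ℝ)) / 2) = (rho z b ^ (d - 1))⁻¹ := by
    rw [rho_comm, rho, ← rpow_neg_half_natCast h0.le, Nat.cast_sub (by omega)]
    congr 1; push_cast; ring
  rw [e, e2] at h1
  refine h1.trans (mul_le_mul_of_nonneg_right ?_ (by have := rho_pos z b; positivity))
  have : √(9 * s ^ 2 - ‖rv z - rv b‖ ^ 2) ≤ 3 * s := by
    refine (Real.sqrt_le_sqrt (show _ ≤ (3 * s) ^ 2 by nlinarith [sq_nonneg ‖rv z - rv b‖])).trans_eq ?_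
    exact Real.sqrt_sq (by linarith)
  linarith

/-- In a ball where the cluster is sparse, the random walk is likely to exit the cluster. -/
lemma exists_half_le_sum_exitMeas (hd : 2 ≤ d) : ∃ β s₀ : ℝ, 0 < β ∧ 1 ≤ s₀ ∧
    ∀ (A : Finset (Fin d → ℤ)) (x : Fin d → ℤ) (s : ℝ), s₀ ≤ s → x ∈ A →
    ((A.filter (fun y => ‖rv y - rv x‖ ≤ s)).card : ℝ) ≤ β * s ^ d →
    1 / 2 ≤ ∑ y ∈ (bdryF latNbrs A).filter (fun y => ‖rv y - rv x‖ ≤ s), exitMeas A x y := by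
  have hd0 : d ≠ 0 := by omega
  have ha := aC_pos (d := d)
  obtain ⟨C₁, hC₁, hs₁⟩ := exists_sum_rho_pred_le (d := d) (by omega)
  set K : ℝ := √(aC d) ^ (d + 2) with hK
  have hK0 : 0 < K := by positivity
  set η : ℝ := 1 / (24 * K * C₁) with hη
  have hη0 : 0 < η := by positivity
  refine ⟨η ^ (d - 1) / (24 * K), 1 + 1 / η, by positivity, ?_, fun A x s hs hx hcard => ?_⟩
  · have : 0 < 1 / η := by positivity
    linarith
  have hη1 : 0 < 1 / η := by positivity
  have hs1 : 1 ≤ s := by linarith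
  have hs0 : 0 < s := by linarith
  have hηs : 1 ≤ η * s := by
    have : η * (1 / η) ≤ η * s := mul_le_mul_of_nonneg_left (by linarith) hη0.le
    rwa [mul_one_div_cancel hη0.ne'] at this
  set S := A.filter (fun y => ‖rv y - rv x‖ ≤ s) with hS
  set p : (Fin d → ℤ) → (Fin d → ℤ) → ℝ := fun b z =>
    fker d (‖rv z - rv b‖ ^ 2 + aC d) - fker d (9 * s ^ 2 + aC d) with hp
  set Q : (Fin d → ℤ) → ℝ := fun z => (s ^ 2)⁻¹ * (‖rv z - rv x‖ ^ 2 + ∑ b ∈ S, K * p b z) with hQ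
  set g : (Fin d → ℤ) → ℝ := fun z => if ‖rv z - rv x‖ ≤ s then min 1 (Q z) else 1 with hg
  have hp0 : ∀ b ∈ S, ∀ z, ‖rv z - rv x‖ ≤ s + 1 → 0 ≤ p b z := by
    intro b hb z hz
    have hb := (Finset.mem_filter.1 hb).2
    have h1 : ‖rv z - rv b‖ ≤ 3 * s := by
      have := norm_sub_le (rv z - rv x) (rv b - rv x)
      rw [sub_sub_sub_cancel_right] at this
      linarith
    have := fker_anti hd (s := ‖rv z - rv b‖ ^ 2 + aC d) (t := 9 * s ^ 2 + aC d) (by positivity)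
      (by nlinarith [norm_nonneg (rv z - rv b)])
    simp only [hp]; linarith
  have hQ0 : ∀ z, ‖rv z - rv x‖ ≤ s + 1 → (s ^ 2)⁻¹ * ‖rv z - rv x‖ ^ 2 ≤ Q z := by
    intro z hz
    refine mul_le_mul_of_nonneg_left ?_ (by positivity)
    have : 0 ≤ ∑ b ∈ S, K * p b z :=
      Finset.sum_nonneg fun b hb => mul_nonneg hK0.le (hp0 b hb z hz)
    linarith
  have hg' : ∀ z, ‖rv z - rv x‖ ≤ s + 1 → g z = min 1 (Q z) := by
    intro z hz
    simp only [hg]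
    split_ifs with h
    · rfl
    · push Not at h
      refine (min_eq_left (le_trans ?_ (hQ0 z hz))).symm
      rw [inv_mul_eq_div, le_div_iff₀ (by positivity), one_mul]
      exact pow_le_pow_left₀ hs0.le h.le 2
  have hg1 : ∀ z, g z ≤ 1 := by
    intro z; simp only [hg]; split_ifs
    exacts [min_le_left _ _, le_rfl]
  have hg0 : ∀ z, 0 ≤ g z := by
    intro z; simp only [hg]; split_ifs with h
    · exact le_min zero_le_one (le_trans (by positivity) (hQ0 z (by linarith)))
    · exact zero_le_one
  have hlapQ : ∀ z ∈ S, lap Q z ≤ 0 := by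
    intro z hz
    have e1 : lap Q z = (s ^ 2)⁻¹ * (1 + ∑ b ∈ S, K * lap (p b) z) := by
      simp only [hQ]
      rw [lap_smul, lap_add (fun y => ‖rv y - rv x‖ ^ 2) (fun y => ∑ b ∈ S, K * p b y)]
      congr 2
      · unfold lap; rw [nbrAvg_norm_sub_sq hd0]; ring
      · unfold lap
        rw [nbrAvg_sum, ← Finset.sum_sub_distrib]
        refine Finset.sum_congr rfl fun b _ => ?_
        rw [nbrAvg_smul]; ring
    have e2 : ∀ b, lap (p b) z ≤ -(rho b z ^ (d + 2))⁻¹ := by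
      intro b
      simp only [hp]
      rw [lap_sub, lap_const hd0, sub_zero]
      exact lap_fker_rho_le hd b z
    have e3 : ∑ b ∈ S, K * lap (p b) z ≤ K * lap (p z) z := by
      refine le_trans (Finset.sum_le_sum (g := fun b => if b = z then K * lap (p z) z else 0)
        fun b _ => ?_) ?_
      · split_ifs with h
        · rw [h]
        · have := rho_pos b z
          have h2 : 0 ≤ (rho b z ^ (d + 2))⁻¹ := by positivity
          exact mul_nonpos_of_nonneg_of_nonpos hK0.le (by linarith [e2 b])
      · rw [Finset.sum_ite_eq' S z, if_pos hz]
    have e4 : K * lap (p z) z ≤ -1 := by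
      have := mul_le_mul_of_nonneg_left (e2 z) hK0.le
      rw [rho_self, ← hK, mul_neg, mul_inv_cancel₀ hK0.ne'] at this
      exact this
    rw [e1]
    exact mul_nonpos_of_nonneg_of_nonpos (by positivity) (by linarith)
  have hsup : ∀ z ∈ A, nbrAvg g z ≤ g z := by
    intro z hz
    by_cases h : ‖rv z - rv x‖ ≤ s
    · rw [hg' z (by linarith)]
      refine le_min (nbrAvg_le_of_le hd0 fun y _ => hg1 y) ?_
      have h1 : nbrAvg g z ≤ nbrAvg Q z := nbrAvg_mono fun y hy => by
        rw [hg' y ((norm_nbr_le hy _).trans (by linarith))]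
        exact min_le_right _ _
      have := hlapQ z (Finset.mem_filter.2 ⟨hz, h⟩)
      unfold lap at this
      linarith
    · have : g z = 1 := by simp only [hg]; rw [if_neg h]
      rw [this]
      exact nbrAvg_le_of_le hd0 fun y _ => hg1 y
  have hQx : Q x ≤ 1 / 2 := by
    have hpt : ∀ b ∈ S, K * p b x ≤ 6 * K * s *
        ((if ‖rv b - rv x‖ ≤ η * s then (rho x b ^ (d - 1))⁻¹ else 0) + ((η * s) ^ (d - 1))⁻¹) := by
      intro b hb
      have hb := (Finset.mem_filter.1 hb).2
      have hρ := rho_pos x b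
      have h1 := mul_le_mul_of_nonneg_left (fker_rho_sub_le hd (s := s) (b := b) (z := x) hs0.le
        (by rw [norm_sub_rev]; linarith)) hK0.le
      have h2 : (rho x b ^ (d - 1))⁻¹ ≤
          (if ‖rv b - rv x‖ ≤ η * s then (rho x b ^ (d - 1))⁻¹ else 0) +
            ((η * s) ^ (d - 1))⁻¹ := by
        split_ifs with h
        · have : 0 ≤ ((η * s) ^ (d - 1))⁻¹ := by positivity
          linarith
        · push Not at h
          rw [zero_add]
          exact inv_anti₀ (by positivity) (pow_le_pow_left₀ (by positivity)
            (h.le.trans (norm_le_rho _ _)) _)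
      calc K * p b x ≤ K * (6 * s * (rho x b ^ (d - 1))⁻¹) := h1
        _ = 6 * K * s * (rho x b ^ (d - 1))⁻¹ := by ring
        _ ≤ _ := mul_le_mul_of_nonneg_left h2 (by positivity)
    have h3 : ∑ b ∈ S, (if ‖rv b - rv x‖ ≤ η * s then (rho x b ^ (d - 1))⁻¹ else 0) ≤
        C₁ * (η * s) := by
      rw [← Finset.sum_filter]
      exact hs₁ x _ hηs _ fun b hb => mem_lball.2 (Finset.mem_filter.1 hb).2
    have h4 : (S.card : ℝ) * ((η * s) ^ (d - 1))⁻¹ ≤ s / (24 * K) := by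
      calc (S.card : ℝ) * ((η * s) ^ (d - 1))⁻¹
          ≤ (η ^ (d - 1) / (24 * K) * s ^ d) * ((η * s) ^ (d - 1))⁻¹ :=
            mul_le_mul_of_nonneg_right hcard (by positivity)
        _ = s / (24 * K) := by
            obtain ⟨k, rfl⟩ : ∃ k, d = k + 1 := ⟨d - 1, by omega⟩
            simp only [Nat.add_sub_cancel]
            rw [mul_pow, pow_succ s k]; field_simp
    have h5 : ∑ b ∈ S, K * p b x ≤ 1 / 2 * s ^ 2 := by
      calc ∑ b ∈ S, K * p b x ≤ _ := Finset.sum_le_sum hpt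
        _ = 6 * K * s * (∑ b ∈ S, (if ‖rv b - rv x‖ ≤ η * s then (rho x b ^ (d - 1))⁻¹ else 0) +
            S.card * ((η * s) ^ (d - 1))⁻¹) := by
          rw [← Finset.mul_sum, Finset.sum_add_distrib, Finset.sum_const, nsmul_eq_mul]
        _ ≤ 6 * K * s * (C₁ * (η * s) + s / (24 * K)) :=
          mul_le_mul_of_nonneg_left (add_le_add h3 h4) (by positivity)
        _ = 1 / 2 * s ^ 2 := by rw [hη]; field_simp; norm_num
    simp only [hQ, sub_self, norm_zero]
    rw [inv_mul_eq_div, div_le_iff₀ (by positivity)]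
    linarith
  have hfin := sum_exitMeas_mul_le hd0 (fun z _ => hg0 z) hsup hx
  have hgx : g x ≤ 1 / 2 := by
    rw [hg' x (by simp; linarith)]
    exact (min_le_right _ _).trans hQx
  have htot := sum_exitMeas hd0 A hx
  rw [← Finset.sum_filter_add_sum_filter_not _ (fun y => ‖rv y - rv x‖ ≤ s)] at htot
  have hout : ∑ y ∈ (bdryF latNbrs A).filter (fun y => ¬ ‖rv y - rv x‖ ≤ s), exitMeas A x y ≤
      ∑ y ∈ bdryF latNbrs A, exitMeas A x y * g y := by
    rw [Finset.sum_filter]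
    refine Finset.sum_le_sum fun y _ => ?_
    have h0 := exitMeas_nonneg hd0 A x y
    split_ifs with h
    · exact mul_nonneg h0 (hg0 y)
    · simp only [hg]; rw [if_neg h, mul_one]
  linarith

/-- Hitting probability, from the origin, of the boundary sites within distance `r` of `ζ`. -/
noncomputable def deepMass (A : Finset (Fin d → ℤ)) (ζ : Fin d → ℤ) (r : ℝ) : ℝ :=
  ∑ y ∈ (bdryF latNbrs A).filter (fun y => ‖rv y - rv ζ‖ ≤ r), exitMeas A 0 y

lemma deepMass_nonneg (hd : d ≠ 0) (A : Finset (Fin d → ℤ)) (ζ : Fin d → ℤ) (r : ℝ) :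
    0 ≤ deepMass A ζ r := Finset.sum_nonneg fun y _ => exitMeas_nonneg hd A 0 y

lemma deepMass_mono (hd : d ≠ 0) (A : Finset (Fin d → ℤ)) (ζ : Fin d → ℤ) {r r' : ℝ} (h : r ≤ r') :
    deepMass A ζ r ≤ deepMass A ζ r' :=
  Finset.sum_le_sum_of_subset_of_nonneg
    (fun _ hy => Finset.mem_filter.2
      ⟨(Finset.mem_filter.1 hy).1, (Finset.mem_filter.1 hy).2.trans h⟩)
    fun y _ _ => exitMeas_nonneg hd A 0 y

lemma deepMass_sub_eq (A : Finset (Fin d → ℤ)) (ζ : Fin d → ℤ) {r r' : ℝ} (h : r ≤ r') :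
    deepMass A ζ r' - deepMass A ζ r = ∑ y ∈ (bdryF latNbrs A).filter
      (fun y => r < ‖rv y - rv ζ‖ ∧ ‖rv y - rv ζ‖ ≤ r'), exitMeas A 0 y := by
  unfold deepMass
  rw [sub_eq_iff_eq_add, Finset.sum_filter, Finset.sum_filter, Finset.sum_filter,
    ← Finset.sum_add_distrib]
  refine Finset.sum_congr rfl fun y _ => ?_
  by_cases h1 : ‖rv y - rv ζ‖ ≤ r
  · have h2 : ‖rv y - rv ζ‖ ≤ r' := h1.trans h
    simp [h1, h2, not_lt.2 h1]
  · simp [h1, not_le.1 h1]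

/-- Crossing a sparse annulus reduces the hitting probability by a constant factor. -/
lemma deepMass_annulus (hd : 2 ≤ d) {β s₀ : ℝ} (hs₀ : 1 ≤ s₀)
    (hβ : ∀ (A : Finset (Fin d → ℤ)) (x : Fin d → ℤ) (s : ℝ), s₀ ≤ s → x ∈ A →
      ((A.filter (fun y => ‖rv y - rv x‖ ≤ s)).card : ℝ) ≤ β * s ^ d →
      1 / 2 ≤ ∑ y ∈ (bdryF latNbrs A).filter (fun y => ‖rv y - rv x‖ ≤ s), exitMeas A x y)
    {A : Finset (Fin d → ℤ)} {ζ : Fin d → ℤ} {r s : ℝ} (hs : s₀ ≤ s) (h0 : 0 ∈ A)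
    (hζ : r < ‖rv ζ‖)
    (hcard : ((A.filter (fun y => r - (2 * s + 4) < ‖rv y - rv ζ‖ ∧ ‖rv y - rv ζ‖ ≤ r)).card : ℝ)
      ≤ β * s ^ d) :
    deepMass A ζ (r - (2 * s + 4)) ≤ 2 / 3 * deepMass A ζ r := by
  have hd0 : d ≠ 0 := by omega
  set r' := r - (2 * s + 4) with hr'
  set S := (bdryF latNbrs A).filter (fun y => r' < ‖rv y - rv ζ‖ ∧ ‖rv y - rv ζ‖ ≤ r) with hS
  set w : (Fin d → ℤ) → ℝ := fun x => ∑ y ∈ S, exitMeas A x y with hw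
  set g : (Fin d → ℤ) → ℝ := fun x => if ‖rv x - rv ζ‖ ≤ r - (s + 2) then 1 / 2 else
    min (w x) (1 / 2) with hg
  have hw0 : ∀ x, 0 ≤ w x := fun x => Finset.sum_nonneg fun y _ => exitMeas_nonneg hd0 A x y
  have hg1 : ∀ x, g x ≤ 1 / 2 := by
    intro z; simp only [hg]; split_ifs
    exacts [le_rfl, min_le_right _ _]
  have hg0 : ∀ x, 0 ≤ g x := by
    intro z; simp only [hg]; split_ifs
    exacts [by norm_num, le_min (hw0 z) (by norm_num)]
  have hmid : ∀ z, (z ∈ A ∨ z ∈ bdryF latNbrs A) → r - (s + 3) < ‖rv z - rv ζ‖ →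
      ‖rv z - rv ζ‖ ≤ r - (s + 2) → 1 / 2 ≤ w z := by
    intro z hz h1 h2
    rcases hz with hz | hz
    · refine (hβ A z s hs hz (le_trans ?_ hcard)).trans ?_
      · refine Nat.cast_le.2 (Finset.card_le_card fun y hy => ?_)
        obtain ⟨hyA, hy⟩ := Finset.mem_filter.1 hy
        have t1 := norm_sub_le (rv z - rv ζ) (rv z - rv y)
        have t2 := norm_sub_le (rv y - rv ζ) (rv y - rv z)
        rw [sub_sub_sub_cancel_left, norm_sub_rev (rv z) (rv y)] at t1
        rw [sub_sub_sub_cancel_left] at t2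
        exact Finset.mem_filter.2 ⟨hyA, by linarith, by linarith⟩
      · refine Finset.sum_le_sum_of_subset_of_nonneg (fun y hy => ?_)
          fun y _ _ => exitMeas_nonneg hd0 A z y
        obtain ⟨hyA, hy⟩ := Finset.mem_filter.1 hy
        have t1 := norm_sub_le (rv z - rv ζ) (rv z - rv y)
        have t2 := norm_sub_le (rv y - rv ζ) (rv y - rv z)
        rw [sub_sub_sub_cancel_left, norm_sub_rev (rv z) (rv y)] at t1
        rw [sub_sub_sub_cancel_left] at t2
        exact Finset.mem_filter.2 ⟨hyA, by linarith, by linarith⟩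
    · have hzS : z ∈ S := Finset.mem_filter.2 ⟨hz, by linarith, by linarith⟩
      have := Finset.single_le_sum (f := fun y => exitMeas A z y)
        (fun y _ => exitMeas_nonneg hd0 A z y) hzS
      rw [exitMeas_of_bdry hd0 hz, if_pos rfl] at this
      simp only [hw]; linarith
  have hsup : ∀ x ∈ A, nbrAvg g x ≤ g x := by
    intro x hx
    by_cases h : ‖rv x - rv ζ‖ ≤ r - (s + 2)
    · have : g x = 1 / 2 := by simp only [hg]; rw [if_pos h]
      rw [this]
      exact nbrAvg_le_of_le hd0 fun y _ => hg1 y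
    · have e : g x = min (w x) (1 / 2) := by simp only [hg]; rw [if_neg h]
      rw [e]
      refine le_min ?_ (nbrAvg_le_of_le hd0 fun y _ => hg1 y)
      have hwx : nbrAvg w x = w x := by
        simp only [hw]
        rw [nbrAvg_sum]
        exact Finset.sum_congr rfl fun y _ => (exitMeas_of_mem hd0 hx y).symm
      rw [← hwx]
      refine nbrAvg_mono fun z hz => ?_
      simp only [hg]
      split_ifs with hz'
      · refine hmid z (latNbrs_mem_union hx hz) ?_ hz'
        have := norm_nbr_ge hz (rv ζ)
        push Not at h
        linarith
      · exact min_le_left _ _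
  have hfin := sum_exitMeas_mul_le hd0 (fun z _ => hg0 z) hsup h0
  have h1 : g 0 ≤ w 0 := by
    have : ¬ ‖rv 0 - rv ζ‖ ≤ r - (s + 2) := by
      rw [norm_rv_zero_sub]; linarith
    simp only [hg]; rw [if_neg this]
    exact min_le_left _ _
  have h2 : 1 / 2 * deepMass A ζ r' ≤ ∑ y ∈ bdryF latNbrs A, exitMeas A 0 y * g y := by
    unfold deepMass
    rw [Finset.sum_filter, Finset.mul_sum]
    refine Finset.sum_le_sum fun y _ => ?_
    have h0 := exitMeas_nonneg hd0 A 0 y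
    split_ifs with h
    · have : ‖rv y - rv ζ‖ ≤ r - (s + 2) := by linarith
      simp only [hg]; rw [if_pos this]; linarith
    · rw [mul_zero]; exact mul_nonneg h0 (hg0 y)
  have h3 := deepMass_sub_eq A ζ (show r' ≤ r by linarith)
  simp only [hw, hS] at h1
  linarith

end Tentacle

section Stage

variable {d : ℕ}

/-- Number of points of `A` within distance `r` of `ζ`. -/
noncomputable def cnt (A : Finset (Fin d → ℤ)) (ζ : Fin d → ℤ) (r : ℝ) : ℝ :=
  ((A.filter (fun y => ‖rv y - rv ζ‖ ≤ r)).card : ℝ)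

/-- The property that the walk is likely to exit `A` before leaving a ball of radius `s ≥ s₀` in
which `A` has density at most `β`. -/
def SparseExit (d : ℕ) (β s₀ : ℝ) : Prop :=
  ∀ (A : Finset (Fin d → ℤ)) (x : Fin d → ℤ) (s : ℝ), s₀ ≤ s → x ∈ A → cnt A x s ≤ β * s ^ d →
    1 / 2 ≤ ∑ y ∈ (bdryF latNbrs A).filter (fun y => ‖rv y - rv x‖ ≤ s), exitMeas A x y

lemma cnt_nonneg (A : Finset (Fin d → ℤ)) (ζ : Fin d → ℤ) (r : ℝ) : 0 ≤ cnt A ζ r :=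
  Nat.cast_nonneg _

lemma cnt_mono_left {A A' : Finset (Fin d → ℤ)} (h : A ⊆ A') (ζ : Fin d → ℤ) (r : ℝ) :
    cnt A ζ r ≤ cnt A' ζ r :=
  Nat.cast_le.2 (Finset.card_le_card (Finset.filter_subset_filter _ h))

lemma cnt_mono (A : Finset (Fin d → ℤ)) (ζ : Fin d → ℤ) {r r' : ℝ} (h : r ≤ r') :
    cnt A ζ r ≤ cnt A ζ r' :=
  Nat.cast_le.2 (Finset.card_le_card fun _ hy => Finset.mem_filter.2
    ⟨(Finset.mem_filter.1 hy).1, (Finset.mem_filter.1 hy).2.trans h⟩)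

lemma cnt_add (A : Finset (Fin d → ℤ)) (ζ : Fin d → ℤ) {r r' : ℝ} (h : r ≤ r') :
    cnt A ζ r + ((A.filter (fun y => r < ‖rv y - rv ζ‖ ∧ ‖rv y - rv ζ‖ ≤ r')).card : ℝ) =
      cnt A ζ r' := by
  unfold cnt
  rw [← Nat.cast_add, ← Finset.card_union_of_disjoint]
  · congr 2
    ext y
    simp only [Finset.mem_union, Finset.mem_filter]
    constructor
    · rintro (⟨h1, h2⟩ | ⟨h1, h2, h3⟩)
      exacts [⟨h1, h2.trans h⟩, ⟨h1, h3⟩]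
    · rintro ⟨h1, h2⟩
      rcases le_or_gt ‖rv y - rv ζ‖ r with h3 | h3
      exacts [Or.inl ⟨h1, h3⟩, Or.inr ⟨h1, h3, h2⟩]
  · rw [Finset.disjoint_left]
    intro y h1 h2
    exact absurd (Finset.mem_filter.1 h1).2 (not_le.2 (Finset.mem_filter.1 h2).2.1)

lemma deepMass_le_pow_mul (hd : 2 ≤ d) {β s₀ : ℝ} (hs₀ : 1 ≤ s₀)
    (hβ : SparseExit d β s₀) {A : Finset (Fin d → ℤ)} {ζ : Fin d → ℤ} {r s : ℝ}
    (hs : s₀ ≤ s) (h0 : 0 ∈ A) (hζ : r < ‖rv ζ‖) (k : ℕ) :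
    ∃ i j : ℕ, i + j = k ∧
      deepMass A ζ (r - k * (2 * s + 4)) ≤ (2 / 3) ^ i * deepMass A ζ r ∧
      j * (β * s ^ d) + cnt A ζ (r - k * (2 * s + 4)) ≤ cnt A ζ r := by
  have hd0 : d ≠ 0 := by omega
  induction k with
  | zero => exact ⟨0, 0, rfl, by simp, by simp⟩
  | succ k ih =>
    obtain ⟨i, j, hij, h1, h2⟩ := ih
    set r₁ := r - k * (2 * s + 4) with hr₁
    have e : r - ((k + 1 : ℕ) : ℝ) * (2 * s + 4) = r₁ - (2 * s + 4) := by
      rw [hr₁]; push_cast; ring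
    have hr : r₁ ≤ r := by
      have : (0 : ℝ) ≤ k * (2 * s + 4) := mul_nonneg (Nat.cast_nonneg _) (by linarith)
      linarith
    have hadd := cnt_add A ζ (show r₁ - (2 * s + 4) ≤ r₁ by linarith)
    rw [e]
    by_cases h : ((A.filter (fun y => r₁ - (2 * s + 4) < ‖rv y - rv ζ‖ ∧
        ‖rv y - rv ζ‖ ≤ r₁)).card : ℝ) ≤ β * s ^ d
    · refine ⟨i + 1, j, by omega, ?_, ?_⟩
      · calc deepMass A ζ (r₁ - (2 * s + 4)) ≤ 2 / 3 * deepMass A ζ r₁ :=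
              deepMass_annulus hd hs₀ hβ hs h0 (by linarith) h
          _ ≤ 2 / 3 * ((2 / 3) ^ i * deepMass A ζ r) :=
              mul_le_mul_of_nonneg_left h1 (by norm_num)
          _ = _ := by ring
      · have := cnt_mono A ζ (show r₁ - (2 * s + 4) ≤ r₁ by linarith)
        linarith
    · refine ⟨i, j + 1, by omega, ?_, ?_⟩
      · exact (deepMass_mono hd0 A ζ (by linarith)).trans h1
      · push Not at h
        push_cast
        linarith

lemma deepMass_le_of_cnt_le (hd : 2 ≤ d) {β s₀ : ℝ} (hβ0 : 0 < β) (hs₀ : 1 ≤ s₀)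
    (hβ : SparseExit d β s₀) {A : Finset (Fin d → ℤ)} {ζ : Fin d → ℤ} {r s : ℝ}
    (hs : s₀ ≤ s) (h0 : 0 ∈ A) (hζ : r < ‖rv ζ‖) {J : ℕ} (hJ : cnt A ζ r ≤ J * (β * s ^ d)) :
    deepMass A ζ (r - J * (4 * (s + 2))) ≤ (2 / 3) ^ J * deepMass A ζ r := by
  obtain ⟨i, j, hij, h1, h2⟩ := deepMass_le_pow_mul hd hs₀ hβ hs h0 hζ (2 * J)
  have hβs : 0 < β * s ^ d := by
    have : 0 < s := by linarith
    positivity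
  have hj : j ≤ J := by
    have h3 := cnt_nonneg A ζ (r - (2 * J : ℕ) * (2 * s + 4))
    have : (j : ℝ) * (β * s ^ d) ≤ J * (β * s ^ d) := by linarith
    exact_mod_cast le_of_mul_le_mul_right this hβs
  have e : r - ((2 * J : ℕ) : ℝ) * (2 * s + 4) = r - J * (4 * (s + 2)) := by push_cast; ring
  rw [e] at h1
  refine h1.trans (mul_le_mul_of_nonneg_right ?_ (deepMass_nonneg (by omega) A ζ r))
  exact pow_le_pow_of_le_one (by norm_num) (by norm_num) (by omega)

variable {Ω : Type*} [MeasurableSpace Ω] {P : Measure Ω} [IsProbabilityMeasure P]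
  {I : ℕ → Ω → Finset (Fin d → ℤ)} {Y : ℕ → Ω → (Fin d → ℤ)}

lemma IsIDLA.prob_stage_le (H : IsIDLA P I Y) (hd : 2 ≤ d) {β s₀ : ℝ} (hβ0 : 0 < β) (hs₀ : 1 ≤ s₀)
    (hβ : SparseExit d β s₀) {ζ : Fin d → ℤ} {r s T : ℝ} {J : ℕ}
    (hs : s₀ ≤ s) (hζ : r < ‖rv ζ‖) (hT0 : 0 ≤ T) (hT : T ≤ J * (β * s ^ d))
    (hJ : (10 : ℝ) * 2 ^ d ≤ J) (t : ℕ) :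
    P {ω | cnt (I t ω) ζ r ≤ T ∧ T / 2 ^ d < cnt (I t ω) ζ (r - J * (4 * (s + 2)))} ≤
      ENNReal.ofReal (Real.exp (-(T * J / (10 * 2 ^ d)))) := by
  have hd0 : d ≠ 0 := by omega
  set r' := r - J * (4 * (s + 2)) with hr'
  have hrr : r' ≤ r := by
    have : (0 : ℝ) ≤ J * (4 * (s + 2)) := mul_nonneg (Nat.cast_nonneg _) (by linarith)
    linarith
  set p : ℝ := (2 / 3) ^ J with hp
  set z : ℝ := Real.exp (J / 5) with hz
  have hz1 : 1 ≤ z := Real.one_le_exp (by positivity)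
  have hp0 : 0 < p := by positivity
  have hpz : p * z ≤ 1 := by
    have e : z = Real.exp (1 / 5) ^ J := by
      rw [hz, ← Real.exp_nat_mul]; congr 1; ring
    rw [e, hp, ← mul_pow]
    refine pow_le_one₀ (by positivity) ?_
    have : Real.exp (1 / 5) ≤ 1 / (1 - 1 / 5) := Real.exp_bound_div_one_sub_of_interval
      (by norm_num) (by norm_num)
    norm_num at this ⊢
    linarith
  set q : ℝ := (1 + p * z)⁻¹ with hq
  have hpz0 : 0 < p * z := by positivity
  have hq0 : 0 < q := by positivity
  have hq1 : q ≤ 1 := inv_le_one_of_one_le₀ (by linarith)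
  have hqe : Real.exp (-1) ≤ q := by
    rw [Real.exp_neg]
    exact inv_anti₀ (by positivity) (by linarith [Real.exp_one_gt_d9])
  have hqm : q * (1 + p * z) = 1 := inv_mul_cancel₀ (by positivity)
  set φ : (Fin d → ℤ) → ℝ := fun x => (if ‖rv x - rv ζ‖ ≤ r' then z else 1) *
    (if ‖rv x - rv ζ‖ ≤ r then q else 1) with hφ
  have hφ0 : φ 0 = 1 := by
    simp only [hφ]
    rw [norm_rv_zero_sub, if_neg (by linarith), if_neg (by linarith), one_mul]
  have hsup : ∀ A : Finset (Fin d → ℤ), 0 ∈ A → cnt A ζ r ≤ T →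
      ∑ y ∈ bdryF latNbrs A, exitMeas A 0 y * φ y ≤ 1 := by
    intro A h0 hA
    have e : ∑ y ∈ bdryF latNbrs A, exitMeas A 0 y * φ y =
        (∑ y ∈ bdryF latNbrs A, exitMeas A 0 y) + (q - 1) * deepMass A ζ r +
          q * (z - 1) * deepMass A ζ r' := by
      unfold deepMass
      rw [Finset.sum_filter, Finset.sum_filter, Finset.mul_sum, Finset.mul_sum,
        ← Finset.sum_add_distrib, ← Finset.sum_add_distrib]
      refine Finset.sum_congr rfl fun y _ => ?_
      simp only [hφ]
      by_cases h1 : ‖rv y - rv ζ‖ ≤ r'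
      · rw [if_pos h1, if_pos (h1.trans hrr), if_pos h1, if_pos (h1.trans hrr)]; ring
      · rw [if_neg h1, if_neg h1]
        split_ifs <;> ring
    rw [sum_exitMeas hd0 A h0] at e
    have h1 := deepMass_le_of_cnt_le hd hβ0 hs₀ hβ hs h0 hζ (hA.trans hT)
    have h2 : q * (z - 1) * deepMass A ζ r' ≤ q * (z - 1) * (p * deepMass A ζ r) :=
      mul_le_mul_of_nonneg_left h1 (mul_nonneg hq0.le (by linarith))
    have h3 : 1 + (q - 1) * deepMass A ζ r + q * (z - 1) * (p * deepMass A ζ r) =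
        1 + (q * (1 + p * z) - 1 - q * p) * deepMass A ζ r := by ring
    have h4 : 0 ≤ q * p * deepMass A ζ r :=
      mul_nonneg (by positivity) (deepMass_nonneg hd0 A ζ r)
    rw [hqm] at h3
    linarith
  have hc : (0 : ℝ) < Real.exp (T * J / (10 * 2 ^ d)) := Real.exp_pos _
  refine (H.prob_le_of_prod hd0 φ (fun x => ?_) (fun A => cnt A ζ r ≤ T) (fun A y h =>
    (cnt_mono_left (Finset.subset_insert y A) ζ r).trans h) hsup t
    (fun ω => cnt (I t ω) ζ r ≤ T ∧ T / 2 ^ d < cnt (I t ω) ζ r') hc fun ω hω => ⟨hω.1, ?_⟩).trans ?_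
  · simp only [hφ]
    refine mul_nonneg ?_ ?_ <;> split_ifs <;> positivity
  · have e1 : ∏ x ∈ I t ω, φ x =
        z ^ ((I t ω).filter (fun y => ‖rv y - rv ζ‖ ≤ r')).card *
        q ^ ((I t ω).filter (fun y => ‖rv y - rv ζ‖ ≤ r)).card := by
      simp only [hφ]
      rw [Finset.prod_mul_distrib, ← Finset.prod_filter, ← Finset.prod_filter,
        Finset.prod_const, Finset.prod_const]
    have e2 : Real.exp (J / 5 * cnt (I t ω) ζ r') =
        z ^ ((I t ω).filter (fun y => ‖rv y - rv ζ‖ ≤ r')).card := by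
      rw [hz, ← Real.exp_nat_mul, cnt, mul_comm]
    have e3 : Real.exp (-cnt (I t ω) ζ r) ≤
        q ^ ((I t ω).filter (fun y => ‖rv y - rv ζ‖ ≤ r)).card := by
      calc Real.exp (-cnt (I t ω) ζ r) =
          Real.exp (-1) ^ ((I t ω).filter (fun y => ‖rv y - rv ζ‖ ≤ r)).card := by
            rw [← Real.exp_nat_mul, cnt]; congr 1; ring
        _ ≤ _ := pow_le_pow_left₀ (Real.exp_pos _).le hqe _
    rw [e1, ← e2]
    refine le_trans ?_ (mul_le_mul_of_nonneg_left e3 (Real.exp_pos _).le)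
    rw [← Real.exp_add]
    refine Real.exp_le_exp.2 ?_
    have h1 : J / 5 * (T / 2 ^ d) ≤ J / 5 * cnt (I t ω) ζ r' :=
      mul_le_mul_of_nonneg_left hω.2.le (by positivity)
    have h2 : T ≤ T * J / (10 * 2 ^ d) := by
      rw [le_div_iff₀ (by positivity)]
      exact mul_le_mul_of_nonneg_left hJ hT0
    have h3 : J / 5 * (T / 2 ^ d) = 2 * (T * J / (10 * 2 ^ d)) := by field_simp; ring
    linarith [hω.1]
  · rw [hφ0, Real.exp_neg, one_div]

end Stage

section Tentacle

variable {d : ℕ}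

/-- Exponent in the bound for the probability of a thin tentacle of length `m`. -/
noncomputable def tentacleExp (d : ℕ) (m : ℝ) : ℝ := if d = 2 then m else m ^ 2

lemma exists_stage_params (hd : 2 ≤ d) {β s₀ : ℝ} (hβ : 0 < β) (hs₀ : 1 ≤ s₀) :
    ∃ A c : ℝ, 0 < A ∧ 0 < c ∧ ∀ m y : ℝ, 1 ≤ y → y ^ d = m → ∃ (J : ℕ → ℕ) (s : ℕ → ℝ), ∀ j : ℕ,
      s₀ ≤ s j ∧ (10 : ℝ) * 2 ^ d ≤ J j ∧ m / 16 * 2 ^ (d * j) ≤ J j * (β * s j ^ d) ∧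
      J j * (4 * (s j + 2)) ≤ A * (1 + y * 2 ^ j) + m / 8 * (1 / 2) ^ j ∧
      c * tentacleExp d m ≤ m / 16 * 2 ^ (d * j) * J j := by
  have hd0 : d ≠ 0 := by omega
  set J0 : ℝ := 10 * 2 ^ d with hJ0
  have hJ1 : 1 ≤ J0 := by
    have : (1 : ℝ) ≤ 2 ^ d := one_le_pow₀ (by norm_num)
    linarith
  set σ' : ℝ := 1 + 1 / β with hσ'
  have hσ'1 : 1 ≤ σ' := by
    have : 0 < 1 / β := by positivity
    linarith
  have hβσ' : 1 ≤ β * σ' ^ d := by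
    have h1 : σ' ≤ σ' ^ d := le_self_pow₀ hσ'1 hd0
    have h2 : β * σ' = β + 1 := by rw [hσ']; field_simp
    have h3 := mul_le_mul_of_nonneg_left h1 hβ.le
    linarith
  have hfirst : ∀ m y : ℝ, 1 ≤ y → y ^ d = m → ∀ (j : ℕ) (J s : ℝ), J0 ≤ J → σ' * (y * 2 ^ j) ≤ s →
      m / 16 * 2 ^ (d * j) ≤ J * (β * s ^ d) := by
    intro m y hy hym j J s hJ hs
    have hy0 : 0 < y := by linarith
    have hm : 0 < m := by rw [← hym]; positivity
    have h1 : (σ' * (y * 2 ^ j)) ^ d ≤ s ^ d := pow_le_pow_left₀ (by positivity) hs d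
    have h2 : (σ' * (y * 2 ^ j)) ^ d = σ' ^ d * (m * 2 ^ (d * j)) := by
      rw [mul_pow, mul_pow, hym, ← pow_mul, mul_comm j]
    have h3 : 0 < m * 2 ^ (d * j) := by positivity
    have h4 : m * 2 ^ (d * j) ≤ β * s ^ d := by
      have h5 := mul_le_mul_of_nonneg_left h1 hβ.le
      rw [h2, ← mul_assoc] at h5
      have h6 := mul_le_mul_of_nonneg_right hβσ' h3.le
      linarith
    have h7 : 1 * (β * s ^ d) ≤ J * (β * s ^ d) :=
      mul_le_mul_of_nonneg_right (hJ1.trans hJ) (h3.le.trans h4)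
    linarith
  have hσ'0 : 0 < σ' := by linarith
  rcases eq_or_ne d 2 with h2 | h2
  · refine ⟨4 * J0 * (s₀ + 2 + σ'), 1, by positivity, one_pos, fun m y hy hym =>
      ⟨fun _ => 10 * 2 ^ d, fun j => s₀ + σ' * (y * 2 ^ j), fun j => ?_⟩⟩
    have hy0 : 0 < y := by linarith
    have hm : 0 < m := by rw [← hym]; positivity
    have hY : 0 < y * 2 ^ j := by positivity
    have e : ((10 * 2 ^ d : ℕ) : ℝ) = J0 := by rw [hJ0]; push_cast; ring
    have hpos : 0 < σ' * (y * 2 ^ j) := by positivity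
    refine ⟨by linarith, by rw [e], ?_, ?_, ?_⟩
    · rw [e]
      exact hfirst m y hy hym j J0 _ le_rfl (by linarith)
    · rw [e]
      have h3 : 0 ≤ m / 8 * (1 / 2) ^ j := by positivity
      have h4 : 4 * J0 * (s₀ + 2 + σ') * (1 + y * 2 ^ j) = J0 * (4 * (s₀ + σ' * (y * 2 ^ j) + 2)) +
        (4 * J0 * ((s₀ + 2) * (y * 2 ^ j)) + 4 * J0 * σ') := by ring
      have h5 : 0 ≤ 4 * J0 * ((s₀ + 2) * (y * 2 ^ j)) + 4 * J0 * σ' := by positivity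
      linarith
    · rw [e, tentacleExp, if_pos h2]
      have h3 : (1 : ℝ) ≤ 2 ^ (d * j) := one_le_pow₀ (by norm_num)
      have h4 : 16 ≤ J0 := by
        rw [hJ0, h2]; norm_num
      have h5 : 1 * 16 ≤ 2 ^ (d * j) * J0 := mul_le_mul h3 h4 (by norm_num) (by positivity)
      have h6 := mul_le_mul_of_nonneg_left h5 (show 0 ≤ m / 16 by positivity)
      have h7 : m / 16 * (2 ^ (d * j) * J0) = m / 16 * 2 ^ (d * j) * J0 := by ring
      linarith
  · have hd3 : 3 ≤ d := by omega
    set σ : ℝ := s₀ + 128 / β with hσ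
    have hσs : s₀ ≤ σ := by
      have : 0 < 128 / β := by positivity
      linarith
    have hσ0 : 0 < σ := by linarith
    set κ : ℝ := 1 / (β * σ ^ d) with hκ
    have hκ0 : 0 < κ := by positivity
    have hκβ : κ * (β * σ ^ d) = 1 := by rw [hκ]; field_simp
    have hκσ : κ * σ ≤ 1 / 128 := by
      have e1 : κ * σ * (β * σ) ≤ 1 := by
        have h1 : σ ^ 2 ≤ σ ^ d := pow_le_pow_right₀ (by linarith) (by omega)
        have h3 := mul_le_mul_of_nonneg_left h1 (show 0 ≤ κ * β by positivity)
        have e2 : κ * β * σ ^ d = 1 := by rw [← hκβ]; ring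
        calc κ * σ * (β * σ) = κ * β * σ ^ 2 := by ring
          _ ≤ 1 := by linarith
      have e2 : 128 ≤ β * σ := by
        have : β * σ = β * s₀ + 128 := by rw [hσ]; field_simp
        have : 0 < β * s₀ := by positivity
        linarith
      have e3 := mul_le_mul_of_nonneg_left e2 (show 0 ≤ κ * σ by positivity)
      linarith
    refine ⟨4 * (J0 + 1) * (s₀ + 2 + σ'), κ / 16, by positivity, by positivity, fun m y hy hym =>
      ⟨fun j => ⌈J0 + κ * m / 2 ^ (d * j)⌉₊, fun j => s₀ + min (σ * 4 ^ j) (σ' * (y * 2 ^ j)),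
        fun j => ?_⟩⟩
    have hy0 : 0 < y := by linarith
    have hm : 0 < m := by rw [← hym]; positivity
    have hY : 0 < y * 2 ^ j := by positivity
    set Q : ℝ := 2 ^ (d * j) with hQ
    have hQ0 : 0 < Q := by positivity
    have hκm : 0 < κ * m / Q := by positivity
    set J : ℝ := (⌈J0 + κ * m / Q⌉₊ : ℝ) with hJ
    have hJl : J0 + κ * m / Q ≤ J := Nat.le_ceil _
    have hJu : J ≤ J0 + κ * m / Q + 1 := (Nat.ceil_lt_add_one (by positivity)).le
    have hmin0 : 0 < min (σ * 4 ^ j) (σ' * (y * 2 ^ j)) := lt_min (by positivity) (by positivity)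
    refine ⟨by linarith, by linarith, ?_, ?_, ?_⟩
    · beta_reduce
      rcases le_total (σ * 4 ^ j) (σ' * (y * 2 ^ j)) with h | h
      · rw [min_eq_left h]
        have h1 : (σ * 4 ^ j) ^ d ≤ (s₀ + σ * 4 ^ j) ^ d :=
          pow_le_pow_left₀ (by positivity) (by linarith) d
        have h3 : (σ * 4 ^ j) ^ d = σ ^ d * (Q * Q) := by
          rw [mul_pow, hQ, ← pow_mul, ← pow_add, ← two_mul, pow_mul 2 2, mul_comm j]
          norm_num
        have h4 : κ * m / Q * (β * (σ ^ d * (Q * Q))) = m * Q := by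
          calc κ * m / Q * (β * (σ ^ d * (Q * Q))) = κ * (β * σ ^ d) * (m * Q) := by field_simp
            _ = m * Q := by rw [hκβ, one_mul]
        have h5 : κ * m / Q * (β * (σ * 4 ^ j) ^ d) ≤ J * (β * (s₀ + σ * 4 ^ j) ^ d) :=
          mul_le_mul (by linarith) (mul_le_mul_of_nonneg_left h1 hβ.le) (by positivity)
            (by linarith)
        rw [h3, h4] at h5
        have : 0 < m * Q := by positivity
        linarith
      · rw [min_eq_right h]
        exact hfirst m y hy hym j J _ (by linarith) (by linarith)
    · set p := min (σ * 4 ^ j) (σ' * (y * 2 ^ j)) with hp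
      have h1 : J * (4 * (s₀ + p + 2)) ≤ (J0 + κ * m / Q + 1) * (4 * (s₀ + p + 2)) :=
        mul_le_mul_of_nonneg_right hJu (by positivity)
      have h3 : (J0 + κ * m / Q + 1) * (4 * (s₀ + p + 2)) =
        4 * (J0 + 1) * (s₀ + 2) + 4 * (J0 + 1) * p + 4 * (κ * m / Q) * (s₀ + 2) +
          4 * (κ * m / Q * p) := by ring
      have h4 : 4 * (J0 + 1) * p ≤ 4 * (J0 + 1) * (σ' * (y * 2 ^ j)) :=
        mul_le_mul_of_nonneg_left (min_le_right _ _) (by positivity)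
      have hQ4 : (4 : ℝ) ^ j / Q ≤ (1 / 2) ^ j := by
        rw [div_le_iff₀ hQ0, hQ, pow_mul, ← mul_pow]
        refine pow_le_pow_left₀ (by norm_num) ?_ j
        have : (2 : ℝ) ^ 3 ≤ 2 ^ d := pow_le_pow_right₀ (by norm_num) hd3
        linarith
      have hQ1 : 1 / Q ≤ (1 / 2) ^ j := by
        refine le_trans ?_ hQ4
        exact div_le_div_of_nonneg_right (one_le_pow₀ (by norm_num)) hQ0.le
      have h5 : κ * m / Q * p ≤ m * (κ * σ) * (1 / 2) ^ j := by
        calc κ * m / Q * p ≤ κ * m / Q * (σ * 4 ^ j) :=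
              mul_le_mul_of_nonneg_left (min_le_left _ _) hκm.le
          _ = m * (κ * σ) * (4 ^ j / Q) := by ring
          _ ≤ _ := mul_le_mul_of_nonneg_left hQ4 (by positivity)
      have h6 : κ * m / Q * (s₀ + 2) ≤ m * (3 * (κ * σ)) * (1 / 2) ^ j := by
        calc κ * m / Q * (s₀ + 2) ≤ κ * m / Q * (3 * σ) :=
              mul_le_mul_of_nonneg_left (by linarith) hκm.le
          _ = m * (3 * (κ * σ)) * (1 / Q) := by ring
          _ ≤ _ := mul_le_mul_of_nonneg_left hQ1 (by positivity)
      have h7 : m * (κ * σ) * (1 / 2) ^ j ≤ m * (1 / 128) * (1 / 2) ^ j :=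
        mul_le_mul_of_nonneg_right (mul_le_mul_of_nonneg_left hκσ hm.le) (by positivity)
      have h8 : 4 * (J0 + 1) * (s₀ + 2 + σ') * (1 + y * 2 ^ j) =
        4 * (J0 + 1) * (s₀ + 2) + 4 * (J0 + 1) * (σ' * (y * 2 ^ j)) +
        (4 * (J0 + 1) * (s₀ + 2) * (y * 2 ^ j) + 4 * (J0 + 1) * σ') := by ring
      have h9 : 0 ≤ 4 * (J0 + 1) * (s₀ + 2) * (y * 2 ^ j) + 4 * (J0 + 1) * σ' := by positivity
      linarith
    · rw [tentacleExp, if_neg h2]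
      have h1 : κ * m / Q ≤ J := by linarith
      have h3 := mul_le_mul_of_nonneg_left h1 (show 0 ≤ m / 16 * Q by positivity)
      have h4 : m / 16 * Q * (κ * m / Q) = κ / 16 * m ^ 2 := by field_simp
      linarith

lemma sq_le_four_mul_two_pow (k : ℕ) : k ^ 2 ≤ 4 * 2 ^ k := by
  induction k with
  | zero => norm_num
  | succ k ih =>
    rcases Nat.lt_or_ge k 3 with h | h
    · interval_cases k <;> norm_num
    · have : 2 * k + 1 ≤ k ^ 2 := by nlinarith
      rw [pow_succ 2 k]
      nlinarith

variable {Ω : Type*} [MeasurableSpace Ω] {P : Measure Ω}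
  {I : ℕ → Ω → Finset (Fin d → ℤ)} {Y : ℕ → Ω → (Fin d → ℤ)}

/-- A cluster reaching `ζ` has at least `m` points within distance `m` of `ζ`. -/
lemma IsIDLA.lt_cnt (H : IsIDLA P I Y) {ζ : Fin d → ℤ} {m : ℝ} (hm : 0 ≤ m) (hζ : m < ‖rv ζ‖)
    (t : ℕ) {ω : Ω} (h : ζ ∈ I t ω) : m < cnt (I t ω) ζ m := by
  have key : ∀ k : ℕ, (k : ℝ) ≤ m → ∃ x ∈ I t ω, l1N (x - ζ) = k := by
    intro k hk
    obtain ⟨x, hx, hxk⟩ := H.exists_eq_of_lipschitz (fun x => (l1N (x - ζ) : ℤ))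
      (fun x y hy => by
        have := l1N_nbr_le hy ζ
        exact_mod_cast this) t ω h (k := k)
      (by
        have : l1N (ζ - ζ) = 0 := by simp [l1N]
        rw [this]
        positivity)
      (by
        have h1 : ‖rv (0 - ζ)‖ ≤ l1N (0 - ζ) := norm_le_l1N _
        rw [rv_sub, norm_rv_zero_sub] at h1
        have h2 : (k : ℝ) ≤ l1N (0 - ζ) := by linarith
        exact_mod_cast h2)
    exact ⟨x, hx, by exact_mod_cast hxk⟩
  choose! x hx hxk using key
  have hle : ∀ k ∈ Finset.range (⌊m⌋₊ + 1), (k : ℝ) ≤ m := by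
    intro k hk
    have : k ≤ ⌊m⌋₊ := by
      have := Finset.mem_range.1 hk
      omega
    exact (Nat.cast_le.2 this).trans (Nat.floor_le hm)
  have hcard : (Finset.range (⌊m⌋₊ + 1)).card ≤
      ((I t ω).filter (fun y => ‖rv y - rv ζ‖ ≤ m)).card := by
    refine Finset.card_le_card_of_injOn x (fun k hk => ?_) (fun k hk l hl hkl => ?_)
    · have hkm := hle k hk
      refine Finset.mem_coe.2 (Finset.mem_filter.2 ⟨hx k hkm, ?_⟩)
      rw [← rv_sub]
      refine (norm_le_l1N _).trans ?_
      rw [hxk k hkm]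
      exact hkm
    · rw [← hxk k (hle k hk), ← hxk l (hle l hl), hkl]
  rw [Finset.card_range] at hcard
  have h1 : ((⌊m⌋₊ + 1 : ℕ) : ℝ) ≤ cnt (I t ω) ζ m := Nat.cast_le.2 hcard
  push_cast at h1
  linarith [Nat.lt_floor_add_one m]

variable [IsProbabilityMeasure P]

lemma IsIDLA.prob_stages_le (H : IsIDLA P I Y) (hd : 2 ≤ d) {β s₀ : ℝ} (hβ0 : 0 < β)
    (hs₀ : 1 ≤ s₀) (hβ : SparseExit d β s₀) {ζ : Fin d → ℤ} {τ E : ℝ} (hτ : 0 ≤ τ)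
    {J : ℕ → ℕ} {s : ℕ → ℝ} (hs : ∀ j, s₀ ≤ s j) (hJ : ∀ j, (10 : ℝ) * 2 ^ d ≤ J j)
    (hT : ∀ j, τ * 2 ^ (d * j) ≤ J j * (β * s j ^ d))
    (hE : ∀ j, E ≤ τ * 2 ^ (d * j) * J j / (10 * 2 ^ d)) (t k : ℕ) {r : ℝ} (hr : r < ‖rv ζ‖) :
    P {ω | cnt (I t ω) ζ r ≤ τ * 2 ^ (d * k) ∧
      τ < cnt (I t ω) ζ (r - ∑ j ∈ Finset.range k, J (j + 1) * (4 * (s (j + 1) + 2)))} ≤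
      k * ENNReal.ofReal (Real.exp (-E)) := by
  induction k generalizing r with
  | zero =>
    have : {ω | cnt (I t ω) ζ r ≤ τ * 2 ^ (d * 0) ∧ τ < cnt (I t ω) ζ
        (r - ∑ j ∈ Finset.range 0, J (j + 1) * (4 * (s (j + 1) + 2)))} = ∅ := by
      ext ω
      simp
    rw [this]
    simp
  | succ k ih =>
    set R : ℝ := J (k + 1) * (4 * (s (k + 1) + 2)) with hR
    have hR0 : 0 ≤ R := mul_nonneg (Nat.cast_nonneg _) (by linarith [hs (k + 1)])
    have h1 := H.prob_stage_le hd hβ0 hs₀ hβ (hs (k + 1)) hr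
      (show 0 ≤ τ * 2 ^ (d * (k + 1)) by positivity) (hT (k + 1)) (hJ (k + 1)) t
    have h2 := ih (r := r - R) (by linarith)
    have e : τ * 2 ^ (d * (k + 1)) / 2 ^ d = τ * 2 ^ (d * k) := by
      rw [mul_add, pow_add, mul_one]; field_simp
    rw [e] at h1
    have hsub : {ω | cnt (I t ω) ζ r ≤ τ * 2 ^ (d * (k + 1)) ∧ τ < cnt (I t ω) ζ
        (r - ∑ j ∈ Finset.range (k + 1), J (j + 1) * (4 * (s (j + 1) + 2)))} ⊆
        {ω | cnt (I t ω) ζ (r - R) ≤ τ * 2 ^ (d * k) ∧ τ < cnt (I t ω) ζ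
          (r - R - ∑ j ∈ Finset.range k, J (j + 1) * (4 * (s (j + 1) + 2)))} ∪
        {ω | cnt (I t ω) ζ r ≤ τ * 2 ^ (d * (k + 1)) ∧ τ * 2 ^ (d * k) < cnt (I t ω) ζ (r - R)} := by
      rintro ω ⟨ha, hb⟩
      rw [Finset.sum_range_succ, ← hR] at hb
      rcases le_or_gt (cnt (I t ω) ζ (r - R)) (τ * 2 ^ (d * k)) with h | h
      · refine Or.inl ⟨h, ?_⟩
        rwa [sub_sub, add_comm R]
      · exact Or.inr ⟨ha, h⟩
    refine (measure_mono hsub).trans ((measure_union_le _ _).trans ?_)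
    push_cast
    rw [add_mul, one_mul]
    refine add_le_add h2 (h1.trans (ENNReal.ofReal_le_ofReal (Real.exp_le_exp.2 ?_)))
    linarith [hE (k + 1)]

lemma IsIDLA.exists_prob_tentacle_le (H : IsIDLA P I Y) (hd : 2 ≤ d) :
    ∃ b c m₀ : ℝ, 0 < b ∧ 0 < c ∧ 1 ≤ m₀ ∧ ∀ (m : ℝ) (ζ : Fin d → ℤ) (t : ℕ), m₀ ≤ m →
      m < ‖rv ζ‖ → P {ω | ζ ∈ I t ω ∧ cnt (I t ω) ζ m ≤ b * m ^ d} ≤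
        ENNReal.ofReal (m * Real.exp (-(c * tentacleExp d m))) := by
  have hd0 : d ≠ 0 := by omega
  obtain ⟨β, s₀, hβ0, hs₀, hβ⟩ := exists_half_le_sum_exitMeas hd
  obtain ⟨A, c, hA, hc, hpar⟩ := exists_stage_params hd hβ0 hs₀
  set b₀ : ℝ := 1 / (64 * (A + 1)) with hb₀
  have hb0 : 0 < b₀ := by positivity
  have hb64 : b₀ * (64 * (A + 1)) = 1 := by rw [hb₀]; field_simp
  have hb1 : b₀ ≤ 1 / 64 := by
    rw [hb₀]
    exact one_div_le_one_div_of_le (by norm_num) (by linarith)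
  refine ⟨b₀ ^ d / 16, c / (10 * 2 ^ d), 256 * (A + 1) ^ 2, by positivity, by positivity,
    by nlinarith, fun m ζ t hm hζ => ?_⟩
  have hm1 : 1 ≤ m := by nlinarith
  have hm0 : 0 < m := by linarith
  set y : ℝ := m ^ ((1 : ℝ) / d) with hy
  have hy1 : 1 ≤ y := Real.one_le_rpow hm1 (by positivity)
  have hy0 : 0 < y := by linarith
  have hyd : y ^ d = m := by
    rw [hy, ← Real.rpow_natCast, ← Real.rpow_mul hm0.le, one_div,
      inv_mul_cancel₀ (by exact_mod_cast hd0), Real.rpow_one]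
  obtain ⟨J, s, hJs⟩ := hpar m y hy1 hyd
  have hex : ∃ k : ℕ, b₀ * m ≤ y * 2 ^ k := by
    obtain ⟨k, hk⟩ := pow_unbounded_of_one_lt (b₀ * m) (show (1 : ℝ) < 2 by norm_num)
    refine ⟨k, hk.le.trans ?_⟩
    have : (0 : ℝ) < 2 ^ k := by positivity
    nlinarith
  classical
  set k := Nat.find hex with hk
  have hk1 : b₀ * m ≤ y * 2 ^ k := Nat.find_spec hex
  have hk2 : k = 0 ∨ y * 2 ^ k ≤ 2 * (b₀ * m) := by
    rcases Nat.eq_zero_or_pos k with h | h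
    · exact Or.inl h
    · right
      have := Nat.find_min hex (show k - 1 < k by omega)
      push Not at this
      have e : (2 : ℝ) ^ k = 2 * 2 ^ (k - 1) := by
        rw [← pow_succ']; congr 1; omega
      rw [e]
      linarith
  have hk2pow : k ≠ 0 → (2 : ℝ) ^ k ≤ m / 32 := by
    intro h
    have h1 := hk2.resolve_left h
    have h2 : 1 * (2 : ℝ) ^ k ≤ y * 2 ^ k := mul_le_mul_of_nonneg_right hy1 (by positivity)
    have h3 := mul_le_mul_of_nonneg_right hb1 hm0.le
    linarith
  have hkm : (k : ℝ) ≤ m := by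
    rcases eq_or_ne k 0 with h | h
    · rw [h]; simpa using hm0.le
    · have h1 := hk2pow h
      have h2 : (k : ℝ) ≤ 2 ^ k := by exact_mod_cast (Nat.lt_two_pow_self (n := k)).le
      linarith
  have hAk : A * k ≤ m / 8 := by
    rcases eq_or_ne k 0 with h | h
    · rw [h]; simp; positivity
    · have h1 := hk2pow h
      have h2 : (k : ℝ) ^ 2 ≤ 4 * 2 ^ k := by exact_mod_cast sq_le_four_mul_two_pow k
      have h3 : (A * k) ^ 2 ≤ (m / 8) ^ 2 := by
        have h4 : A ^ 2 * (k : ℝ) ^ 2 ≤ A ^ 2 * (m / 8) :=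
          mul_le_mul_of_nonneg_left (by linarith) (by positivity)
        have h5 : A ^ 2 * m ≤ (m / 16) * m := by
          refine mul_le_mul_of_nonneg_right ?_ hm0.le
          nlinarith
        have h6 : 0 < m * m := by positivity
        calc (A * k) ^ 2 = A ^ 2 * (k : ℝ) ^ 2 := by ring
          _ ≤ (m / 16) * m / 8 := by linarith
          _ ≤ (m / 8) ^ 2 := by nlinarith
      exact (abs_le_of_sq_le_sq' h3 (by positivity)).2
  set L : ℝ := ∑ j ∈ Finset.range k, J (j + 1) * (4 * (s (j + 1) + 2)) with hL
  have hLm : L ≤ m / 2 := by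
    rcases eq_or_ne k 0 with h | h
    · rw [hL, h]; simp; positivity
    have h1 : L ≤ ∑ j ∈ Finset.range k,
        (A * (1 + y * 2 ^ (j + 1)) + m / 8 * (1 / 2) ^ (j + 1)) :=
      Finset.sum_le_sum fun j _ => (hJs (j + 1)).2.2.2.1
    have h2 : ∑ j ∈ Finset.range k, (A * (1 + y * 2 ^ (j + 1)) + m / 8 * (1 / 2) ^ (j + 1)) =
        A * k + 2 * A * (y * ∑ j ∈ Finset.range k, 2 ^ j) +
          m / 16 * ∑ j ∈ Finset.range k, (1 / 2) ^ j := by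
      have h3 : A * k = ∑ _j ∈ Finset.range k, A := by
        rw [Finset.sum_const, Finset.card_range, nsmul_eq_mul, mul_comm]
      rw [h3, Finset.mul_sum, Finset.mul_sum, Finset.mul_sum, ← Finset.sum_add_distrib,
        ← Finset.sum_add_distrib]
      refine Finset.sum_congr rfl fun j _ => ?_
      rw [pow_succ, pow_succ]
      ring
    have h3 : ∑ j ∈ Finset.range k, (2 : ℝ) ^ j ≤ 2 ^ k := by
      rw [geom_sum_eq (by norm_num)]
      have : (0 : ℝ) < 2 ^ k := by positivity
      linarith
    have h4 : ∑ j ∈ Finset.range k, ((1 : ℝ) / 2) ^ j ≤ 2 := sum_geometric_two_le k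
    have h5 : y * ∑ j ∈ Finset.range k, (2 : ℝ) ^ j ≤ 2 * (b₀ * m) :=
      (mul_le_mul_of_nonneg_left h3 hy0.le).trans (hk2.resolve_left h)
    have h6 : 2 * A * (y * ∑ j ∈ Finset.range k, (2 : ℝ) ^ j) ≤ 2 * A * (2 * (b₀ * m)) :=
      mul_le_mul_of_nonneg_left h5 (by positivity)
    have h7 : 2 * A * (2 * (b₀ * m)) ≤ m / 8 := by
      have h8 : b₀ * (64 * (A + 1)) * m = m := by rw [hb64, one_mul]
      have h9 : 0 < b₀ * m := by positivity
      nlinarith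
    have h8 := mul_le_mul_of_nonneg_left h4 (show 0 ≤ m / 16 by positivity)
    linarith
  have hbk : b₀ ^ d / 16 * m ^ d ≤ m / 16 * 2 ^ (d * k) := by
    have h1 : (b₀ * m) ^ d ≤ (y * 2 ^ k) ^ d := pow_le_pow_left₀ (by positivity) hk1 d
    rw [mul_pow, mul_pow, hyd, ← pow_mul, mul_comm k] at h1
    linarith
  have hmain := H.prob_stages_le hd hβ0 hs₀ hβ (ζ := ζ) (τ := m / 16)
    (E := c / (10 * 2 ^ d) * tentacleExp d m) (by positivity)
    (fun j => (hJs j).1) (fun j => (hJs j).2.1) (fun j => (hJs j).2.2.1)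
    (fun j => by
      rw [le_div_iff₀ (by positivity)]
      refine le_trans (le_of_eq ?_) (hJs j).2.2.2.2
      field_simp) t k hζ
  refine (measure_mono ?_).trans (hmain.trans ?_)
  · rintro ω ⟨h1, h2⟩
    refine ⟨h2.trans hbk, ?_⟩
    have h3 := H.lt_cnt (m := m / 2) (by positivity) (by linarith) t h1
    have h4 := cnt_mono (I t ω) ζ (show m / 2 ≤ m - L by linarith)
    linarith
  · rw [ENNReal.ofReal_mul hm0.le]
    refine mul_le_mul' ?_ le_rfl
    rw [← ENNReal.ofReal_natCast]
    exact ENNReal.ofReal_le_ofReal hkm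

end Tentacle

section Outer

variable {d : ℕ}

/-- Difference of the smoothed kernels at `ζ` and at its image with respect to the sphere of
radius `R = ‖ζ‖ + m`. -/
noncomputable def outH (m : ℝ) (ζ x : Fin d → ℤ) : ℝ :=
  fker d (‖rv x - rv ζ‖ ^ 2 + aC d) -
    fker d (‖rv x - rv ζ‖ ^ 2 + imgD (‖rv ζ‖ + m) ζ x - aC d)

/-- Standing assumptions on the parameters of `outH`. -/
structure OutData (d : ℕ) (N m : ℝ) (ζ : Fin d → ℤ) : Prop where
  hd : 2 ≤ d
  hN : 3 ≤ N
  hm : 16 * aC d ≤ m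
  hζ : 8 * m ≤ ‖rv ζ‖
  hζN : ‖rv ζ‖ + m ≤ N

namespace OutData

variable {N m : ℝ} {ζ : Fin d → ℤ}

lemma basic (H : OutData d N m ζ) : 65 ≤ aC d ∧ 1040 ≤ m ∧ 8320 ≤ ‖rv ζ‖ := by
  have := aC_ge (d := d)
  have := H.hm
  have := H.hζ
  refine ⟨?_, ?_, ?_⟩ <;> linarith

lemma one_sub_ge (H : OutData d N m ζ) :
    m / (‖rv ζ‖ + m) ≤ 1 - ‖rv ζ‖ ^ 2 / (‖rv ζ‖ + m) ^ 2 := by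
  obtain ⟨h1, h2, h3⟩ := H.basic
  have hR : 0 < ‖rv ζ‖ + m := by linarith
  rw [div_le_iff₀ hR, sub_mul, one_mul, pow_two (‖rv ζ‖ + m), ← div_div, div_mul_cancel₀ _ hR.ne',
    le_sub_iff_add_le, ← le_sub_iff_add_le', div_le_iff₀ hR]
  nlinarith

lemma one_sub_le (H : OutData d N m ζ) :
    1 - ‖rv ζ‖ ^ 2 / (‖rv ζ‖ + m) ^ 2 ≤ 2 * (m / (‖rv ζ‖ + m)) := by
  obtain ⟨h1, h2, h3⟩ := H.basic
  have hR : 0 < ‖rv ζ‖ + m := by linarith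
  have e : 1 - ‖rv ζ‖ ^ 2 / (‖rv ζ‖ + m) ^ 2 =
      2 * (m / (‖rv ζ‖ + m)) - (m / (‖rv ζ‖ + m)) ^ 2 := by
    field_simp; ring
  rw [e]
  have := sq_nonneg (m / (‖rv ζ‖ + m))
  linarith

lemma le_imgD (H : OutData d N m ζ) {x : Fin d → ℤ} (hx : ‖rv x‖ ≤ ‖rv ζ‖ + 2) :
    m ^ 2 / 2 ≤ imgD (‖rv ζ‖ + m) ζ x := by
  obtain ⟨h1, h2, h3⟩ := H.basic
  have hR : 0 < ‖rv ζ‖ + m := by linarith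
  have hx0 := norm_nonneg (rv x)
  have h4 : m / 2 * (‖rv ζ‖ + m) ≤ (‖rv ζ‖ + m) ^ 2 - ‖rv x‖ ^ 2 := by
    have e : (‖rv ζ‖ + m) ^ 2 - ‖rv x‖ ^ 2 = (‖rv ζ‖ + m - ‖rv x‖) * (‖rv ζ‖ + m + ‖rv x‖) := by ring
    rw [e]
    exact mul_le_mul (by linarith) (by linarith) hR.le (by linarith)
  calc m ^ 2 / 2 = m / (‖rv ζ‖ + m) * (m / 2 * (‖rv ζ‖ + m)) := by field_simp
    _ ≤ (1 - ‖rv ζ‖ ^ 2 / (‖rv ζ‖ + m) ^ 2) * ((‖rv ζ‖ + m) ^ 2 - ‖rv x‖ ^ 2) :=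
        mul_le_mul H.one_sub_ge h4 (by positivity) (le_trans (by positivity) H.one_sub_ge)
    _ = _ := rfl

lemma imgD_le (H : OutData d N m ζ) {x : Fin d → ℤ} (hx : ‖rv x‖ ≤ ‖rv ζ‖ + 2) :
    imgD (‖rv ζ‖ + m) ζ x ≤ 4 * m * (m + ‖rv x - rv ζ‖) := by
  obtain ⟨h1, h2, h3⟩ := H.basic
  have hR : 0 < ‖rv ζ‖ + m := by linarith
  have hx0 := norm_nonneg (rv x)
  have hr0 := norm_nonneg (rv x - rv ζ)
  have h5 := norm_le_add_dist' ζ x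
  have h4 : (‖rv ζ‖ + m) ^ 2 - ‖rv x‖ ^ 2 ≤ (m + ‖rv x - rv ζ‖) * (2 * (‖rv ζ‖ + m)) := by
    have e : (‖rv ζ‖ + m) ^ 2 - ‖rv x‖ ^ 2 = (‖rv ζ‖ + m - ‖rv x‖) * (‖rv ζ‖ + m + ‖rv x‖) := by ring
    rw [e]
    exact mul_le_mul (by linarith) (by linarith) (by linarith) (by linarith)
  calc imgD (‖rv ζ‖ + m) ζ x =
      (1 - ‖rv ζ‖ ^ 2 / (‖rv ζ‖ + m) ^ 2) * ((‖rv ζ‖ + m) ^ 2 - ‖rv x‖ ^ 2) := rfl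
    _ ≤ 2 * (m / (‖rv ζ‖ + m)) * ((m + ‖rv x - rv ζ‖) * (2 * (‖rv ζ‖ + m))) := by
        refine mul_le_mul H.one_sub_le h4 ?_ (by positivity)
        nlinarith
    _ = _ := by field_simp; ring

/-- The second argument of `outH` exceeds the first by a positive amount. -/
lemma two_aC_le (H : OutData d N m ζ) {x : Fin d → ℤ} (hx : ‖rv x‖ ≤ ‖rv ζ‖ + 2) :
    m ^ 2 / 4 ≤ imgD (‖rv ζ‖ + m) ζ x - 2 * aC d := by
  have h1 := H.le_imgD hx
  obtain ⟨h2, h3, -⟩ := H.basic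
  have h4 := mul_le_mul H.hm H.hm (by linarith) (by linarith)
  nlinarith

lemma outH_eq (m : ℝ) (ζ x : Fin d → ℤ) : outH m ζ x = fker d (rho ζ x ^ 2) -
    fker d (rho ζ x ^ 2 + (imgD (‖rv ζ‖ + m) ζ x - 2 * aC d)) := by
  unfold outH
  rw [rho_sq, show ‖rv x - rv ζ‖ ^ 2 + aC d + (imgD (‖rv ζ‖ + m) ζ x - 2 * aC d) =
    ‖rv x - rv ζ‖ ^ 2 + imgD (‖rv ζ‖ + m) ζ x - aC d by ring]

lemma outH_nonneg (H : OutData d N m ζ) {x : Fin d → ℤ} (hx : ‖rv x‖ ≤ ‖rv ζ‖ + 2) :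
    0 ≤ outH m ζ x := by
  rw [outH_eq, sub_nonneg]
  have := H.two_aC_le hx
  have h := rho_pos ζ x
  exact fker_anti H.hd (by positivity) (by nlinarith)

lemma outH_le (H : OutData d N m ζ) {x : Fin d → ℤ} (hx : ‖rv x‖ ≤ ‖rv ζ‖ + 2) :
    outH m ζ x ≤ 8 * (m * (rho ζ x ^ (d - 1))⁻¹) := by
  obtain ⟨h1, h2, h3⟩ := H.basic
  have hd := H.hd
  have h4 := H.two_aC_le hx
  have h5 := H.imgD_le hx
  have hp := rho_pos ζ x
  have hm0 : 0 < m := by linarith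
  have hr0 := norm_nonneg (rv x - rv ζ)
  have hD : 0 ≤ imgD (‖rv ζ‖ + m) ζ x - 2 * aC d := le_trans (by positivity) h4
  rw [outH_eq]
  rcases le_total ‖rv x - rv ζ‖ m with h | h
  · refine (fker_sub_le_sqrt hd (by positivity) hD).trans ?_
    have e : ((1 - (d : ℝ)) / 2) = -(((d - 1 : ℕ) : ℝ) / 2) := by
      rw [Nat.cast_sub (by omega)]; push_cast; ring
    rw [e, rpow_neg_half_natCast (by positivity), Real.sqrt_sq hp.le]
    have h6 : √(imgD (‖rv ζ‖ + m) ζ x - 2 * aC d) ≤ 4 * m := by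
      refine Real.sqrt_le_iff.2 ⟨by positivity, ?_⟩
      nlinarith
    have h7 := mul_le_mul_of_nonneg_right h6 (show 0 ≤ 2 * (rho ζ x ^ (d - 1))⁻¹ by positivity)
    linarith
  · refine (fker_sub_le hd (by positivity) hD).trans ?_
    rw [rpow_neg_half_natCast (by positivity), Real.sqrt_sq hp.le]
    have h6 : imgD (‖rv ζ‖ + m) ζ x - 2 * aC d ≤ 8 * m * rho ζ x := by
      have h7 := mul_le_mul_of_nonneg_left (h.trans (norm_le_rho ζ x)) hm0.le
      have h8 := mul_le_mul_of_nonneg_left (norm_le_rho ζ x) hm0.le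
      linarith
    refine (mul_le_mul_of_nonneg_right h6 (by positivity)).trans (le_of_eq ?_)
    have e : rho ζ x ^ d = rho ζ x * rho ζ x ^ (d - 1) := by
      rw [← pow_succ']; congr 1; omega
    rw [e]
    field_simp

lemma outH_zero_nonneg (H : OutData d N m ζ) : 0 ≤ outH m ζ 0 :=
  H.outH_nonneg (by rw [rv_zero, norm_zero]; positivity)

lemma outH_zero_le (H : OutData d N m ζ) : outH m ζ 0 ≤ 8 * (m * (‖rv ζ‖ ^ (d - 1))⁻¹) := by
  obtain ⟨h1, h2, h3⟩ := H.basic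
  refine (H.outH_le (by rw [rv_zero, norm_zero]; positivity)).trans ?_
  have hr := norm_le_rho ζ 0
  rw [norm_rv_zero_sub] at hr
  have h4 : (rho ζ 0 ^ (d - 1))⁻¹ ≤ (‖rv ζ‖ ^ (d - 1))⁻¹ :=
    inv_anti₀ (pow_pos (by linarith) _) (pow_le_pow_left₀ (norm_nonneg _) hr _)
  have h5 := mul_le_mul_of_nonneg_left h4 (show 0 ≤ 8 * m by linarith)
  linarith

lemma le_outH_near (H : OutData d N m ζ) {x : Fin d → ℤ} (hx : ‖rv x‖ ≤ ‖rv ζ‖ + 2)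
    (hr : ‖rv x - rv ζ‖ ≤ m / 4) : m ^ 2 / 4 * ((3 * m) ^ d)⁻¹ ≤ outH m ζ x := by
  obtain ⟨h1, h2, h3⟩ := H.basic
  have h4 := H.two_aC_le hx
  have h5 := H.imgD_le hx
  have hp := rho_pos ζ x
  have hm0 : 0 < m := by linarith
  have hr0 := norm_nonneg (rv x - rv ζ)
  have hD : 0 ≤ imgD (‖rv ζ‖ + m) ζ x - 2 * aC d := le_trans (by positivity) h4
  rw [outH_eq]
  refine le_trans ?_ (le_fker_sub H.hd (by positivity) hD)
  rw [rpow_neg_half_natCast (by positivity)]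
  have h6 : √(rho ζ x ^ 2 + (imgD (‖rv ζ‖ + m) ζ x - 2 * aC d)) ≤ 3 * m := by
    refine Real.sqrt_le_iff.2 ⟨by positivity, ?_⟩
    rw [rho_sq]
    have h7 : ‖rv x - rv ζ‖ ^ 2 ≤ (m / 4) ^ 2 := pow_le_pow_left₀ hr0 hr 2
    have h8 := mul_le_mul_of_nonneg_left hr (show 0 ≤ 4 * m by linarith)
    have h9 : 0 < m * m := by positivity
    nlinarith
  refine mul_le_mul h4 (inv_anti₀ ?_ (pow_le_pow_left₀ (Real.sqrt_nonneg _) h6 d)) (by positivity) hD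
  have : 0 < √(rho ζ x ^ 2 + (imgD (‖rv ζ‖ + m) ζ x - 2 * aC d)) :=
    Real.sqrt_pos.2 (by positivity)
  positivity

lemma lap_outH (H : OutData d N m ζ) {x : Fin d → ℤ} (hx : ‖rv x‖ ≤ ‖rv ζ‖ + 2) :
    lap (outH m ζ) x ≤ 0 ∧ -(4 * aC d * (rho ζ x ^ (d + 2))⁻¹) ≤ lap (outH m ζ) x := by
  obtain ⟨h1, h2, h3⟩ := H.basic
  have hd := H.hd
  have ha := aC_pos (d := d)
  have hR : 0 < ‖rv ζ‖ + m := by linarith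
  have hζ0 : ‖rv ζ‖ ≠ 0 := by linarith
  have hp := rho_pos ζ x
  have h4 := H.two_aC_le hx
  have hm2 : 0 ≤ m ^ 2 / 4 := by positivity
  have hμ : 0 ≤ ‖rv ζ‖ ^ 2 / (‖rv ζ‖ + m) ^ 2 := by positivity
  have hμ1 : ‖rv ζ‖ ^ 2 / (‖rv ζ‖ + m) ^ 2 ≤ 1 :=
    div_le_one_of_le₀ (pow_le_pow_left₀ (norm_nonneg _) (by linarith) 2) (sq_nonneg _)
  obtain ⟨a1, a2⟩ := lap_fker_add_le hd x (rv ζ) zero_le_one le_rfl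
  obtain ⟨b1, b2⟩ := lap_fker_sub_le hd x (((‖rv ζ‖ + m) ^ 2 / ‖rv ζ‖ ^ 2) • rv ζ) hμ hμ1
    (by rw [← imgD_eq hR.ne' hζ0]; linarith [sq_nonneg ‖rv x - rv ζ‖])
  simp only [one_mul, ← imgD_eq hR.ne' hζ0] at a1 a2 b1 b2
  have e : lap (outH m ζ) x = lap (fun y => fker d (‖rv y - rv ζ‖ ^ 2 + aC d)) x -
      lap (fun y => fker d (‖rv y - rv ζ‖ ^ 2 + imgD (‖rv ζ‖ + m) ζ y - aC d)) x := lap_sub _ _ x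
  have p0 : (0 : ℝ) < ‖rv x - rv ζ‖ ^ 2 + aC d := by positivity
  have p3 : ‖rv x - rv ζ‖ ^ 2 + aC d ≤ ‖rv x - rv ζ‖ ^ 2 + imgD (‖rv ζ‖ + m) ζ x - aC d := by
    linarith
  have p1 : (0 : ℝ) ≤ (‖rv x - rv ζ‖ ^ 2 + aC d) ^ (-((d : ℝ) / 2) - 1) :=
    Real.rpow_nonneg p0.le _
  have p2 : (0 : ℝ) ≤ (‖rv x - rv ζ‖ ^ 2 + imgD (‖rv ζ‖ + m) ζ x - aC d) ^ (-((d : ℝ) / 2) - 1) :=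
    Real.rpow_nonneg (by linarith) _
  rw [e]
  refine ⟨by linarith [mul_nonneg hμ p2], ?_⟩
  have c2 : (‖rv x - rv ζ‖ ^ 2 + imgD (‖rv ζ‖ + m) ζ x - aC d) ^ (-((d : ℝ) / 2) - 1) ≤
      (‖rv x - rv ζ‖ ^ 2 + aC d) ^ (-((d : ℝ) / 2) - 1) :=
    Real.rpow_le_rpow_of_nonpos p0 p3 (by
      have := neg_half_nonpos (d := d); linarith)
  have c3 := mul_le_of_le_one_left p2 hμ1
  have c5 := mul_le_mul_of_nonneg_left (c3.trans c2) (by positivity : 0 ≤ 2 * aC d)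
  have e2 : (‖rv x - rv ζ‖ ^ 2 + aC d) ^ (-((d : ℝ) / 2) - 1) = (rho ζ x ^ (d + 2))⁻¹ := by
    rw [← rho_sq, rpow_neg_half_sub_one (by positivity), Real.sqrt_sq hp.le]
  rw [e2] at c5 a2
  linarith

lemma abs_outH_sub_le (H : OutData d N m ζ) {x : Fin d → ℤ} (hx : ‖rv x‖ ≤ ‖rv ζ‖ / 4) :
    |outH m ζ x - outH m ζ 0| ≤
      (36 * d * 2 ^ (d + 2) + 2 ^ d) * (‖rv x‖ * m * (‖rv ζ‖ ^ d)⁻¹) := by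
  obtain ⟨h1, h2, h3⟩ := H.basic
  have hζm := H.hζ
  set R := ‖rv ζ‖ with hR
  have hm0 : 0 < m := by linarith
  have hR0 : 0 < R := by linarith
  have hx0 := norm_nonneg (rv x)
  have ha := aC_pos (d := d)
  have hz : ‖rv (0 : Fin d → ℤ)‖ = 0 := by rw [rv_zero, norm_zero]
  have hxR : ‖rv x‖ ≤ R + 2 := by linarith
  have h0R : ‖rv (0 : Fin d → ℤ)‖ ≤ R + 2 := by linarith
  have ix := H.two_aC_le hxR
  have i0 := H.two_aC_le h0R
  have hm2 : 0 ≤ m ^ 2 / 4 := by positivity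
  have hrx : ‖rv x - rv ζ‖ ≤ ‖rv x‖ + R := dist_le_add_norm ζ x
  have hrx' : R ≤ ‖rv x‖ + ‖rv x - rv ζ‖ := norm_le_add_dist' ζ x
  have ixle : imgD (R + m) ζ x - 2 * aC d ≤ 12 * m * R := by
    have h4 := H.imgD_le hxR
    have h5 : 4 * m * (m + ‖rv x - rv ζ‖) ≤ 4 * m * (3 * R) :=
      mul_le_mul_of_nonneg_left (by linarith) (by linarith)
    linarith
  have ixd : |(imgD (R + m) ζ x - 2 * aC d) - (imgD (R + m) ζ 0 - 2 * aC d)| ≤ m * ‖rv x‖ := by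
    have e : (imgD (R + m) ζ x - 2 * aC d) - (imgD (R + m) ζ 0 - 2 * aC d) =
      -((1 - R ^ 2 / (R + m) ^ 2) * ‖rv x‖ ^ 2) := by unfold imgD; rw [hz]; ring
    have p : 0 ≤ 1 - R ^ 2 / (R + m) ^ 2 := le_trans (by positivity) H.one_sub_ge
    rw [e, abs_neg, abs_of_nonneg (by positivity)]
    calc (1 - R ^ 2 / (R + m) ^ 2) * ‖rv x‖ ^ 2 ≤ 2 * (m / (R + m)) * ‖rv x‖ ^ 2 :=
          mul_le_mul_of_nonneg_right H.one_sub_le (by positivity)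
      _ = (2 * (m / (R + m)) * ‖rv x‖) * ‖rv x‖ := by ring
      _ ≤ (2 * (m / (R + m)) * ‖rv x‖) * ((R + m) / 2) :=
          mul_le_mul_of_nonneg_left (by linarith) (by positivity)
      _ = m * ‖rv x‖ := by field_simp
  have hAA : |rho ζ x ^ 2 - rho ζ 0 ^ 2| ≤ 3 * R * ‖rv x‖ := by
    rw [rho_sq, rho_sq, show ‖rv x - rv ζ‖ ^ 2 + aC d - (‖rv 0 - rv ζ‖ ^ 2 + aC d) =
      (‖rv x - rv ζ‖ - R) * (‖rv x - rv ζ‖ + R) by rw [norm_rv_zero_sub]; ring, abs_mul]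
    have q1 : |‖rv x - rv ζ‖ - R| ≤ ‖rv x‖ := by
      rw [abs_le]
      constructor <;> linarith
    have q2 : |‖rv x - rv ζ‖ + R| ≤ 3 * R := by
      rw [abs_of_nonneg (by positivity)]
      linarith
    calc _ ≤ ‖rv x‖ * (3 * R) := mul_le_mul q1 q2 (abs_nonneg _) hx0
      _ = _ := by ring
  have hs0 : (R / 2) ^ 2 ≤ rho ζ x ^ 2 :=
    pow_le_pow_left₀ (by positivity) ((by linarith : R / 2 ≤ ‖rv x - rv ζ‖).trans (norm_le_rho ζ x)) 2
  have hs0' : (R / 2) ^ 2 ≤ rho ζ 0 ^ 2 := by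
    refine pow_le_pow_left₀ (by positivity) (le_trans ?_ (norm_le_rho ζ 0)) 2
    rw [norm_rv_zero_sub]; linarith
  have key := fker_diff_diff_le H.hd (s₀ := (R / 2) ^ 2) (by positivity) hs0 hs0'
    (D := imgD (R + m) ζ x - 2 * aC d) (D' := imgD (R + m) ζ 0 - 2 * aC d) (by linarith)
    (by linarith)
  rw [Real.sqrt_sq (by positivity)] at key
  rw [outH_eq, outH_eq]
  refine key.trans ?_
  have t1 : d * ((R / 2) ^ (d + 2))⁻¹ * (imgD (R + m) ζ x - 2 * aC d) *
      |rho ζ x ^ 2 - rho ζ 0 ^ 2| ≤ d * ((R / 2) ^ (d + 2))⁻¹ * (12 * m * R) * (3 * R * ‖rv x‖) :=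
    mul_le_mul (mul_le_mul_of_nonneg_left ixle (by positivity)) hAA (abs_nonneg _) (by positivity)
  have t2 : ((R / 2) ^ d)⁻¹ *
      |(imgD (R + m) ζ x - 2 * aC d) - (imgD (R + m) ζ 0 - 2 * aC d)| ≤
      ((R / 2) ^ d)⁻¹ * (m * ‖rv x‖) := mul_le_mul_of_nonneg_left ixd (by positivity)
  refine (add_le_add t1 t2).trans (le_of_eq ?_)
  rw [div_pow, div_pow, inv_div, inv_div, pow_add R d 2]
  field_simp
  ring

end OutData

end Outer

section OutDrift

variable {d : ℕ}

namespace OutData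

variable {N m k : ℝ} {ζ : Fin d → ℤ}

lemma lball_subset (H : OutData d N m ζ) {r : ℝ} (hr : r ≤ ‖rv ζ‖ + 2) :
    lball 0 r ⊆ lball ζ (3 * N) := by
  obtain ⟨h1, h2, h3⟩ := H.basic
  intro x hx
  rw [mem_lball_zero] at hx
  rw [mem_lball]
  have := dist_le_add_norm ζ x
  linarith [H.hζN]

lemma wbar_mul_lap_ge (H : OutData d N m ζ) (hk : 20 * d + aC d ≤ k) (hkm : k + m ≤ ‖rv ζ‖)
    {x : Fin d → ℤ} (hx : ‖rv x‖ ≤ k) :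
    -(4 * aC d * (4 * (d * 2 ^ (d + 1)) * (rho ζ x ^ d)⁻¹ +
      2 * 2 ^ d * 2 ^ (d + 2) * (k⁻¹ * (rho 0 x ^ (d - 1))⁻¹))) ≤
      wbar k x * lap (outH m ζ) x := by
  obtain ⟨h1, h2, h3⟩ := H.basic
  have hd := H.hd
  have hd0 : (0 : ℝ) ≤ d := Nat.cast_nonneg d
  have hk0 : 0 < k := by linarith
  have hρ := rho_pos ζ x
  have hρ0 := rho_pos 0 x
  have hx0 := norm_nonneg (rv x)
  have l1 := (H.lap_outH (x := x) (by linarith)).2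
  have w0 := wbar_nonneg hd k x
  have w1 := wbar_le_wf hd k x
  have a1 := norm_le_add_dist' ζ x
  have a2 := norm_le_rho ζ x
  have key : wbar k x * (rho ζ x ^ (d + 2))⁻¹ ≤ 4 * (d * 2 ^ (d + 1)) * (rho ζ x ^ d)⁻¹ +
      2 * 2 ^ d * 2 ^ (d + 2) * (k⁻¹ * (rho 0 x ^ (d - 1))⁻¹) := by
    have t1 : 0 ≤ 4 * (d * 2 ^ (d + 1)) * (rho ζ x ^ d)⁻¹ := by positivity
    have t2 : 0 ≤ 2 * 2 ^ d * 2 ^ (d + 2) * (k⁻¹ * (rho 0 x ^ (d - 1))⁻¹) := by positivity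
    rcases le_or_gt (k / 2) ‖rv x‖ with hx2 | hx2
    · have b1 := Wf_le hd (n := k) (s := ‖rv x‖ ^ 2) hk0 (by nlinarith)
      have b2 : (k ^ 2 - ‖rv x‖ ^ 2) ^ 2 ≤ (2 * k * rho ζ x) ^ 2 := by
        have e1 : 0 ≤ k ^ 2 - ‖rv x‖ ^ 2 := by nlinarith
        refine pow_le_pow_left₀ e1 ?_ 2
        rw [sq_sub_sq]
        exact mul_le_mul (by linarith) (by linarith) (by linarith) (by linarith)
      have b3 : d * 2 ^ (d + 1) * (k ^ 2 - ‖rv x‖ ^ 2) ^ 2 / k ^ 2 ≤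
          4 * (d * 2 ^ (d + 1)) * rho ζ x ^ 2 := by
        rw [div_le_iff₀ (by positivity)]
        calc _ ≤ d * 2 ^ (d + 1) * (2 * k * rho ζ x) ^ 2 :=
              mul_le_mul_of_nonneg_left b2 (by positivity)
          _ = _ := by ring
      have b4 : wbar k x ≤ 4 * (d * 2 ^ (d + 1)) * rho ζ x ^ 2 := by
        unfold wf at w1; linarith
      have b5 := mul_le_mul_of_nonneg_right b4 (by positivity : 0 ≤ (rho ζ x ^ (d + 2))⁻¹)
      have e : 4 * (d * 2 ^ (d + 1)) * rho ζ x ^ 2 * (rho ζ x ^ (d + 2))⁻¹ =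
          4 * (d * 2 ^ (d + 1)) * (rho ζ x ^ d)⁻¹ := by
        rw [pow_add _ d 2]; field_simp
      linarith
    · have b1 := Wf_le_of_le hd (n := k) (s := ‖rv x‖ ^ 2) hk0.le (sq_nonneg _) (by nlinarith)
      rw [← rho_zero] at b1
      have b2 : √(k ^ 2 + aC d) ^ d ≤ (2 * k) ^ d := by
        have := sqrt_sq_add_aC_le (d := d) hk0.le
        exact pow_le_pow_left₀ (Real.sqrt_nonneg _) (by linarith) _
      have b3 : 2 * k * √(k ^ 2 + aC d) ^ d * (rho 0 x ^ (d - 1))⁻¹ ≤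
          2 * k * (2 * k) ^ d * (rho 0 x ^ (d - 1))⁻¹ :=
        mul_le_mul_of_nonneg_right (mul_le_mul_of_nonneg_left b2 (by positivity)) (by positivity)
      have b4 : wbar k x ≤ 2 * k * (2 * k) ^ d * (rho 0 x ^ (d - 1))⁻¹ := by
        unfold wf at w1; linarith
      have b5 : (rho ζ x ^ (d + 2))⁻¹ ≤ 2 ^ (d + 2) * (k ^ (d + 2))⁻¹ := by
        calc (rho ζ x ^ (d + 2))⁻¹ ≤ ((k / 2) ^ (d + 2))⁻¹ :=
              inv_anti₀ (by positivity) (pow_le_pow_left₀ (by positivity) (by linarith) _)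
          _ = _ := by rw [div_pow, inv_div]; ring
      have b6 := mul_le_mul b4 b5 (by positivity) (by positivity)
      have e : 2 * k * (2 * k) ^ d * (rho 0 x ^ (d - 1))⁻¹ * (2 ^ (d + 2) * (k ^ (d + 2))⁻¹) =
          2 * 2 ^ d * 2 ^ (d + 2) * (k⁻¹ * (rho 0 x ^ (d - 1))⁻¹) := by
        rw [mul_pow, pow_add k d 2]; field_simp
      linarith
  have k1 := mul_le_mul_of_nonneg_left l1 w0
  have k2 := mul_le_mul_of_nonneg_left key (by linarith : 0 ≤ 4 * aC d)
  linarith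

lemma exists_sum_wbar_lap_ge (hd : 2 ≤ d) : ∃ C : ℝ, 0 < C ∧ ∀ (N m k : ℝ) (ζ : Fin d → ℤ),
    OutData d N m ζ → 20 * d + aC d ≤ k → k + m ≤ ‖rv ζ‖ →
      -(C * Real.log N) ≤ ∑ x ∈ lball 0 k, wbar k x * lap (outH m ζ) x := by
  obtain ⟨C₂, hC₂, hs₂⟩ := exists_sum_rho_le (d := d) (by omega)
  obtain ⟨C₃, hC₃, hs₃⟩ := exists_sum_rho_pred_le (d := d) (by omega)
  have ha := aC_pos (d := d)
  have hdpos : (0 : ℝ) < d := by exact_mod_cast (by omega : 0 < d)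
  refine ⟨4 * aC d * (4 * (d * 2 ^ (d + 1)) * (4 * C₂) + 2 * 2 ^ d * 2 ^ (d + 2) * C₃),
    by positivity, fun N m k ζ H hk hkm => ?_⟩
  obtain ⟨h1, h2, h3⟩ := H.basic
  have hk0 : 0 < k := by linarith
  have hN := H.hN
  have hL := one_le_log hN
  have s1 := Finset.sum_le_sum fun x (hx : x ∈ lball 0 k) =>
    H.wbar_mul_lap_ge hk hkm (mem_lball_zero.1 hx)
  refine le_trans ?_ s1
  rw [Finset.sum_neg_distrib, ← Finset.mul_sum, Finset.sum_add_distrib, ← Finset.mul_sum,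
    ← Finset.mul_sum, ← Finset.mul_sum, neg_le_neg_iff, mul_assoc (4 * aC d)]
  refine mul_le_mul_of_nonneg_left ?_ (by positivity)
  have a3 := (hs₂ ζ (3 * N) (by linarith) _ (H.lball_subset (r := k) (by linarith))).trans
    (mul_le_mul_of_nonneg_left (log_three_mul_le hN) hC₂.le)
  have a4 := hs₃ 0 k (by linarith) _ subset_rfl
  have a5 : k⁻¹ * ∑ x ∈ lball (0 : Fin d → ℤ) k, (rho 0 x ^ (d - 1))⁻¹ ≤ C₃ * Real.log N := by
    calc _ ≤ k⁻¹ * (C₃ * k) := mul_le_mul_of_nonneg_left a4 (by positivity)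
      _ = C₃ * 1 := by field_simp
      _ ≤ _ := mul_le_mul_of_nonneg_left hL hC₃.le
  have b1 := mul_le_mul_of_nonneg_left a3 (by positivity : 0 ≤ 4 * ((d : ℝ) * 2 ^ (d + 1)))
  have b2 := mul_le_mul_of_nonneg_left a5 (by positivity : (0 : ℝ) ≤ 2 * 2 ^ d * 2 ^ (d + 2))
  linarith

lemma exists_dens_part_ge (hd : 2 ≤ d) : ∃ C : ℝ, 0 < C ∧ ∀ (N m k : ℝ) (ζ : Fin d → ℤ),
    OutData d N m ζ → 20 * d + aC d ≤ k → k + m ≤ ‖rv ζ‖ →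
      unitBallVol d * k ^ d * outH m ζ 0 - C * m ≤
        √(k ^ 2 + aC d) ^ d * ∑ x ∈ lball 0 (k + 1), dens x * outH m ζ x := by
  obtain ⟨C₁, hC₁, hs₁⟩ := exists_sum_rho_succ_le (d := d) (by omega)
  obtain ⟨C₂, hC₂, hs₂⟩ := exists_le_sum_dens hd
  have ha := aC_pos (d := d)
  have hdpos : (0 : ℝ) < d := by exact_mod_cast (by omega : 0 < d)
  set K : ℝ := 36 * d * 2 ^ (d + 2) + 2 ^ d with hK
  have hK0 : 0 < K := by positivity
  refine ⟨2 ^ d * (32 * C₂) + 2 ^ d * (K * (2 * aC d * C₁)), by positivity,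
    fun N m k ζ H hk hkm => ?_⟩
  obtain ⟨h1, h2, h3⟩ := H.basic
  have hk0 : 0 < k := by linarith
  have hR0 : 0 < ‖rv ζ‖ := by linarith
  have hm0 : 0 < m := by linarith
  have h00 := H.outH_zero_nonneg
  have h0le := H.outH_zero_le
  set α := √(k ^ 2 + aC d) ^ d with hα
  have hα0 : 0 ≤ α := by positivity
  have hα1 : k ^ d ≤ α := pow_le_pow_left₀ hk0.le (Real.le_sqrt_of_sq_le (by linarith)) _
  have hα2 : α ≤ (2 * k) ^ d := by
    have := sqrt_sq_add_aC_le (d := d) hk0.le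
    exact pow_le_pow_left₀ (Real.sqrt_nonneg _) (by linarith) _
  have s1 : ∑ x ∈ lball 0 (k / 4), dens x * outH m ζ x ≤
      ∑ x ∈ lball 0 (k + 1), dens x * outH m ζ x := by
    refine Finset.sum_le_sum_of_subset_of_nonneg (lball_mono (by linarith)) fun x hx _ => ?_
    rw [mem_lball_zero] at hx
    exact mul_nonneg (dens_nonneg hd x) (H.outH_nonneg (by linarith))
  have s2 : outH m ζ 0 * ∑ x ∈ lball (0 : Fin d → ℤ) (k / 4), dens x -
      K * (m * (‖rv ζ‖ ^ d)⁻¹) * (2 * aC d) *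
        ∑ x ∈ lball (0 : Fin d → ℤ) (k / 4), (rho 0 x ^ (d + 1))⁻¹ ≤
      ∑ x ∈ lball 0 (k / 4), dens x * outH m ζ x := by
    rw [Finset.mul_sum, Finset.mul_sum, ← Finset.sum_sub_distrib]
    refine Finset.sum_le_sum fun x hx => ?_
    rw [mem_lball_zero] at hx
    have b1 := (abs_le.1 (H.abs_outH_sub_le (x := x) (by linarith))).1
    have b2 := dens_le hd x
    have b3 := dens_nonneg hd x
    have hρ0 := rho_pos 0 x
    have b4 : ‖rv x‖ ≤ rho 0 x := by
      have := norm_le_rho 0 x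
      rwa [rv_zero, sub_zero] at this
    have b5 : dens x * ‖rv x‖ ≤ 2 * aC d * (rho 0 x ^ (d + 1))⁻¹ := by
      calc dens x * ‖rv x‖ ≤ 2 * aC d * (rho 0 x ^ (d + 2))⁻¹ * rho 0 x :=
            mul_le_mul b2 b4 (norm_nonneg _) (by positivity)
        _ = _ := by rw [pow_add _ d 2, pow_add _ d 1]; field_simp
    have b6 := mul_le_mul_of_nonneg_left b1 b3
    have b7 := mul_le_mul_of_nonneg_left b5
      (by positivity : 0 ≤ K * (m * (‖rv ζ‖ ^ d)⁻¹))
    linarith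
  have s3 := hs₂ (k / 4) (by positivity)
  have s4 := mul_le_mul_of_nonneg_left s3 h00
  have s5 := mul_le_mul_of_nonneg_left (hs₁ 0 (lball (0 : Fin d → ℤ) (k / 4)))
    (by positivity : 0 ≤ K * (m * (‖rv ζ‖ ^ d)⁻¹) * (2 * aC d))
  have s6 : outH m ζ 0 * (unitBallVol d - C₂ / (k / 4)) -
      K * (m * (‖rv ζ‖ ^ d)⁻¹) * (2 * aC d) * C₁ ≤
      ∑ x ∈ lball 0 (k + 1), dens x * outH m ζ x := by linarith
  have s7 := mul_le_mul_of_nonneg_left s6 hα0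
  have c1 : unitBallVol d * k ^ d * outH m ζ 0 ≤ α * (outH m ζ 0 * unitBallVol d) := by
    have := mul_le_mul_of_nonneg_right hα1
      (mul_nonneg h00 (unitBallVol_pos (d := d)).le)
    linarith
  have c2 : α * (outH m ζ 0 * (C₂ / (k / 4))) ≤ 2 ^ d * (32 * C₂) * m := by
    have e1 : outH m ζ 0 * (C₂ / (k / 4)) ≤ 8 * (m * (k ^ (d - 1))⁻¹) * (C₂ / (k / 4)) := by
      refine mul_le_mul_of_nonneg_right (h0le.trans ?_) (by positivity)
      have : (‖rv ζ‖ ^ (d - 1))⁻¹ ≤ (k ^ (d - 1))⁻¹ :=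
        inv_anti₀ (by positivity) (pow_le_pow_left₀ hk0.le (by linarith) _)
      have := mul_le_mul_of_nonneg_left this hm0.le
      linarith
    calc _ ≤ (2 * k) ^ d * (8 * (m * (k ^ (d - 1))⁻¹) * (C₂ / (k / 4))) :=
          mul_le_mul hα2 e1 (by positivity) (by positivity)
      _ = _ := by
          obtain ⟨e, rfl⟩ : ∃ e, d = e + 1 := ⟨d - 1, by omega⟩
          rw [Nat.add_sub_cancel, mul_pow, pow_succ k]
          field_simp
          ring
  have c3 : α * (K * (m * (‖rv ζ‖ ^ d)⁻¹) * (2 * aC d) * C₁) ≤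
      2 ^ d * (K * (2 * aC d * C₁)) * m := by
    have e1 : α ≤ 2 ^ d * ‖rv ζ‖ ^ d := by
      refine hα2.trans ?_
      rw [← mul_pow]
      exact pow_le_pow_left₀ (by positivity) (by linarith) _
    calc _ ≤ 2 ^ d * ‖rv ζ‖ ^ d * (K * (m * (‖rv ζ‖ ^ d)⁻¹) * (2 * aC d) * C₁) :=
          mul_le_mul_of_nonneg_right e1 (by positivity)
      _ = _ := by field_simp
  linarith

lemma exists_sum_lball_ge (hd : 2 ≤ d) : ∃ C : ℝ, 0 < C ∧ ∀ (N m k : ℝ) (ζ : Fin d → ℤ),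
    OutData d N m ζ → 20 * d + aC d ≤ k → k + m ≤ ‖rv ζ‖ →
      unitBallVol d * k ^ d * outH m ζ 0 - C * (m + Real.log N) ≤
        ∑ x ∈ lball 0 (k + 1), outH m ζ x := by
  obtain ⟨C₁, hC₁, hs₁⟩ := exists_sum_wbar_lap_ge hd
  obtain ⟨C₂, hC₂, hs₂⟩ := exists_dens_part_ge hd
  refine ⟨C₁ + C₂, by positivity, fun N m k ζ H hk hkm => ?_⟩
  obtain ⟨h1, h2, h3⟩ := H.basic
  have hL := one_le_log H.hN
  have b1 := hs₁ N m k ζ H hk hkm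
  have b2 := hs₂ N m k ζ H hk hkm
  have key := sum_mul_lap (h := wbar k) (w := outH m ζ) (S := lball 0 k) (T := lball 0 (k + 1))
    (fun x hx => wbar_of_notMem hx) (lball_mono (by linarith))
    (fun x hx => latNbrs_subset_lball (mem_lball_zero.1 hx))
  have s : ∑ x ∈ lball 0 (k + 1), outH m ζ x * lap (wbar k) x +
      √(k ^ 2 + aC d) ^ d * ∑ x ∈ lball 0 (k + 1), dens x * outH m ζ x ≤
      ∑ x ∈ lball 0 (k + 1), outH m ζ x := by
    rw [Finset.mul_sum, ← Finset.sum_add_distrib]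
    refine Finset.sum_le_sum fun x hx => ?_
    rw [mem_lball_zero] at hx
    have := mul_le_mul_of_nonneg_left (lap_wbar_add_le_one hd hk hx)
      (H.outH_nonneg (x := x) (by linarith))
    linarith
  have : 0 ≤ C₁ * m := by positivity
  have : 0 ≤ C₂ * Real.log N := by positivity
  linarith

end OutData

end OutDrift

section Outer

variable {d : ℕ}

namespace OutData

lemma exists_drift_ge (hd : 2 ≤ d) : ∃ C : ℝ, 0 < C ∧ ∀ (N m ρ ℓ T : ℝ) (ζ : Fin d → ℤ)
    (A : Finset (Fin d → ℤ)), OutData d N m ζ → 20 * d + aC d + 1 ≤ ℓ → 0 ≤ ρ →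
      ρ + m ≤ ‖rv ζ‖ → T ≤ unitBallVol d * ρ ^ d → A ⊆ lball 0 (‖rv ζ‖ + 1) →
      lball 0 (ρ - ℓ) ⊆ A →
      cnt A ζ (m / 4) * (m ^ 2 / 4 * ((3 * m) ^ d)⁻¹) - C * (m * ℓ + Real.log N) ≤
        ∑ x ∈ A, outH m ζ x - T * outH m ζ 0 := by
  classical
  obtain ⟨C₁, hC₁, hs₁⟩ := exists_sum_lball_ge hd
  have hω := unitBallVol_pos (d := d)
  have hdpos : (0 : ℝ) < d := by exact_mod_cast (by omega : 0 < d)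
  have ha := aC_pos (d := d)
  refine ⟨C₁ + unitBallVol d * d * 16 + 16 * unitBallVol d, by positivity,
    fun N m ρ ℓ T ζ A H hℓ hρ hρm hT hA hin => ?_⟩
  obtain ⟨h1, h2, h3⟩ := H.basic
  have hL := one_le_log H.hN
  have hR0 : 0 < ‖rv ζ‖ := by linarith
  have hm0 : 0 < m := by linarith
  have hℓ1 : 1 ≤ ℓ := by linarith
  have h00 := H.outH_zero_nonneg
  have h0le := H.outH_zero_le
  have hmℓ : m ≤ m * ℓ := by nlinarith
  have hpos : ∀ x ∈ A, 0 ≤ outH m ζ x := fun x hx => by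
    have := mem_lball_zero.1 (hA hx)
    exact H.outH_nonneg (by linarith)
  set F := A.filter (fun y => ‖rv y - rv ζ‖ ≤ m / 4) with hF
  have hdisj : Disjoint F (lball 0 (ρ - ℓ)) := by
    rw [Finset.disjoint_left]
    intro x hx hx'
    rw [hF, Finset.mem_filter] at hx
    rw [mem_lball_zero] at hx'
    have := norm_le_add_dist' ζ x
    linarith [hx.2]
  have hsplit : ∑ x ∈ F, outH m ζ x + ∑ x ∈ lball 0 (ρ - ℓ), outH m ζ x ≤
      ∑ x ∈ A, outH m ζ x := by
    rw [← Finset.sum_union hdisj]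
    exact Finset.sum_le_sum_of_subset_of_nonneg
      (Finset.union_subset (Finset.filter_subset _ _) hin) fun x hx _ => hpos x hx
  have hthick : cnt A ζ (m / 4) * (m ^ 2 / 4 * ((3 * m) ^ d)⁻¹) ≤ ∑ x ∈ F, outH m ζ x := by
    unfold cnt
    rw [← nsmul_eq_mul]
    refine Finset.card_nsmul_le_sum _ _ _ fun x hx => ?_
    rw [Finset.mem_filter] at hx
    have := mem_lball_zero.1 (hA hx.1)
    exact H.le_outH_near (by linarith) hx.2
  have hTh : T * outH m ζ 0 ≤ unitBallVol d * ρ ^ d * outH m ζ 0 :=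
    mul_le_mul_of_nonneg_right hT h00
  have hρR : ρ ^ (d - 1) * outH m ζ 0 ≤ 8 * m := by
    calc _ ≤ ‖rv ζ‖ ^ (d - 1) * (8 * (m * (‖rv ζ‖ ^ (d - 1))⁻¹)) :=
          mul_le_mul (pow_le_pow_left₀ hρ (by linarith) _) h0le h00 (by positivity)
      _ = 8 * m := by field_simp
  have p1 : 0 ≤ C₁ * (m * ℓ + Real.log N) := by positivity
  have p2 : 0 ≤ unitBallVol d * d * 16 * Real.log N := by positivity
  have p3 : 0 ≤ 16 * unitBallVol d * Real.log N := by positivity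
  have p4 : 0 ≤ unitBallVol d * d * 16 * (m * ℓ) := by positivity
  have p5 : 0 ≤ 16 * unitBallVol d * (m * ℓ) := by positivity
  rcases le_or_gt (20 * d + aC d) (ρ - ℓ - 1) with hk | hk
  · have b1 := hs₁ N m (ρ - ℓ - 1) ζ H hk (by linarith)
    rw [sub_add_cancel] at b1
    have b2 := pow_sub_pow_le (a := ρ) (b := ρ - ℓ - 1) (by linarith) (by linarith) d
    have b3 : unitBallVol d * ρ ^ d * outH m ζ 0 -
        unitBallVol d * (ρ - ℓ - 1) ^ d * outH m ζ 0 ≤ unitBallVol d * d * 16 * (m * ℓ) := by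
      calc _ = unitBallVol d * ((ρ ^ d - (ρ - ℓ - 1) ^ d) * outH m ζ 0) := by ring
        _ ≤ unitBallVol d * ((d * (ρ - (ρ - ℓ - 1)) * ρ ^ (d - 1)) * outH m ζ 0) :=
          mul_le_mul_of_nonneg_left (mul_le_mul_of_nonneg_right b2 h00) hω.le
        _ = unitBallVol d * (d * (ℓ + 1)) * (ρ ^ (d - 1) * outH m ζ 0) := by ring
        _ ≤ unitBallVol d * (d * (2 * ℓ)) * (8 * m) := by
          refine mul_le_mul ?_ hρR (by positivity) (by positivity)
          refine mul_le_mul_of_nonneg_left ?_ hω.le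
          exact mul_le_mul_of_nonneg_left (by linarith) hdpos.le
        _ = _ := by ring
    have b4 : C₁ * (m + Real.log N) ≤ C₁ * (m * ℓ + Real.log N) :=
      mul_le_mul_of_nonneg_left (by linarith) hC₁.le
    linarith
  · have b1 : 0 ≤ ∑ x ∈ lball 0 (ρ - ℓ), outH m ζ x :=
      Finset.sum_nonneg fun x hx => hpos x (hin hx)
    have b3 : unitBallVol d * ρ ^ d * outH m ζ 0 ≤ 16 * unitBallVol d * (m * ℓ) := by
      obtain ⟨e, he⟩ : ∃ e, d = e + 1 := ⟨d - 1, by omega⟩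
      have : ρ ^ d = ρ ^ (d - 1) * ρ := by rw [← pow_succ]; congr 1; omega
      rw [this]
      calc _ = unitBallVol d * ρ * (ρ ^ (d - 1) * outH m ζ 0) := by ring
        _ ≤ unitBallVol d * (2 * ℓ) * (8 * m) := by
          refine mul_le_mul ?_ hρR (by positivity) (by positivity)
          exact mul_le_mul_of_nonneg_left (by linarith) hω.le
        _ = _ := by ring
    linarith

end OutData

lemma exp_sub_sq_le {u : ℝ} (hu : 0 ≤ u) : Real.exp (u - u ^ 2) ≤ 1 + u := by
  have h1 := Real.add_one_le_exp (-(u - u ^ 2))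
  have h2 : Real.exp (u - u ^ 2) * Real.exp (-(u - u ^ 2)) = 1 := by
    rw [← Real.exp_add, add_neg_cancel, Real.exp_zero]
  have h3 := Real.exp_pos (u - u ^ 2)
  have h4 := mul_le_mul_of_nonneg_left h1 h3.le
  have h5 : 0 < 1 - u + u ^ 2 := by nlinarith [sq_nonneg (u - 1)]
  have h6 : Real.exp (u - u ^ 2) * (1 - u + u ^ 2) ≤ (1 + u) * (1 - u + u ^ 2) := by
    have : 0 ≤ u ^ 3 := by positivity
    linarith
  exact le_of_mul_le_mul_right h6 h5

variable {Ω : Type*} [MeasurableSpace Ω] {P : Measure Ω} {I : ℕ → Ω → Finset (Fin d → ℤ)}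
  {Y : ℕ → Ω → (Fin d → ℤ)}

/-- Exponential martingale bound for an excess of mass near a distant site. -/
lemma IsIDLA.prob_outH_le (H : IsIDLA P I Y) [IsProbabilityMeasure P] {N m : ℝ} {ζ : Fin d → ℤ}
    (D : OutData d N m ζ) {lam : ℝ} (hlam : 0 ≤ lam) (t : ℕ) (Bad : Ω → Prop) (M : ℝ)
    (hBad : ∀ ω, Bad ω → I t ω ⊆ lball 0 (‖rv ζ‖ + 1) ∧
      M ≤ lam * ∑ x ∈ I t ω, outH m ζ x - lam ^ 2 * ∑ x ∈ I t ω, outH m ζ x ^ 2 -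
        (t + 1) * (lam * outH m ζ 0)) :
    P {ω | Bad ω} ≤ ENNReal.ofReal (Real.exp (-M)) := by
  classical
  have hd0 : d ≠ 0 := by have := D.hd; omega
  obtain ⟨h1, h2, h3⟩ := D.basic
  have h00 := D.outH_zero_nonneg
  set h := outH m ζ with hh
  set φ : (Fin d → ℤ) → ℝ := fun x =>
    Real.exp (lam * h x - (lam * h x) ^ 2 - lam * h 0) with hφ
  have φle : ∀ x, ‖rv x‖ ≤ ‖rv ζ‖ + 2 → φ x ≤ Real.exp (-(lam * h 0)) * (1 + lam * h x) := by
    intro x hx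
    simp only [hφ]
    rw [sub_eq_add_neg, Real.exp_add, mul_comm]
    exact mul_le_mul_of_nonneg_left (exp_sub_sq_le (mul_nonneg hlam (D.outH_nonneg hx)))
      (Real.exp_pos _).le
  have hone : Real.exp (-(lam * h 0)) * (1 + lam * h 0) ≤ 1 := by
    have := Real.add_one_le_exp (lam * h 0)
    calc Real.exp (-(lam * h 0)) * (1 + lam * h 0)
        ≤ Real.exp (-(lam * h 0)) * Real.exp (lam * h 0) :=
          mul_le_mul_of_nonneg_left (by linarith) (Real.exp_pos _).le
      _ = 1 := by rw [← Real.exp_add, neg_add_cancel, Real.exp_zero]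
  have main := H.prob_le_of_prod hd0 φ (fun x => (Real.exp_pos _).le)
    (fun A => A ⊆ lball 0 (‖rv ζ‖ + 1))
    (fun A y hA => (Finset.subset_insert y A).trans hA) ?_ t Bad (Real.exp_pos M)
    fun ω hω => ⟨(hBad ω hω).1, ?_⟩
  · refine main.trans (ENNReal.ofReal_le_ofReal ?_)
    rw [Real.exp_neg, ← one_div]
    refine div_le_div_of_nonneg_right ?_ (Real.exp_pos _).le
    exact (φle 0 (by rw [rv_zero, norm_zero]; linarith)).trans hone
  · intro A hA hAs
    have hin : ∀ x ∈ A, ‖rv x‖ ≤ ‖rv ζ‖ + 1 := fun x hx => mem_lball_zero.1 (hAs hx)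
    have hs := sum_exitMeas_mul_le hd0 (A := A) (g := fun x => 1 + lam * h x) (x := 0)
      (fun x hx => by
        have := mul_nonneg hlam (D.outH_nonneg (x := x) (by linarith [hin x hx]))
        linarith) (fun x hx => ?_) hA
    · calc ∑ y ∈ bdryF latNbrs A, exitMeas A 0 y * φ y
          ≤ ∑ y ∈ bdryF latNbrs A, exitMeas A 0 y * (Real.exp (-(lam * h 0)) * (1 + lam * h y)) := by
            refine Finset.sum_le_sum fun y hy => mul_le_mul_of_nonneg_left (φle y ?_)
              (exitMeas_nonneg hd0 A 0 y)
            obtain ⟨⟨x, hx, hxy⟩, -⟩ := mem_bdryF.1 hy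
            linarith [hin x hx, norm_nbr_le' hxy]
        _ = Real.exp (-(lam * h 0)) * ∑ y ∈ bdryF latNbrs A, exitMeas A 0 y * (1 + lam * h y) := by
            rw [Finset.mul_sum]; exact Finset.sum_congr rfl fun _ _ => by ring
        _ ≤ _ := (mul_le_mul_of_nonneg_left hs (Real.exp_pos _).le).trans hone
    · have e : nbrAvg (fun y => 1 + lam * h y) x = 1 + lam * nbrAvg h x := by
        rw [nbrAvg_add (fun _ => 1) (fun y => lam * h y), nbrAvg_const hd0, nbrAvg_smul]
      rw [e]
      have l := (D.lap_outH (x := x) (by linarith [hin x hx])).1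
      have := mul_nonneg hlam (neg_nonneg.2 l)
      unfold lap at this
      linarith
  · simp only [hφ]
    rw [← Real.exp_sum]
    refine Real.exp_le_exp.2 ((hBad ω hω).2.trans (le_of_eq ?_))
    rw [Finset.sum_sub_distrib, Finset.sum_sub_distrib, Finset.sum_const, H.card_eq,
      nsmul_eq_mul, Finset.mul_sum, Finset.mul_sum]
    push_cast
    simp only [mul_pow]

/-- A cluster that covers a ball of the right volume up to an error `ℓ` is unlikely to put a
positive density of mass near a site at distance `m` from that ball. -/
lemma IsIDLA.exists_prob_thick_le (H : IsIDLA P I Y) [IsProbabilityMeasure P] (hd : 2 ≤ d)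
    {b : ℝ} (hb : 0 < b) : ∃ c C₀ : ℝ, 0 < c ∧ 0 < C₀ ∧ ∀ (N ℓ m ρ : ℝ) (ζ : Fin d → ℤ) (t : ℕ),
      3 ≤ N → C₀ ≤ ℓ → C₀ * ℓ ≤ m → C₀ * Real.log N ≤ m ^ 2 → 8 * m ≤ ‖rv ζ‖ →
      ‖rv ζ‖ + m ≤ N → 0 ≤ ρ → ρ + m ≤ ‖rv ζ‖ → (t : ℝ) ≤ unitBallVol d * ρ ^ d →
      P {ω | I t ω ⊆ lball 0 (‖rv ζ‖ + 1) ∧ lball 0 (ρ - ℓ) ⊆ I t ω ∧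
        b * (m / 4) ^ d < cnt (I t ω) ζ (m / 4)} ≤
        ENNReal.ofReal (Real.exp (-(c * (m ^ 2 / lamN d N)))) := by
  obtain ⟨C₁, hC₁, hs₁⟩ := OutData.exists_drift_ge hd
  obtain ⟨C₂, hC₂, hs₂⟩ := exists_sum_rho_sq_le hd
  have ha := aC_pos (d := d)
  have hd0 : (0 : ℝ) ≤ d := Nat.cast_nonneg d
  set c₂ := b / (4 * 12 ^ d) with hc₂
  have hc₂0 : 0 < c₂ := by positivity
  set ε := c₂ / (256 * C₂) with hε
  have hε0 : 0 < ε := by positivity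
  refine ⟨ε * c₂ / 2, 16 * aC d + 20 * d + 1 + 8 * (C₁ + 8) / c₂, by positivity, by positivity,
    fun N ℓ m ρ ζ t hN hℓ hℓm hLm hζ hζN hρ hρm ht => ?_⟩
  have hq : 0 < 8 * (C₁ + 8) / c₂ := by positivity
  have hℓ1 : 1 ≤ ℓ := by linarith
  have hC16 : 16 * aC d ≤ m := by
    have : 1 * (16 * aC d) ≤ ℓ * (16 * aC d + 20 * d + 1 + 8 * (C₁ + 8) / c₂) :=
      mul_le_mul hℓ1 (by linarith) (by positivity) (by positivity)
    linarith
  have D : OutData d N m ζ := ⟨hd, hN, hC16, hζ, hζN⟩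
  obtain ⟨h1, h2, h3⟩ := D.basic
  have hm0 : 0 < m := by linarith
  have hΛ := one_le_lamN (d := d) hN
  have hL := one_le_log hN
  have h00 := D.outH_zero_nonneg
  have h0m : outH m ζ 0 ≤ 8 * m := by
    refine D.outH_zero_le.trans ?_
    have : (‖rv ζ‖ ^ (d - 1))⁻¹ ≤ 1 := inv_le_one_of_one_le₀ (one_le_pow₀ (by linarith))
    have := mul_le_mul_of_nonneg_left this hm0.le
    linarith
  set lam := ε / lamN d N with hlam
  have hlam0 : 0 < lam := by positivity
  have hb1 : (C₁ + 8) * (m * ℓ + Real.log N) ≤ c₂ * m ^ 2 / 4 := by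
    have e1 : 8 * (C₁ + 8) / c₂ * ℓ ≤ m := by
      refine le_trans (mul_le_mul_of_nonneg_right ?_ (by linarith)) hℓm
      linarith
    have e2 : 8 * (C₁ + 8) / c₂ * Real.log N ≤ m ^ 2 := by
      refine le_trans (mul_le_mul_of_nonneg_right ?_ (by linarith)) hLm
      linarith
    rw [div_mul_eq_mul_div, div_le_iff₀ hc₂0] at e1 e2
    have e3 := mul_le_mul_of_nonneg_right e1 hm0.le
    linarith
  have main := H.prob_outH_le D hlam0.le t (fun ω => I t ω ⊆ lball 0 (‖rv ζ‖ + 1) ∧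
    lball 0 (ρ - ℓ) ⊆ I t ω ∧ b * (m / 4) ^ d < cnt (I t ω) ζ (m / 4))
    (ε * c₂ / 2 * (m ^ 2 / lamN d N)) fun ω hω => ⟨hω.1, ?_⟩
  · exact main
  obtain ⟨hA, hin, hcnt⟩ := hω
  have d1 := hs₁ N m ρ ℓ t ζ (I t ω) D (by linarith) hρ hρm ht hA hin
  have d2 : c₂ * m ^ 2 ≤ cnt (I t ω) ζ (m / 4) * (m ^ 2 / 4 * ((3 * m) ^ d)⁻¹) := by
    calc c₂ * m ^ 2 = b * (m / 4) ^ d * (m ^ 2 / 4 * ((3 * m) ^ d)⁻¹) := by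
          have : (12 : ℝ) ^ d = 4 ^ d * 3 ^ d := by rw [← mul_pow]; norm_num
          rw [hc₂, mul_pow, div_pow, this]
          field_simp
      _ ≤ _ := mul_le_mul_of_nonneg_right hcnt.le (by positivity)
  have d3 : ∑ x ∈ I t ω, outH m ζ x ^ 2 ≤ 64 * m ^ 2 * (C₂ * lamN d N) := by
    refine le_trans (Finset.sum_le_sum (g := fun x => 64 * m ^ 2 * ((rho ζ x ^ (d - 1))⁻¹) ^ 2)
      fun x hx => ?_) ?_
    · have hx' : ‖rv x‖ ≤ ‖rv ζ‖ + 2 := by linarith [mem_lball_zero.1 (hA hx)]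
      have := pow_le_pow_left₀ (D.outH_nonneg hx') (D.outH_le hx') 2
      linarith
    · rw [← Finset.mul_sum]
      exact mul_le_mul_of_nonneg_left (hs₂ ζ N hN _ (hA.trans (D.lball_subset (by linarith))))
        (by positivity)
  have d4 : lam ^ 2 * ∑ x ∈ I t ω, outH m ζ x ^ 2 ≤ lam * (c₂ * m ^ 2 / 4) := by
    calc _ ≤ lam ^ 2 * (64 * m ^ 2 * (C₂ * lamN d N)) :=
          mul_le_mul_of_nonneg_left d3 (sq_nonneg _)
      _ = lam * (c₂ * m ^ 2 / 4) := by
          rw [hlam, hε]; field_simp; norm_num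
  have d5 : outH m ζ 0 ≤ 8 * (m * ℓ + Real.log N) := by nlinarith
  have d6 : lam * (c₂ * m ^ 2 / 2) + lam * (c₂ * m ^ 2 / 4) ≤
      lam * (∑ x ∈ I t ω, outH m ζ x - t * outH m ζ 0 - outH m ζ 0) := by
    rw [← mul_add]
    exact mul_le_mul_of_nonneg_left (by linarith) hlam0.le
  have d7 : ε * c₂ / 2 * (m ^ 2 / lamN d N) = lam * (c₂ * m ^ 2 / 2) := by
    rw [hlam]; field_simp
  linarith

end Outer

section Assembly

variable {d : ℕ} {Ω : Type*} [MeasurableSpace Ω] {P : Measure Ω}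
  {I : ℕ → Ω → Finset (Fin d → ℤ)} {Y : ℕ → Ω → (Fin d → ℤ)}

/-- The order of the fluctuations of the cluster of radius `x`. -/
noncomputable def lamE (d : ℕ) (x : ℝ) : ℝ := if d = 2 then Real.log x else √(Real.log x)

lemma one_le_lamE {x : ℝ} (hx : 3 ≤ x) : 1 ≤ lamE d x := by
  have hL := one_le_log hx
  rw [lamE]
  split_ifs
  · exact hL
  · exact Real.one_le_sqrt.2 hL

lemma lamE_le_log {x : ℝ} (hx : 3 ≤ x) : lamE d x ≤ Real.log x := by
  have hL := one_le_log hx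
  rw [lamE]
  split_ifs
  · exact le_rfl
  · exact Real.sqrt_le_iff.2 ⟨by linarith, by nlinarith⟩

lemma log_le_lamE_sq {x : ℝ} (hx : 3 ≤ x) : Real.log x ≤ lamE d x ^ 2 := by
  have hL := one_le_log hx
  rw [lamE]
  split_ifs
  · nlinarith
  · rw [Real.sq_sqrt (by linarith)]

lemma log_two_mul_le {x : ℝ} (hx : 3 ≤ x) : Real.log (2 * x) ≤ 2 * Real.log x := by
  rw [Real.log_mul (by norm_num) (by linarith), two_mul]
  have : Real.log 2 ≤ Real.log x := Real.log_le_log (by norm_num) (by linarith)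
  linarith

lemma lamN_le_lamE {x : ℝ} (hx : 3 ≤ x) : lamN d (2 * x) ≤ 2 * lamE d x := by
  have h1 := one_le_lamE (d := d) hx
  have h2 := log_two_mul_le hx
  rw [lamN]
  split_ifs with h
  · rwa [lamE, if_pos h]
  · linarith

lemma log_le_sq_div_lamN {x a : ℝ} (hx : 3 ≤ x) (ha : 1 ≤ a) :
    a * Real.log x / 2 ≤ (a * lamE d x) ^ 2 / lamN d (2 * x) := by
  have hL := one_le_log hx
  have hN := one_le_lamN (d := d) (N := 2 * x) (by linarith)
  have h2 := log_two_mul_le hx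
  rw [le_div_iff₀ (by linarith)]
  have haa : a ≤ a ^ 2 := by nlinarith
  have hl : 0 ≤ Real.log x := by linarith
  rw [mul_pow]
  by_cases h : d = 2
  · rw [lamN, lamE, if_pos h, if_pos h]
    calc a * Real.log x / 2 * Real.log (2 * x) ≤ a * Real.log x / 2 * (2 * Real.log x) :=
          mul_le_mul_of_nonneg_left h2 (by positivity)
      _ = a * Real.log x ^ 2 := by ring
      _ ≤ _ := mul_le_mul_of_nonneg_right haa (by positivity)
  · rw [lamN, lamE, if_neg h, if_neg h, Real.sq_sqrt hl]
    have := mul_le_mul_of_nonneg_right haa hl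
    have : 0 ≤ a * Real.log x := by positivity
    linarith

lemma log_le_tentacleExp {x a : ℝ} (hx : 3 ≤ x) (ha : 1 ≤ a) :
    a * Real.log x ≤ tentacleExp d (a * lamE d x) := by
  have hL := one_le_log hx
  by_cases h : d = 2
  · rw [tentacleExp, lamE, if_pos h, if_pos h]
  · rw [tentacleExp, lamE, if_neg h, if_neg h, mul_pow, Real.sq_sqrt (by linarith)]
    exact mul_le_mul_of_nonneg_right (by nlinarith) (by linarith)

lemma measure_biUnion_le_card_mul {ι : Type*} (s : Finset ι) (A : ι → Set Ω) {q : ℝ}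
    (h : ∀ i ∈ s, P (A i) ≤ ENNReal.ofReal q) :
    P (⋃ i ∈ s, A i) ≤ ENNReal.ofReal (s.card * q) := by
  refine (measure_biUnion_finset_le s A).trans ((Finset.sum_le_card_nsmul s _ _ h).trans ?_)
  rw [nsmul_eq_mul, ENNReal.ofReal_mul (Nat.cast_nonneg _), ENNReal.ofReal_natCast]

lemma pow_mul_exp_log {x : ℝ} (hx : 0 < x) (k : ℕ) (γ : ℝ) :
    x ^ k * Real.exp (-((γ + k) * Real.log x)) = Real.exp (-(γ * Real.log x)) := by
  have h : x ^ k = Real.exp (k * Real.log x) := by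
    rw [mul_comm, Real.exp_mul, Real.exp_log hx, Real.rpow_natCast]
  rw [h, ← Real.exp_add]
  congr 1
  ring

lemma IsIDLA.exists_first_outer (H : IsIDLA P I Y) {R : ℝ} (hR : 0 ≤ R) {T : ℕ} {ω : Ω}
    (h : ¬ I T ω ⊆ lball 0 R) : ∃ t ≤ T, ∃ ζ ∈ lball (0 : Fin d → ℤ) (R + 1), R < ‖rv ζ‖ ∧
      ζ ∈ I t ω ∧ I t ω ⊆ lball 0 (‖rv ζ‖ + 1) := by
  classical
  have hex : ∃ t, ¬ I t ω ⊆ lball 0 R := ⟨T, h⟩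
  obtain ⟨t, ht, htm⟩ : ∃ t, (¬ I t ω ⊆ lball 0 R) ∧ ∀ s < t, I s ω ⊆ lball 0 R :=
    ⟨Nat.find hex, Nat.find_spec hex, fun s hs => not_not.1 (Nat.find_min hex hs)⟩
  have htT : t ≤ T := by
    by_contra! hlt
    exact h (htm T hlt)
  rcases t with _ | s
  · refine absurd (fun y hy => ?_) ht
    rw [H.zero, Finset.mem_singleton] at hy
    rw [mem_lball_zero, hy, rv_zero, norm_zero]
    exact hR
  · have hs := htm s (Nat.lt_succ_self s)
    obtain ⟨⟨x, hx, hxy⟩, -⟩ := mem_bdryF.1 (H.bdry s ω)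
    have h1 : ‖rv (Y (s + 1) ω)‖ ≤ R + 1 :=
      (norm_nbr_le' hxy).trans (by linarith [mem_lball_zero.1 (hs hx)])
    have h2 : R < ‖rv (Y (s + 1) ω)‖ := by
      by_contra! hle
      refine ht fun y hy => ?_
      rw [H.step, Finset.mem_insert] at hy
      rcases hy with rfl | hy
      · exact mem_lball_zero.2 hle
      · exact hs hy
    refine ⟨s + 1, htT, Y (s + 1) ω, mem_lball_zero.2 h1, h2, ?_, fun y hy => ?_⟩
    · rw [H.step]
      exact Finset.mem_insert_self _ _
    · rw [H.step, Finset.mem_insert] at hy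
      rw [mem_lball_zero]
      rcases hy with rfl | hy
      · linarith
      · linarith [mem_lball_zero.1 (hs hy)]

variable [IsProbabilityMeasure P]

lemma IsIDLA.exists_prob_not_lball_subset_le (H : IsIDLA P I Y) (hd : 2 ≤ d) {γ : ℝ} (hγ : 0 ≤ γ) :
    ∃ a : ℝ, 1 ≤ a ∧ ∀ (x ρ : ℝ) (t : ℕ), 3 ≤ x → ρ ≤ x → unitBallVol d * ρ ^ d - 1 ≤ t →
      P {ω | ¬ lball 0 (ρ - a * lamE d x) ⊆ I t ω} ≤
        ENNReal.ofReal (Real.exp (-(γ * Real.log x))) := by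
  obtain ⟨c, C₀, hc, hC₀, h⟩ := H.exists_prob_notMem hd
  obtain ⟨a₀, ha₀⟩ : ∃ a₀ : ℝ, a₀ = 2 * C₀ + 1 + 2 * (γ + 2 * d) / c := ⟨_, rfl⟩
  have hq : 0 ≤ 2 * (γ + 2 * d) / c := by positivity
  have h1 : 1 ≤ a₀ := by linarith
  have h2 : 2 * C₀ ≤ a₀ := by linarith
  have h3 : γ + 2 * d ≤ c * (a₀ / 2) := by
    have : 2 * (γ + 2 * d) / c ≤ a₀ := by linarith
    rw [div_le_iff₀ hc] at this
    linarith
  refine ⟨a₀ * (1 + C₀), by nlinarith, fun x ρ t hx hρ ht => ?_⟩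
  have hl := one_le_lamE (d := d) hx
  have hL := one_le_log hx
  rcases lt_or_ge ρ (C₀ * (a₀ * lamE d x)) with hcase | hcase
  · have : {ω | ¬ lball 0 (ρ - a₀ * (1 + C₀) * lamE d x) ⊆ I t ω} = ∅ := by
      refine Set.eq_empty_of_forall_notMem fun ω hω => hω fun y hy => ?_
      have h5 := mem_lball_zero.1 hy
      have h6 := norm_nonneg (rv y)
      have h7 : 0 < a₀ * lamE d x := by positivity
      nlinarith
    rw [this]
    simp
  · have hsub : {ω | ¬ lball 0 (ρ - a₀ * (1 + C₀) * lamE d x) ⊆ I t ω} ⊆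
        ⋃ ζ ∈ lball (0 : Fin d → ℤ) (ρ - a₀ * lamE d x), {ω | ζ ∉ I t ω} := by
      intro ω hω
      obtain ⟨ζ, h5, h6⟩ := Finset.not_subset.1 hω
      simp only [Set.mem_iUnion]
      refine ⟨ζ, lball_mono ?_ h5, h6⟩
      have : 0 ≤ C₀ * (a₀ * lamE d x) := by positivity
      linarith
    refine (measure_mono hsub).trans ((measure_biUnion_le_card_mul _ _
      (q := Real.exp (-((γ + (2 * d : ℕ)) * Real.log x))) fun ζ hζ => ?_).trans
        (ENNReal.ofReal_le_ofReal ?_))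
    · refine (h (2 * x) (a₀ * lamE d x) ρ ζ t (by linarith) ?_ ?_ ?_ (by linarith) hcase ht
        (mem_lball_zero.1 hζ)).trans (ENNReal.ofReal_le_ofReal (Real.exp_le_exp.2 (neg_le_neg ?_)))
      · have := mul_le_mul_of_nonneg_left (lamN_le_lamE (d := d) hx) hC₀.le
        have := mul_le_mul_of_nonneg_right h2 (by linarith : 0 ≤ lamE d x)
        linarith
      · have e1 := mul_le_mul_of_nonneg_left (log_two_mul_le hx) hC₀.le
        have e2 := mul_le_mul_of_nonneg_right h2 (by linarith : 0 ≤ Real.log x)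
        have e3 : a₀ * Real.log x ≤ a₀ ^ 2 * lamE d x ^ 2 :=
          mul_le_mul (by nlinarith) (log_le_lamE_sq hx) (by linarith) (by positivity)
        rw [mul_pow]
        linarith
      · nlinarith
      · have e1 := mul_le_mul_of_nonneg_left (log_le_sq_div_lamN (d := d) hx h1) hc.le
        have e2 := mul_le_mul_of_nonneg_right h3 (by linarith : 0 ≤ Real.log x)
        push_cast
        linarith
    · rw [← pow_mul_exp_log (by linarith : 0 < x) (2 * d) γ]
      refine mul_le_mul_of_nonneg_right ?_ (Real.exp_pos _).le
      have hm := card_le_of_subset_lball (z := (0 : Fin d → ℤ)) (by linarith : (1 : ℝ) ≤ x)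
        (lball_mono (by nlinarith : ρ - a₀ * lamE d x ≤ x))
      refine hm.trans ?_
      rw [pow_mul]
      exact pow_le_pow_left₀ (by linarith) (by nlinarith) d

set_option maxHeartbeats 1000000 in
lemma IsIDLA.exists_prob_mem_outer_le (H : IsIDLA P I Y) (hd : 2 ≤ d) {γ : ℝ} (hγ : 0 ≤ γ) :
    ∃ a : ℝ, 1 ≤ a ∧ ∀ (x ρ : ℝ) (t : ℕ) (ζ : Fin d → ℤ), 3 ≤ x → 8 * (a * lamE d x) ≤ x →
      0 ≤ ρ → ρ ≤ x → (t : ℝ) = unitBallVol d * ρ ^ d → x + a * lamE d x < ‖rv ζ‖ →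
      ‖rv ζ‖ ≤ x + a * lamE d x + 1 →
      P {ω | ζ ∈ I t ω ∧ I t ω ⊆ lball 0 (‖rv ζ‖ + 1)} ≤
        ENNReal.ofReal (3 * Real.exp (-(γ * Real.log x))) := by
  obtain ⟨b, ct, m₀, hb, hct, hm₀, hT⟩ := H.exists_prob_tentacle_le hd
  obtain ⟨ck, Ck, hck, hCk, hK⟩ := H.exists_prob_thick_le hd hb
  obtain ⟨a, ha, hA⟩ := H.exists_prob_not_lball_subset_le hd hγ
  obtain ⟨al, hal⟩ : ∃ al : ℝ, al = a + Ck := ⟨_, rfl⟩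
  obtain ⟨am, ham⟩ : ∃ am : ℝ, am = Ck * al + 2 * Ck + 4 * m₀ + 2 * γ / ck + 4 * (γ + 1) / ct :=
    ⟨_, rfl⟩
  have hal1 : 1 ≤ al := by linarith
  have p1 : 0 ≤ Ck * al := by positivity
  have p2 : 0 ≤ 2 * γ / ck := by positivity
  have p3 : 0 ≤ 4 * (γ + 1) / ct := by positivity
  have q1 : Ck * al ≤ am := by linarith
  have q2 : 2 * Ck ≤ am := by linarith
  have q3 : 4 * m₀ ≤ am := by linarith
  have q4 : γ ≤ ck * (am / 2) := by
    have : 2 * γ / ck ≤ am := by linarith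
    rw [div_le_iff₀ hck] at this
    linarith
  have q5 : γ + 1 ≤ ct * (am / 4) := by
    have : 4 * (γ + 1) / ct ≤ am := by linarith
    rw [div_le_iff₀ hct] at this
    linarith
  have ham1 : 1 ≤ am := by linarith
  clear ham p1 p2 p3
  refine ⟨am, ham1, fun x ρ t ζ hx h8 hρ0 hρ ht hζ1 hζ2 => ?_⟩
  have hl := one_le_lamE (d := d) hx
  have hL := one_le_log hx
  obtain ⟨l, hle⟩ : ∃ l, l = lamE d x := ⟨_, rfl⟩
  have hAx := hA x ρ t hx hρ (by linarith)
  have htx := hT (am / 4 * l) ζ t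
  have hkx := hK (2 * x) (al * l) (am * l) ρ ζ t
  have hte := log_le_tentacleExp (d := d) hx (by linarith : 1 ≤ am / 4)
  have hdv := log_le_sq_div_lamN (d := d) hx ham1
  have hls := log_le_lamE_sq (d := d) hx
  rw [← hle] at h8 hζ1 hζ2 hl hAx hte hdv hls
  have hm1 : 1 ≤ am * l := by nlinarith
  have hm4 : am / 4 * l = am * l / 4 := by ring
  have e1 : P {ω | ζ ∈ I t ω ∧ cnt (I t ω) ζ (am * l / 4) ≤ b * (am * l / 4) ^ d} ≤
      ENNReal.ofReal (Real.exp (-(γ * Real.log x))) := by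
    rw [← hm4]
    refine (htx (by nlinarith) (by linarith)).trans (ENNReal.ofReal_le_ofReal ?_)
    rw [← pow_mul_exp_log (by linarith : 0 < x) 1 γ, pow_one]
    refine mul_le_mul (by linarith) (Real.exp_le_exp.2 (neg_le_neg ?_)) (Real.exp_pos _).le
      (by linarith)
    have f1 := mul_le_mul_of_nonneg_left hte hct.le
    have f2 := mul_le_mul_of_nonneg_right q5 (by linarith : 0 ≤ Real.log x)
    push_cast
    linarith
  have e2 : P {ω | I t ω ⊆ lball 0 (‖rv ζ‖ + 1) ∧ lball 0 (ρ - al * l) ⊆ I t ω ∧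
      b * (am * l / 4) ^ d < cnt (I t ω) ζ (am * l / 4)} ≤
      ENNReal.ofReal (Real.exp (-(γ * Real.log x))) := by
    refine (hkx (by linarith) (by nlinarith) (by nlinarith) ?_ (by linarith) (by linarith) hρ0
      (by linarith) ht.le).trans (ENNReal.ofReal_le_ofReal (Real.exp_le_exp.2 (neg_le_neg ?_)))
    · have f1 := mul_le_mul_of_nonneg_left (log_two_mul_le hx) hCk.le
      have f2 := mul_le_mul_of_nonneg_right q2 (by linarith : 0 ≤ Real.log x)
      have f3 : am * Real.log x ≤ am ^ 2 * l ^ 2 :=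
        mul_le_mul (by nlinarith) hls (by linarith) (by positivity)
      rw [mul_pow]
      linarith
    · have f1 := mul_le_mul_of_nonneg_left hdv hck.le
      have f2 := mul_le_mul_of_nonneg_right q4 (by linarith : 0 ≤ Real.log x)
      linarith
  have hsub : {ω | ζ ∈ I t ω ∧ I t ω ⊆ lball 0 (‖rv ζ‖ + 1)} ⊆
      {ω | ¬ lball 0 (ρ - a * l) ⊆ I t ω} ∪
      ({ω | ζ ∈ I t ω ∧ cnt (I t ω) ζ (am * l / 4) ≤ b * (am * l / 4) ^ d} ∪
      {ω | I t ω ⊆ lball 0 (‖rv ζ‖ + 1) ∧ lball 0 (ρ - al * l) ⊆ I t ω ∧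
        b * (am * l / 4) ^ d < cnt (I t ω) ζ (am * l / 4)}) := by
    rintro ω ⟨g1, g2⟩
    by_cases g3 : lball 0 (ρ - a * l) ⊆ I t ω
    · rcases le_or_gt (cnt (I t ω) ζ (am * l / 4)) (b * (am * l / 4) ^ d) with g4 | g4
      · exact Or.inr (Or.inl ⟨g1, g4⟩)
      · exact Or.inr (Or.inr ⟨g2, (lball_mono (by nlinarith)).trans g3, g4⟩)
    · exact Or.inl g3
  refine (measure_mono hsub).trans ((measure_union_le _ _).trans
    ((add_le_add hAx ((measure_union_le _ _).trans (add_le_add e1 e2))).trans (le_of_eq ?_)))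
  have hp := (Real.exp_pos (-(γ * Real.log x))).le
  rw [← ENNReal.ofReal_add hp hp, ← ENNReal.ofReal_add hp (by positivity)]
  congr 1
  ring

set_option maxHeartbeats 1000000 in
lemma IsIDLA.exists_prob_not_subset_lball_le (H : IsIDLA P I Y) (hd : 2 ≤ d) {γ : ℝ}
    (hγ : 0 ≤ γ) :
    ∃ a : ℝ, 1 ≤ a ∧ ∀ (x : ℝ) (T : ℕ), 3 ≤ x → 8 * (a * lamE d x) ≤ x →
      3 * (unitBallVol d + 1) * 6 ^ d ≤ x → (T : ℝ) ≤ unitBallVol d * x ^ d →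
      P {ω | ¬ I T ω ⊆ lball 0 (x + a * lamE d x)} ≤
        ENNReal.ofReal (Real.exp (-(γ * Real.log x))) := by
  classical
  obtain ⟨a, ha, hA⟩ := H.exists_prob_mem_outer_le hd (γ := γ + (2 * d + 1 : ℕ)) (by positivity)
  refine ⟨a, ha, fun x T hx h8 hx6 hT => ?_⟩
  have hω := unitBallVol_pos (d := d)
  have hl := one_le_lamE (d := d) hx
  have hd0 : d ≠ 0 := by omega
  obtain ⟨m, hm⟩ : ∃ m, m = a * lamE d x := ⟨_, rfl⟩
  have hm1 : 1 ≤ m := by rw [hm]; nlinarith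
  have hA' := hA x
  rw [← hm] at h8 hA' ⊢
  obtain ⟨S, hS⟩ : ∃ S : Finset (ℕ × (Fin d → ℤ)), S = Finset.range (T + 1) ×ˢ
    (lball (0 : Fin d → ℤ) (x + m + 1)).filter fun ζ => x + m < ‖rv ζ‖ := ⟨_, rfl⟩
  have hsub : {ω | ¬ I T ω ⊆ lball 0 (x + m)} ⊆
      ⋃ p ∈ S, {ω | p.2 ∈ I p.1 ω ∧ I p.1 ω ⊆ lball 0 (‖rv p.2‖ + 1)} := by
    intro ω hω
    obtain ⟨t, ht, ζ, h1, h2, h3⟩ := H.exists_first_outer (by linarith) hω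
    simp only [Set.mem_iUnion]
    refine ⟨(t, ζ), ?_, h3⟩
    rw [hS, Finset.mem_product, Finset.mem_filter, Finset.mem_range]
    exact ⟨Nat.lt_succ_of_le ht, h1, h2⟩
  refine (measure_mono hsub).trans ((measure_biUnion_le_card_mul _ _
    (q := 3 * Real.exp (-((γ + (2 * d + 1 : ℕ)) * Real.log x))) fun p hp => ?_).trans
      (ENNReal.ofReal_le_ofReal ?_))
  · obtain ⟨t, ζ⟩ := p
    rw [hS, Finset.mem_product, Finset.mem_filter, Finset.mem_range, mem_lball_zero] at hp
    obtain ⟨h1, h2, h3⟩ := hp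
    have hq : (0 : ℝ) ≤ t / unitBallVol d := by positivity
    have hpow : ((t / unitBallVol d : ℝ) ^ ((d : ℝ)⁻¹)) ^ d = t / unitBallVol d :=
      Real.rpow_inv_natCast_pow hq hd0
    refine hA' ((t / unitBallVol d : ℝ) ^ ((d : ℝ)⁻¹)) t ζ hx h8 (by positivity) ?_ ?_ h3 h2
    · refine (pow_le_pow_iff_left₀ (by positivity) (by linarith) hd0).1 ?_
      rw [hpow, div_le_iff₀ hω]
      have : (t : ℝ) ≤ T := by exact_mod_cast Nat.lt_succ_iff.1 h1
      linarith
    · rw [hpow]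
      field_simp
  · rw [← pow_mul_exp_log (by linarith : 0 < x) (2 * d + 1) γ, ← mul_assoc]
    refine mul_le_mul_of_nonneg_right ?_ (Real.exp_pos _).le
    have hc1 : (S.card : ℝ) ≤ (T + 1) * (3 * (2 * x)) ^ d := by
      rw [hS, Finset.card_product, Finset.card_range]
      push_cast
      refine mul_le_mul_of_nonneg_left (card_le_of_subset_lball (z := 0) (by linarith) ?_)
        (by positivity)
      exact (Finset.filter_subset _ _).trans (lball_mono (by linarith))
    have hx1 : 1 ≤ x ^ d := one_le_pow₀ (by linarith)
    have hc2 : (T + 1 : ℝ) ≤ (unitBallVol d + 1) * x ^ d := by linarith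
    calc (S.card : ℝ) * 3 ≤ (unitBallVol d + 1) * x ^ d * (3 * (2 * x)) ^ d * 3 := by
          refine mul_le_mul_of_nonneg_right (hc1.trans ?_) (by norm_num)
          exact mul_le_mul_of_nonneg_right hc2 (by positivity)
      _ = 3 * (unitBallVol d + 1) * 6 ^ d * (x ^ d * x ^ d) := by
          rw [show 3 * (2 * x) = 6 * x by ring, mul_pow]
          ring
      _ ≤ x * (x ^ d * x ^ d) := mul_le_mul_of_nonneg_right hx6 (by positivity)
      _ = x ^ (2 * d + 1) := by ring

lemma eventually_mul_lamE_le (a : ℝ) (ha : 0 ≤ a) : ∀ᶠ x : ℝ in atTop, a * lamE d x ≤ x := by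
  have h1 := Real.isLittleO_log_id_atTop.bound (by positivity : 0 < (a + 1)⁻¹)
  filter_upwards [h1, eventually_ge_atTop 3] with x hx h3
  have hL := one_le_log h3
  rw [id, Real.norm_of_nonneg (by linarith), Real.norm_of_nonneg (by linarith), inv_mul_eq_div,
    le_div_iff₀ (by positivity)] at hx
  have := mul_le_mul_of_nonneg_left (lamE_le_log (d := d) h3) ha
  linarith

lemma IsIDLA.exists_ae_eventually (H : IsIDLA P I Y) (hd : 2 ≤ d) :
    ∃ K : ℝ, ∀ᵐ ω ∂P, ∀ᶠ n : ℕ in atTop,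
      latBall (n - K * lamE d n) ⊆ (I ⌊unitBallVol d * (n : ℝ) ^ d⌋₊ ω : Set (Fin d → ℤ)) ∧
      (I ⌊unitBallVol d * (n : ℝ) ^ d⌋₊ ω : Set (Fin d → ℤ)) ⊆ latBall (n + K * lamE d n) := by
  classical
  have hω := unitBallVol_pos (d := d)
  obtain ⟨a₁, ha₁, h₁⟩ := H.exists_prob_not_lball_subset_le hd (γ := 2) (by norm_num)
  obtain ⟨a₂, ha₂, h₂⟩ := H.exists_prob_not_subset_lball_le hd (γ := 2) (by norm_num)
  have hev : ∀ᶠ n : ℕ in atTop, (3 : ℝ) ≤ n ∧ 8 * (a₂ * lamE d n) ≤ n ∧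
      3 * (unitBallVol d + 1) * 6 ^ d ≤ n := by
    have h := (eventually_ge_atTop (3 : ℝ)).and ((eventually_mul_lamE_le (d := d) (8 * a₂)
      (by linarith)).and (eventually_ge_atTop (3 * (unitBallVol d + 1) * 6 ^ d)))
    filter_upwards [tendsto_natCast_atTop_atTop.eventually h] with n hn
    exact ⟨hn.1, by linarith [hn.2.1], hn.2.2⟩
  obtain ⟨n₀, hn₀⟩ := eventually_atTop.1 hev
  let T : ℕ → ℕ := fun n => ⌊unitBallVol d * (n : ℝ) ^ d⌋₊
  let E : ℕ → Set Ω := fun n => {ω | n₀ ≤ n ∧ (¬ lball 0 (n - a₁ * lamE d n) ⊆ I (T n) ω ∨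
    ¬ I (T n) ω ⊆ lball 0 (n + a₂ * lamE d n))}
  have hE : ∀ n, P (E n) ≤ ENNReal.ofReal (2 * ((n : ℝ) ^ 2)⁻¹) := by
    intro n
    by_cases hn : n₀ ≤ n
    · obtain ⟨k1, k2, k3⟩ := hn₀ n hn
      have hexp : Real.exp (-(2 * Real.log n)) = ((n : ℝ) ^ 2)⁻¹ := by
        rw [Real.exp_neg, mul_comm, Real.exp_mul, Real.exp_log (by linarith)]
        norm_cast
      have e1 := h₁ n n (T n) k1 le_rfl
        (by linarith [Nat.lt_floor_add_one (unitBallVol d * (n : ℝ) ^ d)])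
      have e2 := h₂ n (T n) k1 k2 k3 (Nat.floor_le (by positivity))
      rw [hexp] at e1 e2
      have hp : 0 ≤ ((n : ℝ) ^ 2)⁻¹ := by positivity
      rw [two_mul, ENNReal.ofReal_add hp hp]
      refine (measure_mono (fun ω hω => ?_)).trans ((measure_union_le _ _).trans (add_le_add e1 e2))
      exact hω.2
    · have : E n = ∅ := Set.eq_empty_of_forall_notMem fun ω hω => hn hω.1
      rw [this, measure_empty]
      exact zero_le
  have hsum : ∑' n, P (E n) ≠ ⊤ := by
    refine ne_top_of_le_ne_top ?_ (ENNReal.tsum_le_tsum hE)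
    exact ((Real.summable_nat_pow_inv.2 (by norm_num)).mul_left 2).tsum_ofReal_ne_top
  refine ⟨max a₁ a₂, ?_⟩
  filter_upwards [ae_eventually_notMem hsum] with ω hω
  filter_upwards [hω, eventually_ge_atTop n₀] with n hn hnn
  have hl := one_le_lamE (d := d) (hn₀ n hnn).1
  have hn' : lball 0 (n - a₁ * lamE d n) ⊆ I (T n) ω ∧ I (T n) ω ⊆ lball 0 (n + a₂ * lamE d n) := by
    by_contra hcon
    exact hn ⟨hnn, not_and_or.1 hcon⟩
  constructor
  · intro x hx
    refine hn'.1 (mem_lball_zero.2 ?_)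
    have h3 : eunorm x ≤ n - max a₁ a₂ * lamE d n := hx
    rw [eunorm_eq] at h3
    have := mul_le_mul_of_nonneg_right (le_max_left a₁ a₂) (by linarith : 0 ≤ lamE d n)
    linarith
  · intro x hx
    have h3 := mem_lball_zero.1 (hn'.2 hx)
    change eunorm x ≤ n + max a₁ a₂ * lamE d n
    rw [eunorm_eq]
    have := mul_le_mul_of_nonneg_right (le_max_right a₁ a₂) (by linarith : 0 ≤ lamE d n)
    linarith

lemma unitBallVol_two : unitBallVol 2 = Real.pi := by
  rw [unitBallVol, EuclideanSpace.volume_ball_fin_two]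
  simp [Real.pi_pos.le]

end Assembly

/-- **Internal DLA on ℤ^d: fluctuations (Jerison–Levine–Sheffield;
Asselah–Gaudillière).**  For `d = 2` the fluctuations of the cluster around the ball are
at most logarithmic, and for `d ≥ 3` they are at most of order `√(log n)`. -/
theorem internal_dla_fluctuations_Zd
    (d : ℕ)
    {Ω : Type*} [MeasurableSpace Ω] (P : Measure Ω) [IsProbabilityMeasure P]
    (I : ℕ → Ω → Finset (Fin d → ℤ)) (Y : ℕ → Ω → (Fin d → ℤ))
    -- dynamics of the internal DLA chain: `Y (n+1)` is the first exit location from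
    -- `I n` of a simple random walk started at the origin, independent of the past
    (h0 : ∀ ω, I 0 ω = {0})
    (hstep : ∀ n ω, I (n+1) ω = insert (Y (n+1) ω) (I n ω))
    (hbd : ∀ n ω, Y (n+1) ω ∈ bdryF latNbrs (I n ω))
    (hlaw : ∀ (n : ℕ) (A : Finset (Fin d → ℤ)), ∀ y ∈ bdryF latNbrs A,
      P {ω | I n ω = A ∧ Y (n+1) ω = y}
        = ENNReal.ofReal (hitMeas latNbrs (↑(bdryF latNbrs A)) 0 y) *
          P {ω | I n ω = A}) :
    -- `d = 2`: logarithmic fluctuations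
    (d = 2 → ∃ c : ℝ, ∀ᵐ ω ∂P, ∀ᶠ n : ℕ in atTop,
      (latBall ((n : ℝ) - c * Real.log n) : Set (Fin d → ℤ)) ⊆
        (I (⌊Real.pi * (n : ℝ) ^ 2⌋₊) ω : Set (Fin d → ℤ)) ∧
      (I (⌊Real.pi * (n : ℝ) ^ 2⌋₊) ω : Set (Fin d → ℤ)) ⊆
        (latBall ((n : ℝ) + c * Real.log n) : Set (Fin d → ℤ))) ∧
    -- `d ≥ 3`: `√log` fluctuations
    (3 ≤ d → ∃ C : ℝ, ∀ᵐ ω ∂P, ∀ᶠ n : ℕ in atTop,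
      (latBall ((n : ℝ) - C * Real.sqrt (Real.log n)) : Set (Fin d → ℤ)) ⊆
        (I (⌊unitBallVol d * (n : ℝ) ^ d⌋₊) ω : Set (Fin d → ℤ)) ∧
      (I (⌊unitBallVol d * (n : ℝ) ^ d⌋₊) ω : Set (Fin d → ℤ)) ⊆
        (latBall ((n : ℝ) + C * Real.sqrt (Real.log n)) : Set (Fin d → ℤ))) := by
  have H : IsIDLA P I Y := ⟨h0, hstep, hbd, hlaw⟩
  refine ⟨?_, fun hd => ?_⟩
  · rintro rfl
    obtain ⟨K, hK⟩ := H.exists_ae_eventually le_rfl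
    simp only [unitBallVol_two, lamE, if_pos] at hK
    exact ⟨K, hK⟩
  · obtain ⟨K, hK⟩ := H.exists_ae_eventually (by omega)
    simp only [lamE, if_neg (show d ≠ 2 by omega)] at hK
    exact ⟨K, hK⟩
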